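/- Let G be an irreducible 4-critical triangle-free graph drawn in the torus, and let H be a connected subgraph of G containing the base graph as a subgraph. For any 4-face g of H bounded by a cycle v1v2v3v4 such that the pair of opposite vertices v1 and v3 is not linked in H, there exists a path P = v1xyv3 of length 3 such that v1xyv3v2 is a non-contractible 5-cycle and H + P is a subgraph of G. -/

import Mathlib

open Set Topology

noncomputable section

/-- The circle `ℝ/ℤ`. -/
abbrev Circle1 : Type := AddCircle (1 : ℝ)

/-- The torus `(ℝ/ℤ) × (ℝ/ℤ)`. -/
abbrev Torus : Type := Circle1 × Circle1

/-- A set is an arc if it is homeomorphic to the open unit interval. -/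
def IsArc {S : Type} [TopologicalSpace S] (A : Set S) : Prop :=
  Nonempty ((Set.Ioo (0 : ℝ) 1) ≃ₜ A)

/-- A drawing, in the space `S`, of a multigraph whose edges `E` have endpoints
given by `ends`.  Vertices are drawn as distinct points, edges as arcs whose closure
adds exactly the endpoint vertices; arcs are pairwise disjoint and avoid all
vertex points. -/
structure MDrawing {V E : Type} (ends : E → Sym2 V) (S : Type) [TopologicalSpace S] where
  vmap : V → S
  vinj : Function.Injective vmap
  emap : E → Set S
  arc : ∀ e, IsArc (emap e)
  closure_emap : ∀ (e : E) (u w : V), ends e = s(u, w) →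
    closure (emap e) = emap e ∪ {vmap u, vmap w}
  vertex_notin : ∀ (e : E) (x : V), vmap x ∉ emap e
  edges_disj : ∀ e f : E, e ≠ f → emap e ∩ emap f = ∅

namespace MDrawing

variable {V E S : Type} [TopologicalSpace S] {ends : E → Sym2 V}

/-- The point set `|G|` of the drawing. -/
def image (d : MDrawing ends S) : Set S :=
  Set.range d.vmap ∪ ⋃ e, d.emap e

/-- A face: a connected component of the complement of the drawing. -/
def IsFace (d : MDrawing ends S) (f : Set S) : Prop :=
  ∃ x ∈ (d.image)ᶜ, f = connectedComponentIn (d.image)ᶜ x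

/-- The length of a face: each edge drawn in the frontier of `g` contributes `2`
if `g` is the unique face whose frontier contains the arc, and `1` otherwise. -/
def faceLen (d : MDrawing ends S) (g : Set S) : ℕ :=
  2 * {e : E | d.emap e ⊆ frontier g ∧
        (∀ g', d.IsFace g' → d.emap e ⊆ frontier g' → g' = g)}.ncard +
    {e : E | d.emap e ⊆ frontier g ∧
        ¬ (∀ g', d.IsFace g' → d.emap e ⊆ frontier g' → g' = g)}.ncard

end MDrawing

/-- A drawing of a simple graph `G`: a drawing of the multigraph whose edge set is
the edge set of `G`. -/
abbrev Drawing {V : Type} (G : SimpleGraph V) (S : Type) [TopologicalSpace S] :=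
  MDrawing (fun e : G.edgeSet => (e : Sym2 V)) S

/-- The point set of (the drawing of) a walk: the vertex points of its support
together with the arcs of its edges. -/
def walkImage {V S : Type} [TopologicalSpace S] {G : SimpleGraph V} (d : Drawing G S)
    {a b : V} (w : G.Walk a b) : Set S :=
  (⋃ v ∈ w.support, {d.vmap v}) ∪
    ⋃ (e : G.edgeSet) (_ : (e : Sym2 V) ∈ w.edges), d.emap e

/-- A closed curve is null-homotopic if it is homotopic to a constant map. -/
def NullHomotopic {S : Type} [TopologicalSpace S] (γ : C(Circle1, S)) : Prop :=
  ∃ c : S, ContinuousMap.Homotopic γ (ContinuousMap.const Circle1 c)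

/-- A set is a contractible simple closed curve if it is the range of an injective
closed curve which is null-homotopic. -/
def ContractibleSet {S : Type} [TopologicalSpace S] (A : Set S) : Prop :=
  ∃ γ : C(Circle1, S), Function.Injective γ ∧ Set.range γ = A ∧ NullHomotopic γ

/-- A cycle (given as a closed walk) is contractible if the closed curve tracing
its drawing is null-homotopic. -/
def ContractibleWalk {V S : Type} [TopologicalSpace S] {G : SimpleGraph V}
    (d : Drawing G S) {a : V} (w : G.Walk a a) : Prop :=
  ContractibleSet (walkImage d w)

/-- A graph is 4-critical if its chromatic number is `4` and every proper subgraph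
has chromatic number at most `3`. -/
def FourCritical {V : Type} (G : SimpleGraph V) : Prop :=
  G.chromaticNumber = 4 ∧
    ∀ H : G.Subgraph, H ≠ ⊤ → H.coe.chromaticNumber ≤ 3

/-- A graph is triangle-free if it contains no 3-cycle. -/
def TriangleFree {V : Type} (G : SimpleGraph V) : Prop :=
  ∀ (a : V) (w : G.Walk a a), w.IsCycle → w.length ≠ 3

/-- `f` is a `k`-face: a face bounded by a cycle of length `k`. -/
def IsKFace {V S : Type} [TopologicalSpace S] {G : SimpleGraph V} (d : Drawing G S)
    (f : Set S) (k : ℕ) : Prop :=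
  d.IsFace f ∧ ∃ (a : V) (w : G.Walk a a), w.IsCycle ∧ w.length = k ∧
    frontier f = walkImage d w

/-- `f` is a face bounded by the 4-cycle `v1 v2 v3 v4`. -/
def IsQuadFace {V S : Type} [TopologicalSpace S] {G : SimpleGraph V} (d : Drawing G S)
    (f : Set S) (v1 v2 v3 v4 : V) : Prop :=
  d.IsFace f ∧ ∃ w : G.Walk v1 v1, w.IsCycle ∧
    w.support = [v1, v2, v3, v4, v1] ∧ frontier f = walkImage d w

/-- A set is an open disk if it is homeomorphic to an open disk in the plane. -/
def IsOpenDisk {S : Type} [TopologicalSpace S] (A : Set S) : Prop :=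
  Nonempty (A ≃ₜ (Metric.ball (0 : ℝ × ℝ) 1))

/-- The map identifying `v3` with `v1` (sending `v3` to `v1` and fixing the rest). -/
def deflateFun {V : Type} (v1 v3 : V) : V → V := fun v =>
  letI := Classical.decEq V
  if v = v3 then v1 else v

/-- The map identifying `v3` with `v1`, viewed as landing in the vertex set with
`v3` removed. -/
def deflatePi {V : Type} (v1 v3 : V) (h : v1 ≠ v3) : V → {v : V // v ≠ v3} := fun v =>
  letI := Classical.decEq V
  if hv : v = v3 then ⟨v1, h⟩ else ⟨v, hv⟩

/-- The edges of the `f`-deflation: all edges of `G` except `v2v3` and `v3v4`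
(one edge of each of the two parallel pairs arising from the identification is kept,
namely `v1v2` and `v1v4`). -/
def DeflEdge {V : Type} (G : SimpleGraph V) (v2 v3 v4 : V) : Type :=
  {e : Sym2 V // e ∈ G.edgeSet ∧ e ≠ s(v2, v3) ∧ e ≠ s(v3, v4)}

/-- The endpoint function of the edges of the deflation. -/
def deflateEnds {V : Type} (G : SimpleGraph V) (v1 v2 v3 v4 : V) (h : v1 ≠ v3) :
    DeflEdge G v2 v3 v4 → Sym2 {v : V // v ≠ v3} :=
  fun e => Sym2.map (deflatePi v1 v3 h) e.1

/-- `M` is an `f`-deflation of the drawn graph `(G, d)` of form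
`(v1v2v3v4) → (v2v'v4)`: the face `f` is bounded by the cycle `v1v2v3v4`, the
vertices `v1` and `v3` are identified to a new vertex `v'` (represented by `v1`)
placed inside `f`, all other vertices keep their points, arcs of edges not incident
with `v1` or `v3` are unchanged, and arcs of edges incident with `v1` or `v3` are
only modified inside `f` (together with the two old vertex points). -/
structure IsDeflation {V : Type} {G : SimpleGraph V} (d : Drawing G Torus)
    (v1 v2 v3 v4 : V) (f : Set Torus) (h13 : v1 ≠ v3)
    (M : MDrawing (deflateEnds G v1 v2 v3 v4 h13) Torus) : Prop where
  quadFace : IsQuadFace d f v1 v2 v3 v4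
  new_vertex : M.vmap ⟨v1, h13⟩ ∈ f
  old_vertices : ∀ (v : V) (hv : v ≠ v3), v ≠ v1 → M.vmap ⟨v, hv⟩ = d.vmap v
  untouched : ∀ e : DeflEdge G v2 v3 v4, v1 ∉ e.1 → v3 ∉ e.1 →
    M.emap e = d.emap ⟨e.1, e.2.1⟩
  extended : ∀ e : DeflEdge G v2 v3 v4, v1 ∈ e.1 ∨ v3 ∈ e.1 →
    M.emap e \ (f ∪ {d.vmap v1, d.vmap v3}) = d.emap ⟨e.1, e.2.1⟩

/-- Adjacency in the deflation identifying `v3` with `v1`. -/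
def DeflAdj {V : Type} (G : SimpleGraph V) (v1 v3 : V) (a b : V) : Prop :=
  ∃ x y : V, G.Adj x y ∧ deflateFun v1 v3 x = a ∧ deflateFun v1 v3 y = b

/-- The deflation identifying `v3` with `v1` is triangle-free (this property of a
deflation does not depend on its drawing). -/
def DeflationTriangleFree {V : Type} (G : SimpleGraph V) (v1 v3 : V) : Prop :=
  ¬ ∃ a b c : V, a ≠ b ∧ b ≠ c ∧ a ≠ c ∧
    DeflAdj G v1 v3 a b ∧ DeflAdj G v1 v3 b c ∧ DeflAdj G v1 v3 a c

/-- A (triangle-free 4-critical) drawn graph is reducible if it has a 4-face such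
that at least one of the two possible deflations of that face is triangle-free. -/
def ReducibleDrawing {V : Type} {G : SimpleGraph V} (d : Drawing G Torus) : Prop :=
  ∃ (f : Set Torus) (v1 v2 v3 v4 : V), IsQuadFace d f v1 v2 v3 v4 ∧
    (DeflationTriangleFree G v1 v3 ∨ DeflationTriangleFree G v2 v4)

/-- An irreducible drawn graph: triangle-free, 4-critical and not reducible. -/
def IrreducibleDrawing {V : Type} {G : SimpleGraph V} (d : Drawing G Torus) : Prop :=
  TriangleFree G ∧ FourCritical G ∧ ¬ ReducibleDrawing d

/-- The point set of the drawing of a subgraph `A` of `G` (inherited drawing). -/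
def subImage {V S : Type} [TopologicalSpace S] {G : SimpleGraph V} (d : Drawing G S)
    (A : G.Subgraph) : Set S :=
  (d.vmap '' A.verts) ∪ ⋃ (e : G.edgeSet) (_ : (e : Sym2 V) ∈ A.edgeSet), d.emap e

/-- A face of the subgraph `A` in its inherited drawing. -/
def IsSubFace {V S : Type} [TopologicalSpace S] {G : SimpleGraph V} (d : Drawing G S)
    (A : G.Subgraph) (g : Set S) : Prop :=
  ∃ x ∈ (subImage d A)ᶜ, g = connectedComponentIn (subImage d A)ᶜ x

/-- The length of a face `g` of the subgraph `A` in its inherited drawing. -/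
def subFaceLen {V S : Type} [TopologicalSpace S] {G : SimpleGraph V} (d : Drawing G S)
    (A : G.Subgraph) (g : Set S) : ℕ :=
  2 * {e : G.edgeSet | (e : Sym2 V) ∈ A.edgeSet ∧ d.emap e ⊆ frontier g ∧
        (∀ g', IsSubFace d A g' → d.emap e ⊆ frontier g' → g' = g)}.ncard +
    {e : G.edgeSet | (e : Sym2 V) ∈ A.edgeSet ∧ d.emap e ⊆ frontier g ∧
        ¬ (∀ g', IsSubFace d A g' → d.emap e ⊆ frontier g' → g' = g)}.ncard

/-- `B` is a base graph contained in `G` with 4-face `fB`: `B` consists of a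
4-cycle `v1v2v3v4` bounding the face `fB` of (the inherited drawing of) `B`,
together with two disjoint links (paths of length 3) joining the two pairs of
opposite vertices of the cycle, each of which forms a non-contractible 5-cycle
with a path of the 4-cycle.  (The base graph is obtained from `K₄` by subdividing
the edges of a perfect matching twice.) -/
def IsBaseSubgraph {V : Type} {G : SimpleGraph V} (d : Drawing G Torus)
    (B : G.Subgraph) (fB : Set Torus) : Prop :=
  ∃ v1 v2 v3 v4 x y z w : V,
    ([v1, v2, v3, v4, x, y, z, w] : List V).Nodup ∧
    B.verts = {v1, v2, v3, v4, x, y, z, w} ∧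
    B.edgeSet = {s(v1, v2), s(v2, v3), s(v3, v4), s(v4, v1), s(v1, x), s(x, y),
      s(y, v3), s(v2, z), s(z, w), s(w, v4)} ∧
    IsSubFace d B fB ∧
    (∃ wc : G.Walk v1 v1, wc.IsCycle ∧ wc.support = [v1, v2, v3, v4, v1] ∧
      frontier fB = walkImage d wc) ∧
    (∃ c5 : G.Walk v1 v1, c5.IsCycle ∧ c5.support = [v1, x, y, v3, v2, v1] ∧
      ¬ ContractibleWalk d c5) ∧
    (∃ c5 : G.Walk v2 v2, c5.IsCycle ∧ c5.support = [v2, z, w, v4, v3, v2] ∧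
      ¬ ContractibleWalk d c5)

/-- The drawn graph `(G, d)` is linked: for every 4-face `f` of `G`, there is a
subgraph of `G` which is a base graph having `f` as its 4-face. -/
def LinkedDrawing {V : Type} {G : SimpleGraph V} (d : Drawing G Torus) : Prop :=
  ∀ (f : Set Torus) (v1 v2 v3 v4 : V), IsQuadFace d f v1 v2 v3 v4 →
    ∃ B : G.Subgraph, IsBaseSubgraph d B f

/-- The subgraph `A` contains a base graph. -/
def ContainsBase {V : Type} {G : SimpleGraph V} (d : Drawing G Torus)
    (A : G.Subgraph) : Prop :=
  ∃ B : G.Subgraph, B ≤ A ∧ ∃ fB : Set Torus, IsBaseSubgraph d B fB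

/-- The pair `v1, v3` of opposite vertices of a 4-face with boundary cycle
`v1 v2 v3 v4` is linked in the subgraph `A`: there is a path `v1 x y v3` in `A`
such that `v1 x y v3 v2` is a non-contractible 5-cycle. -/
def LinkedPairIn {V : Type} {G : SimpleGraph V} (d : Drawing G Torus)
    (A : G.Subgraph) (v1 v2 v3 : V) : Prop :=
  ∃ (x y : V) (c5 : G.Walk v1 v1), c5.IsCycle ∧
    c5.support = [v1, x, y, v3, v2, v1] ∧
    (∀ e ∈ c5.edges, e ∈ A.edgeSet) ∧ ¬ ContractibleWalk d c5

/-- The face `g` of the subgraph `A` (in its inherited drawing) is bounded by the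
4-cycle `v1 v2 v3 v4` of `A`. -/
def SubQuadFace {V : Type} {G : SimpleGraph V} (d : Drawing G Torus)
    (A : G.Subgraph) (g : Set Torus) (v1 v2 v3 v4 : V) : Prop :=
  IsSubFace d A g ∧ ∃ w : G.Walk v1 v1, w.IsCycle ∧
    w.support = [v1, v2, v3, v4, v1] ∧ (∀ e ∈ w.edges, e ∈ A.edgeSet) ∧
    frontier g = walkImage d w

namespace KY
set_option linter.unusedSectionVars false
set_option linter.unusedSimpArgs false
set_option linter.unusedVariables false
open scoped Classical

/-- number of ordered adjacent pairs between two finite sets -/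
def ed {V : Type} (G : SimpleGraph V) (A B : Finset V) : ℤ :=
  ∑ u ∈ A, ∑ v ∈ B, if G.Adj u v then 1 else 0

/-- twice the potential -/
def P {V : Type} (G : SimpleGraph V) (R : Finset V) : ℤ := 10 * (R.card : ℤ) - 3 * ed G R R

def Col {V : Type} (G : SimpleGraph V) : Prop :=
  ∃ c : V → Fin 3, ∀ u v, G.Adj u v → c u ≠ c v

def ColOn {V : Type} (G : SimpleGraph V) (S : Finset V) : Prop :=
  ∃ c : V → Fin 3, ∀ u ∈ S, ∀ v ∈ S, G.Adj u v → c u ≠ c v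

def GoodOn {V : Type} (G : SimpleGraph V) (S : Finset V) : Prop :=
  ∀ R ⊆ S, R.Nonempty → 6 ≤ P G R

variable {V : Type} {G : SimpleGraph V}

lemma ed_comm (A B : Finset V) : ed G A B = ed G B A := by
  unfold ed; rw [Finset.sum_comm]; simp [G.adj_comm]

lemma ed_nonneg (A B : Finset V) : 0 ≤ ed G A B :=
  Finset.sum_nonneg fun _ _ => Finset.sum_nonneg fun _ _ => by split_ifs <;> simp

lemma ed_union_left {A A' : Finset V} (h : Disjoint A A') (B : Finset V) :
    ed G (A ∪ A') B = ed G A B + ed G A' B := by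
  unfold ed; rw [Finset.sum_union h]

lemma ed_union_right {A A' : Finset V} (h : Disjoint A A') (B : Finset V) :
    ed G B (A ∪ A') = ed G B A + ed G B A' := by
  rw [ed_comm, ed_union_left h, ed_comm A, ed_comm A']

lemma ed_mono_left {A A' : Finset V} (h : A ⊆ A') (B : Finset V) : ed G A B ≤ ed G A' B :=
  Finset.sum_le_sum_of_subset_of_nonneg h fun _ _ _ =>
    Finset.sum_nonneg fun _ _ => by split_ifs <;> simp

lemma ed_mono_right {A A' : Finset V} (h : A ⊆ A') (B : Finset V) : ed G B A ≤ ed G B A' := by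
  rw [ed_comm, ed_comm B]; exact ed_mono_left h B

lemma ed_pos {A B : Finset V} {a b : V} (ha : a ∈ A) (hb : b ∈ B) (h : G.Adj a b) :
    1 ≤ ed G A B := by
  have h1 : ed G {a} {b} = 1 := by simp only [ed, Finset.sum_singleton, if_pos h]
  have h2 : ed G {a} {b} ≤ ed G A B :=
    (ed_mono_left (by simpa using ha) _).trans (ed_mono_right (by simpa using hb) _)
  omega

lemma ed_single (a b : V) : ed G {a} {b} = if G.Adj a b then 1 else 0 := by
  simp only [ed, Finset.sum_singleton]

lemma ed_self_single (a : V) : ed G {a} {a} = 0 := by simp [ed]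

lemma P_union {A B : Finset V} (h : Disjoint A B) :
    P G (A ∪ B) = P G A + P G B - 6 * ed G A B := by
  unfold P
  rw [Finset.card_union_of_disjoint h, ed_union_left h, ed_union_right h, ed_union_right h,
    ed_comm B A]
  push_cast; ring

lemma P_single (a : V) : P G {a} = 10 := by simp [P, ed_self_single]

lemma P_empty : P G ∅ = 0 := by simp [P, ed]

lemma P_insert {a : V} {A : Finset V} (h : a ∉ A) :
    P G (insert a A) = 10 + P G A - 6 * ed G {a} A := by
  rw [Finset.insert_eq, P_union (by simpa using h), P_single]

lemma P_even (R : Finset V) : Even (P G R) := by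
  induction R using Finset.induction_on with
  | empty => simp [P_empty]
  | insert a A h ih =>
    rw [P_insert h]
    obtain ⟨k, hk⟩ := ih
    exact ⟨5 + k - 3 * ed G {a} A, by omega⟩

lemma ed_le_card (A B : Finset V) : ed G A B ≤ A.card * B.card := by
  unfold ed
  calc _ ≤ ∑ u ∈ A, ∑ v ∈ B, (1 : ℤ) := by
        refine Finset.sum_le_sum fun _ _ => Finset.sum_le_sum fun _ _ => ?_
        split_ifs <;> simp
    _ = _ := by simp

/-- a set of at most three vertices has potential at least that of the complete graph -/
lemma P_ge (R : Finset V) : 10 * (R.card : ℤ) - 3 * (R.card * (R.card - 1)) ≤ P G R := by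
  induction R using Finset.induction_on with
  | empty => simp [P_empty]
  | insert a A h ih =>
    rw [P_insert h, Finset.card_insert_of_notMem h]
    have := ed_le_card (G := G) {a} A
    simp only [Finset.card_singleton] at this
    push_cast at *
    nlinarith

/-- The graph obtained from `G` by replacing `R` by a triangle of colour classes. -/
def Y (G : SimpleGraph V) (R : Finset V) (φ : V → Fin 3) : SimpleGraph (V ⊕ Fin 3) where
  Adj
    | .inl a, .inl b => G.Adj a b
    | .inl a, .inr i => ∃ u ∈ R, φ u = i ∧ G.Adj a u
    | .inr i, .inl a => ∃ u ∈ R, φ u = i ∧ G.Adj a u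
    | .inr i, .inr j => i ≠ j
  symm := ⟨by
    rintro (a | i) (b | j) h
    · exact G.adj_symm h
    · exact h
    · exact h
    · exact fun e => h e.symm⟩
  loopless := ⟨by
    rintro (a | i) h
    · exact G.loopless.irrefl a h
    · exact h rfl⟩

def RX (R : Finset V) (φ : V → Fin 3) (X : Finset (Fin 3)) : Finset V := R.filter (φ · ∈ X)

lemma P_Y (R : Finset V) (φ : V → Fin 3) (A : Finset V) (X : Finset (Fin 3)) :
    P G A + (10 * (X.card : ℤ) - 3 * (X.card * (X.card - 1))) - 6 * ed G A (RX R φ X)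
      ≤ P (Y G R φ) (A.disjSum X) := by
  have hd : Disjoint (A.map Function.Embedding.inl) (X.map (Function.Embedding.inr (α := V))) := by
    rw [Finset.disjoint_left]; simp
  have h00 : P (Y G R φ) (A.disjSum X) = P (Y G R φ) (A.map Function.Embedding.inl)
      + P (Y G R φ) (X.map Function.Embedding.inr) - 6 * ed (Y G R φ)
        (A.map Function.Embedding.inl) (X.map Function.Embedding.inr) := by
    rw [← P_union hd]; congr 1
    ext x; simp [Finset.mem_disjSum]
  rw [h00]
  have h1 : P (Y G R φ) (A.map Function.Embedding.inl) = P G A := by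
    simp only [P, ed, Finset.card_map, Finset.sum_map, Function.Embedding.inl_apply]; rfl
  have h2 : 10 * (X.card : ℤ) - 3 * (X.card * (X.card - 1)) ≤
      P (Y G R φ) (X.map Function.Embedding.inr) := by
    have := P_ge (G := Y G R φ) (X.map Function.Embedding.inr)
    simpa using this
  have h3 : ed (Y G R φ) (A.map Function.Embedding.inl) (X.map Function.Embedding.inr) ≤
      ed G A (RX R φ X) := by
    unfold ed
    simp only [Finset.sum_map]
    refine Finset.sum_le_sum fun a _ => ?_
    have h4 : RX R φ X = X.biUnion (fun i => R.filter (φ · = i)) := by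
      ext v; simp [RX, and_comm]
    rw [h4, Finset.sum_biUnion]
    · refine Finset.sum_le_sum fun i _ => ?_
      split_ifs with h
      · obtain ⟨u, hu, hi, ha⟩ := h
        have : (if G.Adj a u then (1 : ℤ) else 0) ≤
            ∑ v ∈ R.filter (φ · = i), if G.Adj a v then (1 : ℤ) else 0 :=
          Finset.single_le_sum (f := fun v => if G.Adj a v then (1 : ℤ) else 0)
            (fun _ _ => by split_ifs <;> simp) (by simp [hu, hi])
        simpa [ha] using this
      · exact Finset.sum_nonneg fun _ _ => by split_ifs <;> simp
    · intro i _ j _ hij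
      simp only [Function.onFun]
      rw [Finset.disjoint_left]
      intro v hv hv'
      simp only [Finset.mem_filter] at hv hv'
      exact hij (hv.2.symm.trans hv'.2)
  linarith

variable [Fintype V]

/-- a colouring of `Y` gives a colouring of `G` extending `φ` -/
lemma col_of_Y (R : Finset V) (φ : V → Fin 3)
    (hφ : ∀ u ∈ R, ∀ v ∈ R, G.Adj u v → φ u ≠ φ v)
    (h : ColOn (Y G R φ) ((Finset.univ \ R).disjSum Finset.univ)) :
    ∃ c : V → Fin 3, (∀ u v, G.Adj u v → c u ≠ c v) ∧ ∀ u ∈ R, c u = φ u := by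
  obtain ⟨c, hc⟩ := h
  have hinj : Function.Injective (fun i : Fin 3 => c (.inr i)) := by
    intro i j hij
    by_contra hne
    exact hc (.inr i) (by simp) (.inr j) (by simp) hne hij
  have hbij := Finite.injective_iff_bijective.mp hinj
  let σ := Equiv.ofBijective _ hbij
  have hσ : ∀ i, σ i = c (.inr i) := fun i => rfl
  refine ⟨fun v => if v ∈ R then φ v else σ.symm (c (.inl v)), ?_, ?_⟩
  · intro u v huv
    by_cases hu : u ∈ R <;> by_cases hv : v ∈ R
    · simpa [hu, hv] using hφ u hu v hv huv
    · simp only [hu, hv, if_true, if_false]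
      intro he
      rw [Equiv.eq_symm_apply, hσ] at he
      exact hc (.inr (φ u)) (by simp) (.inl v) (by simp [hv]) ⟨u, hu, rfl, huv.symm⟩ he
    · simp only [hu, hv, if_true, if_false]
      intro he
      rw [Equiv.symm_apply_eq, hσ] at he
      exact hc (.inl u) (by simp [hu]) (.inr (φ v)) (by simp) ⟨v, hv, rfl, huv⟩ he
    · simp only [hu, hv, if_false]
      intro he
      exact hc (.inl u) (by simp [hu]) (.inl v) (by simp [hv]) huv (σ.symm.injective he)
  · intro u hu; simp [hu]

def IH (n : ℕ) : Prop := ∀ (W : Type) [Fintype W] (G : SimpleGraph W), Fintype.card W < n →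
  (∀ R : Finset W, R.Nonempty → 6 ≤ P G R) → Col G

lemma IH.on {n : ℕ} (h : IH n) {U : Type} (G : SimpleGraph U) (S : Finset U) (hS : S.card < n)
    (hg : GoodOn G S) : ColOn G S := by
  obtain ⟨c, hc⟩ := h S (G.induce (S : Set U)) (by simpa using hS) (by
    intro R hR
    have := hg (R.map (Function.Embedding.subtype _)) (by
      intro x; simp only [Finset.mem_map]; rintro ⟨y, _, rfl⟩; exact y.2) (by simpa using hR)
    simp only [P, ed, Finset.card_map, Finset.sum_map, Function.Embedding.coe_subtype] at this
    simp only [P, ed, SimpleGraph.comap_adj, Function.Embedding.coe_subtype]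
    convert this using 7
    split_ifs <;> simp_all)
  refine ⟨fun u => if hu : u ∈ S then c ⟨u, hu⟩ else 0, ?_⟩
  intro u hu v hv huv
  simp only [hu, hv, dif_pos]
  exact hc _ _ (by simpa using huv)


lemma ed_congr {G G' : SimpleGraph V} {A B : Finset V}
    (h : ∀ a ∈ A, ∀ b ∈ B, (G.Adj a b ↔ G'.Adj a b)) : ed G A B = ed G' A B := by
  unfold ed
  refine Finset.sum_congr rfl fun a ha => Finset.sum_congr rfl fun b hb => ?_
  simp only [h a ha b hb]

lemma P_congr {G G' : SimpleGraph V} {A : Finset V}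
    (h : ∀ a ∈ A, ∀ b ∈ A, (G.Adj a b ↔ G'.Adj a b)) : P G A = P G' A := by
  unfold P; rw [ed_congr h]

lemma ed_empty (A : Finset V) : ed G A ∅ = 0 := by simp [ed]

lemma ed_insert_right {a : V} {B : Finset V} (h : a ∉ B) (A : Finset V) :
    ed G A (insert a B) = ed G A {a} + ed G A B := by
  rw [Finset.insert_eq, ed_union_right (by simpa using h)]

/-- adding an edge -/
def addE (G : SimpleGraph V) (u v : V) (h : u ≠ v) : SimpleGraph V where
  Adj a b := G.Adj a b ∨ (a = u ∧ b = v) ∨ (a = v ∧ b = u)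
  symm := ⟨by
    rintro a b (h | h | h)
    · exact Or.inl h.symm
    · exact Or.inr (Or.inr h.symm)
    · exact Or.inr (Or.inl h.symm)⟩
  loopless := ⟨by
    rintro a (h' | ⟨rfl, h'⟩ | ⟨rfl, h'⟩)
    · exact G.loopless.irrefl a h'
    · exact h h'
    · exact h h'.symm⟩

lemma ed_addE {u v : V} (h : u ≠ v) (hn : ¬ G.Adj u v) (R : Finset V) :
    ed (addE G u v h) R R = ed G R R + if u ∈ R ∧ v ∈ R then 2 else 0 := by
  have h1 : ∀ a b, (if (addE G u v h).Adj a b then (1 : ℤ) else 0) =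
      (if G.Adj a b then 1 else 0) + ((if a = u then (if b = v then 1 else 0) else 0) +
        (if a = v then (if b = u then 1 else 0) else 0)) := by
    intro a b
    have hn' : ¬ G.Adj v u := fun h => hn h.symm
    simp only [addE]
    grind
  unfold ed
  simp only [h1, Finset.sum_add_distrib]
  congr 1
  by_cases hu : u ∈ R <;> by_cases hv : v ∈ R <;> simp [hu, hv, Finset.sum_ite_eq']

lemma P_addE {u v : V} (h : u ≠ v) (hn : ¬ G.Adj u v) (R : Finset V) :
    P (addE G u v h) R = P G R - if u ∈ R ∧ v ∈ R then 6 else 0 := by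
  unfold P; rw [ed_addE h hn]; split_ifs <;> ring

lemma P_addE_ge {u v : V} (h : u ≠ v) (R : Finset V) :
    P G R - 6 ≤ P (addE G u v h) R := by
  by_cases hn : G.Adj u v
  · have : P (addE G u v h) R = P G R := P_congr fun a _ b _ => by
      simp only [addE]
      constructor
      · rintro (h | ⟨rfl, rfl⟩ | ⟨rfl, rfl⟩)
        exacts [h, hn, hn.symm]
      · exact Or.inl
    linarith
  · rw [P_addE h hn]; split_ifs <;> linarith

section crit
variable (ih : IH (Fintype.card V)) (hg : ∀ R : Finset V, R.Nonempty → 6 ≤ P G R) (hnc : ¬ Col G)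
include ih hg

lemma sub_col {R : Finset V} (hR : R ≠ Finset.univ) : ColOn G R :=
  ih.on G R (Finset.card_lt_iff_ne_univ _ |>.2 hR) fun S _ => hg S

include hnc

lemma Ykey {R : Finset V} (hc : 4 ≤ R.card) (φ : V → Fin 3)
    (hφ : ∀ u ∈ R, ∀ v ∈ R, G.Adj u v → φ u ≠ φ v) :
    ∃ (A : Finset V) (X : Finset (Fin 3)), Disjoint A R ∧ X.Nonempty ∧
      P G (A ∪ R) ≤ P G R + 4 - (10 * (X.card : ℤ) - 3 * (X.card * (X.card - 1)))
        - 6 * ed G A (R \ RX R φ X) := by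
  by_contra hcon
  push Not at hcon
  apply hnc
  obtain ⟨c, hc1, -⟩ := col_of_Y R φ hφ (ih.on _ _ (by
    rw [Finset.card_disjSum, Finset.card_sdiff_of_subset (Finset.subset_univ _)]
    have := Finset.card_le_univ R
    simp only [Finset.card_univ, Fintype.card_fin]
    omega) (by
    intro R' hR' hne
    by_contra hlt
    obtain ⟨k, hk⟩ := P_even (G := Y G R φ) R'
    have h4 : P (Y G R φ) R' ≤ 4 := by omega
    have hdec : R'.toLeft.disjSum R'.toRight = R' := Finset.toLeft_disjSum_toRight
    have hd : Disjoint R'.toLeft R := by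
      rw [Finset.disjoint_left]
      intro a ha
      have := hR' (Finset.mem_toLeft.1 ha)
      simpa using this
    have hP := P_Y (G := G) R φ R'.toLeft R'.toRight
    rw [hdec] at hP
    by_cases hX : R'.toRight.Nonempty
    · have h1 := hcon _ _ hd hX
      rw [P_union hd] at h1
      have h2 : ed G R'.toLeft R = ed G R'.toLeft (RX R φ R'.toRight) +
          ed G R'.toLeft (R \ RX R φ R'.toRight) := by
        rw [← ed_union_right Finset.disjoint_sdiff]
        congr 1
        exact (Finset.union_sdiff_of_subset (Finset.filter_subset _ _)).symm
      rw [h2] at h1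
      linarith
    · rw [Finset.not_nonempty_iff_eq_empty] at hX
      have hA : R'.toLeft.Nonempty := by
        rw [← hdec, hX] at hne
        obtain ⟨x, hx⟩ := hne
        rcases Finset.mem_disjSum.1 hx with ⟨a, ha, _⟩ | ⟨a, ha, _⟩
        · exact ⟨a, ha⟩
        · simp at ha
      have h0 : RX R φ ∅ = ∅ := by simp [RX]
      rw [hX, h0, ed_empty] at hP
      have := hg _ hA
      simp at hP
      linarith))
  exact ⟨c, hc1⟩

omit hg hnc ih [Fintype V] in
lemma kX_ge {X : Finset (Fin 3)} (h : X.Nonempty) :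
    10 ≤ (10 * (X.card : ℤ) - 3 * (X.card * (X.card - 1))) ∧
    (2 ≤ X.card → 12 ≤ (10 * (X.card : ℤ) - 3 * (X.card * (X.card - 1)))) := by
  have h1 : X.card ≤ 3 := by simpa using Finset.card_le_univ X
  have h2 : 1 ≤ X.card := h.card_pos
  generalize X.card = k at *
  interval_cases k <;> norm_num

lemma L6 {R : Finset V} (hR : R ≠ Finset.univ) (h2 : 2 ≤ R.card) : 12 ≤ P G R := by
  by_contra hlt
  let T : Finset (Finset V) := Finset.univ.filter fun R => R ≠ Finset.univ ∧ 2 ≤ R.card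
  obtain ⟨R0, hR0, hmin⟩ := Finset.exists_min_image T (P G) ⟨R, by simp [T, hR, h2]⟩
  have hm := hmin R (by simp [T, hR, h2])
  simp only [T, Finset.mem_filter, Finset.mem_univ, true_and] at hR0
  obtain ⟨k, hk⟩ := P_even (G := G) R0
  have h10 : P G R0 ≤ 10 := by omega
  have h4 : 4 ≤ R0.card := by
    have := P_ge (G := G) R0
    by_contra h
    have h3 : R0.card < 4 := by omega
    have h2 := hR0.2
    generalize R0.card = k at *
    interval_cases k <;> norm_num at this <;> omega
  obtain ⟨φ, hφ⟩ := sub_col ih hg hR0.1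
  obtain ⟨A, X, hd, hX, hle⟩ := Ykey ih hg hnc h4 φ hφ
  have hk := (kX_ge hX).1
  have he := ed_nonneg (G := G) A (R0 \ RX R0 φ X)
  by_cases hu : A ∪ R0 = Finset.univ
  · have := hg (A ∪ R0) (by
      rw [hu]; obtain ⟨x, _⟩ := Finset.card_pos.1 (by omega : 0 < R0.card); exact ⟨x, by simp⟩)
    omega
  · have := hmin (A ∪ R0) (by
      simp only [T, Finset.mem_filter, Finset.mem_univ, true_and]
      exact ⟨hu, hR0.2.trans (Finset.card_le_card Finset.subset_union_right)⟩)
    omega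

lemma good_addE {R : Finset V} (hR : R ≠ Finset.univ) {u v : V} (h : u ≠ v) :
    GoodOn (addE G u v h) R := by
  intro S hS hne
  by_cases hc : 2 ≤ S.card
  · have hSu : S ≠ Finset.univ := fun e => hR (Finset.univ_subset_iff.1 (e ▸ hS))
    have := L6 ih hg hnc hSu hc
    have := P_addE_ge (G := G) h S
    omega
  · have h1 : S.card = 1 := by have := hne.card_pos; omega
    obtain ⟨a, rfl⟩ := Finset.card_eq_one.1 h1
    rw [P_single]; norm_num

lemma col_addE {R : Finset V} (hR : R ≠ Finset.univ) {u v : V} (h : u ≠ v) (hu : u ∈ R)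
    (hv : v ∈ R) : ∃ c : V → Fin 3, (∀ u ∈ R, ∀ v ∈ R, G.Adj u v → c u ≠ c v) ∧ c u ≠ c v := by
  obtain ⟨c, hc⟩ := ih.on (addE G u v h) R (Finset.card_lt_iff_ne_univ _ |>.2 hR)
    (good_addE ih hg hnc hR h)
  exact ⟨c, fun a ha b hb hab => hc a ha b hb (Or.inl hab),
    hc u hu v hv (Or.inr (Or.inl ⟨rfl, rfl⟩))⟩

lemma two_boundary {R : Finset V} (hR : R ≠ Finset.univ) (h2 : 2 ≤ R.card) :
    ∃ u ∈ R, ∃ v ∈ R, u ≠ v ∧ (∃ w, w ∉ R ∧ G.Adj u w) ∧ ∃ w, w ∉ R ∧ G.Adj v w := by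
  by_contra hcon
  push Not at hcon
  apply hnc
  obtain ⟨c1, hc1⟩ := sub_col ih hg hR
  have hne : R.Nonempty := Finset.card_pos.1 (by omega)
  obtain ⟨u, hu, hu'⟩ : ∃ u ∈ R, ∀ v ∈ R, ∀ w, w ∉ R → G.Adj v w → v = u := by
    by_cases hb : ∃ u ∈ R, ∃ w, w ∉ R ∧ G.Adj u w
    · obtain ⟨u, hu, w, hw, huw⟩ := hb
      refine ⟨u, hu, fun v hv w' hw' hvw => ?_⟩
      by_contra hne
      exact hcon u hu v hv (Ne.symm hne) ⟨w, hw, huw⟩ w' hw' hvw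
    · push Not at hb
      obtain ⟨u, hu⟩ := hne
      exact ⟨u, hu, fun v hv w hw hvw => absurd hvw (hb v hv w hw)⟩
  obtain ⟨v, hv, hvu⟩ := Finset.exists_mem_ne (by omega : 1 < R.card) u
  obtain ⟨c2, hc2⟩ := sub_col ih hg (R := insert u Rᶜ) (by
    intro h
    have : v ∈ insert u Rᶜ := by rw [h]; simp
    simp [hvu, hv] at this)
  let σ := Equiv.swap (c2 u) (c1 u)
  refine ⟨fun w => if w ∈ R then c1 w else σ (c2 w), ?_⟩
  have key : ∀ a ∈ R, ∀ b, b ∉ R → G.Adj a b → c1 a ≠ σ (c2 b) := by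
    intro a ha b hb hab
    obtain rfl := hu' a ha b hb hab
    have : c1 a = σ (c2 a) := by simp [σ]
    rw [this]
    exact fun h => hc2 a (by simp) b (by simp [hb]) hab (σ.injective h)
  intro a b hab
  by_cases ha : a ∈ R <;> by_cases hb : b ∈ R <;> simp only [ha, hb, if_true, if_false]
  · exact hc1 a ha b hb hab
  · exact key a ha b hb hab
  · exact (key b hb a ha hab.symm).symm
  · exact fun h => hc2 a (by simp [ha]) b (by simp [hb]) hab (σ.injective h)

lemma L7 {R : Finset V} (hR : R ≠ Finset.univ) (h2 : 2 ≤ R.card) (hP : P G R ≤ 12) :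
    ∀ u ∈ R, ∀ v ∈ R, u ≠ v → G.Adj u v := by
  by_cases h4 : 4 ≤ R.card
  · exfalso
    obtain ⟨u, hu, v, hv, huv, ⟨w, hw, huw⟩, ⟨w', hw', hvw⟩⟩ := two_boundary ih hg hnc hR h2
    obtain ⟨φ, hφ, hne⟩ := col_addE ih hg hnc hR huv hu hv
    obtain ⟨A, X, hd, hX, hle⟩ := Ykey ih hg hnc h4 φ hφ
    have hk := (kX_ge hX)
    have he := ed_nonneg (G := G) A (R \ RX R φ X)
    have hun : A ∪ R = Finset.univ := by
      by_contra hu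
      have := L6 ih hg hnc hu (h2.trans (Finset.card_le_card Finset.subset_union_right))
      omega
    have h6 := hg (A ∪ R) ⟨u, by simp [hu]⟩
    have hX1 : X.card = 1 := by
      have := hX.card_pos
      by_contra hne1
      have h := hk.2 (by omega)
      omega
    have he0 : ed G A (R \ RX R φ X) = 0 := by omega
    obtain ⟨i, rfl⟩ := Finset.card_eq_one.1 hX1
    have hA : ∀ w, w ∉ R → w ∈ A := fun w hw => by
      have : w ∈ A ∪ R := by rw [hun]; simp
      simpa [hw] using this
    by_cases hi : φ u = i
    · have := ed_pos (G := G) (hA w' hw') (b := v) (B := R \ RX R φ {i})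
        (by simp only [Finset.mem_sdiff, RX, Finset.mem_filter, Finset.mem_singleton]
            exact ⟨hv, fun h => hne (hi.trans h.2.symm)⟩) hvw.symm
      omega
    · have := ed_pos (G := G) (hA w hw) (b := u) (B := R \ RX R φ {i})
        (by simp only [Finset.mem_sdiff, RX, Finset.mem_filter, Finset.mem_singleton]
            exact ⟨hu, fun h => hi h.2⟩) huw.symm
      omega
  · intro u hu v hv huv
    by_contra hn
    have h1 := P_ge (G := addE G u v huv) R
    rw [P_addE huv hn, if_pos ⟨hu, hv⟩] at h1
    have h3 : R.card < 4 := by omega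
    generalize R.card = k at *
    interval_cases k <;> norm_num at h1 <;> omega

end crit

section crit2
variable (ih : IH (Fintype.card V)) (hg : ∀ R : Finset V, R.Nonempty → 6 ≤ P G R) (hnc : ¬ Col G)

def N (G : SimpleGraph V) (x : V) : Finset V := Finset.univ.filter (G.Adj x)

lemma mem_N {x y : V} : y ∈ N G x ↔ G.Adj x y := by simp [N]

lemma ed_N (x : V) (A : Finset V) : ed G {x} A = (A.filter (G.Adj x)).card := by
  simp [ed]

include hnc in
lemma ext2 {x y : V} (hxy : x ≠ y) (c : V → Fin 3)
    (hc : ∀ u, u ≠ x → u ≠ y → ∀ v, v ≠ x → v ≠ y → G.Adj u v → c u ≠ c v) (a b : Fin 3)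
    (hab : a ≠ b) (ha : ∀ w, w ≠ y → G.Adj x w → c w ≠ a)
    (hb : ∀ w, w ≠ x → G.Adj y w → c w ≠ b) : False := by
  apply hnc
  refine ⟨fun w => if w = x then a else if w = y then b else c w, ?_⟩
  intro u v huv
  have := huv.symm
  have := huv.ne
  grind

include ih hg hnc

lemma min_deg (x : V) : 3 ≤ (N G x).card := by
  by_contra hlt
  obtain ⟨c, hc⟩ := sub_col ih hg (R := Finset.univ \ {x}) (by
    intro h
    have : x ∈ Finset.univ \ {x} := by rw [h]; simp
    simp at this)
  obtain ⟨a, ha⟩ : ∃ a : Fin 3, a ∉ (N G x).image c := by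
    by_contra h
    push Not at h
    have h1 : (N G x).image c = Finset.univ := Finset.eq_univ_iff_forall.2 h
    have h2 := Finset.card_image_le (s := N G x) (f := c)
    rw [h1] at h2
    simp at h2
    omega
  apply hnc
  refine ⟨fun w => if w = x then a else c w, ?_⟩
  have ha' : ∀ w, G.Adj x w → c w ≠ a := by
    intro w hw h
    exact ha (Finset.mem_image.2 ⟨w, mem_N.2 hw, h⟩)
  intro u v huv
  have h1 := huv.symm
  have h2 := huv.ne
  have hc' : ∀ u, u ≠ x → ∀ v, v ≠ x → G.Adj u v → c u ≠ c v := by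
    intro u hu v hv; exact hc u (by simp [hu]) v (by simp [hv])
  grind

lemma L9 {x y z : V} (hxy : G.Adj x y) (hxz : G.Adj x z) (hyz : G.Adj y z)
    (hx : (N G x).card = 3) (hy : (N G y).card = 3) : False := by
  obtain ⟨x', hx', hxy', hxz'⟩ : ∃ x' ∈ N G x, x' ≠ y ∧ x' ≠ z := by
    by_contra h
    push Not at h
    have : N G x ⊆ {y, z} := fun w hw => by
      by_cases e : w = y
      · simp [e]
      · simp [h w hw e]
    have := (Finset.card_le_card this).trans Finset.card_le_two
    omega
  obtain ⟨y', hy', hyx', hyz'⟩ : ∃ y' ∈ N G y, y' ≠ x ∧ y' ≠ z := by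
    by_contra h
    push Not at h
    have : N G y ⊆ {x, z} := fun w hw => by
      by_cases e : w = x
      · simp [e]
      · simp [h w hw e]
    have := (Finset.card_le_card this).trans Finset.card_le_two
    omega
  have hNx : ∀ w, G.Adj x w → w = y ∨ w = z ∨ w = x' := by
    have : ({y, z, x'} : Finset V) = N G x := Finset.eq_of_subset_of_card_le (by
      intro w; simp only [Finset.mem_insert, Finset.mem_singleton]
      rintro (rfl | rfl | rfl)
      exacts [mem_N.2 hxy, mem_N.2 hxz, hx']) (by
      rw [hx, Finset.card_eq_three.2 ⟨y, z, x', hyz.ne, hxy'.symm, hxz'.symm, rfl⟩])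
    intro w hw
    have := mem_N.2 hw
    rw [← ‹_ = N G x›] at this
    simpa using this
  have hNy : ∀ w, G.Adj y w → w = x ∨ w = z ∨ w = y' := by
    have : ({x, z, y'} : Finset V) = N G y := Finset.eq_of_subset_of_card_le (by
      intro w; simp only [Finset.mem_insert, Finset.mem_singleton]
      rintro (rfl | rfl | rfl)
      exacts [mem_N.2 hxy.symm, mem_N.2 hyz, hy']) (by
      rw [hy, Finset.card_eq_three.2 ⟨x, z, y', hxz.ne, hyx'.symm, hyz'.symm, rfl⟩])
    intro w hw
    have := mem_N.2 hw
    rw [← ‹_ = N G y›] at this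
    simpa using this
  rw [mem_N] at hx' hy'
  have hne : x' ≠ y' := by
    rintro rfl
    by_cases hu : ({x', x, y, z} : Finset V) = Finset.univ
    · by_cases hz : G.Adj z x'
      · have := hg {x', x, y, z} ⟨x, by simp⟩
        rw [P_insert (by simp [hxy', hxz', hyx']), P_insert (by simp [hxy.ne, hxz.ne]),
          P_insert (by simp [hyz.ne]), P_single,
          ed_insert_right (by simp [hxy.ne, hxz.ne, hyz.ne]), ed_insert_right (by simp [hxy.ne, hxz.ne, hyz.ne]),
          ed_insert_right (by simp [hyz.ne])] at this
        simp only [ed_single, hxy, hxz, hyz, hx'.symm, hy'.symm, hz.symm, if_true] at this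
        omega
      · have hz' : ¬ G.Adj x' z := fun h => hz h.symm
        refine ext2 hnc hxy.ne (fun _ => 2) ?_ 0 1 (by decide) (by simp) (by simp)
        intro u hux huy v hvx hvy huv
        have hu' : u ∈ ({x', x, y, z} : Finset V) := by rw [hu]; simp
        have hv' : v ∈ ({x', x, y, z} : Finset V) := by rw [hu]; simp
        simp [hux, huy, hvx, hvy] at hu' hv'
        have := huv.ne
        grind
    · have := L6 ih hg hnc hu (by
        rw [Finset.card_insert_of_notMem (by simp [hxy', hxz', hyx'])]
        rw [Finset.card_insert_of_notMem (by simp [hxy.ne, hxz.ne])]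
        omega)
      rw [P_insert (by simp [hxy', hxz', hyx']), P_insert (by simp [hxy.ne, hxz.ne]),
          P_insert (by simp [hyz.ne]), P_single,
          ed_insert_right (by simp [hxy.ne, hxz.ne, hyz.ne]), ed_insert_right (by simp [hxy.ne, hxz.ne, hyz.ne]),
          ed_insert_right (by simp [hyz.ne])] at this
      simp only [ed_single, hxy, hxz, hyz, hx'.symm, hy'.symm, if_true] at this
      split_ifs at this <;> omega
  obtain ⟨c, hc, hc'⟩ := col_addE ih hg hnc (R := Finset.univ \ {x, y}) (by
    intro h
    have : x ∈ Finset.univ \ {x, y} := by rw [h]; simp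
    simp at this) hne (by simp [hx'.ne', hxy']) (by simp [hy'.ne', hyx'])
  have dec : ∀ p q r : Fin 3, q ≠ r → ∃ a b, a ≠ b ∧ p ≠ a ∧ q ≠ a ∧ p ≠ b ∧ r ≠ b := by decide
  obtain ⟨a, b, hab, h1, h2, h3, h4⟩ := dec (c z) _ _ hc'
  refine ext2 hnc hxy.ne c ?_ a b hab ?_ ?_
  · intro u hux huy v hvx hvy
    exact hc u (by simp [hux, huy]) v (by simp [hvx, hvy])
  · intro w hw hxw
    rcases hNx w hxw with rfl | rfl | rfl
    exacts [absurd rfl hw, h1, h2]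
  · intro w hw hxw
    rcases hNy w hxw with rfl | rfl | rfl
    exacts [absurd rfl hw, h3, h4]

/-- identification of two vertices -/
def glue (G : SimpleGraph V) (u v : V) : SimpleGraph V where
  Adj a b := a ≠ b ∧ (G.Adj a b ∨ (a = u ∧ G.Adj v b) ∨ (b = u ∧ G.Adj v a))
  symm := ⟨by
    rintro a b ⟨hn, h | h | h⟩
    · exact ⟨hn.symm, Or.inl h.symm⟩
    · exact ⟨hn.symm, Or.inr (Or.inr h)⟩
    · exact ⟨hn.symm, Or.inr (Or.inl h)⟩⟩
  loopless := ⟨by rintro a ⟨h, _⟩; exact h rfl⟩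

omit ih hg hnc in
lemma P_glue {u v : V} (hn : ¬ G.Adj u v) (huv : u ≠ v) {R : Finset V} (hu : u ∈ R) (hv : v ∉ R) :
    P G (insert v R) ≤ P (glue G u v) R + 10 := by
  obtain ⟨R0, h0, rfl⟩ : ∃ R0, u ∉ R0 ∧ R = insert u R0 := ⟨R.erase u, by simp, by simp [hu]⟩
  have hv0 : v ∉ R0 := fun h => hv (by simp [h])
  rw [P_insert hv, P_insert h0, P_insert h0, ed_insert_right h0, ed_single,
    if_neg (fun h => hn h.symm)]
  have h1 : P (glue G u v) R0 = P G R0 := P_congr fun a ha b hb => by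
    have h1 : a ≠ u := fun e => h0 (e ▸ ha)
    have h2 : b ≠ u := fun e => h0 (e ▸ hb)
    simp only [glue, h1, h2, false_and, or_false]
    exact ⟨fun h => h.2, fun h => ⟨h.ne, h⟩⟩
  have h2 : ed (glue G u v) {u} R0 ≤ ed G {u} R0 + ed G {v} R0 := by
    simp only [ed, Finset.sum_singleton, ← Finset.sum_add_distrib]
    refine Finset.sum_le_sum fun b hb => ?_
    have h2 : b ≠ u := fun e => h0 (e ▸ hb)
    simp only [glue, h2, false_and, or_false]
    split_ifs <;> simp_all
  omega

lemma L10 {x y u v : V} (hxy : G.Adj x y) (hxu : G.Adj x u) (hxv : G.Adj x v)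
    (huv : u ≠ v) (hyu : u ≠ y) (hyv : v ≠ y)
    (hx : (N G x).card = 3) (hy : (N G y).card = 3) : G.Adj u v := by
  by_contra hn
  have hNx : ∀ w, G.Adj x w → w = y ∨ w = u ∨ w = v := by
    have : ({y, u, v} : Finset V) = N G x := Finset.eq_of_subset_of_card_le (by
      intro w; simp only [Finset.mem_insert, Finset.mem_singleton]
      rintro (rfl | rfl | rfl)
      exacts [mem_N.2 hxy, mem_N.2 hxu, mem_N.2 hxv]) (by
      rw [hx, Finset.card_eq_three.2 ⟨y, u, v, hyu.symm, hyv.symm, huv, rfl⟩])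
    intro w hw
    have := mem_N.2 hw
    rw [← ‹_ = N G x›] at this
    simpa using this
  obtain ⟨c, hc⟩ : ColOn (glue G u v) (Finset.univ \ {x, y, v}) := by
    apply ih.on
    · apply Finset.card_lt_univ_of_notMem (x := x); simp
    · intro R hR hne
      have hxR : x ∉ R := fun h => by simpa using hR h
      have hyR : y ∉ R := fun h => by simpa using hR h
      have hvR : v ∉ R := fun h => by simpa using hR h
      by_cases hu : u ∈ R
      · by_contra hlt
        have h1 := P_glue hn huv hu hvR
        have hx' : x ∉ insert v R := by simp [hxR, hxv.ne]
        have h2 : P G (insert x (insert v R)) ≤ 12 := by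
          rw [P_insert hx']
          have h3 : 2 ≤ ed G {x} (insert v R) := by
            rw [ed_N]
            have : ({u, v} : Finset V) ⊆ (insert v R).filter (G.Adj x) := by
              intro w; simp only [Finset.mem_insert, Finset.mem_singleton, Finset.mem_filter]
              rintro (rfl | rfl) <;> simp [*]
            have := Finset.card_le_card this
            rw [Finset.card_pair huv] at this
            exact_mod_cast this
          obtain ⟨k, hk⟩ := P_even (G := glue G u v) R
          omega
        refine hn (L7 ih hg hnc (R := insert x (insert v R)) ?_ ?_ h2 u (by simp [hu]) v (by simp) huv)
        · intro h
          have : y ∈ insert x (insert v R) := by rw [h]; simp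
          simp [hyR, hxy.ne', hyv.symm] at this
        · rw [Finset.card_insert_of_notMem hx', Finset.card_insert_of_notMem hvR]; omega
      · have h1 : P (glue G u v) R = P G R := P_congr fun a ha b hb => by
          have h1 : a ≠ u := fun e => hu (e ▸ ha)
          have h2 : b ≠ u := fun e => hu (e ▸ hb)
          simp only [glue, h1, h2, false_and, or_false]
          exact ⟨fun h => h.2, fun h => ⟨h.ne, h⟩⟩
        rw [h1]; exact hg R hne
  let c' : V → Fin 3 := fun w => if w = v then c u else c w
  have hc' : ∀ a, a ≠ x → a ≠ y → ∀ b, b ≠ x → b ≠ y → G.Adj a b → c' a ≠ c' b := by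
    intro a hax hay b hbx hby hab
    have key : ∀ b, b ≠ x → b ≠ y → G.Adj v b → c u ≠ c b := by
      intro b hbx hby hvb
      have hbu : b ≠ u := by rintro rfl; exact hn hvb.symm
      exact hc u (by simp [hxu.ne', hyu, huv]) b (by simp [hbx, hby, hvb.ne'])
        ⟨hbu.symm, Or.inr (Or.inl ⟨rfl, hvb⟩)⟩
    by_cases ha : a = v <;> by_cases hb : b = v <;> simp only [c', ha, hb, if_true, if_false]
    · exact absurd (ha.trans hb.symm) hab.ne
    · exact key b hbx hby (ha ▸ hab)
    · exact (key a hax hay (hb ▸ hab.symm)).symm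
    · exact hc a (by simp [hax, hay, ha]) b (by simp [hbx, hby, hb]) ⟨hab.ne, Or.inl hab⟩
  obtain ⟨b, hb⟩ : ∃ b : Fin 3, b ∉ ((N G y).erase x).image c' := by
    by_contra h
    push Not at h
    have h1 : ((N G y).erase x).image c' = Finset.univ := Finset.eq_univ_iff_forall.2 h
    have h2 := Finset.card_image_le (s := (N G y).erase x) (f := c')
    rw [h1, Finset.card_erase_of_mem (mem_N.2 hxy.symm), hy] at h2
    simp at h2
  have dec : ∀ p b : Fin 3, ∃ a, a ≠ b ∧ p ≠ a := by decide
  obtain ⟨a, hab, ha⟩ := dec (c u) b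
  refine ext2 hnc hxy.ne c' hc' a b hab ?_ ?_
  · intro w hw hxw
    rcases hNx w hxw with rfl | rfl | rfl
    · exact absurd rfl hw
    · simp [c', huv, ha]
    · simp [c', ha]
  · intro w hw hyw h
    exact hb (Finset.mem_image.2 ⟨w, Finset.mem_erase.2 ⟨hw, mem_N.2 hyw⟩, h⟩)

lemma final : False := by
  let D : Finset V := Finset.univ.filter fun x => (N G x).card = 3
  have hne : Nonempty V := by
    by_contra h
    rw [not_nonempty_iff] at h
    exact hnc ⟨fun _ => 0, fun u => isEmptyElim u⟩
  have hdeg : ∀ A : Finset V, ed G A Finset.univ = ∑ x ∈ A, ((N G x).card : ℤ) := by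
    intro A
    simp [ed, N]
  have h2 : ∀ x ∈ D, 2 ≤ ed G {x} Dᶜ := by
    intro x hx
    simp only [D, Finset.mem_filter, Finset.mem_univ, true_and] at hx
    rw [ed_N]
    by_contra hlt
    have h1 : (N G x ∩ Dᶜ).card ≤ 1 := by
      have : N G x ∩ Dᶜ = Dᶜ.filter (G.Adj x) := by ext w; simp [N, and_comm]
      rw [this]; omega
    have h3 : 2 ≤ (N G x ∩ D).card := by
      have := Finset.card_inter_add_card_sdiff (N G x) D
      rw [Finset.sdiff_eq_inter_compl] at this
      omega
    obtain ⟨y, hy, z, hz, hyz⟩ := Finset.one_lt_card.1 (show 1 < (N G x ∩ D).card by omega)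
    simp only [Finset.mem_inter, D, Finset.mem_filter, Finset.mem_univ, true_and] at hy hz
    obtain ⟨w, hw, hwy, hwz⟩ : ∃ w ∈ N G x, w ≠ y ∧ w ≠ z := by
      by_contra h
      push Not at h
      have : N G x ⊆ {y, z} := fun w hw => by
        by_cases e : w = y
        · simp [e]
        · simp [h w hw e]
      have := (Finset.card_le_card this).trans Finset.card_le_two
      omega
    have hxy := mem_N.1 hy.1
    have hxz := mem_N.1 hz.1
    have hxw := mem_N.1 hw
    have hzw := L10 ih hg hnc hxy hxz hxw hwz.symm hyz.symm hwy hx hy.2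
    exact L9 ih hg hnc hxz hxw hzw hx hz.2
  have e1 : 2 * (D.card : ℤ) ≤ ed G D Dᶜ := by
    have : ed G D Dᶜ = ∑ x ∈ D, ed G {x} Dᶜ := by simp only [ed, Finset.sum_singleton]
    rw [this]
    calc 2 * (D.card : ℤ) = ∑ x ∈ D, (2 : ℤ) := by simp [mul_comm]
      _ ≤ _ := Finset.sum_le_sum h2
  have e2 : ed G D Dᶜ ≤ ed G Dᶜ Finset.univ := by
    rw [ed_comm]; exact ed_mono_right (Finset.subset_univ _) _
  have e3 : ed G D Finset.univ = 3 * D.card := by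
    rw [hdeg, Finset.sum_congr rfl (g := fun _ => (3 : ℤ))]
    · simp [mul_comm]
    · intro x hx
      simp only [D, Finset.mem_filter, Finset.mem_univ, true_and] at hx
      simp [hx]
  have e4 : 4 * (Dᶜ.card : ℤ) ≤ ed G Dᶜ Finset.univ := by
    rw [hdeg]
    calc 4 * (Dᶜ.card : ℤ) = ∑ x ∈ Dᶜ, (4 : ℤ) := by simp [mul_comm]
      _ ≤ _ := Finset.sum_le_sum fun x hx => by
        have := min_deg ih hg hnc x
        simp only [D, Finset.mem_compl, Finset.mem_filter, Finset.mem_univ, true_and] at hx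
        have : 4 ≤ (N G x).card := by omega
        exact_mod_cast this
  have e5 : ed G Finset.univ Finset.univ = ed G D Finset.univ + ed G Dᶜ Finset.univ := by
    rw [← ed_union_left disjoint_compl_right, Finset.union_compl]
  have e6 : D.card + Dᶜ.card = (Finset.univ : Finset V).card := by
    rw [Finset.card_add_card_compl]; simp
  have := hg Finset.univ Finset.univ_nonempty
  unfold P at this
  rw [← e6] at this
  push_cast at this
  omega

end crit2

theorem ky_aux (n : ℕ) : IH n := by
  induction n with
  | zero => intro W _ G h; omega
  | succ n ih =>
    intro W _ G hlt hg
    by_contra hnc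
    refine final (G := G) ?_ hg hnc
    intro W' _ G' h' hg'
    exact ih W' G' (by omega) hg'

theorem ky (G : SimpleGraph V) (hg : ∀ R : Finset V, R.Nonempty → 6 ≤ P G R) : Col G :=
  ky_aux (Fintype.card V + 1) V G (by omega) hg

theorem kyOn (G : SimpleGraph V) (S : Finset V) (hg : GoodOn G S) : ColOn G S :=
  (ky_aux (S.card + 1)).on G S (by omega) hg

end KY


namespace PDG
open scoped Classical
set_option linter.unusedSectionVars false
set_option linter.unusedSimpArgs false
set_option linter.unusedVariables false
set_option autoImplicit false

variable {V : Type} [Fintype V]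

/-- elements of the binary cycle space -/
def IsCyc (Γ : SimpleGraph V) (z : Sym2 V → ZMod 2) : Prop :=
  (∀ e, e ∉ Γ.edgeSet → z e = 0) ∧ ∀ v, ∑ w, z s(v, w) = 0

def dl (Γ : SimpleGraph V) {F : Type} (l r : Sym2 V → F) (φ : F → ZMod 2) (e : Sym2 V) : ZMod 2 :=
  if e ∈ Γ.edgeSet then φ (l e) + φ (r e) else 0

/-- algebraic planar dual -/
structure PD (Γ : SimpleGraph V) where
  F : Type
  fin : Finite F
  l : Sym2 V → F
  r : Sym2 V → F
  even : ∀ φ, IsCyc Γ (dl Γ l r φ)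
  exact : ∀ z, IsCyc Γ z → ∃ φ, dl Γ l r φ = z
  conn : ∀ φ, dl Γ l r φ = 0 → ∀ a b, φ a = φ b
  loc : ∀ (v : V) (φ : F → ZMod 2), (∀ w, Γ.Adj v w → φ (l s(v, w)) = φ (r s(v, w))) →
    ∀ w w', Γ.Adj v w → Γ.Adj v w' → φ (l s(v, w)) = φ (l s(v, w'))

lemma z2_add_eq_zero {a b : ZMod 2} : a + b = 0 ↔ a = b := by revert a b; decide

lemma z2_cases (a : ZMod 2) : a = 0 ∨ a = 1 := by revert a; decide

lemma IsCyc.add {Γ : SimpleGraph V} {z z' : Sym2 V → ZMod 2} (h : IsCyc Γ z) (h' : IsCyc Γ z') :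
    IsCyc Γ (z + z') := by
  refine ⟨fun e he => by simp [h.1 e he, h'.1 e he], fun v => ?_⟩
  simp [Finset.sum_add_distrib, h.2 v, h'.2 v]

lemma dl_add (Γ : SimpleGraph V) {F : Type} (l r : Sym2 V → F) (φ φ' : F → ZMod 2) :
    dl Γ l r (φ + φ') = dl Γ l r φ + dl Γ l r φ' := by
  funext e; simp only [dl, Pi.add_apply]; split_ifs <;> ring

lemma dl_const (Γ : SimpleGraph V) {F : Type} (l r : Sym2 V → F) (c : ZMod 2) :
    dl Γ l r (fun _ => c) = 0 := by
  funext e; simp only [dl, Pi.zero_apply]; split_ifs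
  · exact z2_add_eq_zero.2 rfl
  · rfl

/-- restriction to a subgraph -/
def relPD {Γ : SimpleGraph V} (D : PD Γ) (Γ₁ : SimpleGraph V) : Setoid D.F where
  r a b := ∀ φ : D.F → ZMod 2, (∀ e, e ∉ Γ₁.edgeSet → dl Γ D.l D.r φ e = 0) → φ a = φ b
  iseqv := ⟨fun _ _ _ => rfl, fun h φ hφ => (h φ hφ).symm,
    fun h h' φ hφ => (h φ hφ).trans (h' φ hφ)⟩

section sub
variable {Γ : SimpleGraph V} (D : PD Γ) {Γ₁ : SimpleGraph V} (hle : Γ₁ ≤ Γ)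
include hle

lemma edgeSet_le {e : Sym2 V} (h : e ∈ Γ₁.edgeSet) : e ∈ Γ.edgeSet :=
  SimpleGraph.edgeSet_mono hle h

lemma rel_of_notMem {e : Sym2 V} (he : e ∈ Γ.edgeSet) (he1 : e ∉ Γ₁.edgeSet) :
    (relPD D Γ₁).r (D.l e) (D.r e) := by
  intro φ hφ
  have := hφ e he1
  simpa [dl, he, z2_add_eq_zero] using this

lemma dl_quot (φ : Quotient (relPD D Γ₁) → ZMod 2) :
    dl Γ₁ (fun e => (⟦D.l e⟧ : Quotient (relPD D Γ₁))) (fun e => ⟦D.r e⟧) φ =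
      dl Γ D.l D.r (fun a => φ ⟦a⟧) := by
  funext e
  unfold dl
  by_cases h1 : e ∈ Γ₁.edgeSet
  · simp [h1, edgeSet_le hle h1]
  · by_cases h : e ∈ Γ.edgeSet
    · have : (⟦D.l e⟧ : Quotient (relPD D Γ₁)) = ⟦D.r e⟧ :=
        Quotient.sound (rel_of_notMem D hle h h1)
      simp only [h1, h, this, if_true, if_false]
      exact (z2_add_eq_zero.2 rfl).symm
    · simp [h1, h]

def subPD : PD Γ₁ where
  F := Quotient (relPD D Γ₁)
  fin := by
    have := D.fin
    exact Finite.of_surjective _ (Quotient.mk_surjective (s := relPD D Γ₁))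
  l e := ⟦D.l e⟧
  r e := ⟦D.r e⟧
  even φ := by
    refine ⟨fun e he => by simp [dl, he], fun v => ?_⟩
    rw [dl_quot D hle]
    exact (D.even _).2 v
  exact z hz := by
    obtain ⟨φ, hφ⟩ := D.exact z ⟨fun e he => hz.1 e (fun h => he (edgeSet_le hle h)), hz.2⟩
    refine ⟨Quotient.lift φ fun a b hab => hab φ fun e he => ?_, ?_⟩
    · rw [hφ]; exact hz.1 e he
    · rw [dl_quot D hle]; exact hφ
  conn φ hφ := by
    rw [dl_quot D hle] at hφ
    have := D.conn _ hφ
    intro a b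
    induction a using Quotient.ind
    induction b using Quotient.ind
    exact this _ _
  loc v φ hφ := by
    have := D.loc v (fun a => φ ⟦a⟧) (by
      intro w hw
      by_cases h1 : Γ₁.Adj v w
      · exact hφ w h1
      · exact congrArg φ (Quotient.sound (rel_of_notMem D hle (e := s(v, w)) hw h1)))
    intro w w' hw hw'
    exact this w w' (hle hw) (hle hw')

end sub

def ind {F : Type} (f : F) : F → ZMod 2 := fun a => if a = f then 1 else 0

/-- a face of the subgraph obtained from a class -/
lemma face_sub {Γ : SimpleGraph V} (D : PD Γ) {Γ₁ : SimpleGraph V} (hle : Γ₁ ≤ Γ)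
    {φ : D.F → ZMod 2} {f0 : D.F} (h0 : φ f0 = 1)
    (hsup : ∀ e, e ∉ Γ₁.edgeSet → dl Γ D.l D.r φ e = 0)
    (hcl : ∀ a, φ a = 1 → (relPD D Γ₁).r a f0) :
    dl Γ₁ (subPD D hle).l (subPD D hle).r (ind (F := Quotient (relPD D Γ₁)) ⟦f0⟧) =
      dl Γ D.l D.r φ := by
  have := dl_quot D hle (ind ⟦f0⟧)
  refine this.trans ?_
  congr 1
  funext a
  unfold ind
  split_ifs with h
  · have h2 : (relPD D Γ₁).r a f0 := Quotient.exact h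
    rw [h2 φ hsup, h0]
  · rcases z2_cases (φ a) with h' | h'
    · exact h'.symm
    · exact absurd (Quotient.sound (hcl a h')) h

structure Cy (Γ : SimpleGraph V) {n : ℕ} [NeZero n] (c : Fin n → V) : Prop where
  inj : Function.Injective c
  adj : ∀ i, Γ.Adj (c i) (c (i + 1))
  len : n = 4 ∨ n = 5

def zc {n : ℕ} [NeZero n] (c : Fin n → V) (e : Sym2 V) : ZMod 2 :=
  if ∃ i, e = s(c i, c (i + 1)) then 1 else 0

lemma fin4_ne : ∀ i : Fin 4, i ≠ i + 1 ∧ i ≠ i + 1 + 1 := by decide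
lemma fin5_ne : ∀ i : Fin 5, i ≠ i + 1 ∧ i ≠ i + 1 + 1 := by decide

section cyc
variable {Γ : SimpleGraph V} {n : ℕ} [NeZero n] {c : Fin n → V} (hc : Cy Γ c)
include hc

lemma zc_edge (i : Fin n) : zc c s(c i, c (i + 1)) = 1 := by
  unfold zc; rw [if_pos ⟨i, rfl⟩]

lemma Cy.ne2 (i : Fin n) : i ≠ i + 1 + 1 := by
  rcases hc.len with rfl | rfl
  · exact (fin4_ne i).2
  · exact (fin5_ne i).2

lemma Cy.ne1 (i : Fin n) : i ≠ i + 1 := by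
  rcases hc.len with rfl | rfl
  · exact (fin4_ne i).1
  · exact (fin5_ne i).1

lemma Cy.edge_inj {i j : Fin n} (h : s(c i, c (i + 1)) = s(c j, c (j + 1))) : i = j := by
  rw [Sym2.eq_iff] at h
  rcases h with h | h
  · exact hc.inj h.1
  · have h1 := hc.inj h.1
    have h2 := hc.inj h.2
    exfalso
    apply hc.ne2 j
    rw [← h1, h2]

/-- sum at a vertex of an element supported on the cycle -/
lemma sum_at {z : Sym2 V → ZMod 2} (hz : ∀ e, (∀ i, e ≠ s(c i, c (i + 1))) → z e = 0)
    (i : Fin n) : ∑ w, z s(c (i + 1), w) = z s(c i, c (i + 1)) + z s(c (i + 1), c (i + 1 + 1)) := by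
  have hne : c i ≠ c (i + 1 + 1) := fun h => hc.ne2 i (hc.inj h)
  have : ∑ w, z s(c (i + 1), w) = ∑ w ∈ ({c i, c (i + 1 + 1)} : Finset V), z s(c (i + 1), w) := by
    symm
    apply Finset.sum_subset (Finset.subset_univ _)
    intro w _ hw
    apply hz
    intro j hj
    apply hw
    rw [Sym2.eq_iff] at hj
    rcases hj with h | h
    · have := hc.inj h.1
      simp [h.2, this]
    · have := hc.inj h.1
      have : i = j := add_right_cancel this
      simp [h.2, this]
  rw [this, Finset.sum_pair hne, Sym2.eq_swap]

lemma sum_off {z : Sym2 V → ZMod 2} (hz : ∀ e, (∀ i, e ≠ s(c i, c (i + 1))) → z e = 0)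
    {v : V} (hv : ∀ i, v ≠ c i) : ∑ w, z s(v, w) = 0 := by
  refine Finset.sum_eq_zero fun w _ => hz _ fun i hi => ?_
  rw [Sym2.eq_iff] at hi
  rcases hi with h | h
  · exact hv _ h.1
  · exact hv _ h.1

lemma fin_const {f : Fin n → ZMod 2} (h : ∀ i, f i = f (i + 1)) (i : Fin n) : f i = f 0 := by
  have : ∀ k : ℕ, f (Fin.ofNat n k) = f 0 := by
    intro k
    induction k with
    | zero => rfl
    | succ k ih =>
      rw [← ih, h (Fin.ofNat n k)]
      congr 1
      ext
      simp [Fin.val_add]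
  have := this i.val
  simpa using this

lemma zc_isCyc : IsCyc Γ (zc c) := by
  have hz : ∀ e, (∀ i, e ≠ s(c i, c (i + 1))) → zc c e = 0 := by
    intro e he; unfold zc; rw [if_neg]; rintro ⟨i, hi⟩; exact he i hi
  refine ⟨fun e he => hz e ?_, fun v => ?_⟩
  · rintro i rfl; exact he (hc.adj i)
  · by_cases hv : ∃ i, v = c i
    · obtain ⟨i, rfl⟩ := hv
      have := sum_at hc hz (i - 1)
      simp only [sub_add_cancel] at this
      rw [this]
      have h1 := zc_edge hc (i - 1)
      have h2 := zc_edge hc i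
      simp only [sub_add_cancel] at h1
      rw [h1, h2]; decide
    · push Not at hv
      exact sum_off hc hz hv

lemma cyc_on {z : Sym2 V → ZMod 2} (hzc : IsCyc Γ z) (hz : ∀ e, zc c e = 0 → z e = 0) :
    z = 0 ∨ z = zc c := by
  have hz' : ∀ e, (∀ i, e ≠ s(c i, c (i + 1))) → z e = 0 := by
    intro e he; apply hz; unfold zc; rw [if_neg]; rintro ⟨i, hi⟩; exact he i hi
  have h1 := fin_const hc (f := fun i => z s(c i, c (i + 1))) (fun i => by
    have := sum_at hc hz' i
    rw [hzc.2] at this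
    exact z2_add_eq_zero.1 this.symm)
  rcases z2_cases (z s(c 0, c (0 + 1))) with h0 | h0
  · left
    funext e
    by_cases he : ∃ i, e = s(c i, c (i + 1))
    · obtain ⟨i, rfl⟩ := he
      rw [h1 i]; exact h0
    · push Not at he; exact hz' e he
  · right
    funext e
    by_cases he : ∃ i, e = s(c i, c (i + 1))
    · obtain ⟨i, rfl⟩ := he
      rw [h1 i, zc_edge hc]; exact h0
    · push Not at he; rw [hz' e he]; unfold zc; rw [if_neg]; rintro ⟨i, hi⟩; exact he i hi

end cyc

lemma zc_ne {n : ℕ} [NeZero n] {c : Fin n → V} {e : Sym2 V} (h : zc c e ≠ 0) :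
    ∃ i, e = s(c i, c (i + 1)) := by
  unfold zc at h
  by_contra h'
  rw [if_neg h'] at h; exact h rfl

end PDG


namespace PDG
open scoped Classical
set_option linter.unusedSectionVars false
set_option linter.unusedSimpArgs false
set_option linter.unusedVariables false
set_option autoImplicit false

variable {V : Type} [Fintype V]

def TF (Γ : SimpleGraph V) : Prop := ∀ a b c, Γ.Adj a b → Γ.Adj b c → Γ.Adj c a → False

def Ext (V : Type) [Fintype V] (m : ℕ) : Prop :=
  ∀ (Γ : SimpleGraph V) (D : PD Γ) (n : ℕ) [NeZero n] (c : Fin n → V),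
    Γ.edgeSet.ncard < m → TF Γ → Cy Γ c → ∀ f0, dl Γ D.l D.r (ind f0) = zc c →
    ∀ ψ : Fin n → Fin 3, (∀ i, ψ i ≠ ψ (i + 1)) →
    ∃ col : V → Fin 3, (∀ u v, Γ.Adj u v → col u ≠ col v) ∧ ∀ i, col (c i) = ψ i

/-- subgraph of edges satisfying a predicate -/
def res (Γ : SimpleGraph V) (p : Sym2 V → Prop) : SimpleGraph V where
  Adj u v := Γ.Adj u v ∧ p s(u, v)
  symm := ⟨fun u v h => ⟨h.1.symm, by rw [Sym2.eq_swap]; exact h.2⟩⟩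
  loopless := ⟨fun u h => Γ.loopless.irrefl u h.1⟩

lemma res_le (Γ : SimpleGraph V) (p : Sym2 V → Prop) : res Γ p ≤ Γ := fun _ _ h => h.1

lemma mem_res {Γ : SimpleGraph V} {p : Sym2 V → Prop} {e : Sym2 V} :
    e ∈ (res Γ p).edgeSet ↔ e ∈ Γ.edgeSet ∧ p e := by
  induction e using Sym2.ind with
  | _ u v => rfl

lemma res_lt {Γ : SimpleGraph V} {p : Sym2 V → Prop} {e : Sym2 V} (he : e ∈ Γ.edgeSet)
    (hp : ¬ p e) : (res Γ p).edgeSet.ncard < Γ.edgeSet.ncard := by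
  apply Set.ncard_lt_ncard _ (Set.toFinite _)
  refine ⟨fun e h => (mem_res.1 h).1, fun h => hp (mem_res.1 (h he)).2⟩

lemma TF.mono {Γ Γ' : SimpleGraph V} (h : TF Γ) (hle : Γ' ≤ Γ) : TF Γ' :=
  fun a b c h1 h2 h3 => h a b c (hle h1) (hle h2) (hle h3)

lemma mem_of_zc {Γ : SimpleGraph V} {n : ℕ} [NeZero n] {c : Fin n → V} (hc : Cy Γ c) {e : Sym2 V}
    (h : zc c e ≠ 0) : e ∈ Γ.edgeSet := by
  obtain ⟨i, rfl⟩ := zc_ne h; exact hc.adj i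

section
variable {Γ : SimpleGraph V} (D : PD Γ) {n : ℕ} [NeZero n] {c : Fin n → V} (htf : TF Γ)
  (hc : Cy Γ c) {f0 : D.F} (hf0 : dl Γ D.l D.r (ind f0) = zc c)

include hf0 in
lemma side_f0 {e : Sym2 V} (he : zc c e = 1) : D.l e = f0 ∨ D.r e = f0 := by
  rw [← hf0] at he
  unfold dl at he
  split_ifs at he with h
  · by_contra hcon
    push Not at hcon
    simp [ind, hcon.1, hcon.2] at he
  · simp at he

include htf hc hf0 in
lemma split_step (ih : Ext V Γ.edgeSet.ncard) (ψ : Fin n → Fin 3) (hψ : ∀ i, ψ i ≠ ψ (i + 1))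
    {k : ℕ} [NeZero k] {K : Fin k → V} (hK : Cy Γ K) (hne : zc K ≠ zc c) {φ : D.F → ZMod 2}
    (hφ : dl Γ D.l D.r φ = zc K) (h0 : φ f0 = 0) {e0 : Sym2 V} (he0 : e0 ∈ Γ.edgeSet)
    (hl : φ (D.l e0) = 1) (hr : φ (D.r e0) = 1) :
    ∃ col : V → Fin 3, (∀ u v, Γ.Adj u v → col u ≠ col v) ∧ ∀ i, col (c i) = ψ i := by
  let po : Sym2 V → Prop := fun e => φ (D.l e) = 0 ∨ φ (D.r e) = 0
  let pi : Sym2 V → Prop := fun e => φ (D.l e) = 1 ∨ φ (D.r e) = 1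
  have hzK : ∀ e ∈ Γ.edgeSet, zc K e = φ (D.l e) + φ (D.r e) := by
    intro e he; rw [← hφ]; simp [dl, he]
  have hKmix : ∀ e, zc K e ≠ 0 → po e ∧ pi e := by
    intro e he
    have h1 := hzK e (mem_of_zc hK he)
    rw [h1] at he
    rcases z2_cases (φ (D.l e)) with h | h <;> rcases z2_cases (φ (D.r e)) with h' | h' <;>
      simp_all [po, pi]
    exact he (by decide)
  have hCo : ∀ e, zc c e ≠ 0 → po e := by
    intro e he
    have he1 : zc c e = 1 := (z2_cases _).resolve_left he
    rcases side_f0 D hf0 he1 with h | h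
    · left; rw [h, h0]
    · right; rw [h, h0]
  -- the outer graph
  have hco : Cy (res Γ po) c := ⟨hc.inj, fun i => ⟨hc.adj i, hCo _ (by rw [zc_edge hc]; simp)⟩, hc.len⟩
  have hKi : Cy (res Γ pi) K :=
    ⟨hK.inj, fun i => ⟨hK.adj i, (hKmix _ (by rw [zc_edge hK]; simp)).2⟩, hK.len⟩
  have hKo : Cy (res Γ po) K :=
    ⟨hK.inj, fun i => ⟨hK.adj i, (hKmix _ (by rw [zc_edge hK]; simp)).1⟩, hK.len⟩
  have hsc : ∀ e, e ∉ (res Γ po).edgeSet → zc c e = 0 := fun e he => (zc_isCyc hco).1 e he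
  obtain ⟨col1, hcol1, hcol1c⟩ := ih (res Γ po) (subPD D (res_le Γ po)) n c
    (res_lt he0 (by simp [po, hl, hr])) (htf.mono (res_le _ _)) hco
    (Quotient.mk (relPD D (res Γ po)) f0)
    ((face_sub D (res_le Γ po) (φ := ind f0) (f0 := f0) (by simp [ind])
      (fun e he => by rw [hf0]; exact hsc e he) (by
        intro a ha
        have : a = f0 := by by_contra h; simp [ind, h] at ha
        rw [this])).trans hf0) ψ hψ
  -- an edge of c outside
  obtain ⟨e1, he1, he1K⟩ : ∃ e, zc c e ≠ 0 ∧ zc K e = 0 := by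
    by_contra hcon
    push Not at hcon
    rcases cyc_on hK (zc_isCyc hc) (fun e h => by
      by_contra h'; exact hcon e h' h) with h | h
    · have := zc_edge hc 0
      rw [h] at this; simp at this
    · exact hne h.symm
  have hout1 : ¬ pi e1 := by
    have h1 := hzK e1 (mem_of_zc hc he1)
    have h2 := hCo e1 he1
    rw [he1K] at h1
    have h3 := z2_add_eq_zero.1 h1.symm
    simp only [po, pi] at *
    rw [h3] at h2 ⊢
    simp at h2
    simp [h2]
  -- the outside is one class in the inner graph
  have hφ1 : dl Γ D.l D.r (φ + fun _ => 1) = zc K := by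
    rw [dl_add, dl_const, hφ, add_zero]
  obtain ⟨col2, hcol2, hcol2K⟩ := ih (res Γ pi) (subPD D (res_le Γ pi)) k K
    (res_lt (mem_of_zc hc he1) hout1) (htf.mono (res_le _ _)) hKi
    (Quotient.mk (relPD D (res Γ pi)) f0)
    ((face_sub D (res_le Γ pi) (φ := φ + fun _ => 1) (f0 := f0) (by simp [h0])
      (fun e he => by rw [hφ1]; exact (zc_isCyc hKi).1 e he) (by
        intro a ha η hη
        have ha0 : φ a = 0 := by
          rcases z2_cases (φ a) with h | h
          · exact h
          · simp [h] at ha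
        let η2 : D.F → ZMod 2 := fun x => if φ x = 0 then η x else 0
        have hsup : ∀ e, zc K e = 0 → dl Γ D.l D.r η2 e = 0 := by
          intro e he
          unfold dl
          split_ifs with hee
          · have h3 := z2_add_eq_zero.1 ((hzK e hee).symm.trans he)
            simp only [η2, h3]
            split_ifs with h4
            · have := hη e (by
                rw [mem_res]; rintro ⟨-, h5⟩
                simp only [pi, h3, h4] at h5
                simp at h5)
              simpa [dl, hee] using this
            · rfl
          · rfl
        have hfin : ∀ x y, φ x = 0 → φ y = 0 → η2 x = η2 y := by
          intro x y hx hy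
          rcases cyc_on hK (D.even η2) hsup with h | h
          · exact D.conn _ h x y
          · have h5 : dl Γ D.l D.r (η2 + φ) = 0 := by
              rw [dl_add, h, hφ]; funext e; exact z2_add_eq_zero.2 rfl
            have := D.conn _ h5 x y
            simpa [hx, hy] using this
        have := hfin a f0 ha0 h0
        simpa [η2, ha0, h0] using this)).trans hφ1) (fun i => col1 (K i))
      (fun i => hcol1 _ _ (hKo.adj i))
  have hloc : ∀ v, (∀ i, v ≠ K i) → ∀ w w', Γ.Adj v w → Γ.Adj v w' → pi s(v, w) →
      ¬ po s(v, w') := by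
    intro v hv w w' hw hw' hpi hpo
    have hbal : ∀ w, Γ.Adj v w → φ (D.l s(v, w)) = φ (D.r s(v, w)) := by
      intro w hw
      have h1 := hzK s(v, w) hw
      have h2 : zc K s(v, w) = 0 := by
        by_contra h
        obtain ⟨i, hi⟩ := zc_ne h
        rw [Sym2.eq_iff] at hi
        rcases hi with h | h
        · exact hv _ h.1
        · exact hv _ h.1
      rw [h2] at h1
      exact z2_add_eq_zero.1 h1.symm
    have := D.loc v φ hbal w w' hw hw'
    simp only [po, pi, ← hbal w hw, ← hbal w' hw', or_self] at hpi hpo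
    rw [hpi, hpo] at this
    simp at this
  have hboth : ∀ v w w', Γ.Adj v w → Γ.Adj v w' → pi s(v, w) → po s(v, w') → col2 v = col1 v := by
    intro v w w' h1 h2 h3 h4
    by_cases hv : ∃ i, v = K i
    · obtain ⟨i, rfl⟩ := hv
      exact hcol2K i
    · push Not at hv
      exact absurd h4 (hloc v hv w w' h1 h2 h3)
  refine ⟨fun v => if ∃ w, (res Γ pi).Adj v w then col2 v else col1 v, ?_, ?_⟩
  · intro u v huv
    by_cases hp : pi s(u, v)
    · have h1 : ∃ w, (res Γ pi).Adj u w := ⟨v, huv, hp⟩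
      have h2 : ∃ w, (res Γ pi).Adj v w := ⟨u, huv.symm, by rw [Sym2.eq_swap]; exact hp⟩
      simp only [h1, h2, if_true]
      exact hcol2 _ _ ⟨huv, hp⟩
    · have hpo : po s(u, v) := by
        simp only [po, pi] at *
        push Not at hp
        left
        exact (z2_cases _).resolve_right hp.1
      have hpo' : po s(v, u) := by rw [Sym2.eq_swap]; exact hpo
      have key : ∀ x y, Γ.Adj x y → po s(x, y) →
          (if ∃ w, (res Γ pi).Adj x w then col2 x else col1 x) = col1 x := by
        intro x y hxy hp
        split_ifs with h
        · obtain ⟨w, hw⟩ := h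
          exact hboth x w y hw.1 hxy hw.2 hp
        · rfl
      dsimp only
      rw [key u v huv hpo, key v u huv.symm hpo']
      exact hcol1 _ _ ⟨huv, hpo⟩
  · intro i
    rw [← hcol1c i]
    dsimp only
    split_ifs with h
    · obtain ⟨w, hw⟩ := h
      exact hboth _ w _ hw.1 (hc.adj i) hw.2 (hCo _ (by rw [zc_edge hc]; simp))
    · rfl

/-- without splitting cycles, short cycles are facial -/
lemma facial_of_no_split
    (NA : ∀ (k : ℕ) [NeZero k] (K : Fin k → V) (φ : D.F → ZMod 2), Cy Γ K → zc K ≠ zc c →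
      dl Γ D.l D.r φ = zc K → φ f0 = 0 → ∀ e ∈ Γ.edgeSet, φ (D.l e) = 1 → φ (D.r e) = 1 → False)
    {k : ℕ} [NeZero k] {K : Fin k → V} (hK : Cy Γ K) (hne : zc K ≠ zc c) :
    ∃ f, f ≠ f0 ∧ dl Γ D.l D.r (ind f) = zc K := by
  obtain ⟨φ, hφ, h0⟩ : ∃ φ, dl Γ D.l D.r φ = zc K ∧ φ f0 = 0 := by
    obtain ⟨φ, hφ⟩ := D.exact _ (zc_isCyc hK)
    rcases z2_cases (φ f0) with h | h
    · exact ⟨φ, hφ, h⟩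
    · exact ⟨φ + fun _ => 1, by rw [dl_add, dl_const, hφ, add_zero], by
        simp only [Pi.add_apply, h]; decide⟩
  have hNA := NA k K φ hK hne hφ h0
  obtain ⟨f, hf⟩ : ∃ f, φ f = 1 := by
    by_contra h
    push Not at h
    have : φ = fun _ => 0 := funext fun x => (z2_cases _).resolve_right (h x)
    rw [this, dl_const] at hφ
    have h1 := zc_edge hK 0
    rw [← hφ] at h1; simp at h1
  have hff : f ≠ f0 := by rintro rfl; rw [h0] at hf; simp at hf
  have hsup : ∀ e, zc K e = 0 → dl Γ D.l D.r (ind f) e = 0 := by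
    intro e he
    unfold dl
    split_ifs with hee
    · have h1 : φ (D.l e) = φ (D.r e) := by
        rw [← hφ] at he; simpa [dl, hee, z2_add_eq_zero] using he
      have h2 : D.l e ≠ f := by
        intro h; rw [h, hf] at h1
        exact hNA e hee (by rw [h, hf]) h1.symm
      have h3 : D.r e ≠ f := by
        intro h; rw [h, hf] at h1
        exact hNA e hee h1 (by rw [h, hf])
      simp [ind, h2, h3]
    · rfl
  rcases cyc_on hK (D.even _) hsup with h | h
  · have := D.conn _ h f f0
    simp [ind, hff.symm] at this
  · exact ⟨f, hff, h⟩

end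

end PDG


namespace PDG
open scoped Classical
set_option linter.unusedSectionVars false
set_option linter.unusedSimpArgs false
set_option linter.unusedVariables false
set_option autoImplicit false

variable {V : Type} [Fintype V]

/-- configuration of a facial 4-cycle with identifiable opposite vertices -/
structure QD {Γ : SimpleGraph V} (D : PD Γ) (v1 v2 v3 v4 : V) (f f0 : D.F) : Prop where
  h12 : Γ.Adj v1 v2
  h32 : Γ.Adj v3 v2
  h34 : Γ.Adj v3 v4
  h14 : Γ.Adj v1 v4
  n13 : ¬ Γ.Adj v1 v3
  ne13 : v1 ≠ v3
  ne24 : v2 ≠ v4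
  com : ∀ w, Γ.Adj v1 w → Γ.Adj v3 w → w = v2 ∨ w = v4
  no3 : ∀ x y, Γ.Adj v1 x → Γ.Adj x y → Γ.Adj y v3 → False
  on : ∀ e, e = s(v1, v2) ∨ e = s(v3, v2) ∨ e = s(v3, v4) ∨ e = s(v1, v4) →
    (D.l e = f ∧ D.r e ≠ f) ∨ (D.l e ≠ f ∧ D.r e = f)
  off : ∀ e ∈ Γ.edgeSet, e ≠ s(v1, v2) → e ≠ s(v3, v2) → e ≠ s(v3, v4) → e ≠ s(v1, v4) →
    D.l e ≠ f ∧ D.r e ≠ f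
  f0f : f0 ≠ f
  tf : TF Γ

/-- push forward of edge functions -/
def push (v1 v3 : V) (z : Sym2 V → ZMod 2) (e : Sym2 V) : ZMod 2 :=
  if v3 ∈ e then 0 else if v1 ∈ e then z e + z (Sym2.map (Equiv.swap v1 v3) e) else z e

/-- identified graph -/
def idg (Γ : SimpleGraph V) (v1 v3 : V) (n13 : ¬ Γ.Adj v1 v3) : SimpleGraph V where
  Adj a b := a ≠ v3 ∧ b ≠ v3 ∧ (Γ.Adj a b ∨ (a = v1 ∧ Γ.Adj v3 b) ∨ (b = v1 ∧ Γ.Adj a v3))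
  symm := ⟨fun a b h => ⟨h.2.1, h.1, by
    rcases h.2.2 with h | h | h
    · exact Or.inl h.symm
    · exact Or.inr (Or.inr ⟨h.1, h.2.symm⟩)
    · exact Or.inr (Or.inl ⟨h.1, h.2.symm⟩)⟩⟩
  loopless := ⟨fun a h => by
    rcases h.2.2 with h | ⟨rfl, h'⟩ | ⟨rfl, h'⟩
    · exact Γ.loopless.irrefl a h
    · exact n13 h'.symm
    · exact n13 h'⟩

def lft (Γ : SimpleGraph V) (v1 v3 : V) (e : Sym2 V) : Sym2 V :=
  if e ∈ Γ.edgeSet then e else Sym2.map (Equiv.swap v1 v3) e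

lemma push_13 (v1 v3 w : V) (z : Sym2 V → ZMod 2) (h1 : v1 ≠ v3) (hw1 : w ≠ v1) (hw : w ≠ v3) :
    push v1 v3 z s(v1, w) = z s(v1, w) + z s(v3, w) := by
  simp [push, h1, h1.symm, hw, hw.symm, Sym2.map_mk, Equiv.swap_apply_of_ne_of_ne hw1 hw]

lemma push_oth (v1 v3 v w : V) (z : Sym2 V → ZMod 2) (hv1 : v ≠ v1) (hv : v ≠ v3) (hw1 : w ≠ v1)
    (hw : w ≠ v3) : push v1 v3 z s(v, w) = z s(v, w) := by
  simp [push, hv, hw, hv1, hw1, hw1.symm, hw.symm, hv.symm, hv1.symm]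

lemma push_add (v1 v3 : V) (z z' : Sym2 V → ZMod 2) :
    push v1 v3 (z + z') = push v1 v3 z + push v1 v3 z' := by
  funext e; simp only [push, Pi.add_apply]; split_ifs <;> ring

section
variable {Γ : SimpleGraph V} {v1 v3 : V} (n13 : ¬ Γ.Adj v1 v3) (h13 : v1 ≠ v3)
  {z : Sym2 V → ZMod 2} (hz : ∀ e, e ∉ Γ.edgeSet → z e = 0)
include n13 h13 hz

lemma z_self (v : V) : z s(v, v) = 0 := hz _ (by simp)

lemma push_off (e : Sym2 V) (he : e ∉ (idg Γ v1 v3 n13).edgeSet) : push v1 v3 z e = 0 := by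
  have key : ∀ w, s(v1, w) ∉ (idg Γ v1 v3 n13).edgeSet → push v1 v3 z s(v1, w) = 0 := by
    intro w hw
    by_cases hw3 : w = v3
    · simp [push, hw3]
    by_cases hw1 : w = v1
    · subst hw1
      simp [push, h13.symm, z_self n13 h13 hz]
    rw [push_13 v1 v3 w z h13 hw1 hw3]
    rw [hz, hz, add_zero]
    · intro h; exact hw ⟨h13, hw3, Or.inr (Or.inl ⟨rfl, h⟩)⟩
    · intro h; exact hw ⟨h13, hw3, Or.inl h⟩
  induction e using Sym2.ind with
  | _ u v =>
    by_cases hu : u = v1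
    · rw [hu]; exact key v (hu ▸ he)
    by_cases hv : v = v1
    · rw [hv, Sym2.eq_swap]; rw [hv, Sym2.eq_swap] at he; exact key u he
    by_cases hu3 : u = v3
    · simp [push, hu3]
    by_cases hv3 : v = v3
    · simp [push, hv3]
    rw [push_oth _ _ _ _ _ hu hu3 hv hv3]
    exact hz _ fun h => he ⟨hu3, hv3, Or.inl h⟩

lemma sum_push_v3 : ∑ w, push v1 v3 z s(v3, w) = 0 := by
  apply Finset.sum_eq_zero; intro w _; simp [push]

lemma sum_push_v1 : ∑ w, push v1 v3 z s(v1, w) = ∑ w, z s(v1, w) + ∑ w, z s(v3, w) := by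
  rw [← Finset.sum_add_distrib]
  apply Finset.sum_congr rfl
  intro w _
  by_cases hw3 : w = v3
  · subst hw3
    rw [z_self n13 h13 hz, hz s(v1, w) n13]; simp [push]
  by_cases hw1 : w = v1
  · subst hw1
    rw [z_self n13 h13 hz, hz s(v3, w) (fun h => n13 (SimpleGraph.Adj.symm h))]
    simp [push, h13.symm, z_self n13 h13 hz]
  exact push_13 v1 v3 w z h13 hw1 hw3

lemma sum_push_oth (v : V) (hv1 : v ≠ v1) (hv3 : v ≠ v3) :
    ∑ w, push v1 v3 z s(v, w) = ∑ w, z s(v, w) := by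
  have : ∀ w, push v1 v3 z s(v, w) = z s(v, w) + ((if w = v1 then z s(v, v3) else 0) +
      (if w = v3 then z s(v, v3) else 0)) := by
    intro w
    by_cases hw3 : w = v3
    · subst hw3
      rw [if_neg h13.symm, if_pos rfl, zero_add, z2_add_eq_zero.2 rfl]
      simp [push]
    by_cases hw1 : w = v1
    · subst hw1
      rw [if_pos rfl, if_neg h13, add_zero, Sym2.eq_swap, push_13 _ _ _ _ h13 hv1 hv3,
        Sym2.eq_swap (a := v) (b := v3)]
    rw [if_neg hw1, if_neg hw3, push_oth _ _ _ _ _ hv1 hv3 hw1 hw3]; simp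
  simp only [this, Finset.sum_add_distrib, Finset.sum_ite_eq', Finset.mem_univ, if_true]
  rw [z2_add_eq_zero.2 rfl, add_zero]

end

section
variable {Γ : SimpleGraph V} {D : PD Γ} {v1 v2 v3 v4 : V} {f f0 : D.F} (Q : QD D v1 v2 v3 v4 f f0)

def rho (Q : QD D v1 v2 v3 v4 f f0) (x : D.F) : {x : D.F // x ≠ f} :=
  if h : x ≠ f then ⟨x, h⟩ else ⟨f0, Q.f0f⟩

def oth (D : PD Γ) (f : D.F) (e : Sym2 V) : D.F := if D.l e = f then D.r e else D.l e

def lN (Q : QD D v1 v2 v3 v4 f f0) (e : Sym2 V) : {x : D.F // x ≠ f} :=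
  if e = s(v1, v2) ∨ e = s(v1, v4) then rho Q (oth D f e) else rho Q (D.l (lft Γ v1 v3 e))

def rN (Q : QD D v1 v2 v3 v4 f f0) (e : Sym2 V) : {x : D.F // x ≠ f} :=
  if e = s(v1, v2) ∨ e = s(v1, v4) then rho Q (oth D f (Sym2.map (Equiv.swap v1 v3) e))
  else rho Q (D.r (lft Γ v1 v3 e))

lemma rho_val {x : D.F} (h : x ≠ f) : (rho Q x).1 = x := by simp [rho, h]

include Q
lemma nadj_of (w : V) (h2 : w ≠ v2) (h4 : w ≠ v4) : ¬ Γ.Adj v1 w ∨ ¬ Γ.Adj v3 w := by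
  by_contra h
  push Not at h
  rcases Q.com w h.1 h.2 with h | h
  · exact h2 h
  · exact h4 h

lemma oth_spec {e : Sym2 V}
    (he : e = s(v1, v2) ∨ e = s(v3, v2) ∨ e = s(v3, v4) ∨ e = s(v1, v4)) :
    oth D f e ≠ f ∧ ∀ φ : D.F → ZMod 2, φ (D.l e) + φ (D.r e) = φ f + φ (oth D f e) := by
  rcases Q.on e he with h | h
  · simp only [oth, if_pos h.1]
    exact ⟨h.2, fun φ => by rw [h.1]⟩
  · simp only [oth, if_neg h.1]
    exact ⟨h.1, fun φ => by rw [h.2, add_comm]⟩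

lemma swap_v1 (w : V) (h1 : w ≠ v1) (h3 : w ≠ v3) :
    Sym2.map (Equiv.swap v1 v3) s(v1, w) = s(v3, w) := by
  simp [Sym2.map_mk, Equiv.swap_apply_of_ne_of_ne h1 h3]

/-- structure of the edges of the identified graph -/
lemma edge_cases {e : Sym2 V} (he : e ∈ (idg Γ v1 v3 Q.n13).edgeSet) :
    (e = s(v1, v2)) ∨ (e = s(v1, v4)) ∨
    (∃ w, e = s(v1, w) ∧ w ≠ v1 ∧ w ≠ v3 ∧ w ≠ v2 ∧ w ≠ v4 ∧ Γ.Adj v1 w ∧ ¬ Γ.Adj v3 w) ∨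
    (∃ w, e = s(v1, w) ∧ w ≠ v1 ∧ w ≠ v3 ∧ w ≠ v2 ∧ w ≠ v4 ∧ ¬ Γ.Adj v1 w ∧ Γ.Adj v3 w) ∨
    (e ∈ Γ.edgeSet ∧ v1 ∉ e ∧ v3 ∉ e) := by
  have key : ∀ w, (idg Γ v1 v3 Q.n13).Adj v1 w →
    (w = v2) ∨ (w = v4) ∨
    (w ≠ v1 ∧ w ≠ v3 ∧ w ≠ v2 ∧ w ≠ v4 ∧ Γ.Adj v1 w ∧ ¬ Γ.Adj v3 w) ∨
    (w ≠ v1 ∧ w ≠ v3 ∧ w ≠ v2 ∧ w ≠ v4 ∧ ¬ Γ.Adj v1 w ∧ Γ.Adj v3 w) := by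
    intro w hw
    by_cases h2 : w = v2
    · exact Or.inl h2
    by_cases h4 : w = v4
    · exact Or.inr (Or.inl h4)
    have := nadj_of Q w h2 h4
    have hw1 := hw.ne'
    rcases hw with ⟨_, h3, h | h | h⟩
    · tauto
    · tauto
    · exact absurd h.1 hw1
  induction e using Sym2.ind with
  | _ u v =>
    have key2 : ∀ w, (idg Γ v1 v3 Q.n13).Adj v1 w → _ := fun w hw => key w hw
    by_cases hu : u = v1
    · subst hu
      rcases key v he with h | h | h | h
      · left; rw [h]
      · right; left; rw [h]
      · right; right; left; exact ⟨v, rfl, h⟩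
      · right; right; right; left; exact ⟨v, rfl, h⟩
    by_cases hv : v = v1
    · subst hv
      rw [Sym2.eq_swap] at he ⊢
      rcases key u he with h | h | h | h
      · left; rw [h]
      · right; left; rw [h]
      · right; right; left; exact ⟨u, rfl, h⟩
      · right; right; right; left; exact ⟨u, rfl, h⟩
    right; right; right; right
    have he' : (idg Γ v1 v3 Q.n13).Adj u v := he
    rcases he' with ⟨h1, h3, h | h | h⟩
    · refine ⟨h, ?_, ?_⟩
      · simp [Ne.symm hu, Ne.symm hv]
      · simp [Ne.symm h1, Ne.symm h3]
    · exact absurd h.1 hu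
    · exact absurd h.1 hv

lemma ne21 : v2 ≠ v1 := Q.h12.ne'
lemma ne23 : v2 ≠ v3 := Q.h32.ne'
lemma ne41 : v4 ≠ v1 := Q.h14.ne'
lemma ne43 : v4 ≠ v3 := Q.h34.ne'

lemma off1 {e : Sym2 V} (he : e ∈ Γ.edgeSet) (h2 : v2 ∉ e) (h4 : v4 ∉ e) :
    D.l e ≠ f ∧ D.r e ≠ f := by
  apply Q.off e he <;> rintro rfl <;> simp at h2 h4

lemma off2 {e : Sym2 V} (he : e ∈ Γ.edgeSet) (h2 : v1 ∉ e) (h4 : v3 ∉ e) :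
    D.l e ≠ f ∧ D.r e ≠ f := by
  apply Q.off e he <;> rintro rfl <;> simp at h2 h4

lemma lft_mem {e : Sym2 V} (he : e ∈ (idg Γ v1 v3 Q.n13).edgeSet) : lft Γ v1 v3 e ∈ Γ.edgeSet := by
  unfold lft
  split_ifs with h
  · exact h
  · rcases edge_cases Q he with rfl | rfl | ⟨w, rfl, h1, h3, h2, h4, ha, hb⟩ |
      ⟨w, rfl, h1, h3, h2, h4, ha, hb⟩ | ⟨h', h1, h3⟩
    · exact absurd Q.h12 h
    · exact absurd Q.h14 h
    · exact absurd ha h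
    · rw [swap_v1 Q w h1 h3]; exact hb
    · exact (h h').elim

lemma lN_gen {e : Sym2 V} (he : e ∈ (idg Γ v1 v3 Q.n13).edgeSet)
    (h12 : e ≠ s(v1, v2)) (h14 : e ≠ s(v1, v4)) :
    (lN Q e).1 = D.l (lft Γ v1 v3 e) ∧ (rN Q e).1 = D.r (lft Γ v1 v3 e) := by
  have h : D.l (lft Γ v1 v3 e) ≠ f ∧ D.r (lft Γ v1 v3 e) ≠ f := by
    have hm := lft_mem Q he
    rcases edge_cases Q he with rfl | rfl | ⟨w, rfl, h1, h3, h2, h4, ha, hb⟩ |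
      ⟨w, rfl, h1, h3, h2, h4, ha, hb⟩ | ⟨h', h1, h3⟩
    · exact absurd rfl h12
    · exact absurd rfl h14
    · have : lft Γ v1 v3 s(v1, w) = s(v1, w) := if_pos ha
      rw [this] at hm ⊢
      exact off1 Q hm (by simp [ne21 Q, h2.symm]) (by simp [ne41 Q, h4.symm])
    · have : lft Γ v1 v3 s(v1, w) = s(v3, w) := by
        unfold lft; rw [if_neg (show s(v1, w) ∉ Γ.edgeSet from ha), swap_v1 Q w h1 h3]
      rw [this] at hm ⊢
      exact off1 Q hm (by simp [ne23 Q, h2.symm]) (by simp [ne43 Q, h4.symm])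
    · have : lft Γ v1 v3 e = e := if_pos h'
      rw [this]
      exact off2 Q h' h1 h3
  simp only [lN, rN, h12, h14, or_self, if_false]
  exact ⟨rho_val Q h.1, rho_val Q h.2⟩

lemma spec_edge {e : Sym2 V} {w : V} (hw : w = v2 ∨ w = v4) (he : e = s(v1, w)) :
    (lN Q e).1 = oth D f s(v1, w) ∧ (rN Q e).1 = oth D f s(v3, w) := by
  subst he
  have hm : s(v1, w) = s(v1, v2) ∨ s(v1, w) = s(v1, v4) := by
    rcases hw with rfl | rfl <;> simp
  have h13 : w ≠ v1 ∧ w ≠ v3 := by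
    rcases hw with rfl | rfl
    · exact ⟨ne21 Q, ne23 Q⟩
    · exact ⟨ne41 Q, ne43 Q⟩
  simp only [lN, rN, if_pos hm, swap_v1 Q w h13.1 h13.2]
  refine ⟨rho_val Q (oth_spec Q ?_).1, rho_val Q (oth_spec Q ?_).1⟩
  · rcases hw with rfl | rfl <;> simp
  · rcases hw with rfl | rfl <;> simp

lemma dl_idg (φ : D.F → ZMod 2) :
    dl (idg Γ v1 v3 Q.n13) (lN Q) (rN Q) (fun x => φ x.1) = push v1 v3 (dl Γ D.l D.r φ) := by
  have hz : ∀ e, e ∉ Γ.edgeSet → dl Γ D.l D.r φ e = 0 := fun e he => by simp [dl, he]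
  funext e
  by_cases he : e ∈ (idg Γ v1 v3 Q.n13).edgeSet
  swap
  · rw [push_off Q.n13 Q.ne13 hz e he]; simp [dl, he]
  have special : ∀ w, (w = v2 ∨ w = v4) → e = s(v1, w) → Γ.Adj v1 w → Γ.Adj v3 w →
      φ (lN Q e).1 + φ (rN Q e).1 = push v1 v3 (dl Γ D.l D.r φ) e := by
    intro w hw hew ha hb
    rw [(spec_edge Q hw hew).1, (spec_edge Q hw hew).2, hew,
      push_13 _ _ _ _ Q.ne13 ha.ne' hb.ne']
    simp only [dl, SimpleGraph.mem_edgeSet, ha, hb, if_true]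
    rw [(oth_spec Q (e := s(v1, w)) (by rcases hw with rfl | rfl <;> simp)).2,
      (oth_spec Q (e := s(v3, w)) (by rcases hw with rfl | rfl <;> simp)).2]
    have : φ f + φ f = 0 := z2_add_eq_zero.2 rfl
    linear_combination -this
  rw [dl, if_pos he]
  by_cases h12 : e = s(v1, v2)
  · exact special v2 (Or.inl rfl) h12 Q.h12 Q.h32
  by_cases h14 : e = s(v1, v4)
  · exact special v4 (Or.inr rfl) h14 Q.h14 Q.h34
  rw [(lN_gen Q he h12 h14).1, (lN_gen Q he h12 h14).2]
  rcases edge_cases Q he with rfl | rfl | ⟨w, rfl, h1, h3, h2, h4, ha, hb⟩ |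
      ⟨w, rfl, h1, h3, h2, h4, ha, hb⟩ | ⟨h', h1, h3⟩
  · exact absurd rfl h12
  · exact absurd rfl h14
  · have : lft Γ v1 v3 s(v1, w) = s(v1, w) := if_pos ha
    rw [push_13 _ _ _ _ Q.ne13 h1 h3, this]
    simp [dl, ha, hb]
  · have : lft Γ v1 v3 s(v1, w) = s(v3, w) := by
      unfold lft; rw [if_neg (show s(v1, w) ∉ Γ.edgeSet from ha), swap_v1 Q w h1 h3]
    rw [push_13 _ _ _ _ Q.ne13 h1 h3, this]
    simp [dl, ha, hb]
  · have : lft Γ v1 v3 e = e := if_pos h'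
    rw [this]
    simp [push, h1, h3, dl, h']

lemma choose_ext (φ' : {x : D.F // x ≠ f} → ZMod 2) {w : V} (hw : w = v2 ∨ w = v4) :
    ∃ φ : D.F → ZMod 2, φ' = (fun x => φ x.1) ∧ dl Γ D.l D.r φ s(v1, w) = 0 := by
  have hs : s(v1, w) = s(v1, v2) ∨ s(v1, w) = s(v3, v2) ∨ s(v1, w) = s(v3, v4) ∨
      s(v1, w) = s(v1, v4) := by rcases hw with rfl | rfl <;> simp
  obtain ⟨h1, h2⟩ := oth_spec Q hs
  refine ⟨fun x => if h : x ≠ f then φ' ⟨x, h⟩ else φ' ⟨_, h1⟩, ?_, ?_⟩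
  · funext x; simp [x.2]
  · have ha : Γ.Adj v1 w := by
      rcases hw with rfl | rfl
      · exact Q.h12
      · exact Q.h14
    rw [dl, if_pos (show s(v1, w) ∈ Γ.edgeSet from ha)]
    refine (h2 (fun x => if h : x ≠ f then φ' ⟨x, h⟩ else φ' ⟨_, h1⟩)).trans ?_
    apply z2_add_eq_zero.2
    simp [h1]

/-- vanishing of the lift of a vanishing push -/
lemma van_oth {z : Sym2 V → ZMod 2} (hz : ∀ e, e ∉ Γ.edgeSet → z e = 0) {w : V} (h1 : w ≠ v1)
    (h3 : w ≠ v3) (h2 : w ≠ v2) (h4 : w ≠ v4) (hp : push v1 v3 z s(v1, w) = 0) :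
    z s(v1, w) = 0 ∧ z s(v3, w) = 0 := by
  rw [push_13 _ _ _ _ Q.ne13 h1 h3] at hp
  rcases nadj_of Q w h2 h4 with h | h
  · have := hz s(v1, w) h
    rw [this, zero_add] at hp; exact ⟨this, hp⟩
  · have := hz s(v3, w) h
    rw [this, add_zero] at hp; exact ⟨hp, this⟩

lemma van_star {z : Sym2 V → ZMod 2} (hz : IsCyc Γ z) (h12 : z s(v1, v2) = 0)
    (hp : ∀ w, push v1 v3 z s(v1, w) = 0) : ∀ w, z s(v1, w) = 0 ∧ z s(v3, w) = 0 := by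
  have hself : ∀ w, z s(w, w) = 0 := fun w => hz.1 _ (by simp)
  have h13 : z s(v1, v3) = 0 := hz.1 _ Q.n13
  have hcase : ∀ w, w ≠ v4 → z s(v1, w) = 0 ∧ z s(v3, w) = 0 := by
    intro w h4
    by_cases h1 : w = v1
    · rw [h1]; exact ⟨hself _, by rw [Sym2.eq_swap]; exact h13⟩
    by_cases h3 : w = v3
    · rw [h3]; exact ⟨h13, hself _⟩
    by_cases h2 : w = v2
    · subst h2
      have := hp w
      rw [push_13 _ _ _ _ Q.ne13 h1 h3, h12, zero_add] at this
      exact ⟨h12, this⟩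
    exact van_oth Q hz.1 h1 h3 h2 h4 (hp w)
  have h14 : z s(v1, v4) = 0 := by
    have := hz.2 v1
    rw [Finset.sum_eq_single v4 (fun w _ hw => (hcase w hw).1) (by simp)] at this
    exact this
  intro w
  by_cases h4 : w = v4
  · subst h4
    have := hp w
    rw [push_13 _ _ _ _ Q.ne13 (ne41 Q) (ne43 Q), h14, zero_add] at this
    exact ⟨h14, this⟩
  · exact hcase w h4

/-- comparison of left faces -/
lemma l_eq (φ : D.F → ZMod 2) {e : Sym2 V} (he : e ∈ (idg Γ v1 v3 Q.n13).edgeSet)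
    (h0 : dl Γ D.l D.r φ (lft Γ v1 v3 e) = 0) : φ (lN Q e).1 = φ (D.l (lft Γ v1 v3 e)) := by
  by_cases h : e = s(v1, v2) ∨ e = s(v1, v4)
  · obtain ⟨w, hw, rfl⟩ : ∃ w, (w = v2 ∨ w = v4) ∧ e = s(v1, w) := by
      rcases h with h | h
      · exact ⟨v2, Or.inl rfl, h⟩
      · exact ⟨v4, Or.inr rfl, h⟩
    have ha : s(v1, w) ∈ Γ.edgeSet := by
      rcases hw with rfl | rfl
      · exact Q.h12
      · exact Q.h14
    have hl : lft Γ v1 v3 s(v1, w) = s(v1, w) := if_pos ha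
    rw [hl] at h0 ⊢
    rw [(spec_edge Q hw rfl).1]
    rw [dl, if_pos ha] at h0
    have hs : s(v1, w) = s(v1, v2) ∨ s(v1, w) = s(v3, v2) ∨ s(v1, w) = s(v3, v4) ∨
      s(v1, w) = s(v1, v4) := by rcases hw with rfl | rfl <;> simp
    have h2 := z2_add_eq_zero.1 h0
    unfold oth
    split_ifs
    · exact h2.symm
    · rfl
  · push Not at h
    rw [(lN_gen Q he h.1 h.2).1]

def idPD : PD (idg Γ v1 v3 Q.n13) where
  F := {x : D.F // x ≠ f}
  fin := by
    have := D.fin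
    infer_instance
  l := lN Q
  r := rN Q
  even φ' := by
    obtain ⟨φ, rfl, -⟩ := choose_ext Q φ' (Or.inl rfl)
    rw [dl_idg]
    have hz := D.even φ
    refine ⟨fun e he => push_off Q.n13 Q.ne13 hz.1 e he, fun v => ?_⟩
    by_cases h1 : v = v1
    · subst h1; rw [sum_push_v1 Q.n13 Q.ne13 hz.1, hz.2, hz.2, add_zero]
    by_cases h3 : v = v3
    · subst h3; exact sum_push_v3 Q.n13 Q.ne13 hz.1
    rw [sum_push_oth Q.n13 Q.ne13 hz.1 v h1 h3, hz.2]
  exact z' hz' := by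
    
    let z0 : Sym2 V → ZMod 2 := fun e => if e ∈ Γ.edgeSet ∧ e ≠ s(v3, v2) ∧ e ≠ s(v3, v4)
      then z' (Sym2.map (fun v => if v = v3 then v1 else v) e) else 0
    let a : ZMod 2 := ∑ w, z0 s(v3, w)
    let zz : Sym2 V → ZMod 2 := fun e => if e = s(v1, v2) ∨ e = s(v3, v2) then a else 0
    have hz0 : ∀ e, e ∉ Γ.edgeSet → z0 e = 0 := fun e he => by simp [z0, he]
    have hzz : ∀ e, e ∉ Γ.edgeSet → zz e = 0 := by
      intro e he
      simp only [zz]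
      rw [if_neg]
      rintro (rfl | rfl)
      · exact he Q.h12
      · exact he Q.h32
    have hz : ∀ e, e ∉ Γ.edgeSet → (z0 + zz) e = 0 := fun e he => by
      simp [hz0 e he, hzz e he]
    have hzz3 : ∑ w, zz s(v3, w) = a := by
      rw [Finset.sum_eq_single v2]
      · simp [zz]
      · intro w _ hw
        simp only [zz]
        rw [if_neg]
        simp [Q.ne13.symm, hw, ne23 Q, (ne23 Q).symm]
      · simp
    have hpzz : push v1 v3 zz = 0 := by
      funext e
      by_cases he : e ∈ (idg Γ v1 v3 Q.n13).edgeSet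
      swap
      · exact push_off Q.n13 Q.ne13 hzz e he
      rcases edge_cases Q he with rfl | rfl | ⟨w, rfl, h1, h3, h2, h4, ha, hb⟩ |
        ⟨w, rfl, h1, h3, h2, h4, ha, hb⟩ | ⟨h', h1, h3⟩
      · rw [push_13 _ _ _ _ Q.ne13 (ne21 Q) (ne23 Q)]
        simp only [zz]; simp; exact z2_add_eq_zero.2 rfl
      · rw [push_13 _ _ _ _ Q.ne13 (ne41 Q) (ne43 Q)]
        simp [zz, Q.ne24, Q.ne24.symm, Q.ne13, Q.ne13.symm, ne41 Q, ne43 Q]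
      · rw [push_13 _ _ _ _ Q.ne13 h1 h3]
        simp [zz, h2, Q.ne13, Q.ne13.symm, h1, h3]
      · rw [push_13 _ _ _ _ Q.ne13 h1 h3]
        simp [zz, h2, Q.ne13, Q.ne13.symm, h1, h3]
      · simp only [push, h1, h3, if_false, zz]
        rw [if_neg]; rfl
        rintro (rfl | rfl)
        · simp at h1
        · simp at h3
    have hpz0 : push v1 v3 z0 = z' := by
      funext e
      by_cases he : e ∈ (idg Γ v1 v3 Q.n13).edgeSet
      swap
      · rw [push_off Q.n13 Q.ne13 hz0 e he, hz'.1 e he]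
      have A : ∀ w, s(v1, w) ≠ s(v3, v2) ∧ s(v1, w) ≠ s(v3, v4) := by
        intro w
        simp [Q.ne13, (ne21 Q).symm, (ne41 Q).symm]
      rcases edge_cases Q he with rfl | rfl | ⟨w, rfl, h1, h3, h2, h4, ha, hb⟩ |
        ⟨w, rfl, h1, h3, h2, h4, ha, hb⟩ | ⟨h', h1, h3⟩
      · rw [push_13 _ _ _ _ Q.ne13 (ne21 Q) (ne23 Q)]
        simp [z0, Q.h12, A, Q.ne13, ne23 Q, Sym2.map_mk]
      · rw [push_13 _ _ _ _ Q.ne13 (ne41 Q) (ne43 Q)]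
        simp [z0, Q.h14, A, Q.ne13, ne43 Q, Sym2.map_mk]
      · rw [push_13 _ _ _ _ Q.ne13 h1 h3]
        simp [z0, ha, hb, A, Q.ne13, h3, Sym2.map_mk]
      · rw [push_13 _ _ _ _ Q.ne13 h1 h3]
        simp [z0, ha, hb, A, Q.ne13, h3, h2, h4, Sym2.map_mk]
      · have hne : e ≠ s(v3, v2) ∧ e ≠ s(v3, v4) := by
          constructor <;> rintro rfl <;> simp at h3
        simp only [push, h1, h3, if_false, z0, h', hne, true_and, if_true, ne_eq, not_false_eq_true]
        congr 1
        induction e using Sym2.ind with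
        | _ u v =>
          simp at h3
          simp [Sym2.map_mk, Ne.symm h3.1, Ne.symm h3.2]
    have hpush : push v1 v3 (z0 + zz) = z' := by rw [push_add, hpzz, hpz0, add_zero]
    have hs3 : ∑ w, (z0 + zz) s(v3, w) = 0 := by
      simp only [Pi.add_apply, Finset.sum_add_distrib, hzz3]
      exact z2_add_eq_zero.2 rfl
    have hcyc : IsCyc Γ (z0 + zz) := by
      refine ⟨hz, fun v => ?_⟩
      by_cases h3 : v = v3
      · subst h3; exact hs3
      by_cases h1 : v = v1
      · subst h1
        have := sum_push_v1 Q.n13 Q.ne13 hz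
        rw [hs3, hpush, hz'.2, add_zero] at this
        exact this.symm
      have := sum_push_oth Q.n13 Q.ne13 hz v h1 h3
      rw [hpush, hz'.2] at this
      exact this.symm
    obtain ⟨φ, hφ⟩ := D.exact _ hcyc
    exact ⟨fun x => φ x.1, by rw [dl_idg, hφ, hpush]⟩
  conn φ' := by
    obtain ⟨φ, rfl, h12⟩ := choose_ext Q φ' (Or.inl rfl)
    intro h
    rw [dl_idg] at h
    have hz := D.even φ
    have hst := van_star Q hz h12 (fun w => by rw [h]; rfl)
    have : dl Γ D.l D.r φ = 0 := by
      funext e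
      induction e using Sym2.ind with
      | _ u v =>
        by_cases hu : u = v1
        · rw [hu]; exact (hst v).1
        by_cases hu3 : u = v3
        · rw [hu3]; exact (hst v).2
        by_cases hv : v = v1
        · rw [hv, Sym2.eq_swap]; exact (hst u).1
        by_cases hv3 : v = v3
        · rw [hv3, Sym2.eq_swap]; exact (hst u).2
        exact (push_oth v1 v3 u v _ hu hu3 hv hv3).symm.trans (by rw [h])
    intro a b
    exact D.conn φ this a b
  loc v φ' := by
    obtain ⟨φ, rfl, h12⟩ : ∃ φ : D.F → ZMod 2, φ' = (fun x => φ x.1) ∧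
        dl Γ D.l D.r φ s(v1, if v = v4 then v4 else v2) = 0 := by
      apply choose_ext Q
      split_ifs <;> simp
    intro hb w w' hw hw'
    have hz := D.even φ
    have hp : ∀ w, push v1 v3 (dl Γ D.l D.r φ) s(v, w) = 0 := by
      intro w
      rw [← dl_idg Q]
      unfold dl
      split_ifs with h
      · exact z2_add_eq_zero.2 (hb w h)
      · rfl
    by_cases h3 : v = v3
    · exact absurd h3 hw.1
    by_cases h1 : v = v1
    · subst h1
      rw [if_neg (ne41 Q).symm] at h12
      have hst := van_star Q hz h12 hp
      have key : ∀ w, (idg Γ v v3 Q.n13).Adj v w →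
          φ (lN Q s(v, w)).1 = φ (D.l s(v, v2)) := by
        have e1 : φ (D.l s(v, v2)) = φ f := by
          have := (hst v2).1
          rw [dl, if_pos (show s(v, v2) ∈ Γ.edgeSet from Q.h12)] at this
          rcases Q.on s(v, v2) (by simp) with h | h
          · rw [h.1]
          · rw [h.2] at this; exact z2_add_eq_zero.1 this
        have e3 : φ (D.l s(v3, v2)) = φ f := by
          have := (hst v2).2
          rw [dl, if_pos (show s(v3, v2) ∈ Γ.edgeSet from Q.h32)] at this
          rcases Q.on s(v3, v2) (by simp) with h | h
          · rw [h.1]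
          · rw [h.2] at this; exact z2_add_eq_zero.1 this
        have bal : ∀ u, (∀ w, dl Γ D.l D.r φ s(u, w) = 0) → ∀ w, Γ.Adj u w →
            φ (D.l s(u, w)) = φ (D.r s(u, w)) := by
          intro u hu w hw
          have := hu w
          rw [dl, if_pos (show s(u, w) ∈ Γ.edgeSet from hw)] at this
          exact z2_add_eq_zero.1 this
        intro w hw
        have hm := lft_mem Q (e := s(v, w)) hw
        have hlf : lft Γ v v3 s(v, w) = s(v, w) ∨ lft Γ v v3 s(v, w) = s(v3, w) := by
          unfold lft
          split_ifs
          · exact Or.inl rfl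
          · right; exact swap_v1 Q w hw.ne' hw.2.1
        rcases hlf with h | h
        · rw [l_eq Q φ hw (by rw [h]; exact (hst w).1), h]
          rw [h] at hm
          exact D.loc v φ (bal v fun w => (hst w).1) w v2 hm Q.h12
        · rw [l_eq Q φ hw (by rw [h]; exact (hst w).2), h, e1, ← e3]
          rw [h] at hm
          exact D.loc v3 φ (bal v3 fun w => (hst w).2) w v2 hm Q.h32
      dsimp only
      rw [key w hw, key w' hw']
    · have hvan : ∀ w, dl Γ D.l D.r φ s(v, w) = 0 := by
        have hA : dl Γ D.l D.r φ s(v, v1) = 0 ∧ dl Γ D.l D.r φ s(v, v3) = 0 := by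
          have hpp := hp v1
          rw [Sym2.eq_swap] at hpp
          by_cases h24 : v = v2 ∨ v = v4
          · have h12' : dl Γ D.l D.r φ s(v1, v) = 0 := by
              rcases h24 with rfl | rfl
              · rwa [if_neg Q.ne24] at h12
              · rwa [if_pos rfl] at h12
            rw [push_13 _ _ _ _ Q.ne13 h1 h3, h12', zero_add] at hpp
            rw [Sym2.eq_swap, Sym2.eq_swap (a := v) (b := v3)]
            exact ⟨h12', hpp⟩
          · push Not at h24
            rw [Sym2.eq_swap, Sym2.eq_swap (a := v) (b := v3)]
            exact van_oth Q hz.1 h1 h3 h24.1 h24.2 hpp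
        intro w
        by_cases hw1 : w = v1
        · rw [hw1]; exact hA.1
        by_cases hw3 : w = v3
        · rw [hw3]; exact hA.2
        exact (push_oth v1 v3 v w _ h1 h3 hw1 hw3).symm.trans (hp w)
      have bal : ∀ w, Γ.Adj v w → φ (D.l s(v, w)) = φ (D.r s(v, w)) := by
        intro w hw
        have := hvan w
        rw [dl, if_pos (show s(v, w) ∈ Γ.edgeSet from hw)] at this
        exact z2_add_eq_zero.1 this
      have key : ∀ w, (idg Γ v1 v3 Q.n13).Adj v w → ∃ u, Γ.Adj v u ∧
          φ (lN Q s(v, w)).1 = φ (D.l s(v, u)) := by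
        intro w hw
        have hm := lft_mem Q (e := s(v, w)) hw
        have : ∃ u, lft Γ v1 v3 s(v, w) = s(v, u) := by
          unfold lft
          split_ifs
          · exact ⟨w, rfl⟩
          · exact ⟨Equiv.swap v1 v3 w, by
              simp [Sym2.map_mk, Equiv.swap_apply_of_ne_of_ne h1 h3]⟩
        obtain ⟨u, hu⟩ := this
        refine ⟨u, by rw [hu] at hm; exact hm, ?_⟩
        rw [l_eq Q φ hw (by rw [hu]; exact hvan u), hu]
      obtain ⟨u, hu, e1⟩ := key w hw
      obtain ⟨u', hu', e2⟩ := key w' hw'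
      dsimp only
      rw [e1, e2]
      exact D.loc v φ bal u u' hu hu'

lemma idg_tf : TF (idg Γ v1 v3 Q.n13) := by
  have key : ∀ b c, (idg Γ v1 v3 Q.n13).Adj v1 b → (idg Γ v1 v3 Q.n13).Adj b c →
      (idg Γ v1 v3 Q.n13).Adj c v1 → False := by
    intro b c h1 h2 h3
    have hb := h1.ne'
    have hc := h3.ne
    have hbc : Γ.Adj b c := by
      rcases h2.2.2 with h | h | h
      · exact h
      · exact absurd h.1 hb
      · exact absurd h.1 hc
    have hb' : Γ.Adj v1 b ∨ Γ.Adj v3 b := by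
      rcases h1.2.2 with h | h | h
      · exact Or.inl h
      · exact Or.inr h.2
      · exact absurd h.1 hb
    have hc' : Γ.Adj v1 c ∨ Γ.Adj v3 c := by
      rcases h3.2.2 with h | h | h
      · exact Or.inl h.symm
      · exact absurd h.1 hc
      · exact Or.inr h.2.symm
    rcases hb' with hb' | hb' <;> rcases hc' with hc' | hc'
    · exact Q.tf _ _ _ hb' hbc hc'.symm
    · exact Q.no3 b c hb' hbc hc'.symm
    · exact Q.no3 c b hc' hbc.symm hb'.symm
    · exact Q.tf _ _ _ hb' hbc hc'.symm
  have red : ∀ a b, (idg Γ v1 v3 Q.n13).Adj a b → a ≠ v1 → b ≠ v1 → Γ.Adj a b := by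
    intro a b h ha hb
    rcases h.2.2 with h | h | h
    · exact h
    · exact absurd h.1 ha
    · exact absurd h.1 hb
  intro a b c h1 h2 h3
  by_cases ha : a = v1
  · subst ha; exact key b c h1 h2 h3
  by_cases hb : b = v1
  · subst hb; exact key c a h2 h3 h1
  by_cases hc : c = v1
  · subst hc; exact key a b h3 h1 h2
  exact Q.tf a b c (red _ _ h1 ha hb) (red _ _ h2 hb hc) (red _ _ h3 hc ha)

def pid (v1 v3 : V) (v : V) : V := if v = v3 then v1 else v

lemma idg_adj {u v : V} (h : Γ.Adj u v) :
    (idg Γ v1 v3 Q.n13).Adj (pid v1 v3 u) (pid v1 v3 v) := by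
  unfold pid
  have h13 := Q.ne13
  by_cases hu : u = v3 <;> by_cases hv : v = v3
  · subst hu; subst hv; exact absurd h (Γ.loopless.irrefl _)
  · subst hu; simp only [if_true, hv, if_false]; exact ⟨h13, hv, Or.inr (Or.inl ⟨rfl, h⟩)⟩
  · subst hv; simp only [if_true, hu, if_false]; exact ⟨hu, h13, Or.inr (Or.inr ⟨rfl, h⟩)⟩
  · simp only [hu, hv, if_false]; exact ⟨hu, hv, Or.inl h⟩

lemma idg_lt : (idg Γ v1 v3 Q.n13).edgeSet.ncard < Γ.edgeSet.ncard := by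
  have hsub : (idg Γ v1 v3 Q.n13).edgeSet ⊆
      Sym2.map (pid v1 v3) '' (Γ.edgeSet \ {s(v3, v2)}) := by
    intro e he
    by_cases h2 : v1 ∈ e ∧ v2 ∈ e
    · have : e = s(v1, v2) := (Sym2.mem_and_mem_iff (ne21 Q).symm).1 h2
      subst this
      refine ⟨s(v1, v2), ⟨Q.h12, ?_⟩, ?_⟩
      · simp [Q.ne13, (ne21 Q).symm]
      · simp [Sym2.map_mk, pid, Q.ne13, ne23 Q]
    rcases edge_cases Q he with rfl | rfl | ⟨w, rfl, h1, h3, h2, h4, ha, hb⟩ |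
        ⟨w, rfl, h1, h3, h2, h4, ha, hb⟩ | ⟨h', h1, h3⟩
    · simp at h2
    · refine ⟨s(v1, v4), ⟨Q.h14, ?_⟩, ?_⟩
      · simp [Q.ne13, (ne21 Q).symm]
      · simp [Sym2.map_mk, pid, Q.ne13, ne43 Q]
    · refine ⟨s(v1, w), ⟨ha, ?_⟩, ?_⟩
      · simp [Q.ne13, (ne21 Q).symm]
      · simp [Sym2.map_mk, pid, Q.ne13, h3]
    · refine ⟨s(v3, w), ⟨hb, ?_⟩, ?_⟩
      · simp [Q.ne13, (ne21 Q).symm, h2, h3]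
      · simp [Sym2.map_mk, pid, Q.ne13, h3]
    · refine ⟨e, ⟨h', ?_⟩, ?_⟩
      · rintro rfl; simp at h3
      · induction e using Sym2.ind with
        | _ u v =>
          simp at h3
          simp [Sym2.map_mk, pid, Ne.symm h3.1, Ne.symm h3.2]
  calc _ ≤ (Sym2.map (pid v1 v3) '' (Γ.edgeSet \ {s(v3, v2)})).ncard :=
        Set.ncard_le_ncard hsub (Set.toFinite _)
    _ ≤ (Γ.edgeSet \ {s(v3, v2)}).ncard := Set.ncard_image_le (Set.toFinite _)
    _ < _ := Set.ncard_sdiff_singleton_lt_of_mem (show s(v3, v2) ∈ Γ.edgeSet from Q.h32) (Set.toFinite _)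

lemma ident_step {n : ℕ} [NeZero n] {c : Fin n → V} (hc : Cy Γ c)
    (hf0 : dl Γ D.l D.r (ind f0) = zc c) (hc3 : ∀ i, c i ≠ v3)
    (ih : Ext V Γ.edgeSet.ncard) (ψ : Fin n → Fin 3) (hψ : ∀ i, ψ i ≠ ψ (i + 1)) :
    ∃ col : V → Fin 3, (∀ u v, Γ.Adj u v → col u ≠ col v) ∧ ∀ i, col (c i) = ψ i := by
  have hc' : Cy (idg Γ v1 v3 Q.n13) c :=
    ⟨hc.inj, fun i => ⟨hc3 _, hc3 _, Or.inl (hc.adj i)⟩, hc.len⟩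
  have hz3 : ∀ e, v3 ∈ e → zc c e = 0 := by
    intro e he
    by_contra h
    obtain ⟨i, rfl⟩ := zc_ne h
    simp [(hc3 _).symm] at he
  obtain ⟨col, h1, h2⟩ := ih (idg Γ v1 v3 Q.n13) (idPD Q) n c (idg_lt Q) (idg_tf Q) hc'
    ⟨f0, Q.f0f⟩ (by
      have := dl_idg Q (ind f0)
      have e1 : (fun x : {x : D.F // x ≠ f} => ind f0 x.1) = ind ⟨f0, Q.f0f⟩ := by
        funext x; simp [ind, Subtype.ext_iff]
      rw [e1] at this
      refine this.trans ?_
      rw [hf0]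
      funext e
      unfold push
      split_ifs with h h'
      · exact (hz3 e h).symm
      · rw [hz3 (Sym2.map (Equiv.swap v1 v3) e), add_zero]
        rw [Sym2.mem_map]
        exact ⟨v1, h', by simp⟩
      · rfl) ψ hψ
  refine ⟨fun v => col (pid v1 v3 v), fun u v h => h1 _ _ (idg_adj Q h), fun i => ?_⟩
  simp only [pid, hc3 i, if_false]
  exact h2 i

end

end PDG


namespace PDG
open scoped Classical
set_option linter.unusedSectionVars false
set_option linter.unusedSimpArgs false
set_option linter.unusedVariables false
set_option autoImplicit false

variable {V : Type} [Fintype V]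

def ie (a b : V) (e : Sym2 V) : ZMod 2 := if e = s(a, b) then 1 else 0

lemma ie_comm (a b : V) (e : Sym2 V) : ie a b e = ie b a e := by
  unfold ie; rw [Sym2.eq_swap]

lemma zc_sum {Γ : SimpleGraph V} {n : ℕ} [NeZero n] {c : Fin n → V} (hc : Cy Γ c) (e : Sym2 V) :
    zc c e = ∑ i, ie (c i) (c (i + 1)) e := by
  unfold zc ie
  split_ifs with h
  · obtain ⟨i, rfl⟩ := h
    rw [Finset.sum_eq_single i]
    · simp
    · intro j _ hj
      rw [if_neg]
      intro h
      exact hj (hc.edge_inj h).symm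
    · simp
  · push Not at h
    symm
    apply Finset.sum_eq_zero
    intro i _
    rw [if_neg (h i)]

lemma fin4_cases : ∀ i j : Fin 4, j = i ∨ j = i + 1 ∨ j = i + 2 ∨ j = i + 3 := by decide
lemma fin4_arith : ∀ i : Fin 4, i + 1 + 1 = i + 2 ∧ i + 2 + 1 = i + 3 ∧ i + 3 + 1 = i ∧
  i ≠ i + 1 ∧ i ≠ i + 2 ∧ i ≠ i + 3 ∧ i + 1 ≠ i + 2 ∧ i + 1 ≠ i + 3 ∧ i + 2 ≠ i + 3 := by decide

lemma fin4_adj : ∀ i j : Fin 4, j = i ∨ j = i + 1 ∨ i = j + 1 ∨ (j = i + 1 + 1) := by decide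
lemma fin5_adj : ∀ i j : Fin 5, j = i ∨ j = i + 1 ∨ i = j + 1 ∨ (j = i + 1 + 1) ∨
  (i = j + 1 + 1) := by decide

lemma chordless {Γ : SimpleGraph V} (htf : TF Γ) {n : ℕ} [NeZero n] {c : Fin n → V}
    (hc : Cy Γ c) {i j : Fin n} (h : Γ.Adj (c i) (c j)) : zc c s(c i, c j) = 1 := by
  have : j = i ∨ j = i + 1 ∨ i = j + 1 ∨ j = i + 1 + 1 ∨ i = j + 1 + 1 := by
    rcases hc.len with rfl | rfl
    · have := fin4_adj i j; tauto
    · exact fin5_adj i j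
  rcases this with rfl | rfl | rfl | rfl | rfl
  · exact absurd h (Γ.loopless.irrefl _)
  · exact zc_edge hc i
  · rw [Sym2.eq_swap]; exact zc_edge hc j
  · exact (htf _ _ _ (hc.adj i) (hc.adj _) h.symm).elim
  · exact (htf _ _ _ (hc.adj j) (hc.adj _) h).elim

lemma cy4 {Γ : SimpleGraph V} {a b c d : V} (h1 : Γ.Adj a b) (h2 : Γ.Adj b c) (h3 : Γ.Adj c d)
    (h4 : Γ.Adj d a) (h5 : a ≠ c) (h6 : b ≠ d) : Cy Γ (![a, b, c, d] : Fin 4 → V) := by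
  refine ⟨?_, ?_, Or.inl rfl⟩
  · have i1 := h1.ne
    have i2 := h2.ne
    have i3 := h3.ne
    have i4 := h4.ne
    clear h1 h2 h3 h4
    intro x y hxy
    fin_cases x <;> fin_cases y <;> first | rfl | (exfalso; simp at hxy; simp_all)
  · intro x
    fin_cases x
    · exact h1
    · exact h2
    · exact h3
    · exact h4

lemma cy5 {Γ : SimpleGraph V} {a b c d e : V} (h1 : Γ.Adj a b) (h2 : Γ.Adj b c) (h3 : Γ.Adj c d)
    (h4 : Γ.Adj d e) (h5 : Γ.Adj e a) (h6 : a ≠ c) (h7 : b ≠ d) (h8 : c ≠ e) (h9 : d ≠ a)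
    (h10 : e ≠ b) : Cy Γ (![a, b, c, d, e] : Fin 5 → V) := by
  refine ⟨?_, ?_, Or.inr rfl⟩
  · have i1 := h1.ne
    have i2 := h2.ne
    have i3 := h3.ne
    have i4 := h4.ne
    have i5 := h5.ne
    clear h1 h2 h3 h4 h5
    intro x y hxy
    fin_cases x <;> fin_cases y <;> first | rfl | (exfalso; simp at hxy; simp_all)
  · intro x
    fin_cases x
    · exact h1
    · exact h2
    · exact h3
    · exact h4
    · exact h5

section
variable {Γ : SimpleGraph V} (D : PD Γ) {n : ℕ} [NeZero n] {c : Fin n → V} (htf : TF Γ)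
  (hc : Cy Γ c) {f0 : D.F} (hf0 : dl Γ D.l D.r (ind f0) = zc c)
  (NA : ∀ (k : ℕ) [NeZero k] (K : Fin k → V) (φ : D.F → ZMod 2), Cy Γ K → zc K ≠ zc c →
      dl Γ D.l D.r φ = zc K → φ f0 = 0 → ∀ e ∈ Γ.edgeSet, φ (D.l e) = 1 → φ (D.r e) = 1 → False)

lemma zc_ne_of_mem {k : ℕ} [NeZero k] {K : Fin k → V} (hK : Cy Γ K) {i : Fin k}
    (hi : ∀ j, K i ≠ c j) : zc K ≠ zc c := by
  intro h
  have := zc_edge hK i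
  rw [h] at this
  obtain ⟨j, hj⟩ := zc_ne (by rw [this]; simp : zc c s(K i, K (i + 1)) ≠ 0)
  rw [Sym2.eq_iff] at hj
  rcases hj with h | h
  · exact hi _ h.1
  · exact hi _ h.1

include htf hc hf0 NA
lemma three {k : ℕ} [NeZero k] {K1 K2 : Fin k → V} {q : Fin 4 → V} (h1 : Cy Γ K1) (h2 : Cy Γ K2)
    {i1 i2 : Fin k} (hi1 : ∀ j, K1 i1 ≠ c j) (hi2 : ∀ j, K2 i2 ≠ c j) {f : D.F} (hff : f ≠ f0)
    (hf : dl Γ D.l D.r (ind f) = zc q) (hs : ∀ e, zc K1 e + zc K2 e = zc q e)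
    {e : Sym2 V} (he1 : zc K1 e = 1) (he2 : zc K2 e = 1) : False := by
  obtain ⟨f1, hf1, e1⟩ := facial_of_no_split D NA h1 (zc_ne_of_mem h1 hi1)
  obtain ⟨f2, hf2, e2⟩ := facial_of_no_split D NA h2 (zc_ne_of_mem h2 hi2)
  have hqe : zc q e = 0 := by rw [← hs, he1, he2]; decide
  have h0 : dl Γ D.l D.r (ind f1 + ind f2 + ind f) = 0 := by
    rw [dl_add, dl_add, e1, e2, hf]
    funext e
    simp only [Pi.add_apply, hs]
    exact z2_add_eq_zero.2 rfl
  have := D.conn _ h0 f f0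
  have hn1 : f ≠ f1 := by
    rintro rfl
    rw [hf] at e1
    rw [← e1, hqe] at he1; simp at he1
  have hn2 : f ≠ f2 := by
    rintro rfl
    rw [hf] at e2
    rw [← e2, hqe] at he2; simp at he2
  simp [ind, hn1, hn2, hff.symm, hf1.symm, hf2.symm] at this

set_option maxHeartbeats 1000000 in
lemma exists_QD {q : Fin 4 → V} (hq : Cy Γ q) (hne : zc q ≠ zc c) :
    ∃ (v1 v2 v3 v4 : V) (f : D.F), QD D v1 v2 v3 v4 f f0 ∧ ∀ i, c i ≠ v3 := by
  obtain ⟨i, hi⟩ : ∃ i, ∀ j, q i ≠ c j := by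
    by_contra hcon
    push Not at hcon
    choose g hg using hcon
    rcases cyc_on hc (zc_isCyc hq) (by
      intro e he
      by_contra h
      obtain ⟨i, rfl⟩ := zc_ne h
      have := hq.adj i
      rw [hg i, hg (i + 1)] at this he
      rw [chordless htf hc this] at he
      simp at he) with h | h
    · have := zc_edge hq 0
      rw [h] at this; simp at this
    · exact hne h
  obtain ⟨f, hff, hf⟩ := facial_of_no_split D NA hq hne
  have hno : ∀ e ∈ Γ.edgeSet, D.l e = f → D.r e = f → False := by
    intro e he hl hr
    exact NA 4 q (ind f) hq hne hf (by simp [ind, hff.symm]) e he (by simp [ind, hl])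
      (by simp [ind, hr])
  obtain ⟨a1, a2, a3, n1, n2, n3, n4, n5, n6⟩ := fin4_arith i
  obtain ⟨v1, e1⟩ : ∃ v, v = q (i + 2) := ⟨_, rfl⟩
  obtain ⟨v2, e2⟩ : ∃ v, v = q (i + 3) := ⟨_, rfl⟩
  obtain ⟨v3, e3⟩ : ∃ v, v = q i := ⟨_, rfl⟩
  obtain ⟨v4, e4⟩ : ∃ v, v = q (i + 1) := ⟨_, rfl⟩
  have h34 : Γ.Adj v3 v4 := by rw [e3, e4]; exact hq.adj i
  have h41 : Γ.Adj v4 v1 := by have := hq.adj (i + 1); rwa [a1, ← e1, ← e4] at this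
  have h12 : Γ.Adj v1 v2 := by have := hq.adj (i + 2); rwa [a2, ← e1, ← e2] at this
  have h23 : Γ.Adj v2 v3 := by have := hq.adj (i + 3); rwa [a3, ← e2, ← e3] at this
  have h13 : v1 ≠ v3 := by rw [e1, e3]; exact fun h => n2 (hq.inj h).symm
  have h24 : v2 ≠ v4 := by rw [e2, e4]; exact fun h => n5 (hq.inj h).symm
  have hn13 : ¬ Γ.Adj v1 v3 := fun h => htf _ _ _ h12 h23 h.symm
  have hv3 : ∀ j, v3 ≠ c j := by rw [e3]; exact hi
  have hedge : ∀ e, zc q e ≠ 0 ↔ e = s(v1, v2) ∨ e = s(v3, v2) ∨ e = s(v3, v4) ∨ e = s(v1, v4) := by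
    intro e
    constructor
    · intro h
      obtain ⟨j, rfl⟩ := zc_ne h
      rcases fin4_cases i j with rfl | rfl | rfl | rfl
      · rw [← e3, ← e4]; simp
      · rw [a1, ← e1, ← e4]; right; right; right; exact Sym2.eq_swap
      · rw [a2, ← e1, ← e2]; left; rfl
      · rw [a3, ← e2, ← e3]; right; left; exact Sym2.eq_swap
    · have z1 := zc_edge hq i
      have z2 := zc_edge hq (i + 1)
      have z3 := zc_edge hq (i + 2)
      have z4 := zc_edge hq (i + 3)
      rw [← e3, ← e4] at z1
      rw [a1, ← e1, ← e4, Sym2.eq_swap] at z2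
      rw [a2, ← e1, ← e2] at z3
      rw [a3, ← e2, ← e3, Sym2.eq_swap] at z4
      rintro (rfl | rfl | rfl | rfl)
      · rw [z3]; simp
      · rw [z4]; simp
      · rw [z1]; simp
      · rw [z2]; simp
  have hqs : ∀ e, zc q e = ie v1 v2 e + ie v2 v3 e + ie v3 v4 e + ie v4 v1 e := by
    intro e
    have z := zc_sum hq e
    rw [Fintype.sum_equiv (Equiv.addLeft i) (fun j => ie (q (i + j)) (q (i + j + 1)) e)
      (fun j => ie (q j) (q (j + 1)) e) (fun j => rfl)|>.symm] at z
    rw [z, Fin.sum_univ_four]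
    simp only [add_zero, a1, a2, a3, ← e1, ← e2, ← e3, ← e4]
    ring
  have hmem : ∀ e, zc q e ≠ 0 → e ∈ Γ.edgeSet := fun e h => mem_of_zc hq h
  have hcase : ∀ e ∈ Γ.edgeSet, ind f (D.l e) + ind f (D.r e) = zc q e := by
    intro e he; rw [← hf]; simp [dl, he]
  refine ⟨v1, v2, v3, v4, f, ⟨h12, h23.symm, h34, h41.symm, hn13, h13, h24, ?_, ?_, ?_, ?_,
    hff.symm, htf⟩, fun i h => hv3 i h.symm⟩
  · intro w hw1 hw3
    by_contra hcon
    push Not at hcon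
    have C1 : Cy Γ (![v1, v2, v3, w] : Fin 4 → V) :=
      cy4 h12 h23 hw3 hw1.symm h13 (Ne.symm hcon.1)
    have C2 : Cy Γ (![v1, v4, v3, w] : Fin 4 → V) :=
      cy4 h41.symm h34.symm hw3 hw1.symm h13 (Ne.symm hcon.2)
    have z1 : zc (![v1, v2, v3, w] : Fin 4 → V) s(v3, w) = 1 := zc_edge C1 2
    have z2 : zc (![v1, v4, v3, w] : Fin 4 → V) s(v3, w) = 1 := zc_edge C2 2
    refine three D htf hc hf0 NA C1 C2 (i1 := 2) (i2 := 2) hv3 hv3 hff hf (fun e => ?_) z1 z2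
    rw [zc_sum C1, zc_sum C2, hqs, Fin.sum_univ_four, Fin.sum_univ_four]
    have E1 : ie v4 v3 e = ie v3 v4 e := ie_comm _ _ _
    have E2 : ie v4 v1 e = ie v1 v4 e := ie_comm _ _ _
    have t1 := z2_add_eq_zero.2 (rfl : ie v3 w e = _)
    have t2 := z2_add_eq_zero.2 (rfl : ie w v1 e = _)
    change (ie v1 v2 e + ie v2 v3 e + ie v3 w e + ie w v1 e) +
      (ie v1 v4 e + ie v4 v3 e + ie v3 w e + ie w v1 e) = _
    rw [E1, E2]
    linear_combination t1 + t2
  · intro x y hx hxy hy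
    have x2 : x ≠ v2 := by rintro rfl; exact htf _ _ _ hxy hy h23.symm
    have x4 : x ≠ v4 := by rintro rfl; exact htf _ _ _ hxy hy h34
    have y2 : y ≠ v2 := by rintro rfl; exact htf _ _ _ hx hxy h12.symm
    have y4 : y ≠ v4 := by rintro rfl; exact htf _ _ _ hx hxy h41
    have x3 : x ≠ v3 := by rintro rfl; exact hn13 hx
    have y1 : y ≠ v1 := by rintro rfl; exact hn13 hy
    have C1 : Cy Γ (![v1, v2, v3, y, x] : Fin 5 → V) :=
      cy5 h12 h23 hy.symm hxy.symm hx.symm h13 y2.symm x3.symm y1 x2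
    have C2 : Cy Γ (![v1, v4, v3, y, x] : Fin 5 → V) :=
      cy5 h41.symm h34.symm hy.symm hxy.symm hx.symm h13 y4.symm x3.symm y1 x4
    have z1 : zc (![v1, v2, v3, y, x] : Fin 5 → V) s(y, x) = 1 := zc_edge C1 3
    have z2 : zc (![v1, v4, v3, y, x] : Fin 5 → V) s(y, x) = 1 := zc_edge C2 3
    refine three D htf hc hf0 NA C1 C2 (i1 := 2) (i2 := 2) hv3 hv3 hff hf (fun e => ?_) z1 z2
    rw [zc_sum C1, zc_sum C2, hqs, Fin.sum_univ_five, Fin.sum_univ_five]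
    have E1 : ie v4 v3 e = ie v3 v4 e := ie_comm _ _ _
    have E2 : ie v4 v1 e = ie v1 v4 e := ie_comm _ _ _
    have t1 := z2_add_eq_zero.2 (rfl : ie v3 y e = _)
    have t2 := z2_add_eq_zero.2 (rfl : ie y x e = _)
    have t3 := z2_add_eq_zero.2 (rfl : ie x v1 e = _)
    change (ie v1 v2 e + ie v2 v3 e + ie v3 y e + ie y x e + ie x v1 e) +
      (ie v1 v4 e + ie v4 v3 e + ie v3 y e + ie y x e + ie x v1 e) = _
    rw [E1, E2]
    linear_combination t1 + t2 + t3
  · intro e he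
    have h := (hedge e).2 he
    have h1 := hcase e (hmem e h)
    rw [(z2_cases (zc q e)).resolve_left h] at h1
    by_cases hl : D.l e = f <;> by_cases hr : D.r e = f
    · exact (hno e (hmem e h) hl hr).elim
    · exact Or.inl ⟨hl, hr⟩
    · exact Or.inr ⟨hl, hr⟩
    · simp [ind, hl, hr] at h1
  · intro e he t1 t2 t3 t4
    have h : zc q e = 0 := by
      by_contra h
      rcases (hedge e).1 h with h | h | h | h <;> contradiction
    have h1 := hcase e he
    rw [h] at h1
    by_cases hl : D.l e = f <;> by_cases hr : D.r e = f
    · exact (hno e he hl hr).elim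
    · simp [ind, hl, hr] at h1
    · simp [ind, hl, hr] at h1
    · exact ⟨hl, hr⟩

end

end PDG


namespace PDG
open scoped Classical
set_option linter.unusedSectionVars false
set_option linter.unusedSimpArgs false
set_option linter.unusedVariables false
set_option autoImplicit false

variable {V : Type} [Fintype V]

def supp (z : Sym2 V → ZMod 2) : Finset (Sym2 V) := Finset.univ.filter (z · ≠ 0)

lemma IsCyc.next {Γ : SimpleGraph V} {z : Sym2 V → ZMod 2} (h : IsCyc Γ z) {v w : V}
    (hw : z s(w, v) ≠ 0) : ∃ w', w' ≠ w ∧ z s(v, w') ≠ 0 := by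
  by_contra hcon
  push Not at hcon
  have := h.2 v
  rw [Finset.sum_eq_single w (fun b _ hb => hcon b hb) (by simp), Sym2.eq_swap] at this
  exact hw this

lemma IsCyc.mem {Γ : SimpleGraph V} {z : Sym2 V → ZMod 2} (h : IsCyc Γ z) {v w : V}
    (hw : z s(v, w) ≠ 0) : Γ.Adj v w := by
  by_contra hcon
  exact hw (h.1 _ hcon)

lemma supp5 {Γ : SimpleGraph V} (htf : TF Γ) {z : Sym2 V → ZMod 2} (h : IsCyc Γ z) (hz : z ≠ 0) :
    5 ≤ (supp z).card ∨ ∃ q : Fin 4 → V, Cy Γ q ∧ z = zc q := by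
  obtain ⟨e, he⟩ := Function.ne_iff.1 hz
  induction e using Sym2.ind with
  | _ a b =>
  obtain ⟨c, hca, hc⟩ := h.next he
  obtain ⟨d, hdb, hd⟩ := h.next hc
  have hab := h.mem he
  have hbc := h.mem hc
  have hcd := h.mem hd
  have hda : d ≠ a := by rintro rfl; exact htf _ _ _ hab hbc hcd
  obtain ⟨e, hec, hee⟩ := h.next hd
  have hde := h.mem hee
  have heb : e ≠ b := by rintro rfl; exact htf _ _ _ hbc hcd hde
  have n1 := hab.ne
  have n2 := hbc.ne
  have n3 := hcd.ne
  have n4 := hde.ne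
  by_cases hea : e = a
  · subst hea
    have hq := cy4 hab hbc hcd hde hca.symm hdb.symm
    by_cases hz' : z = zc (![e, b, c, d] : Fin 4 → V)
    · exact Or.inr ⟨_, hq, hz'⟩
    left
    obtain ⟨x, hx⟩ := Function.ne_iff.1 hz'
    have key : ∀ y, zc (![e, b, c, d] : Fin 4 → V) y ≠ 0 → z y ≠ 0 := by
      intro y hy
      obtain ⟨i, rfl⟩ := zc_ne hy
      fin_cases i
      · exact he
      · exact hc
      · exact hd
      · exact hee
    have hzx : z x ≠ 0 ∧ zc (![e, b, c, d] : Fin 4 → V) x = 0 := by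
      have := key x
      rcases z2_cases (z x) with h1 | h1 <;>
      rcases z2_cases (zc (![e, b, c, d] : Fin 4 → V) x) with h2 | h2 <;> simp_all
    have hxn : ∀ i : Fin 4, x ≠ s((![e, b, c, d] : Fin 4 → V) i, (![e, b, c, d] : Fin 4 → V) (i + 1)) := by
      rintro i rfl
      have := zc_edge hq i
      rw [this] at hzx
      simp at hzx
    have x0 := hxn 0
    have x1 := hxn 1
    have x2 := hxn 2
    have x3 := hxn 3
    change x ≠ s(e, b) at x0
    change x ≠ s(b, c) at x1
    change x ≠ s(c, d) at x2
    change x ≠ s(d, e) at x3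
    have hs : ({x, s(e, b), s(b, c), s(c, d), s(d, e)} : Finset (Sym2 V)) ⊆ supp z := by
      intro y hy
      simp only [Finset.mem_insert, Finset.mem_singleton] at hy
      simp only [supp, Finset.mem_filter, Finset.mem_univ, true_and]
      rcases hy with rfl | rfl | rfl | rfl | rfl
      exacts [hzx.1, he, hc, hd, hee]
    have := Finset.card_le_card hs
    have h5 : ({x, s(e, b), s(b, c), s(c, d), s(d, e)} : Finset (Sym2 V)).card = 5 := by
      repeat rw [Finset.card_insert_of_notMem]
      · rfl
      all_goals
        simp only [Finset.mem_insert, Finset.mem_singleton, Sym2.eq_iff]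
        tauto
    omega
  · left
    obtain ⟨f, hfd, hff⟩ := h.next hee
    have n5 := (h.mem hff).ne
    have hs : ({s(a, b), s(b, c), s(c, d), s(d, e), s(e, f)} : Finset (Sym2 V)) ⊆ supp z := by
      intro y hy
      simp only [Finset.mem_insert, Finset.mem_singleton] at hy
      simp only [supp, Finset.mem_filter, Finset.mem_univ, true_and]
      rcases hy with rfl | rfl | rfl | rfl | rfl
      exacts [he, hc, hd, hee, hff]
    have := Finset.card_le_card hs
    have h5 : ({s(a, b), s(b, c), s(c, d), s(d, e), s(e, f)} : Finset (Sym2 V)).card = 5 := by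
      repeat rw [Finset.card_insert_of_notMem]
      · rfl
      all_goals
        simp only [Finset.mem_insert, Finset.mem_singleton, Sym2.eq_iff]
        grind
    omega

lemma sum_sym {z : Sym2 V → ZMod 2} (h : ∀ v, z s(v, v) = 0) : ∑ v, ∑ w, z s(v, w) = 0 := by
  rw [← Finset.sum_product']
  refine Finset.sum_involution (fun p _ => (p.2, p.1)) ?_ ?_ ?_ ?_
  · rintro ⟨a, b⟩ _
    simp only
    rw [Sym2.eq_swap]; exact z2_add_eq_zero.2 rfl
  · rintro ⟨a, b⟩ _ hne heq
    simp only [Prod.mk.injEq] at heq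
    apply hne
    rw [heq.1]; exact h _
  · simp
  · simp

lemma euler {Γ : SimpleGraph V} (D : PD Γ) {R : Finset V} (hR : R.Nonempty)
    (hin : ∀ u v, Γ.Adj u v → u ∈ R ∧ v ∈ R) :
    Γ.edgeSet.ncard + 2 ≤ Nat.card D.F + R.card := by
  obtain ⟨r0, hr0⟩ := hR
  have := D.fin
  let E := Γ.edgeSet
  let _ : Fintype D.F := Fintype.ofFinite _
  have : Nonempty D.F := ⟨D.l s(r0, r0)⟩
  let ext : (E → ZMod 2) → Sym2 V → ZMod 2 := fun z e => if h : e ∈ Γ.edgeSet then z ⟨e, h⟩ else 0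
  let L : (D.F → ZMod 2) →ₗ[ZMod 2] (E → ZMod 2) :=
    { toFun := fun φ e => φ (D.l e.1) + φ (D.r e.1)
      map_add' := by intro a b; funext e; simp; ring
      map_smul' := by intro a b; funext e; simp; ring }
  let R' := {x : V // x ∈ R.erase r0}
  let B : (E → ZMod 2) →ₗ[ZMod 2] (R' → ZMod 2) :=
    { toFun := fun z v => ∑ w, ext z s(v.1, w)
      map_add' := by
        intro a b; funext v; simp only [Pi.add_apply, ← Finset.sum_add_distrib]
        refine Finset.sum_congr rfl fun w _ => ?_
        simp only [ext]; split_ifs <;> simp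
      map_smul' := by
        intro a b; funext v
        simp only [Pi.smul_apply, smul_eq_mul, Finset.mul_sum, RingHom.id_apply]
        refine Finset.sum_congr rfl fun w _ => ?_
        simp only [ext]; split_ifs <;> simp }
  have hker : LinearMap.ker B ≤ LinearMap.range L := by
    intro z hz
    have hz' : ∀ v, v ∈ R → v ≠ r0 → ∑ w, ext z s(v, w) = 0 := by
      intro v hv hv0
      exact congrFun hz ⟨v, Finset.mem_erase.2 ⟨hv0, hv⟩⟩
    have hout : ∀ v, v ∉ R → ∑ w, ext z s(v, w) = 0 := by
      intro v hv
      refine Finset.sum_eq_zero fun w _ => ?_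
      simp only [ext]
      rw [dif_neg]
      intro h
      exact hv (hin v w h).1
    have hcyc : IsCyc Γ (ext z) := by
      refine ⟨fun e he => by simp [ext, he], fun v => ?_⟩
      by_cases h0 : v = r0
      · subst h0
        have := sum_sym (z := ext z) (by intro v; simp [ext])
        rwa [Finset.sum_eq_single v] at this
        · intro b _ hb
          by_cases hbR : b ∈ R
          · exact hz' b hbR hb
          · exact hout b hbR
        · simp
      · by_cases hbR : v ∈ R
        · exact hz' v hbR h0
        · exact hout v hbR
    obtain ⟨φ, hφ⟩ := D.exact _ hcyc
    refine ⟨φ, ?_⟩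
    funext e
    have := congrFun hφ e.1
    simp only [dl, ext] at this
    rw [if_pos e.2, dif_pos e.2] at this
    exact this
  have h1 := LinearMap.finrank_range_add_finrank_ker L
  have h2 := LinearMap.finrank_range_add_finrank_ker B
  have h3 := Submodule.finrank_mono hker
  have h4 : 1 ≤ Module.finrank (ZMod 2) (LinearMap.ker L) := by
    have : Nontrivial (LinearMap.ker L) := by
      refine ⟨⟨⟨fun _ => 1, ?_⟩, 0, ?_⟩⟩
      · rw [LinearMap.mem_ker]; funext e; exact z2_add_eq_zero.2 rfl
      · intro h
        have := congrArg Subtype.val h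
        have := congrFun this (Classical.arbitrary D.F)
        simp at this
    exact Module.finrank_pos
  have h5 : Module.finrank (ZMod 2) (LinearMap.range B) ≤ Fintype.card R' := by
    have := Submodule.finrank_le (LinearMap.range B)
    rwa [Module.finrank_fintype_fun_eq_card] at this
  have h6 : Fintype.card R' = R.card - 1 := by
    rw [Fintype.card_coe, Finset.card_erase_of_mem hr0]
  rw [Module.finrank_fintype_fun_eq_card] at h1 h2
  have h7 : Fintype.card E = Γ.edgeSet.ncard := by
    rw [← Nat.card_eq_fintype_card]; rfl
  rw [Nat.card_eq_fintype_card]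
  have h8 : 1 ≤ R.card := Finset.card_pos.2 ⟨r0, hr0⟩
  omega

lemma sum_len {Γ : SimpleGraph V} (D : PD Γ) [Fintype D.F] :
    ∑ f, (supp (dl Γ D.l D.r (ind f))).card ≤ 2 * Γ.edgeSet.ncard := by
  have h7 : Γ.edgeSet.ncard = (Finset.univ.filter (· ∈ Γ.edgeSet)).card := by
    rw [Set.ncard_eq_toFinset_card']; congr 1; ext; simp
  rw [h7]
  have h1 : ∀ f, (supp (dl Γ D.l D.r (ind f))).card =
      ∑ e ∈ Finset.univ.filter (· ∈ Γ.edgeSet), if dl Γ D.l D.r (ind f) e ≠ 0 then 1 else 0 := by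
    intro f
    rw [← Finset.sum_filter, Finset.filter_filter, Finset.sum_const, smul_eq_mul, mul_one]
    congr 1
    ext e
    simp only [supp, Finset.mem_filter, Finset.mem_univ, true_and]
    constructor
    · intro h; refine ⟨?_, h⟩
      by_contra hc; apply h; simp [dl, hc]
    · exact fun h => h.2
  simp only [h1]
  rw [Finset.sum_comm, mul_comm, ← smul_eq_mul]
  apply Finset.sum_le_card_nsmul
  intro e he
  rw [← Finset.sum_filter, Finset.sum_const, smul_eq_mul, mul_one]
  refine (Finset.card_le_card (t := {D.l e, D.r e}) ?_).trans Finset.card_le_two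
  intro f hf
  simp only [Finset.mem_filter, Finset.mem_univ, true_and] at hf
  simp only [Finset.mem_insert, Finset.mem_singleton]
  by_contra hcon
  push Not at hcon
  apply hf
  simp [dl, ind, hcon.1.symm, hcon.2.symm]

end PDG


namespace PDG
open scoped Classical
set_option linter.unusedSectionVars false
set_option linter.unusedSimpArgs false
set_option linter.unusedVariables false
set_option autoImplicit false

variable {V : Type} [Fintype V]

lemma ed_eq {Γ Γ₁ : SimpleGraph V} {R : Finset V}
    (h : ∀ u v, Γ₁.Adj u v ↔ Γ.Adj u v ∧ u ∈ R ∧ v ∈ R) :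
    KY.ed Γ R R = 2 * (Γ₁.edgeSet.ncard : ℤ) := by
  have h1 := Γ₁.sum_degrees_eq_twice_card_edges
  have h7 : Γ₁.edgeSet.ncard = Γ₁.edgeFinset.card := by
    rw [Set.ncard_eq_toFinset_card']; congr 1
  rw [h7]
  have : (∑ v, (Γ₁.degree v : ℤ)) = 2 * (Γ₁.edgeFinset.card : ℤ) := by exact_mod_cast h1
  rw [← this]
  unfold KY.ed
  rw [← Finset.sum_subset (Finset.subset_univ R)]
  · refine Finset.sum_congr rfl fun u hu => ?_
    rw [← SimpleGraph.card_neighborFinset_eq_degree, ← Finset.sum_filter, Finset.sum_const]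
    simp only [nsmul_eq_mul, mul_one]
    congr 2
    ext v
    simp [h, hu]; tauto
  · intro u _ hu
    rw [← SimpleGraph.card_neighborFinset_eq_degree]
    simp only [Nat.cast_eq_zero, Finset.card_eq_zero]
    ext v
    simp [h, hu]

lemma supp_zc {Γ : SimpleGraph V} {n : ℕ} [NeZero n] {c : Fin n → V} (hc : Cy Γ c) :
    n ≤ (supp (zc c)).card := by
  have : (Finset.univ.image fun i => s(c i, c (i + 1))) ⊆ supp (zc c) := by
    intro e he
    simp only [Finset.mem_image, Finset.mem_univ, true_and] at he
    obtain ⟨i, rfl⟩ := he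
    simp [supp, zc_edge hc i]
  have := Finset.card_le_card this
  rwa [Finset.card_image_of_injective _ (fun i j h => hc.edge_inj h), Finset.card_univ,
    Fintype.card_fin] at this

lemma dens {Γ : SimpleGraph V} (D : PD Γ) (htf : TF Γ) {z0 : Sym2 V → ZMod 2}
    (N4 : ∀ q : Fin 4 → V, Cy Γ q → zc q = z0) {R : Finset V} (h3 : 3 ≤ R.card) :
    16 ≤ KY.P Γ R := by
  rcases Nat.lt_or_ge 3 R.card with h4 | h4
  swap
  · have h3' : R.card = 3 := le_antisymm h4 h3
    obtain ⟨a, b, c, hab, hac, hbc, rfl⟩ := Finset.card_eq_three.1 h3'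
    have := htf a b c
    unfold KY.P KY.ed
    rw [h3']
    have hs : ∀ f : V → ℤ, ∑ x ∈ {a, b, c}, f x = f a + (f b + f c) := by
      intro f
      rw [Finset.sum_insert (by simp [hab, hac]), Finset.sum_insert (by simp [hbc]), Finset.sum_singleton]
    simp only [hs]
    simp only [SimpleGraph.irrefl, if_false, Γ.adj_comm b a, Γ.adj_comm c a, Γ.adj_comm c b]
    rw [Γ.adj_comm c a] at this
    by_cases h1 : Γ.Adj a b <;> by_cases h2 : Γ.Adj b c <;> by_cases h3 : Γ.Adj a c <;>
      simp [h1, h2, h3] at this ⊢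
  let Γ₁ := res Γ fun e => ∀ x ∈ e, x ∈ R
  have hle : Γ₁ ≤ Γ := res_le _ _
  have hadj : ∀ u v, Γ₁.Adj u v ↔ Γ.Adj u v ∧ u ∈ R ∧ v ∈ R := by
    intro u v
    simp [Γ₁, res]
  have hed := ed_eq hadj
  let D₁ := subPD D hle
  have hR : R.Nonempty := Finset.card_pos.1 (by omega)
  have heul := euler D₁ hR (fun u v h => ((hadj u v).1 h).2)
  have := D₁.fin
  let _ : Fintype D₁.F := Fintype.ofFinite _
  have hsum := sum_len D₁
  rw [Nat.card_eq_fintype_card] at heul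
  unfold KY.P
  rw [hed]
  by_cases hN : Fintype.card D₁.F ≤ 2
  · omega
  push Not at hN
  have hne : ∀ f, dl Γ₁ D₁.l D₁.r (ind f) ≠ 0 := by
    intro f hf
    obtain ⟨g, hg⟩ := Fintype.exists_ne_of_one_lt_card (by omega) f
    have := D₁.conn _ hf f g
    simp [ind, hg] at this
  have hcy : ∀ q : Fin 4 → V, Cy Γ₁ q → zc q = z0 := fun q hq =>
    N4 q ⟨hq.inj, fun i => hle (hq.adj i), hq.len⟩
  have huniq : ∀ f g, dl Γ₁ D₁.l D₁.r (ind f) = z0 → dl Γ₁ D₁.l D₁.r (ind g) = z0 → f = g := by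
    intro f g hf hg
    by_contra hfg
    have h0 : dl Γ₁ D₁.l D₁.r (ind f + ind g) = 0 := by
      rw [dl_add, hf, hg]; funext e; exact z2_add_eq_zero.2 rfl
    obtain ⟨x, hx⟩ : ∃ x, x ∉ ({f, g} : Finset D₁.F) := by
      by_contra hcon
      push Not at hcon
      have := Finset.card_le_card (fun x _ => hcon x : Finset.univ ⊆ ({f, g} : Finset D₁.F))
      have h2 := Finset.card_le_two (a := f) (b := g)
      rw [Finset.card_univ] at this
      omega
    simp only [Finset.mem_insert, Finset.mem_singleton, not_or] at hx
    have := D₁.conn _ h0 f x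
    simp [ind, hx.1, hx.2, hfg] at this
  have hlen : ∀ f, 5 ≤ (supp (dl Γ₁ D₁.l D₁.r (ind f))).card +
      (if dl Γ₁ D₁.l D₁.r (ind f) = z0 then 1 else 0) := by
    intro f
    rcases supp5 (htf.mono hle) (D₁.even _) (hne f) with h | ⟨q, hq, hz⟩
    · omega
    · rw [if_pos (by rw [hz]; exact hcy q hq), hz]
      have := supp_zc hq
      omega
  have h5 := Finset.sum_le_sum (fun f (_ : f ∈ Finset.univ) => hlen f)
  rw [Finset.sum_add_distrib, Finset.sum_const, Finset.card_univ, ← Finset.sum_filter,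
    Finset.sum_const, smul_eq_mul, smul_eq_mul, mul_one] at h5
  have h6 : (Finset.univ.filter fun f => dl Γ₁ D₁.l D₁.r (ind f) = z0).card ≤ 1 := by
    rw [Finset.card_le_one]
    intro a ha b hb
    simp only [Finset.mem_filter, Finset.mem_univ, true_and] at ha hb
    exact huniq a b ha hb
  omega

end PDG


namespace PDG
open scoped Classical
set_option linter.unusedSectionVars false
set_option linter.unusedSimpArgs false
set_option linter.unusedVariables false
set_option autoImplicit false

variable {V : Type} [Fintype V]

section dec
def eI (n : ℕ) [NeZero n] (I : Finset (Fin n)) : ℤ :=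
  ∑ i ∈ I, ∑ j ∈ I, if j = i + 1 ∨ i = j + 1 then 1 else 0

set_option maxRecDepth 100000 in
lemma dec4 : ∀ I : Finset (Fin 4), ((∀ i ∈ I, i + 1 ∉ I) → 10 * (I.card : ℤ) - 3 * eI 4 I ≤ 20) ∧
    ((∀ i, i ∉ I → i + 1 ∈ I) → 10 * (I.card : ℤ) - 3 * eI 4 I ≤ 22) := by
  unfold eI; decide +kernel

set_option maxRecDepth 100000 in
lemma dec5 : ∀ I : Finset (Fin 5), ((∀ i ∈ I, i + 1 ∉ I) → 10 * (I.card : ℤ) - 3 * eI 5 I ≤ 20) ∧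
    ((∀ i, i ∉ I → i + 1 ∈ I) → 10 * (I.card : ℤ) - 3 * eI 5 I ≤ 24) ∧
    (I = Finset.univ → 10 * (I.card : ℤ) - 3 * eI 5 I ≤ 20) := by
  unfold eI; decide +kernel
end dec

lemma decX {n : ℕ} [NeZero n] (hn : n = 4 ∨ n = 5) (ψ : Fin n → Fin 3)
    (hψ : ∀ i, ψ i ≠ ψ (i + 1)) {X : Finset (Fin 3)} (hX : X.Nonempty) :
    10 * ((Finset.univ.filter (ψ · ∈ X)).card : ℤ) - 3 * eI n (Finset.univ.filter (ψ · ∈ X)) ≤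
      (10 * (X.card : ℤ) - 3 * (X.card * (X.card - 1))) + 10 := by
  have h1 : X.card ≤ 3 := by simpa using Finset.card_le_univ X
  have h2 : 1 ≤ X.card := hX.card_pos
  obtain h | h | h : X.card = 1 ∨ X.card = 2 ∨ X.card = 3 := by omega
  · obtain ⟨x, rfl⟩ := Finset.card_eq_one.1 h
    have hi : ∀ i ∈ Finset.univ.filter (ψ · ∈ ({x} : Finset (Fin 3))),
        i + 1 ∉ Finset.univ.filter (ψ · ∈ ({x} : Finset (Fin 3))) := by
      intro i hi hi'
      simp only [Finset.mem_filter, Finset.mem_univ, true_and, Finset.mem_singleton] at hi hi'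
      exact hψ i (hi.trans hi'.symm)
    rw [h]
    rcases hn with rfl | rfl
    · exact ((dec4 _).1 hi).trans (by norm_num)
    · exact ((dec5 _).1 hi).trans (by norm_num)
  · have hi : ∀ i, i ∉ Finset.univ.filter (ψ · ∈ X) → i + 1 ∈ Finset.univ.filter (ψ · ∈ X) := by
      intro i hi
      simp only [Finset.mem_filter, Finset.mem_univ, true_and] at hi ⊢
      by_contra hi'
      have : insert (ψ i) (insert (ψ (i + 1)) X) ⊆ Finset.univ := Finset.subset_univ _
      have := Finset.card_le_card this
      rw [Finset.card_insert_of_notMem (by simp [hi, hψ i]), Finset.card_insert_of_notMem hi', h] at this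
      simp at this
    rw [h]
    rcases hn with rfl | rfl
    · have := (dec4 _).2 hi; norm_num; linarith
    · have := (dec5 _).2.1 hi; norm_num; linarith
  · have hu : X = Finset.univ := by
      rw [← Finset.card_eq_iff_eq_univ, h]; rfl
    have hI : Finset.univ.filter (ψ · ∈ X) = Finset.univ := by simp [hu]
    rw [h]
    rcases hn with rfl | rfl
    · have := (dec4 (Finset.univ.filter (ψ · ∈ X))).2 (by simp [hI]); norm_num; linarith
    · have := (dec5 (Finset.univ.filter (ψ · ∈ X))).2.2 hI; norm_num; linarith

lemma step_c {Γ : SimpleGraph V} (D : PD Γ) {n : ℕ} [NeZero n] {c : Fin n → V} (htf : TF Γ)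
    (hc : Cy Γ c) (N4 : ∀ q : Fin 4 → V, Cy Γ q → zc q = zc c)
    (ψ : Fin n → Fin 3) (hψ : ∀ i, ψ i ≠ ψ (i + 1)) :
    ∃ col : V → Fin 3, (∀ u v, Γ.Adj u v → col u ≠ col v) ∧ ∀ i, col (c i) = ψ i := by
  let C : Finset V := Finset.univ.image c
  obtain ⟨φ, hφ⟩ : ∃ φ : V → Fin 3, ∀ i, φ (c i) = ψ i :=
    ⟨Function.extend c ψ 0, fun i => hc.inj.extend_apply _ _ _⟩
  have hd := fun {R : Finset V} => dens D htf N4 (R := R)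
  have hgood : KY.GoodOn (KY.Y Γ C φ) ((Finset.univ \ C).disjSum Finset.univ) := by
    intro R hR hne
    let A := R.toLeft
    let X := R.toRight
    have hRe : R = A.disjSum X := (Finset.toLeft_disjSum_toRight (u := R)).symm
    have hA : ∀ a ∈ A, a ∉ C := by
      intro a ha
      have := hR (Finset.mem_toLeft.1 ha)
      simpa using this
    have hPY := KY.P_Y (G := Γ) C φ A X
    rw [hRe]
    by_cases hX : X.Nonempty
    swap
    · rw [Finset.not_nonempty_iff_eq_empty] at hX
      have hB : KY.RX C φ X = ∅ := by simp [KY.RX, hX]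
      rw [hB, KY.ed_empty] at hPY
      have hAn : A.Nonempty := by
        rw [Finset.nonempty_iff_ne_empty]
        intro h
        rw [hRe, h, hX] at hne
        simp at hne
      have hX0 : X.card = 0 := by simp [hX]
      rw [hX0] at hPY
      have : 6 ≤ KY.P Γ A := by
        by_cases h3 : 3 ≤ A.card
        · have := hd h3; linarith
        · have h1 := KY.P_ge (G := Γ) A
          have h2 : 1 ≤ A.card := hAn.card_pos
          obtain h | h : A.card = 1 ∨ A.card = 2 := by omega
          · rw [h] at h1; norm_num at h1; linarith
          · rw [h] at h1; norm_num at h1; linarith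
      push_cast at hPY
      linarith
    · set B := KY.RX C φ X with hBdef
      have hBC : ∀ b ∈ B, b ∈ C := fun b hb => (Finset.mem_filter.1 hb).1
      have hdis : Disjoint A B := Finset.disjoint_left.2 fun a ha hb => hA a ha (hBC a hb)
      have hPU := KY.P_union (G := Γ) hdis
      have hk := (KY.kX_ge hX).1
      have hBe : B = (Finset.univ.filter (ψ · ∈ X)).map ⟨c, hc.inj⟩ := by
        ext b
        simp only [hBdef, KY.RX, C, Finset.mem_filter, Finset.mem_image, Finset.mem_univ, true_and,
          Finset.mem_map, Function.Embedding.coeFn_mk]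
        constructor
        · rintro ⟨⟨i, rfl⟩, h⟩; exact ⟨i, by rwa [hφ] at h, rfl⟩
        · rintro ⟨i, h, rfl⟩; exact ⟨⟨i, rfl⟩, by rwa [hφ]⟩
      have hPB : KY.P Γ B ≤ (10 * (X.card : ℤ) - 3 * (X.card * (X.card - 1))) + 10 := by
        refine le_trans ?_ (decX hc.len ψ hψ hX)
        unfold KY.P
        have h1 : B.card = (Finset.univ.filter (ψ · ∈ X)).card := by rw [hBe, Finset.card_map]
        have h2 : eI n (Finset.univ.filter (ψ · ∈ X)) ≤ KY.ed Γ B B := by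
          rw [hBe]
          unfold KY.ed eI
          simp only [Finset.sum_map, Function.Embedding.coeFn_mk]
          refine Finset.sum_le_sum fun i _ => Finset.sum_le_sum fun j _ => ?_
          by_cases h : j = i + 1 ∨ i = j + 1
          · rw [if_pos, if_pos]
            · rcases h with rfl | rfl
              · exact hc.adj i
              · exact (hc.adj j).symm
            · exact h
          · rw [if_neg h]; split_ifs <;> norm_num
        rw [h1]
        linarith
      by_cases h3 : 3 ≤ (A ∪ B).card
      · have := hd h3
        linarith
      · rw [Finset.card_union_of_disjoint hdis] at h3
        by_cases hA0 : A.card = 0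
        · rw [Finset.card_eq_zero] at hA0
          rw [hA0] at hPY ⊢
          rw [KY.P_empty, KY.ed_comm, KY.ed_empty] at hPY
          linarith
        · have hPA := KY.P_ge (G := Γ) A
          have hel := KY.ed_le_card (G := Γ) A B
          obtain ⟨h1, h2⟩ | ⟨h1, h2⟩ | ⟨h1, h2⟩ : (A.card = 1 ∧ B.card = 0) ∨
            (A.card = 1 ∧ B.card = 1) ∨ (A.card = 2 ∧ B.card = 0) := by omega
          all_goals
            rw [h1, h2] at hel
            rw [h1] at hPA
            norm_num at hPA hel
            linarith
  have hφC : ∀ u ∈ C, ∀ v ∈ C, Γ.Adj u v → φ u ≠ φ v := by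
    intro u hu v hv huv
    simp only [C, Finset.mem_image, Finset.mem_univ, true_and] at hu hv
    obtain ⟨i, rfl⟩ := hu
    obtain ⟨j, rfl⟩ := hv
    have := chordless htf hc huv
    obtain ⟨k, hk⟩ := zc_ne (by rw [this]; simp : zc c s(c i, c j) ≠ 0)
    rw [hφ, hφ]
    rw [Sym2.eq_iff] at hk
    rcases hk with ⟨h1, h2⟩ | ⟨h1, h2⟩
    · rw [hc.inj h1, hc.inj h2]; exact hψ k
    · rw [hc.inj h1, hc.inj h2]; exact (hψ k).symm
  obtain ⟨col, h1, h2⟩ := KY.col_of_Y C φ hφC (KY.kyOn _ _ hgood)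
  refine ⟨col, h1, fun i => ?_⟩
  rw [h2 (c i) (Finset.mem_image_of_mem _ (Finset.mem_univ i)), hφ]

theorem ext_all (m : ℕ) : Ext V m := by
  induction m with
  | zero => intro Γ D n _ c h; omega
  | succ m ih =>
  intro Γ D n _ c hm htf hc f0 hf0 ψ hψ
  have ih' : Ext V Γ.edgeSet.ncard := by
    intro Γ' D' n' _ c' h'
    exact ih Γ' D' n' c' (by omega)
  by_cases NA : ∀ (k : ℕ) [NeZero k] (K : Fin k → V) (φ : D.F → ZMod 2), Cy Γ K → zc K ≠ zc c →
      dl Γ D.l D.r φ = zc K → φ f0 = 0 → ∀ e ∈ Γ.edgeSet, φ (D.l e) = 1 → φ (D.r e) = 1 → False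
  swap
  · push Not at NA
    obtain ⟨k, _, K, φ, hK, hne, hφ, h0, e, he, hl, hr, -⟩ := NA
    exact split_step D htf hc hf0 ih' ψ hψ hK hne hφ h0 he hl hr
  by_cases N4 : ∀ q : Fin 4 → V, Cy Γ q → zc q = zc c
  · exact step_c D htf hc N4 ψ hψ
  · push Not at N4
    obtain ⟨q, hq, hne⟩ := N4
    obtain ⟨v1, v2, v3, v4, f, Q, hc3⟩ := exists_QD D htf hc hf0 NA hq hne
    exact ident_step Q hc hf0 hc3 ih' ψ hψ

theorem extend (Γ : SimpleGraph V) (D : PD Γ) (n : ℕ) [NeZero n] (c : Fin n → V)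
    (htf : TF Γ) (hc : Cy Γ c) (f0 : D.F) (hf0 : dl Γ D.l D.r (ind f0) = zc c)
    (ψ : Fin n → Fin 3) (hψ : ∀ i, ψ i ≠ ψ (i + 1)) :
    ∃ col : V → Fin 3, (∀ u v, Γ.Adj u v → col u ≠ col v) ∧ ∀ i, col (c i) = ψ i :=
  ext_all _ Γ D n c (Nat.lt_succ_self _) htf hc f0 hf0 ψ hψ

end PDG


namespace TopP
open scoped Classical
set_option linter.unusedSectionVars false
set_option linter.unusedSimpArgs false
set_option linter.unusedVariables false
set_option autoImplicit false

/-- `f` has a continuous logarithm on `K`. -/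
def HL (K : Set ℂ) (f : ℂ → ℂ) : Prop :=
  ∃ L : ℂ → ℂ, ContinuousOn L K ∧ ∀ z ∈ K, Complex.exp (L z) = f z

/-- Every nonvanishing continuous function on `K` has a logarithm. -/
def Acyc (K : Set ℂ) : Prop :=
  ∀ f : ℂ → ℂ, ContinuousOn f K → (∀ z ∈ K, f z ≠ 0) → HL K f

theorem hl_hom {X : Type*} [TopologicalSpace X] (H : C(unitInterval × X, ℂ)) (h0 : ∀ p, H p ≠ 0)
    (L0 : C(X, ℂ)) (hL : ∀ x, Complex.exp (L0 x) = H (0, x)) :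
    ∃ L : C(X, ℂ), ∀ x, Complex.exp (L x) = H (1, x) := by
  let H' : C(unitInterval × X, {z : ℂ // z ≠ 0}) :=
    ⟨fun p => ⟨H p, h0 p⟩, by fun_prop⟩
  have hz : ∀ a, H' (0, a) = (fun z : ℂ ↦ (⟨_, z.exp_ne_zero⟩ : {z : ℂ // z ≠ 0})) (L0 a) := by
    intro a; apply Subtype.ext; exact (hL a).symm
  let M := Complex.isCoveringMap_exp.liftHomotopy H' L0 hz
  refine ⟨⟨fun x => M (1, x), by fun_prop⟩, fun x => ?_⟩
  have := congr_fun (Complex.isCoveringMap_exp.liftHomotopy_lifts H' L0 hz) (1, x)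
  exact congrArg Subtype.val this

theorem hl_plane (f : ℂ → ℂ) (hf : Continuous f) (h0 : ∀ z, f z ≠ 0) :
    ∃ L : ℂ → ℂ, Continuous L ∧ ∀ z, Complex.exp (L z) = f z := by
  obtain ⟨L, hL⟩ := hl_hom (X := ℂ) ⟨fun p => f ((p.1 : ℝ) * p.2), by fun_prop⟩ (fun p => h0 _)
    (ContinuousMap.const _ (Complex.log (f 0))) (by intro x; simp [Complex.exp_log (h0 0)])
  exact ⟨L, L.continuous, fun z => by simpa using hL z⟩

theorem hl_I (f : C(unitInterval, ℂ)) (h0 : ∀ z, f z ≠ 0) :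
    ∃ L : C(unitInterval, ℂ), ∀ z, Complex.exp (L z) = f z := by
  obtain ⟨L, hL⟩ := hl_hom (X := unitInterval) ⟨fun p => f (p.1 * p.2), by fun_prop⟩ (fun p => h0 _)
    (ContinuousMap.const _ (Complex.log (f 0))) (by intro x; simp [Complex.exp_log (h0 0)])
  exact ⟨L, fun z => by simpa using hL z⟩

theorem acyc_arc (g : C(unitInterval, ℂ)) (hg : Function.Injective g) : Acyc (range g) := by
  intro f hf h0
  have hfg : Continuous (f ∘ g) := hf.comp_continuous g.continuous (fun x => mem_range_self x)
  obtain ⟨L, hL⟩ := hl_I ⟨f ∘ g, hfg⟩ (fun z => h0 _ (mem_range_self z))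
  have hemb : IsClosedEmbedding g := g.continuous.isClosedEmbedding hg
  have hinv : ∀ x, Function.invFun g (g x) = x := Function.leftInverse_invFun hg
  refine ⟨fun z => L (Function.invFun g z), ?_, ?_⟩
  · rw [continuousOn_iff_continuous_domRestrict]
    have hq : IsQuotientMap (rangeFactorization g) := by
      have : Continuous (rangeFactorization g) := by fun_prop
      refine IsClosedMap.isQuotientMap ?_ this rangeFactorization_surjective
      exact this.isClosedMap
    rw [hq.continuous_iff]
    have : ((range g).domRestrict fun z => L (Function.invFun g z)) ∘ rangeFactorization g = L := by
      funext x; simp [rangeFactorization, hinv]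
    rw [this]; exact L.continuous
  · rintro _ ⟨x, rfl⟩
    simp only [hinv]; exact hL x

theorem log_unique {X : Type*} [TopologicalSpace X] {S : Set X} (hS : IsPreconnected S) {L M : X → ℂ}
    (hL : ContinuousOn L S) (hM : ContinuousOn M S)
    (h : ∀ z ∈ S, Complex.exp (L z) = Complex.exp (M z)) {a : X} (ha : a ∈ S) :
    ∀ z ∈ S, L z - M z = L a - M a := by
  have := Complex.isCoveringMap_exp.eqOn_of_comp_eqOn hS (g₁ := L) (g₂ := fun z => M z + (L a - M a))
    hL (hM.add continuousOn_const) (by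
      intro z hz
      apply Subtype.ext
      simp [Complex.exp_add, Complex.exp_sub, h z hz, h a ha, Complex.exp_ne_zero]) ha (by simp)
  intro z hz
  have := this hz
  simp only at this
  rw [this]; ring

theorem HL.mono {K K' : Set ℂ} {f : ℂ → ℂ} (h : HL K f) (hs : K' ⊆ K) : HL K' f := by
  obtain ⟨L, h1, h2⟩ := h
  exact ⟨L, h1.mono hs, fun z hz => h2 z (hs hz)⟩

theorem HL.congr {K : Set ℂ} {f g : ℂ → ℂ} (h : HL K f) (hs : ∀ z ∈ K, f z = g z) : HL K g := by
  obtain ⟨L, h1, h2⟩ := h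
  exact ⟨L, h1, fun z hz => by rw [h2 z hz, hs z hz]⟩

theorem HL.inv {K : Set ℂ} {f : ℂ → ℂ} (h : HL K f) : HL K (fun z => (f z)⁻¹) := by
  obtain ⟨L, h1, h2⟩ := h
  exact ⟨fun z => - L z, h1.neg, fun z hz => by rw [Complex.exp_neg, h2 z hz]⟩

theorem HL.mul {K : Set ℂ} {f g : ℂ → ℂ} (h : HL K f) (h' : HL K g) : HL K (fun z => f z * g z) := by
  obtain ⟨L, h1, h2⟩ := h
  obtain ⟨M, h3, h4⟩ := h'
  exact ⟨fun z => L z + M z, h1.add h3, fun z hz => by rw [Complex.exp_add, h2 z hz, h4 z hz]⟩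

/-- moving the pole along a path off `K`. -/
theorem hl_move (K : Set ℂ) (a b : ℂ) (h : JoinedIn Kᶜ a b) :
    HL K (fun z => (z - b) / (z - a)) := by
  obtain ⟨p, hp⟩ := h
  obtain ⟨L, hL⟩ := hl_hom (X := K) ⟨fun q => ((q.2 : ℂ) - p q.1) / ((q.2 : ℂ) - a), by
    refine Continuous.div (by fun_prop) (by fun_prop) ?_
    intro q hq
    have := hp 0
    rw [p.source] at this
    exact this ((sub_eq_zero.1 hq) ▸ q.2.2)⟩
    (by
      intro q
      refine div_ne_zero ?_ ?_
      · intro hq; exact hp q.1 ((sub_eq_zero.1 hq) ▸ q.2.2)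
      · intro hq
        have := hp 0
        rw [p.source] at this
        exact this ((sub_eq_zero.1 hq) ▸ q.2.2)) (ContinuousMap.const _ 0) (by
      intro x
      have : (x : ℂ) - a ≠ 0 := by
        intro hq
        have := hp 0
        rw [p.source] at this
        exact this ((sub_eq_zero.1 hq) ▸ x.2)
      simp [div_self this])
  refine ⟨fun z => if hz : z ∈ K then L ⟨z, hz⟩ else 0, ?_, ?_⟩
  · rw [continuousOn_iff_continuous_domRestrict]
    convert L.continuous using 1
    funext x; simp [x.2]
  · intro z hz
    simp only [hz, dite_true]
    rw [hL]; simp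

/-- gluing on closed sets -/
theorem hl_glue {K1 K2 : Set ℂ} (h1 : IsClosed K1) (h2 : IsClosed K2) {L M f : ℂ → ℂ}
    (hL : ContinuousOn L K1) (hM : ContinuousOn M K2) (hLf : ∀ z ∈ K1, Complex.exp (L z) = f z)
    (hMf : ∀ z ∈ K2, Complex.exp (M z) = f z) (he : ∀ z ∈ K1, z ∈ K2 → L z = M z) :
    HL (K1 ∪ K2) f := by
  refine ⟨fun z => if z ∈ K1 then L z else M z, ?_, ?_⟩
  · apply ContinuousOn.union_of_isClosed _ _ h1 h2
    · exact hL.congr (fun z hz => by simp [hz])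
    · refine hM.congr (fun z hz => ?_)
      by_cases h : z ∈ K1
      · simp [h, he z h hz]
      · simp [h]
  · intro z hz
    by_cases h : z ∈ K1
    · simp [h, hLf]
    · simp [h, hMf z (hz.resolve_left h)]

theorem hl_glue_open {K1 K2 : Set ℂ} (h1 : IsOpen K1) (h2 : IsOpen K2) {L M f : ℂ → ℂ}
    (hL : ContinuousOn L K1) (hM : ContinuousOn M K2) (hLf : ∀ z ∈ K1, Complex.exp (L z) = f z)
    (hMf : ∀ z ∈ K2, Complex.exp (M z) = f z) (he : ∀ z ∈ K1, z ∈ K2 → L z = M z) :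
    HL (K1 ∪ K2) f := by
  refine ⟨fun z => if z ∈ K1 then L z else M z, ?_, ?_⟩
  · apply ContinuousOn.union_of_isOpen _ _ h1 h2
    · exact hL.congr (fun z hz => by simp [hz])
    · refine hM.congr (fun z hz => ?_)
      by_cases h : z ∈ K1
      · simp [h, he z h hz]
      · simp [h]
  · intro z hz
    by_cases h : z ∈ K1
    · simp [h, hLf]
    · simp [h, hMf z (hz.resolve_left h)]

theorem acyc_glue1 {K1 K2 : Set ℂ} (h1 : IsClosed K1) (h2 : IsClosed K2) (a1 : Acyc K1) (a2 : Acyc K2)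
    (p : ℂ) (hp : K1 ∩ K2 ⊆ {p}) : Acyc (K1 ∪ K2) := by
  intro f hf h0
  obtain ⟨L, hL, hL'⟩ := a1 f (hf.mono subset_union_left) (fun z hz => h0 z (Or.inl hz))
  obtain ⟨M, hM, hM'⟩ := a2 f (hf.mono subset_union_right) (fun z hz => h0 z (Or.inr hz))
  by_cases hpp : p ∈ K1 ∩ K2
  · refine hl_glue h1 h2 hL (M := fun z => M z + (L p - M p)) (hM.add continuousOn_const) hL' ?_ ?_
    · intro z hz
      rw [Complex.exp_add, hM' z hz, Complex.exp_sub, hL' p hpp.1, hM' p hpp.2,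
        div_self (h0 p (Or.inl hpp.1)), mul_one]
    · intro z hz hz'
      have : z = p := hp ⟨hz, hz'⟩
      subst this; ring
  · refine hl_glue h1 h2 hL hM hL' hM' ?_
    intro z hz hz'
    have : z = p := hp ⟨hz, hz'⟩
    subst this; exact absurd ⟨hz, hz'⟩ hpp

theorem hl_circle (a : ℂ) (R : ℝ) (hR : 0 < R) (n : ℤ)
    (h : HL (Metric.sphere a R) (fun z => (z - a) ^ n)) : n = 0 := by
  obtain ⟨L, hL, hL'⟩ := h
  have hm : ∀ t : ℝ, a + R * Complex.exp (t * Complex.I) ∈ Metric.sphere a R := by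
    intro t
    simp [Complex.norm_exp_ofReal_mul_I, abs_of_pos hR]
  have h1 : Continuous fun t : ℝ => L (a + R * Complex.exp (t * Complex.I)) :=
    hL.comp_continuous (by fun_prop) hm
  have key := log_unique (X := ℝ) isPreconnected_univ h1.continuousOn
    (M := fun t : ℝ => n * (Real.log R + t * Complex.I)) (by fun_prop) (by
      intro t _
      rw [hL' _ (hm t), Complex.exp_int_mul, Complex.exp_add, ← Complex.ofReal_exp, Real.exp_log hR]
      simp) (mem_univ 0) (2 * Real.pi) (mem_univ _)
  simp only [Complex.ofReal_mul, Complex.ofReal_ofNat, Complex.exp_two_pi_mul_I, Complex.ofReal_zero,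
    zero_mul, Complex.exp_zero] at key
  have : (n : ℂ) * (2 * Real.pi * Complex.I) = 0 := by linear_combination -key
  simpa [Real.pi_ne_zero] using this

end TopP


namespace TopP
open scoped Classical
set_option linter.unusedSectionVars false
set_option linter.unusedSimpArgs false
set_option linter.unusedVariables false
set_option autoImplicit false

theorem cc_closure {X : Type*} [TopologicalSpace X] [LocallyConnectedSpace X] {O : Set X} (hO : IsOpen O) {x y : X}
    (hy : y ∈ closure (connectedComponentIn O x)) (hyO : y ∈ O) : y ∈ connectedComponentIn O x := by
  rw [mem_closure_iff] at hy
  obtain ⟨z, hz1, hz2⟩ := hy _ (hO.connectedComponentIn (x := y)) (mem_connectedComponentIn hyO)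
  rw [connectedComponentIn_eq hz2, ← connectedComponentIn_eq hz1]
  exact mem_connectedComponentIn hyO

theorem cc_frontier {X : Type*} [TopologicalSpace X] [LocallyConnectedSpace X] {K : Set X} (hK : IsClosed K) (x : X) :
    frontier (connectedComponentIn Kᶜ x) ⊆ K := by
  intro y hy
  rw [(hK.isOpen_compl.connectedComponentIn).frontier_eq] at hy
  by_contra h
  exact hy.2 (cc_closure hK.isOpen_compl hy.1 h)

theorem cc_eq_of_mem {X : Type*} [TopologicalSpace X] {O : Set X} {x y z : X}
    (h1 : z ∈ connectedComponentIn O x) (h2 : z ∈ connectedComponentIn O y) :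
    connectedComponentIn O x = connectedComponentIn O y := by
  rw [connectedComponentIn_eq h1, connectedComponentIn_eq h2]

theorem cc_eq_of_pre {X : Type*} [TopologicalSpace X] {O S : Set X} {x y : X} (hS : IsPreconnected S) (hSO : S ⊆ O)
    (h1 : x ∈ S) (h2 : y ∈ S) :
    connectedComponentIn O x = connectedComponentIn O y :=
  connectedComponentIn_eq ((hS.subset_connectedComponentIn h1 hSO) h2)

theorem pre_ext (R : ℝ) (hR : 0 < R) : IsPreconnected {z : ℂ | R < ‖z‖} := by
  have : {z : ℂ | R < ‖z‖} = Complex.exp '' {w : ℂ | Real.log R < w.re} := by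
    ext z
    constructor
    · intro hz
      have hz' : z ≠ 0 := by rintro rfl; simp at hz; linarith
      refine ⟨Complex.log z, ?_, Complex.exp_log hz'⟩
      simp only [mem_ofPred_eq, Complex.log_re]
      exact Real.log_lt_log hR hz
    · rintro ⟨w, hw, rfl⟩
      simp only [mem_ofPred_eq, Complex.norm_exp] at hw ⊢
      rwa [Real.log_lt_iff_lt_exp hR] at hw
  rw [this]
  refine IsPreconnected.image ?_ _ (by fun_prop)
  exact (convex_halfSpace_re_gt (Real.log R)).isPreconnected

theorem exists_ext {K : Set ℂ} (hK : Bornology.IsBounded K) : ∃ R : ℝ, 0 < R ∧ {z : ℂ | R < ‖z‖} ⊆ Kᶜ := by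
  obtain ⟨R, hR, h⟩ := hK.exists_pos_norm_le
  exact ⟨R, hR, fun z hz hzK => absurd (h z hzK) (not_le.2 hz)⟩

theorem not_bdd_ext (R : ℝ) : ¬ Bornology.IsBounded {z : ℂ | R < ‖z‖} := by
  intro h
  obtain ⟨C, hC, h⟩ := h.exists_pos_norm_le
  have := h ((|R| + C + 1 : ℝ) : ℂ) (by
    simp only [mem_ofPred_eq, Complex.norm_real, Real.norm_eq_abs]
    have h1 := le_abs_self R
    have h2 := le_abs_self (|R| + C + 1)
    linarith)
  simp only [Complex.norm_real, Real.norm_eq_abs] at this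
  have h2 := le_abs_self (|R| + C + 1)
  have := abs_nonneg R
  linarith

/-- there is a point whose component is the unique unbounded one -/
theorem exists_outer {K : Set ℂ} (hK : Bornology.IsBounded K) :
    ∃ o ∈ Kᶜ, (¬ Bornology.IsBounded (connectedComponentIn Kᶜ o)) ∧
      ∀ x, ¬ Bornology.IsBounded (connectedComponentIn Kᶜ x) →
        connectedComponentIn Kᶜ x = connectedComponentIn Kᶜ o := by
  obtain ⟨R, hR, h⟩ := exists_ext hK
  have ho : ((R + 1 : ℝ) : ℂ) ∈ {z : ℂ | R < ‖z‖} := by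
    simp only [mem_ofPred_eq, Complex.norm_real, Real.norm_eq_abs]
    have := le_abs_self (R+1); linarith
  have hsub := (pre_ext R hR).subset_connectedComponentIn ho h
  refine ⟨_, h ho, fun hb => not_bdd_ext R (hb.subset hsub), ?_⟩
  intro x hx
  have : ∃ y ∈ connectedComponentIn Kᶜ x, R < ‖y‖ := by
    by_contra hc
    push Not at hc
    exact hx (isBounded_iff_forall_norm_le.2 ⟨R, hc⟩)
  obtain ⟨y, hy1, hy2⟩ := this
  exact cc_eq_of_mem hy1 (hsub hy2)

theorem tietze {K : Set ℂ} (hK : IsClosed K) {L : ℂ → ℂ} (hL : ContinuousOn L K) :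
    ∃ M : ℂ → ℂ, Continuous M ∧ ∀ z ∈ K, M z = L z := by
  obtain ⟨M, hM⟩ := ContinuousMap.exists_restrict_eq hK ⟨K.domRestrict L, continuousOn_iff_continuous_domRestrict.1 hL⟩
  refine ⟨M, M.continuous, fun z hz => ?_⟩
  exact congrArg (fun F => F ⟨z, hz⟩) hM

theorem F2 {K : Set ℂ} (hK : IsCompact K) {a : ℂ} (ha : a ∉ K)
    (hb : Bornology.IsBounded (connectedComponentIn Kᶜ a)) (f : ℂ → ℂ)
    (hf : ContinuousOn f (closure (connectedComponentIn Kᶜ a)))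
    (h0 : ∀ z ∈ closure (connectedComponentIn Kᶜ a), f z ≠ 0) (n : ℤ)
    (h : HL K (fun z => (z - a) ^ n * f z)) : n = 0 := by
  set U := connectedComponentIn Kᶜ a with hU
  obtain ⟨L, hL, hL'⟩ := h
  obtain ⟨M, hM, hM'⟩ := tietze hK.isClosed hL
  have hUo : IsOpen U := hK.isClosed.isOpen_compl.connectedComponentIn
  have haU : a ∈ U := mem_connectedComponentIn ha
  have hfr := cc_frontier hK.isClosed a
  have hbd : ∀ z ∈ closure U, z ∉ U → Complex.exp (M z) / f z = (z - a)^n := by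
    intro z hz hzU
    have : z ∈ K := hfr (by rw [hUo.frontier_eq]; exact ⟨hz, hzU⟩)
    rw [hM' z this, hL' z this]
    field_simp [h0 z hz]
  let h : ℂ → ℂ := fun z => if z ∈ U then Complex.exp (M z) / f z else (z - a)^n
  have hc1 : ContinuousOn h (closure U) := by
    refine ContinuousOn.congr (f := fun z => Complex.exp (M z) / f z) ?_ ?_
    · exact ContinuousOn.div (by fun_prop) hf h0
    · intro z hz
      by_cases hzU : z ∈ U
      · simp [h, hzU]
      · simp [h, hzU, hbd z hz hzU]
  have hc2 : ContinuousOn h Uᶜ := by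
    refine ContinuousOn.congr (f := fun z => (z - a)^n) ?_ ?_
    · refine ContinuousOn.zpow₀ (by fun_prop) n ?_
      intro z hz
      left
      intro hza
      rw [sub_eq_zero] at hza
      subst hza; exact hz haU
    · intro z hz
      have : z ∉ U := hz
      simp [h, this]
  have hc : Continuous h := by
    rw [← continuousOn_univ]
    have : (univ : Set ℂ) = closure U ∪ Uᶜ := by
      symm; rw [eq_univ_iff_forall]; intro z
      by_cases hz : z ∈ U
      · exact Or.inl (subset_closure hz)
      · exact Or.inr hz
    rw [this]
    exact hc1.union_of_isClosed hc2 isClosed_closure hUo.isClosed_compl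
  obtain ⟨N, hN, hN'⟩ := hl_plane h hc (by
    intro z
    by_cases hz : z ∈ U
    · simp only [h, hz, if_true]
      exact div_ne_zero (Complex.exp_ne_zero _) (h0 z (subset_closure hz))
    · simp only [h, hz, if_false]
      refine zpow_ne_zero _ ?_
      intro hza
      rw [sub_eq_zero] at hza
      subst hza; exact hz haU)
  obtain ⟨R, hR, hRb⟩ := hb.subset_ball_lt 0 a
  apply hl_circle a R hR n
  refine ⟨N, hN.continuousOn, fun z hz => ?_⟩
  rw [hN' z]
  have : z ∉ U := fun hzU => by
    have := hRb hzU
    rw [Metric.mem_ball] at this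
    rw [Metric.mem_sphere] at hz
    linarith
  simp [h, this]

theorem sep_aux {K : Set ℂ} (hK : IsCompact K) {a b : ℂ} (ha : a ∉ K) (hb : b ∉ K)
    (hne : connectedComponentIn Kᶜ a ≠ connectedComponentIn Kᶜ b) : b ∉ closure (connectedComponentIn Kᶜ a) := by
  intro h
  have := cc_closure hK.isClosed.isOpen_compl h hb
  exact hne (connectedComponentIn_eq this)

theorem sep {K : Set ℂ} (hK : IsCompact K) {a b : ℂ} (ha : a ∉ K) (hb : b ∉ K)
    (h : HL K (fun z => (z - a) / (z - b))) :
    connectedComponentIn Kᶜ a = connectedComponentIn Kᶜ b := by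
  by_contra hne
  have key : ∀ a b : ℂ, a ∉ K → b ∉ K → connectedComponentIn Kᶜ a ≠ connectedComponentIn Kᶜ b →
      HL K (fun z => (z - a) / (z - b)) → ¬ Bornology.IsBounded (connectedComponentIn Kᶜ a) := by
    intro a b ha hb hne h hbd
    have hz : ∀ z ∈ closure (connectedComponentIn Kᶜ a), z - b ≠ 0 := by
      intro z hz hzb
      rw [sub_eq_zero] at hzb; subst hzb
      exact sep_aux hK ha hb hne hz
    have := F2 hK ha hbd (fun z => (z - b)⁻¹) (ContinuousOn.inv₀ (by fun_prop) hz)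
      (fun z h => inv_ne_zero (hz z h)) 1 (h.congr (fun z _ => by simp [div_eq_mul_inv]))
    omega
  have h1 := key a b ha hb hne h
  have h2 := key b a hb ha (Ne.symm hne) (h.inv.congr (fun z _ => by simp))
  obtain ⟨o, ho, _, hu⟩ := exists_outer hK.isBounded
  exact hne ((hu a h1).trans (hu b h2).symm)

theorem acyc_conn {K : Set ℂ} (hK : IsCompact K) (hA : Acyc K) : IsPreconnected Kᶜ := by
  apply isPreconnected_of_forall_pair
  intro a ha b hb
  have := sep hK ha hb (hA _ (by
    refine ContinuousOn.div (by fun_prop) (by fun_prop) ?_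
    intro z hz hzb
    rw [sub_eq_zero] at hzb; subst hzb; exact hb hz) (by
    intro z hz
    refine div_ne_zero ?_ ?_ <;> intro hzb <;> rw [sub_eq_zero] at hzb <;> subst hzb
    · exact ha hz
    · exact hb hz))
  refine ⟨connectedComponentIn Kᶜ a, connectedComponentIn_subset _ _, mem_connectedComponentIn ha, ?_,
    isPreconnected_connectedComponentIn⟩
  rw [this]; exact mem_connectedComponentIn hb

theorem joined_of_cc {K : Set ℂ} (hK : IsClosed K) {a b : ℂ} (ha : a ∉ K)
    (h : b ∈ connectedComponentIn Kᶜ a) : JoinedIn Kᶜ a b := by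
  have ho : IsOpen (connectedComponentIn Kᶜ a) := hK.isOpen_compl.connectedComponentIn
  have hc : IsConnected (connectedComponentIn Kᶜ a) := isConnected_connectedComponentIn_iff.2 ha
  have := ho.isConnected_iff_isPathConnected.1 hc
  exact (this.joinedIn a (mem_connectedComponentIn ha) b h).mono (connectedComponentIn_subset _ _)

end TopP


namespace TopP
open scoped Classical
set_option linter.unusedSectionVars false
set_option linter.unusedSimpArgs false
set_option linter.unusedVariables false
set_option autoImplicit false

theorem pre_pball (a : ℂ) (r : ℝ) (hr : 0 < r) : IsPreconnected (Metric.ball a r \ {a}) := by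
  have : Metric.ball a r \ {a} = (fun w => a + Complex.exp w) '' {w : ℂ | w.re < Real.log r} := by
    ext z
    constructor
    · rintro ⟨hz, hz'⟩
      have hz' : z - a ≠ 0 := by rw [sub_ne_zero]; exact hz'
      refine ⟨Complex.log (z - a), ?_, by simp [Complex.exp_log hz']⟩
      simp only [mem_ofPred_eq, Complex.log_re]
      refine Real.log_lt_log (norm_pos_iff.2 hz') ?_
      rwa [Metric.mem_ball, dist_eq_norm] at hz
    · rintro ⟨w, hw, rfl⟩
      simp only [mem_ofPred_eq] at hw
      refine ⟨?_, ?_⟩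
      · simp only [Metric.mem_ball, dist_self_add_left, Complex.norm_exp]
        rwa [Real.lt_log_iff_exp_lt hr] at hw
      · simp [Complex.exp_ne_zero]
  rw [this]
  refine IsPreconnected.image ?_ _ (by fun_prop)
  exact (convex_halfSpace_re_lt (Real.log r)).isPreconnected

theorem ne_of_notMem {K : Set ℂ} {z a : ℂ} (hz : z ∈ K) (ha : a ∉ K) : z - a ≠ 0 := by
  intro h; rw [sub_eq_zero] at h; subst h; exact ha hz

theorem F2' {K : Set ℂ} (hK : IsCompact K) {a b c : ℂ} (ha : a ∉ K) (hb : b ∉ K) (hc : c ∉ K)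
    (hab : connectedComponentIn Kᶜ a ≠ connectedComponentIn Kᶜ b)
    (hac : connectedComponentIn Kᶜ a ≠ connectedComponentIn Kᶜ c)
    (hbd : Bornology.IsBounded (connectedComponentIn Kᶜ a)) (i j k : ℤ)
    (h : HL K (fun z => (z - a) ^ i * ((z - b) ^ j * (z - c) ^ k))) : i = 0 := by
  have h1 : ∀ z ∈ closure (connectedComponentIn Kᶜ a), z - b ≠ 0 := fun z hz =>
    ne_of_notMem hz (sep_aux hK ha hb hab)
  have h2 : ∀ z ∈ closure (connectedComponentIn Kᶜ a), z - c ≠ 0 := fun z hz =>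
    ne_of_notMem hz (sep_aux hK ha hc hac)
  refine F2 hK ha hbd (fun z => (z - b) ^ j * (z - c) ^ k) ?_ ?_ i h
  · refine ContinuousOn.mul (ContinuousOn.zpow₀ (by fun_prop) _ (fun z hz => Or.inl (h1 z hz)))
      (ContinuousOn.zpow₀ (by fun_prop) _ (fun z hz => Or.inl (h2 z hz)))
  · intro z hz
    exact mul_ne_zero (zpow_ne_zero _ (h1 z hz)) (zpow_ne_zero _ (h2 z hz))

/-- auxiliary data: logs of a function on `K'` and on the arc, agreeing at one end and differing
by `n · 2πi` at the other end -/
theorem log_pair {K' : Set ℂ} (g : C(unitInterval, ℂ)) (hg : Function.Injective g)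
    (h0 : g 0 ∈ K') (h1 : g 1 ∈ K') (f : ℂ → ℂ) (hf : ContinuousOn f (range g))
    (hf0 : ∀ z ∈ range g, f z ≠ 0) (hL : HL K' f) :
    ∃ (L M : ℂ → ℂ) (n : ℤ), ContinuousOn L K' ∧ ContinuousOn M (range g) ∧
      (∀ z ∈ K', Complex.exp (L z) = f z) ∧ (∀ z ∈ range g, Complex.exp (M z) = f z) ∧
      L (g 0) = M (g 0) ∧ L (g 1) = M (g 1) + n * (2 * Real.pi * Complex.I) := by
  obtain ⟨L, hL1, hL2⟩ := hL
  obtain ⟨M, hM1, hM2⟩ := acyc_arc g hg f hf hf0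
  have hM3 : ∀ z ∈ range g, Complex.exp (M z + (L (g 0) - M (g 0))) = f z := by
    intro z hz
    rw [Complex.exp_add, hM2 z hz, Complex.exp_sub, hL2 _ h0, hM2 _ (mem_range_self _),
      div_self (hf0 _ (mem_range_self _)), mul_one]
  have : Complex.exp (L (g 1)) = Complex.exp (M (g 1) + (L (g 0) - M (g 0))) := by
    rw [hM3 _ (mem_range_self _), hL2 _ h1]
  obtain ⟨n, hn⟩ := Complex.exp_eq_exp_iff_exists_int.1 this
  exact ⟨L, fun z => M z + (L (g 0) - M (g 0)), n, hL1, hM1.add continuousOn_const, hL2, hM3,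
    by ring, hn⟩

theorem cont_quot {K : Set ℂ} {a b : ℂ} (hb : b ∉ K) :
    ContinuousOn (fun z => (z - a) / (z - b)) K :=
  ContinuousOn.div (by fun_prop) (by fun_prop) (fun z hz => ne_of_notMem hz hb)

theorem E1 {K' : Set ℂ} (hK' : IsCompact K') (g : C(unitInterval, ℂ)) (hg : Function.Injective g)
    (hd : ∀ t, g t ∈ K' → t = 0 ∨ t = 1) (h0 : g 0 ∈ K') (h1 : g 1 ∈ K') (a b c : ℂ)
    (ha : a ∉ K' ∪ range g) (hb : b ∉ K' ∪ range g) (hc : c ∉ K' ∪ range g)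
    (hba : JoinedIn K'ᶜ b a) (hca : JoinedIn K'ᶜ c a) :
    connectedComponentIn (K' ∪ range g)ᶜ a = connectedComponentIn (K' ∪ range g)ᶜ b ∨
    connectedComponentIn (K' ∪ range g)ᶜ a = connectedComponentIn (K' ∪ range g)ᶜ c ∨
    connectedComponentIn (K' ∪ range g)ᶜ b = connectedComponentIn (K' ∪ range g)ᶜ c := by
  by_contra hcon
  push Not at hcon
  obtain ⟨hab, hac, hbc⟩ := hcon
  have hgc : IsCompact (range g) := isCompact_range g.continuous
  have hK : IsCompact (K' ∪ range g) := hK'.union hgc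
  have ha' : a ∉ range g := fun h => ha (Or.inr h)
  have hb' : b ∉ range g := fun h => hb (Or.inr h)
  have hc' : c ∉ range g := fun h => hc (Or.inr h)
  obtain ⟨L1, M1, n1, hL1, hM1, hL1', hM1', e10, e11⟩ := log_pair g hg h0 h1
    (fun z => (z - a) / (z - b)) (cont_quot hb')
    (fun z hz => div_ne_zero (ne_of_notMem hz ha') (ne_of_notMem hz hb')) (hl_move K' b a hba)
  obtain ⟨L2, M2, n2, hL2, hM2, hL2', hM2', e20, e21⟩ := log_pair g hg h0 h1
    (fun z => (z - a) / (z - c)) (cont_quot hc')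
    (fun z hz => div_ne_zero (ne_of_notMem hz ha') (ne_of_notMem hz hc')) (hl_move K' c a hca)
  have hend : ∀ z ∈ K', z ∈ range g → z = g 0 ∨ z = g 1 := by
    rintro z hz ⟨t, rfl⟩
    rcases hd t hz with rfl | rfl <;> simp
  have hglue : HL (K' ∪ range g) (fun z => ((z - a) / (z - b)) ^ n2 * ((z - a) / (z - c)) ^ (-n1)) := by
    refine hl_glue hK'.isClosed hgc.isClosed
      (L := fun z => n2 * L1 z + ((-n1 : ℤ) : ℂ) * L2 z) (M := fun z => n2 * M1 z + ((-n1 : ℤ) : ℂ) * M2 z)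
      ((continuousOn_const.mul hL1).add (continuousOn_const.mul hL2))
      ((continuousOn_const.mul hM1).add (continuousOn_const.mul hM2)) ?_ ?_ ?_
    · intro z hz
      rw [Complex.exp_add, Complex.exp_int_mul, Complex.exp_int_mul, hL1' z hz, hL2' z hz]
    · intro z hz
      rw [Complex.exp_add, Complex.exp_int_mul, Complex.exp_int_mul, hM1' z hz, hM2' z hz]
    · intro z hz hz'
      rcases hend z hz hz' with rfl | rfl
      · simp only [e10, e20]
      · simp only [e11, e21]; push_cast; ring
  have hA : ∀ z ∈ K' ∪ range g, z - a ≠ 0 := fun z hz => ne_of_notMem hz ha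
  have hB : ∀ z ∈ K' ∪ range g, z - b ≠ 0 := fun z hz => ne_of_notMem hz hb
  have hC : ∀ z ∈ K' ∪ range g, z - c ≠ 0 := fun z hz => ne_of_notMem hz hc
  have q1 : Bornology.IsBounded (connectedComponentIn (K' ∪ range g)ᶜ a) → n2 - n1 = 0 := by
    intro hbd
    refine F2' hK ha hb hc hab hac hbd (n2 - n1) (-n2) n1 (hglue.congr ?_)
    intro z hz
    have h1 := hA z hz; have h2 := hB z hz; have h3 := hC z hz
    rw [div_zpow, div_zpow, zpow_sub₀ h1, zpow_neg, zpow_neg, zpow_neg]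
    field_simp
  have q2 : Bornology.IsBounded (connectedComponentIn (K' ∪ range g)ᶜ b) → -n2 = 0 := by
    intro hbd
    refine F2' hK hb ha hc hab.symm hbc hbd (-n2) (n2 - n1) n1 (hglue.congr ?_)
    intro z hz
    have h1 := hA z hz; have h2 := hB z hz; have h3 := hC z hz
    rw [div_zpow, div_zpow, zpow_sub₀ h1, zpow_neg, zpow_neg, zpow_neg]
    field_simp
  have q3 : Bornology.IsBounded (connectedComponentIn (K' ∪ range g)ᶜ c) → n1 = 0 := by
    intro hbd
    refine F2' hK hc ha hb hac.symm hbc.symm hbd (n1) (n2 - n1) (-n2) (hglue.congr ?_)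
    intro z hz
    have h1 := hA z hz; have h2 := hB z hz; have h3 := hC z hz
    rw [div_zpow, div_zpow, zpow_sub₀ h1, zpow_neg, zpow_neg, zpow_neg]
    field_simp
  obtain ⟨o, ho, _, hu⟩ := exists_outer hK.isBounded
  have hn1 : n1 = 0 := by
    by_cases u3 : Bornology.IsBounded (connectedComponentIn (K' ∪ range g)ᶜ c)
    · exact q3 u3
    · have u1 : Bornology.IsBounded (connectedComponentIn (K' ∪ range g)ᶜ a) := by
        by_contra u; exact hac ((hu _ u).trans (hu _ u3).symm)
      have u2 : Bornology.IsBounded (connectedComponentIn (K' ∪ range g)ᶜ b) := by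
        by_contra u; exact hbc ((hu _ u).trans (hu _ u3).symm)
      have := q1 u1; have := q2 u2; omega
  apply hab
  refine sep hK ha hb (hl_glue hK'.isClosed hgc.isClosed hL1 hM1 hL1' hM1' ?_)
  intro z hz hz'
  rcases hend z hz hz' with rfl | rfl
  · exact e10
  · rw [e11, hn1]; simp

/-- the open arc -/
def oarc (g : C(unitInterval, ℂ)) : Set ℂ := g '' Ioo 0 1

theorem oarc_pre (g : C(unitInterval, ℂ)) : IsPreconnected (oarc g) :=
  isPreconnected_Ioo.image _ g.continuous.continuousOn

theorem oarc_ne (g : C(unitInterval, ℂ)) : (oarc g).Nonempty := by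
  refine ⟨g ⟨1/2, by norm_num, by norm_num⟩, _, ⟨?_, ?_⟩, rfl⟩ <;>
    (rw [← Subtype.coe_lt_coe]; norm_num)

theorem oarc_sub (g : C(unitInterval, ℂ)) : oarc g ⊆ range g := image_subset_range _ _

theorem oarc_cases (g : C(unitInterval, ℂ)) {z : ℂ} (hz : z ∈ range g) : z ∈ oarc g ∨ z = g 0 ∨ z = g 1 := by
  obtain ⟨t, rfl⟩ := hz
  by_cases h0 : t = 0
  · subst h0; simp
  by_cases h1 : t = 1
  · subst h1; simp
  · left
    exact ⟨t, ⟨lt_of_le_of_ne t.2.1 (fun h => h0 h.symm), lt_of_le_of_ne t.2.2 (fun h => h1 h)⟩, rfl⟩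

theorem touch_cc {K' : Set ℂ} (hK' : IsCompact K') (g : C(unitInterval, ℂ))
    (hd : ∀ t, g t ∈ K' → t = 0 ∨ t = 1) {a : ℂ}
    (ht : (closure (connectedComponentIn (K' ∪ range g)ᶜ a) ∩ oarc g).Nonempty) :
    oarc g ⊆ connectedComponentIn K'ᶜ a := by
  obtain ⟨y, hy1, hy2⟩ := ht
  have hsub : oarc g ⊆ K'ᶜ := by
    rintro _ ⟨t, ⟨ht0, ht1⟩, rfl⟩ h
    rcases hd t h with rfl | rfl
    · exact lt_irrefl _ ht0
    · exact lt_irrefl _ ht1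
  have h1 : y ∈ connectedComponentIn K'ᶜ a := by
    refine cc_closure hK'.isClosed.isOpen_compl (closure_mono (connectedComponentIn_mono _ ?_) hy1) (hsub hy2)
    exact compl_subset_compl.2 subset_union_left
  rw [connectedComponentIn_eq h1]
  exact (oarc_pre g).subset_connectedComponentIn hy2 hsub

theorem lemmaE {K' : Set ℂ} (hK' : IsCompact K') (g : C(unitInterval, ℂ)) (hg : Function.Injective g)
    (hd : ∀ t, g t ∈ K' → t = 0 ∨ t = 1) (h0 : g 0 ∈ K') (h1 : g 1 ∈ K') (a b c : ℂ)
    (ha : a ∉ K' ∪ range g) (hb : b ∉ K' ∪ range g) (hc : c ∉ K' ∪ range g)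
    (ta : (closure (connectedComponentIn (K' ∪ range g)ᶜ a) ∩ oarc g).Nonempty)
    (tb : (closure (connectedComponentIn (K' ∪ range g)ᶜ b) ∩ oarc g).Nonempty)
    (tc : (closure (connectedComponentIn (K' ∪ range g)ᶜ c) ∩ oarc g).Nonempty) :
    connectedComponentIn (K' ∪ range g)ᶜ a = connectedComponentIn (K' ∪ range g)ᶜ b ∨
    connectedComponentIn (K' ∪ range g)ᶜ a = connectedComponentIn (K' ∪ range g)ᶜ c ∨
    connectedComponentIn (K' ∪ range g)ᶜ b = connectedComponentIn (K' ∪ range g)ᶜ c := by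
  obtain ⟨y, hy⟩ := oarc_ne g
  have sa := touch_cc hK' g hd ta hy
  have sb := touch_cc hK' g hd tb hy
  have sc := touch_cc hK' g hd tc hy
  have haK : a ∈ K'ᶜ := fun h => ha (Or.inl h)
  have hbK : b ∈ K'ᶜ := fun h => hb (Or.inl h)
  have hcK : c ∈ K'ᶜ := fun h => hc (Or.inl h)
  refine E1 hK' g hg hd h0 h1 a b c ha hb hc (joined_of_cc hK'.isClosed hbK ?_) (joined_of_cc hK'.isClosed hcK ?_)
  · rw [cc_eq_of_mem sb sa]; exact mem_connectedComponentIn haK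
  · rw [cc_eq_of_mem sc sa]; exact mem_connectedComponentIn haK

theorem arc_interior (g : C(unitInterval, ℂ)) (hg : Function.Injective g) : interior (range g) = ∅ := by
  by_contra hne
  obtain ⟨x, hx⟩ := nonempty_iff_ne_empty.2 hne
  have hO : IsOpen (g ⁻¹' interior (range g)) := isOpen_interior.preimage g.continuous
  have hne' : (g ⁻¹' interior (range g)).Nonempty := by
    obtain ⟨t, rfl⟩ := interior_subset hx
    exact ⟨t, hx⟩
  have hdense : Dense (Ioo (0 : unitInterval) 1) := by
    rw [dense_iff_closure_eq, closure_Ioo (by simp : (0:unitInterval) ≠ 1)]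
    ext t; simp [t.2.1, unitInterval.le_one']
  obtain ⟨s, hs1, hs2⟩ := hdense.inter_open_nonempty _ hO hne'
  obtain ⟨r, hr, hball⟩ := Metric.isOpen_iff.1 isOpen_interior _ hs1
  have hball := hball.trans interior_subset
  have hpre : IsPreconnected (g ⁻¹' (Metric.ball (g s) r \ {g s})) :=
    (pre_pball _ r hr).preimage_of_isClosedMap hg (g.continuous.isClosedMap) (sdiff_subset.trans hball)
  have hnb : g ⁻¹' Metric.ball (g s) r ∈ 𝓝 s :=
    (Metric.isOpen_ball.preimage g.continuous).mem_nhds (Metric.mem_ball_self hr)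
  obtain ⟨u, hu, hu'⟩ := exists_Ioc_subset_of_mem_nhds hnb ⟨0, hs2.1⟩
  obtain ⟨v, hv, hv'⟩ := exists_Ico_subset_of_mem_nhds hnb ⟨1, hs2.2⟩
  obtain ⟨u1, hu1, hu2⟩ := exists_between hu
  obtain ⟨v1, hv1, hv2⟩ := exists_between hv
  have m1 : u1 ∈ g ⁻¹' (Metric.ball (g s) r \ {g s}) :=
    ⟨hu' ⟨hu1, hu2.le⟩, fun h => hu2.ne (hg h)⟩
  have m2 : v1 ∈ g ⁻¹' (Metric.ball (g s) r \ {g s}) :=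
    ⟨hv' ⟨hv1.le, hv2⟩, fun h => hv1.ne (hg h).symm⟩
  have := hpre.ordConnected.out m1 m2 ⟨hu2.le, hv1.le⟩
  exact this.2 rfl

theorem jordan_disc {B : Set ℂ} (hB : IsCompact B) (g : C(unitInterval, ℂ)) (hg : Function.Injective g)
    (hd : ∀ t, g t ∈ B → t = 0 ∨ t = 1) (hj : JoinedIn B (g 0) (g 1)) :
    ¬ IsPreconnected (B ∪ range g)ᶜ := by
  intro hpre
  have hgc : IsCompact (range g) := isCompact_range g.continuous
  set p := g 0 with hp
  set q := g 1 with hq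
  have hpq : p ≠ q := fun h => by
    have := hg h; simp at this
  have hj' : JoinedIn (range g)ᶜᶜ p q := by
    rw [compl_compl]
    exact ⟨⟨g, rfl, rfl⟩, fun t => mem_range_self t⟩
  obtain ⟨L, hL, hL'⟩ := hl_move (range g)ᶜ p q hj'
  obtain ⟨M, hM, hM'⟩ := hl_move Bᶜ p q (by rwa [compl_compl])
  obtain ⟨o, ho, -, -⟩ := exists_outer (hB.union hgc).isBounded
  have hu := log_unique hpre (hL.mono (compl_subset_compl.2 subset_union_right))
    (hM.mono (compl_subset_compl.2 subset_union_left)) (by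
      intro z hz
      rw [hL' z (fun h => hz (Or.inr h)), hM' z (fun h => hz (Or.inl h))]) ho
  have hoL : o ∈ (range g)ᶜ := fun h => ho (Or.inr h)
  have hoM : o ∈ Bᶜ := fun h => ho (Or.inl h)
  have H : HL ((range g)ᶜ ∪ Bᶜ) (fun z => (z - q) / (z - p)) := by
    refine hl_glue_open hgc.isClosed.isOpen_compl hB.isClosed.isOpen_compl hL
      (M := fun z => M z + (L o - M o)) (hM.add continuousOn_const) hL' ?_ ?_
    · intro z hz
      rw [Complex.exp_add, hM' z hz, Complex.exp_sub, hL' o hoL, hM' o hoM, div_self, mul_one]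
      refine div_ne_zero (ne_of_notMem hoL ?_) (ne_of_notMem hoL ?_) <;> simp [hp, hq]
    · intro z hz hz'
      have := hu z (by rw [mem_compl_iff, mem_union]; tauto)
      linear_combination this
  have hqp : q - p ≠ 0 := sub_ne_zero.2 hpq.symm
  have hr : 0 < ‖q - p‖ / 2 := by have := norm_pos_iff.2 hqp; linarith
  have hs : Metric.sphere q (‖q - p‖ / 2) ⊆ (range g)ᶜ ∪ Bᶜ := by
    intro z hz
    by_contra hcon
    simp only [mem_union, mem_compl_iff, not_or, not_not] at hcon
    rw [Metric.mem_sphere, dist_eq_norm] at hz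
    obtain ⟨⟨t, rfl⟩, hzB⟩ := hcon
    rcases hd t hzB with rfl | rfl
    · rw [← hp, norm_sub_rev] at hz; linarith
    · rw [← hq, sub_self, norm_zero] at hz; linarith
  have H2 : HL (Metric.sphere q (‖q - p‖ / 2)) (fun z => z - p) := by
    have hsl : ∀ z ∈ Metric.sphere q (‖q - p‖ / 2), 1 + (z - q) / (q - p) ∈ Complex.slitPlane := by
      intro z hz
      apply Complex.mem_slitPlane_of_norm_lt_one
      rw [Metric.mem_sphere, dist_eq_norm] at hz
      rw [norm_div, hz]
      have := norm_pos_iff.2 hqp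
      field_simp; norm_num
    refine ⟨fun z => Complex.log (1 + (z - q) / (q - p)) + Complex.log (q - p), ?_, ?_⟩
    · refine ContinuousOn.add (ContinuousOn.clog (by fun_prop) hsl) continuousOn_const
    · intro z hz
      rw [Complex.exp_add, Complex.exp_log (Complex.slitPlane_ne_zero (hsl z hz)), Complex.exp_log hqp]
      field_simp; ring
  have := hl_circle q _ hr 1 (((H.mono hs).mul H2).congr (by
    intro z hz
    have : z - p ≠ 0 := by
      intro h; rw [sub_eq_zero] at h; subst h
      rw [Metric.mem_sphere, dist_eq_norm, norm_sub_rev] at hz; linarith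
    simp; field_simp))
  omega

theorem jordan {B : Set ℂ} (hB : IsCompact B) (hA : Acyc B) (g : C(unitInterval, ℂ)) (hg : Function.Injective g)
    (hd : ∀ t, g t ∈ B → t = 0 ∨ t = 1) (hj : JoinedIn B (g 0) (g 1)) :
    (∀ c ∉ B ∪ range g, (closure (connectedComponentIn (B ∪ range g)ᶜ c) ∩ oarc g).Nonempty) ∧
    ∃ a b, a ∉ B ∪ range g ∧ b ∉ B ∪ range g ∧
      Bornology.IsBounded (connectedComponentIn (B ∪ range g)ᶜ a) ∧
      ¬ Bornology.IsBounded (connectedComponentIn (B ∪ range g)ᶜ b) ∧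
      ∀ c ∉ B ∪ range g, connectedComponentIn (B ∪ range g)ᶜ c = connectedComponentIn (B ∪ range g)ᶜ a ∨
        connectedComponentIn (B ∪ range g)ᶜ c = connectedComponentIn (B ∪ range g)ᶜ b := by
  have hgc : IsCompact (range g) := isCompact_range g.continuous
  have hK := hB.union hgc
  have hT : ∀ c ∉ B ∪ range g, (closure (connectedComponentIn (B ∪ range g)ᶜ c) ∩ oarc g).Nonempty := by
    intro c hc
    by_contra hne
    rw [not_nonempty_iff_eq_empty] at hne
    set U := connectedComponentIn (B ∪ range g)ᶜ c with hU
    have hUo : IsOpen U := hK.isClosed.isOpen_compl.connectedComponentIn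
    have hpre := acyc_conn hB hA
    have hcU : c ∈ U := mem_connectedComponentIn hc
    have hcl : ∀ z ∈ Bᶜ, z ∈ closure U → z ∈ U := by
      intro z hz hzU
      by_contra hzn
      have : z ∈ B ∪ range g := cc_frontier hK.isClosed c (by rw [← hU, hUo.frontier_eq]; exact ⟨hzU, hzn⟩)
      rcases this with h | h
      · exact hz h
      · rcases oarc_cases g h with h | h | h
        · exact (hne ▸ (⟨hzU, h⟩ : z ∈ closure U ∩ oarc g) : z ∈ (∅ : Set ℂ))
        · exact hz (h ▸ hj.source_mem)
        · exact hz (h ▸ hj.target_mem)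
    obtain ⟨y, hy⟩ := oarc_ne g
    have hyB : y ∈ Bᶜ := by
      obtain ⟨t, ⟨h0, h1⟩, rfl⟩ := hy
      intro h
      rcases hd t h with rfl | rfl
      · exact lt_irrefl _ h0
      · exact lt_irrefl _ h1
    have hyU : y ∉ closure U := fun h => (hne ▸ (⟨h, hy⟩ : y ∈ closure U ∩ oarc g) : y ∈ (∅ : Set ℂ))
    obtain ⟨z, hz1, hz2, hz3⟩ := hpre U (closure U)ᶜ hUo isClosed_closure.isOpen_compl (by
      intro z hz
      by_cases h : z ∈ closure U
      · exact Or.inl (hcl z hz h)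
      · exact Or.inr h) ⟨c, fun h => hc (Or.inl h), hcU⟩ ⟨y, hyB, hyU⟩
    exact hz3 (subset_closure hz2)
  refine ⟨hT, ?_⟩
  obtain ⟨o, ho, hob, hu⟩ := exists_outer hK.isBounded
  have : ∃ a ∉ B ∪ range g, connectedComponentIn (B ∪ range g)ᶜ a ≠ connectedComponentIn (B ∪ range g)ᶜ o := by
    by_contra hcon
    push Not at hcon
    apply jordan_disc hB g hg hd hj
    have : (B ∪ range g)ᶜ = connectedComponentIn (B ∪ range g)ᶜ o := by
      apply Subset.antisymm
      · intro z hz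
        rw [← hcon z hz]; exact mem_connectedComponentIn hz
      · exact connectedComponentIn_subset _ _
    rw [this]; exact isPreconnected_connectedComponentIn
  obtain ⟨a, ha, hao⟩ := this
  refine ⟨a, o, ha, ho, ?_, hob, ?_⟩
  · by_contra h; exact hao (hu a h)
  · intro c hc
    have := lemmaE hB g hg hd hj.source_mem hj.target_mem c a o hc ha ho (hT c hc) (hT a ha) (hT o ho)
    tauto

end TopP


namespace PDG
open scoped Classical
set_option linter.unusedSectionVars false
set_option linter.unusedSimpArgs false
set_option linter.unusedVariables false
set_option autoImplicit false
open TopP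

variable {V : Type} [Fintype V]

def bd (z : Sym2 V → ZMod 2) (x : V) : ZMod 2 := ∑ w, z s(x, w)

def inde (e : Sym2 V) : Sym2 V → ZMod 2 := fun f => if f = e then 1 else 0

lemma bd_add (z z' : Sym2 V → ZMod 2) (x : V) : bd (z + z') x = bd z x + bd z' x := by
  simp [bd, Finset.sum_add_distrib]

lemma bd_inde {a b : V} (h : a ≠ b) (x : V) :
    bd (inde s(a, b)) x = (if x = a then 1 else 0) + (if x = b then 1 else 0) := by
  unfold bd inde
  by_cases ha : x = a
  · subst ha
    rw [Finset.sum_eq_single b]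
    · simp [h]
    · intro w _ hw
      simp only [Sym2.eq_iff, ite_eq_right_iff]
      rintro (⟨_, h'⟩ | ⟨h', _⟩)
      · exact absurd h' hw
      · exact absurd h' h
    · simp
  · by_cases hb : x = b
    · subst hb
      rw [Finset.sum_eq_single a]
      · simp [h, ha, Sym2.eq_swap]
      · intro w _ hw
        simp only [Sym2.eq_iff, ite_eq_right_iff]
        rintro (⟨h', _⟩ | ⟨_, h'⟩)
        · exact absurd h' ha
        · exact absurd h' hw
      · simp
    · simp [ha, hb]

def Rch (T : Set (Sym2 V)) : V → V → Prop := Relation.ReflTransGen (fun a b => s(a, b) ∈ T)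

lemma Rch.chain {Γ : SimpleGraph V} {T : Set (Sym2 V)} (hT : T ⊆ Γ.edgeSet) {u x : V} (h : Rch T u x) :
    ∃ y : Sym2 V → ZMod 2, (∀ e ∉ T, y e = 0) ∧
      ∀ w, bd y w = (if w = u then 1 else 0) + (if w = x then 1 else 0) := by
  induction h with
  | refl =>
    refine ⟨0, fun _ _ => rfl, fun w => ?_⟩
    have : ∀ a : ZMod 2, a + a = 0 := by decide
    simp [bd, this]
  | @tail b c hb hbc ih =>
    obtain ⟨y, hy1, hy2⟩ := ih
    have hne : b ≠ c := Γ.ne_of_adj (hT hbc)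
    refine ⟨y + inde s(b, c), fun e he => ?_, fun w => ?_⟩
    · have : e ≠ s(b, c) := fun h => he (h ▸ hbc)
      simp [hy1 e he, inde, this]
    · rw [bd_add, hy2, bd_inde hne]
      have : ∀ a b c : ZMod 2, a + b + (b + c) = a + c := by decide
      rw [this]

/-- forests -/
def Fr (Γ : SimpleGraph V) (T : Set (Sym2 V)) : Prop :=
  ∀ z, IsCyc Γ z → (∀ e ∉ T, z e = 0) → z = 0

lemma Fr.mono {Γ : SimpleGraph V} {T T' : Set (Sym2 V)} (h : Fr Γ T) (hs : T' ⊆ T) : Fr Γ T' :=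
  fun z hz h' => h z hz (fun e he => h' e (fun h => he (hs h)))

lemma Fr.bridge {Γ : SimpleGraph V} {T : Set (Sym2 V)} (hT : T ⊆ Γ.edgeSet) (h : Fr Γ T) {u v : V}
    (he : s(u, v) ∈ T) : ¬ Rch (T \ {s(u, v)}) u v := by
  intro hr
  obtain ⟨y, hy1, hy2⟩ := hr.chain (sdiff_subset.trans hT)
  have hne : u ≠ v := Γ.ne_of_adj (hT he)
  have hz : y + inde s(u, v) = 0 := by
    apply h
    · refine ⟨fun e he' => ?_, fun x => ?_⟩
      · have h1 : e ≠ s(u, v) := fun h => he' (h ▸ hT he)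
        have h2 : e ∉ T \ {s(u, v)} := fun h => he' (hT h.1)
        simp [inde, h1, hy1 e h2]
      · change bd (y + inde s(u, v)) x = 0
        rw [bd_add, hy2, bd_inde hne]
        have : ∀ a : ZMod 2, a + a = 0 := by decide
        rw [this]
    · intro e he'
      have h1 : e ≠ s(u, v) := fun h => he' (h ▸ he)
      have h2 : e ∉ T \ {s(u, v)} := fun h => he' (h.1)
      simp [inde, h1, hy1 e h2]
  have := congrFun hz s(u, v)
  simp [inde, hy1 s(u, v) (fun h => h.2 rfl)] at this

/-- circuits: minimal nonzero elements of the cycle space -/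
structure Circ (Γ : SimpleGraph V) (z : Sym2 V → ZMod 2) : Prop where
  cyc : IsCyc Γ z
  ne : z ≠ 0
  min : ∀ z', IsCyc Γ z' → (∀ e, z e = 0 → z' e = 0) → z' = 0 ∨ z' = z

def sp (z : Sym2 V → ZMod 2) : Set (Sym2 V) := {e | z e ≠ 0}

lemma IsCyc.sp_sub {Γ : SimpleGraph V} {z : Sym2 V → ZMod 2} (h : IsCyc Γ z) : sp z ⊆ Γ.edgeSet := by
  intro e he
  by_contra h'
  exact he (h.1 e h')

lemma Circ.fr {Γ : SimpleGraph V} {z : Sym2 V → ZMod 2} (h : Circ Γ z) {e : Sym2 V} (he : e ∈ sp z) :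
    Fr Γ (sp z \ {e}) := by
  intro z' hz' hs
  rcases h.min z' hz' (fun f hf => hs f (fun h => h.1 hf)) with h' | h'
  · exact h'
  · subst h'
    exact absurd (hs e (fun h => h.2 rfl)) he

lemma IsCyc.rch {Γ : SimpleGraph V} {z : Sym2 V → ZMod 2} (h : IsCyc Γ z) {u v : V} (he : s(u, v) ∈ sp z) :
    Rch (sp z \ {s(u, v)}) u v := by
  by_contra hr
  let R : V → Prop := Rch (sp z \ {s(u, v)}) u
  have hRu : R u := Relation.ReflTransGen.refl
  have hRv : ¬ R v := hr
  have hloop : ∀ x, z s(x, x) = 0 := fun x => by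
    apply h.1; intro hx; exact Γ.loopless.irrefl x hx
  have h1 : ∑ x, ∑ w, (fun e : Sym2 V => if ∀ a ∈ e, R a then z e else 0) s(x, w) = 0 :=
    sum_sym (z := fun e : Sym2 V => if ∀ a ∈ e, R a then z e else 0) (fun x => by simp [hloop])
  have h2 : ∑ x, ∑ w, (if R x then z s(x, w) else 0) = 0 := by
    apply Finset.sum_eq_zero
    intro x _
    by_cases hx : R x
    · simp only [hx, if_true]; exact h.2 x
    · simp [hx]
  have h3 : ∀ x w, (if R x then z s(x, w) else 0) =
      (fun e : Sym2 V => if ∀ a ∈ e, R a then z e else 0) s(x, w) + if x = u ∧ w = v then 1 else 0 := by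
    intro x w
    simp only [Sym2.mem_iff, forall_eq_or_imp, forall_eq]
    by_cases hx : R x
    · by_cases hw : R w
      · have : w ≠ v := fun h => hRv (h ▸ hw)
        simp [hx, hw, this]
      · simp only [hx, hw, if_true, and_false, if_false, zero_add]
        by_cases hxw : x = u ∧ w = v
        · obtain ⟨rfl, rfl⟩ := hxw
          simp only [and_self, if_true]
          exact (z2_cases _).resolve_left he
        · simp only [hxw, if_false]
          by_contra hz
          apply hw
          refine Relation.ReflTransGen.tail hx ⟨hz, ?_⟩
          simp only [mem_singleton_iff, Sym2.eq_iff]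
          rintro (h | ⟨h1, h2⟩)
          · exact hxw h
          · exact hRv (h1 ▸ hx)
    · have : x ≠ u := fun h => hx (h ▸ hRu)
      simp [hx, this]
  simp only [h3, Finset.sum_add_distrib] at h2
  rw [h1] at h2
  rw [Finset.sum_eq_single u] at h2
  · rw [Finset.sum_eq_single v] at h2 <;> simp at h2 ⊢
    
  · intro b _ hb; simp [hb]
  · simp

/-! drawings -/

structure PGr (Γ : SimpleGraph V) (S : Type) [TopologicalSpace S] where
  vm : V → S
  ea : Sym2 V → Set S
  arc : ∀ u v, Γ.Adj u v → ∃ g : C(unitInterval, S), Function.Injective g ∧ g 0 = vm u ∧ g 1 = vm v ∧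
    g '' Ioo 0 1 = ea s(u, v)
  vnot : ∀ x, ∀ e ∈ Γ.edgeSet, vm x ∉ ea e
  disj : ∀ e ∈ Γ.edgeSet, ∀ f ∈ Γ.edgeSet, e ≠ f → ea e ∩ ea f = ∅
  inj : Function.Injective vm

variable {Γ : SimpleGraph V} (D : PGr Γ ℂ)

def PGr.ca (e : Sym2 V) : Set ℂ := D.ea e ∪ D.vm '' {x | x ∈ e}
def PGr.im (T : Set (Sym2 V)) : Set ℂ := ⋃ e ∈ T, D.ca e

lemma range_eq_I {S : Type} (g : unitInterval → S) : range g = g '' Ioo 0 1 ∪ {g 0, g 1} := by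
  ext z
  constructor
  · rintro ⟨t, rfl⟩
    by_cases h0 : t = 0
    · subst h0; simp
    by_cases h1 : t = 1
    · subst h1; simp
    · left
      exact ⟨t, ⟨lt_of_le_of_ne t.2.1 (fun h => h0 h.symm), lt_of_le_of_ne t.2.2 (fun h => h1 h)⟩, rfl⟩
  · rintro (⟨t, _, rfl⟩ | h | h)
    · exact ⟨t, rfl⟩
    · exact ⟨0, h.symm⟩
    · exact ⟨1, h.symm⟩

lemma PGr.ca_eq {u v : V} {g : C(unitInterval, ℂ)} (h0 : g 0 = D.vm u) (h1 : g 1 = D.vm v)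
    (h : g '' Ioo 0 1 = D.ea s(u, v)) : D.ca s(u, v) = range g := by
  rw [range_eq_I, h, h0, h1, PGr.ca]
  congr 1
  ext z
  simp [eq_comm]

lemma PGr.ca_compact {e : Sym2 V} (he : e ∈ Γ.edgeSet) : IsCompact (D.ca e) := by
  induction e with | _ u v
  obtain ⟨g, _, h0, h1, h⟩ := D.arc u v he
  rw [D.ca_eq h0 h1 h]
  exact isCompact_range g.continuous

lemma PGr.ca_acyc {e : Sym2 V} (he : e ∈ Γ.edgeSet) : Acyc (D.ca e) := by
  induction e with | _ u v
  obtain ⟨g, hg, h0, h1, h⟩ := D.arc u v he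
  rw [D.ca_eq h0 h1 h]
  exact acyc_arc g hg

lemma PGr.im_compact {T : Set (Sym2 V)} (hT : T ⊆ Γ.edgeSet) : IsCompact (D.im T) :=
  (toFinite T).isCompact_biUnion (fun e he => D.ca_compact (hT he))

lemma PGr.ca_inter {e f : Sym2 V} (he : e ∈ Γ.edgeSet) (hf : f ∈ Γ.edgeSet) (hne : e ≠ f) {z : ℂ}
    (h1 : z ∈ D.ca e) (h2 : z ∈ D.ca f) : ∃ x, x ∈ e ∧ x ∈ f ∧ z = D.vm x := by
  rcases h1 with h1 | ⟨x, hx, rfl⟩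
  · rcases h2 with h2 | ⟨x, hx, rfl⟩
    · exact absurd (D.disj e he f hf hne ▸ (⟨h1, h2⟩ : z ∈ D.ea e ∩ D.ea f) : z ∈ (∅ : Set ℂ)) (fun h => h)
    · exact absurd h1 (D.vnot x e he)
  · rcases h2 with h2 | ⟨y, hy, hxy⟩
    · exact absurd h2 (D.vnot x f hf)
    · rw [D.inj hxy] at hy
      exact ⟨x, hx, hy, rfl⟩

lemma PGr.vm_mem_im {T : Set (Sym2 V)} (hT : T ⊆ Γ.edgeSet) {x : V} (h : D.vm x ∈ D.im T) : ∃ e ∈ T, x ∈ e := by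
  simp only [PGr.im, mem_iUnion] at h
  obtain ⟨e, he, h | ⟨y, hy, hxy⟩⟩ := h
  · exact absurd h (D.vnot x e (hT he))
  · exact ⟨e, he, D.inj hxy ▸ hy⟩

lemma PGr.im_union (T T' : Set (Sym2 V)) : D.im (T ∪ T') = D.im T ∪ D.im T' := by
  exact biUnion_union _ _ _

lemma PGr.im_single (e : Sym2 V) : D.im {e} = D.ca e := by simp [PGr.im]

lemma PGr.im_mono {T T' : Set (Sym2 V)} (h : T ⊆ T') : D.im T ⊆ D.im T' := biUnion_subset_biUnion_left h

theorem PGr.acyc {T : Set (Sym2 V)} (hT : T ⊆ Γ.edgeSet) (hF : Fr Γ T) : Acyc (D.im T) := by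
  obtain ⟨n, hn⟩ : ∃ n, T.ncard = n := ⟨_, rfl⟩
  induction n using Nat.strong_induction_on generalizing T with
  | _ n ih =>
  by_cases hemp : T = ∅
  · subst hemp
    intro f _ _
    exact ⟨0, by simp [PGr.im], by simp [PGr.im]⟩
  obtain ⟨e, he⟩ := nonempty_iff_ne_empty.2 hemp
  induction e with | _ u v
  have hbr := hF.bridge hT he
  set e := s(u, v) with hedef
  let T1 : Set (Sym2 V) := {f | f ∈ T \ {e} ∧ ∃ x ∈ f, Rch (T \ {e}) u x}
  let T2 : Set (Sym2 V) := {f | f ∈ T \ {e} ∧ f ∉ T1}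
  have hT1 : T1 ⊆ T := fun f hf => hf.1.1
  have hT2 : T2 ⊆ T := fun f hf => hf.1.1
  have hT1s : T1 ⊂ T := ⟨hT1, fun h => (h he).1.2 rfl⟩
  have hT2s : T2 ⊂ T := ⟨hT2, fun h => (h he).1.2 rfl⟩
  have key : ∀ f ∈ T1, ∀ x ∈ f, Rch (T \ {e}) u x := by
    rintro f ⟨hf, y, hy, hr⟩ x hx
    by_cases hxy : x = y
    · rw [hxy]; exact hr
    · have : f = s(y, x) := (Sym2.mem_and_mem_iff (Ne.symm hxy)).1 ⟨hy, hx⟩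
      exact hr.tail (this ▸ hf)
  have A1 := ih _ (hn ▸ ncard_lt_ncard hT1s (toFinite _)) (hT1.trans hT) (hF.mono hT1) rfl
  have A2 := ih _ (hn ▸ ncard_lt_ncard hT2s (toFinite _)) (hT2.trans hT) (hF.mono hT2) rfl
  have C1 := (D.im_compact (hT1.trans hT)).isClosed
  have C2 := (D.im_compact (hT2.trans hT)).isClosed
  have C0 := (D.ca_compact (hT he)).isClosed
  have hTeq : T = ({e} ∪ T1) ∪ T2 := by
    ext f
    constructor
    · intro hf
      by_cases h : f = e
      · exact Or.inl (Or.inl h)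
      · by_cases h1 : f ∈ T1
        · exact Or.inl (Or.inr h1)
        · exact Or.inr ⟨⟨hf, h⟩, h1⟩
    · rintro ((h | h) | h)
      · rw [mem_singleton_iff.1 h]; exact he
      · exact hT1 h
      · exact hT2 h
  rw [hTeq, D.im_union, D.im_union, D.im_single]
  have G1 : Acyc (D.ca e ∪ D.im T1) := by
    refine acyc_glue1 C0 C1 (D.ca_acyc (hT he)) A1 (D.vm u) ?_
    rintro z ⟨hz1, hz2⟩
    simp only [PGr.im, mem_iUnion] at hz2
    obtain ⟨f, hf, hzf⟩ := hz2
    obtain ⟨x, hx1, hx2, rfl⟩ := D.ca_inter (hT he) (hT (hT1 hf)) (Ne.symm hf.1.2) hz1 hzf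
    rw [hedef, Sym2.mem_iff] at hx1
    rcases hx1 with rfl | rfl
    · rfl
    · exact absurd (key f hf x hx2) hbr
  refine acyc_glue1 (C0.union C1) C2 G1 A2 (D.vm v) ?_
  rintro z ⟨hz1, hz2⟩
  simp only [PGr.im, mem_iUnion] at hz2
  obtain ⟨f, hf, hzf⟩ := hz2
  rcases hz1 with hz1 | hz1
  · obtain ⟨x, hx1, hx2, rfl⟩ := D.ca_inter (hT he) (hT (hT2 hf)) (Ne.symm hf.1.2) hz1 hzf
    rw [hedef, Sym2.mem_iff] at hx1
    rcases hx1 with rfl | rfl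
    · exact absurd ⟨hf.1, x, hx2, Relation.ReflTransGen.refl⟩ hf.2
    · rfl
  · simp only [PGr.im, mem_iUnion] at hz1
    obtain ⟨f', hf', hzf'⟩ := hz1
    obtain ⟨x, hx1, hx2, rfl⟩ := D.ca_inter (hT (hT1 hf')) (hT (hT2 hf)) (fun h => hf.2 (h ▸ hf')) hzf' hzf
    exact absurd ⟨hf.1, x, hx2, key f' hf' x hx1⟩ hf.2

lemma acyc_pt (p : ℂ) : Acyc {p} := by
  intro f _ h0
  exact ⟨fun _ => Complex.log (f p), continuousOn_const, fun z hz => by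
    rw [mem_singleton_iff.1 hz, Complex.exp_log (h0 p rfl)]⟩

lemma acyc_fin {K : Set ℂ} (hK : IsClosed K) (hA : Acyc K) {P : Set ℂ} (hP : P.Finite) : Acyc (K ∪ P) := by
  induction P, hP using Set.Finite.induction_on with
  | empty => simpa using hA
  | @insert a P _ hP ih =>
    have : K ∪ insert a P = (K ∪ P) ∪ {a} := by ext; simp
    rw [this]
    exact acyc_glue1 (hK.union hP.isClosed) isClosed_singleton ih (acyc_pt a) a (fun z hz => hz.2)

lemma PGr.joined {T : Set (Sym2 V)} (hT : T ⊆ Γ.edgeSet) {u v : V} (h : Rch T u v) (hne : u ≠ v) :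
    JoinedIn (D.im T) (D.vm u) (D.vm v) := by
  have : u = v ∨ JoinedIn (D.im T) (D.vm u) (D.vm v) := by
    induction h with
    | refl => exact Or.inl rfl
    | @tail b c hb hbc ih =>
      right
      obtain ⟨g, hg, h0, h1, h⟩ := D.arc b c (hT hbc)
      have hj : JoinedIn (D.im T) (D.vm b) (D.vm c) := by
        refine ⟨⟨g, h0, h1⟩, fun t => ?_⟩
        apply mem_biUnion hbc
        rw [D.ca_eq h0 h1 h]
        exact mem_range_self t
      by_cases hub : u = b
      · rw [hub]; exact hj
      · exact ((ih hub).resolve_left hub).trans hj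
  exact this.resolve_left hne

end PDG


namespace PDG
open scoped Classical
set_option linter.unusedSectionVars false
set_option linter.unusedSimpArgs false
set_option linter.unusedVariables false
set_option autoImplicit false
open TopP

variable {V : Type} [Fintype V] {Γ : SimpleGraph V} (D : PGr Γ ℂ)

def PGr.K : Set ℂ := D.im Γ.edgeSet

lemma PGr.K_compact : IsCompact D.K := D.im_compact subset_rfl

lemma PGr.ea_sub {T : Set (Sym2 V)} {e : Sym2 V} (he : e ∈ T) : D.ea e ⊆ D.im T :=
  fun z hz => mem_biUnion he (Or.inl hz)

lemma PGr.ea_not {T : Set (Sym2 V)} (hT : T ⊆ Γ.edgeSet) {e : Sym2 V} (he : e ∈ Γ.edgeSet) (heT : e ∉ T) {z : ℂ}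
    (hz : z ∈ D.ea e) : z ∉ D.im T := by
  intro h
  simp only [PGr.im, mem_iUnion] at h
  obtain ⟨f, hf, hzf⟩ := h
  obtain ⟨x, _, _, rfl⟩ := D.ca_inter he (hT hf) (fun h => heT (h ▸ hf)) (Or.inl hz) hzf
  exact D.vnot x e he hz

lemma PGr.ea_pre {e : Sym2 V} (he : e ∈ Γ.edgeSet) : IsPreconnected (D.ea e) := by
  induction e with | _ u v
  obtain ⟨g, _, _, _, h⟩ := D.arc u v he
  rw [← h]; exact oarc_pre g

lemma PGr.ea_uniq {e f : Sym2 V} (he : e ∈ Γ.edgeSet) (hf : f ∈ Γ.edgeSet) {z : ℂ} (h1 : z ∈ D.ea e) (h2 : z ∈ D.ea f) :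
    e = f := by
  by_contra hne
  have := D.disj e he f hf hne
  exact (this ▸ (⟨h1, h2⟩ : z ∈ D.ea e ∩ D.ea f) : z ∈ (∅ : Set ℂ))

/-- data for one edge -/
lemma PGr.edge_data {T : Set (Sym2 V)} (hT : T ⊆ Γ.edgeSet) {e : Sym2 V} (he : e ∈ T) :
    ∃ (g : C(unitInterval, ℂ)) (K' : Set ℂ), Function.Injective g ∧ IsCompact K' ∧ oarc g = D.ea e ∧
      (∀ t, g t ∈ K' → t = 0 ∨ t = 1) ∧ g 0 ∈ K' ∧ g 1 ∈ K' ∧ K' ∪ range g = D.im T := by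
  induction e with | _ u v
  obtain ⟨g, hg, h0, h1, h⟩ := D.arc u v (hT he)
  refine ⟨g, D.im (T \ {s(u, v)}) ∪ {g 0, g 1}, hg,
    (D.im_compact (sdiff_subset.trans hT)).union (by simp), h, ?_, by simp, by simp, ?_⟩
  · intro t ht
    rcases oarc_cases g (mem_range_self t) with h' | h' | h'
    · exfalso
      have h'' : g t ∈ D.ea s(u, v) := h ▸ h'
      rcases ht with ht | ht | ht
      · exact D.ea_not (T := T \ {s(u, v)}) (sdiff_subset.trans hT) (hT he) (fun h => h.2 rfl) h'' ht
      · rw [ht, h0] at h''; exact D.vnot _ _ (hT he) h''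
      · rw [mem_singleton_iff.1 ht, h1] at h''; exact D.vnot _ _ (hT he) h''
    · exact Or.inl (hg h')
    · exact Or.inr (hg h')
  · have : T = (T \ {s(u, v)}) ∪ {s(u, v)} := by
      ext f; by_cases hf : f = s(u, v) <;> simp [hf, he]
    conv_rhs => rw [this, D.im_union, D.im_single, D.ca_eq h0 h1 h]
    rw [union_assoc, union_eq_self_of_subset_left (s := {g 0, g 1})]
    rintro z (rfl | rfl) <;> exact mem_range_self _

lemma PGr.near {T : Set (Sym2 V)} (hT : T ⊆ Γ.edgeSet) {e : Sym2 V} (he : e ∈ T) {x : ℂ} (hx : x ∈ D.ea e) :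
    ∃ ε > 0, Metric.ball x ε ∩ D.im T ⊆ D.ea e := by
  obtain ⟨g, K', hg, hK', ho, hd, h0, h1, hU⟩ := D.edge_data hT he
  have hxK : x ∈ K'ᶜ := by
    rw [← ho] at hx
    obtain ⟨t, ⟨ht0, ht1⟩, rfl⟩ := hx
    intro h
    rcases hd t h with rfl | rfl
    · exact lt_irrefl _ ht0
    · exact lt_irrefl _ ht1
  obtain ⟨ε, hε, hb⟩ := Metric.isOpen_iff.1 hK'.isClosed.isOpen_compl x hxK
  refine ⟨ε, hε, ?_⟩
  rintro z ⟨hz1, hz2⟩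
  rw [← hU] at hz2
  rw [← ho]
  rcases hz2 with hz2 | hz2
  · exact absurd hz2 (hb hz1)
  · rcases oarc_cases g hz2 with h | rfl | rfl
    · exact h
    · exact absurd h0 (hb hz1)
    · exact absurd h1 (hb hz1)

lemma PGr.near_touch {T : Set (Sym2 V)} (hT : T ⊆ Γ.edgeSet) {e : Sym2 V} (he : e ∈ T) {x : ℂ} (hx : x ∈ D.ea e)
    {ε : ℝ} (hε : 0 < ε) (hb : Metric.ball x ε ∩ D.im T ⊆ D.ea e) {q : ℂ} (hq : q ∈ Metric.ball x ε)
    (hqT : q ∉ D.im T) : (closure (connectedComponentIn (D.im T)ᶜ q) ∩ D.ea e).Nonempty := by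
  by_contra hne
  set U := connectedComponentIn (D.im T)ᶜ q with hU
  have ho : IsOpen (D.im T)ᶜ := (D.im_compact hT).isClosed.isOpen_compl
  have hUo : IsOpen U := ho.connectedComponentIn
  have hcl : ∀ y ∈ Metric.ball x ε, y ∈ closure U → y ∈ U := by
    intro y hy hyU
    by_cases hyT : y ∈ D.im T
    · exact absurd ⟨y, hyU, hb ⟨hy, hyT⟩⟩ hne
    · exact cc_closure ho hyU hyT
  have hpre : IsPreconnected (Metric.ball x ε) := (convex_ball x ε).isPreconnected
  have hsub : Metric.ball x ε ⊆ U := by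
    refine hpre.subset_of_closure_inter_subset hUo ⟨q, hq, mem_connectedComponentIn hqT⟩ ?_
    rintro y ⟨h1, h2⟩; exact hcl y h2 h1
  exact connectedComponentIn_subset _ _ (hsub (Metric.mem_ball_self hε)) (D.ea_sub he hx)

def PGr.Fc : Type := {C : Set ℂ // ∃ x ∉ D.K, C = connectedComponentIn D.Kᶜ x}

def PGr.fc (z : ℂ) (hz : z ∉ D.K) : D.Fc := ⟨connectedComponentIn D.Kᶜ z, z, hz, rfl⟩

lemma PGr.fc_of_mem (f : D.Fc) {z : ℂ} (hz : z ∈ f.1) : ∃ h, f = D.fc z h := by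
  obtain ⟨C, x, hx, rfl⟩ := f
  refine ⟨connectedComponentIn_subset _ _ hz, Subtype.ext (connectedComponentIn_eq hz)⟩

lemma PGr.two_faces {e : Sym2 V} (he : e ∈ Γ.edgeSet) :
    ∃ l r : D.Fc, ∀ f : D.Fc, (closure f.1 ∩ D.ea e).Nonempty ↔ f = l ∨ f = r := by
  obtain ⟨g, K', hg, hK', ho, hd, h0, h1, hU⟩ := D.edge_data subset_rfl he
  have hex : ∃ f : D.Fc, (closure f.1 ∩ D.ea e).Nonempty := by
    obtain ⟨x, hx⟩ := oarc_ne g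
    rw [ho] at hx
    obtain ⟨ε, hε, hb⟩ := D.near subset_rfl he hx
    have : ∃ q ∈ Metric.ball x ε, q ∉ range g := by
      by_contra hcon
      push Not at hcon
      have : x ∈ interior (range g) := mem_interior.2 ⟨_, hcon, Metric.isOpen_ball, Metric.mem_ball_self hε⟩
      rw [arc_interior g hg] at this; exact this
    obtain ⟨q, hq, hqg⟩ := this
    have hqK : q ∉ D.K := fun h => hqg (oarc_sub g (ho ▸ hb ⟨hq, h⟩))
    exact ⟨D.fc q hqK, D.near_touch subset_rfl he hx hε hb hq hqK⟩
  have h3 : ∀ f1 f2 f3 : D.Fc, (closure f1.1 ∩ D.ea e).Nonempty → (closure f2.1 ∩ D.ea e).Nonempty →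
      (closure f3.1 ∩ D.ea e).Nonempty → f1 = f2 ∨ f1 = f3 ∨ f2 = f3 := by
    rintro ⟨_, a, ha, rfl⟩ ⟨_, b, hb, rfl⟩ ⟨_, c, hc, rfl⟩ ta tb tc
    simp only [PGr.K, ← hU, ← ho] at ha hb hc ta tb tc
    have := lemmaE hK' g hg hd h0 h1 a b c ha hb hc ta tb tc
    rw [hU] at this
    rcases this with h | h | h
    · exact Or.inl (Subtype.ext h)
    · exact Or.inr (Or.inl (Subtype.ext h))
    · exact Or.inr (Or.inr (Subtype.ext h))
  obtain ⟨l, hl⟩ := hex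
  by_cases h2 : ∃ r : D.Fc, r ≠ l ∧ (closure r.1 ∩ D.ea e).Nonempty
  · obtain ⟨r, hrl, hr⟩ := h2
    refine ⟨l, r, fun f => ⟨fun hf => ?_, ?_⟩⟩
    · rcases h3 l r f hl hr hf with h | h | h
      · exact absurd h.symm hrl
      · exact Or.inl h.symm
      · exact Or.inr h.symm
    · rintro (rfl | rfl) <;> assumption
  · push Not at h2
    refine ⟨l, l, fun f => ⟨fun hf => ?_, ?_⟩⟩
    · by_contra hne
      have hne : f ≠ l := fun h => hne (Or.inl h)
      exact absurd hf (not_nonempty_iff_eq_empty.2 (h2 f hne))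
    · rintro (rfl | rfl) <;> assumption

lemma PGr.exists_fc : Nonempty D.Fc := by
  obtain ⟨o, ho, _⟩ := exists_outer D.K_compact.isBounded
  exact ⟨D.fc o ho⟩

lemma PGr.exists_lr : ∃ l r : Sym2 V → D.Fc, ∀ e ∈ Γ.edgeSet, ∀ f : D.Fc,
    (closure f.1 ∩ D.ea e).Nonempty ↔ f = l e ∨ f = r e := by
  have : ∀ e : Sym2 V, ∃ l r : D.Fc, e ∈ Γ.edgeSet → ∀ f : D.Fc, (closure f.1 ∩ D.ea e).Nonempty ↔ f = l ∨ f = r := by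
    intro e
    by_cases he : e ∈ Γ.edgeSet
    · obtain ⟨l, r, h⟩ := D.two_faces he; exact ⟨l, r, fun _ => h⟩
    · obtain ⟨f⟩ := D.exists_fc; exact ⟨f, f, fun h => absurd h he⟩
  choose l r h using this
  exact ⟨l, r, fun e he => h e he⟩

def PGr.LR (l r : Sym2 V → D.Fc) : Prop := ∀ e ∈ Γ.edgeSet, ∀ f : D.Fc,
    (closure f.1 ∩ D.ea e).Nonempty ↔ f = l e ∨ f = r e

variable {D} {l r : Sym2 V → D.Fc} (hlr : D.LR l r)

def Phi (l : Sym2 V → D.Fc) (φ : D.Fc → ZMod 2) (z : ℂ) : ZMod 2 :=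
  if h : z ∉ D.K then φ (D.fc z h) else if h : ∃ e ∈ Γ.edgeSet, z ∈ D.ea e then φ (l h.choose) else 0

lemma Phi_off (φ : D.Fc → ZMod 2) {z : ℂ} (h : z ∉ D.K) : Phi l φ z = φ (D.fc z h) := by
  simp [Phi, h]

lemma Phi_on (φ : D.Fc → ZMod 2) {z : ℂ} {e : Sym2 V} (he : e ∈ Γ.edgeSet) (hz : z ∈ D.ea e) : Phi l φ z = φ (l e) := by
  have h1 : z ∈ D.K := D.ea_sub he hz
  have h2 : ∃ e ∈ Γ.edgeSet, z ∈ D.ea e := ⟨e, he, hz⟩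
  have : h2.choose = e := D.ea_uniq h2.choose_spec.1 he h2.choose_spec.2 hz
  simp only [Phi, h1, not_true, dite_false, h2, dite_true, this]

include hlr in
lemma Phi_const (φ : D.Fc → ZMod 2) {S : Set ℂ} (hS : IsPreconnected S)
    (h : ∀ z ∈ S, z ∈ D.K → ∃ e ∈ Γ.edgeSet, z ∈ D.ea e ∧ φ (l e) = φ (r e)) {a b : ℂ} (ha : a ∈ S) (hb : b ∈ S) :
    Phi l φ a = Phi l φ b := by
  have hc : ContinuousOn (fun z => (Phi l φ z).val) S := by
    intro z hz
    apply ContinuousAt.continuousWithinAt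
    have key : ∃ O ∈ 𝓝 z, ∀ q ∈ O, Phi l φ q = Phi l φ z := by
      by_cases hzK : z ∈ D.K
      · obtain ⟨e, he, hze, hφ⟩ := h z hz hzK
        obtain ⟨ε, hε, hb⟩ := D.near subset_rfl he hze
        refine ⟨Metric.ball z ε, Metric.ball_mem_nhds z hε, fun q hq => ?_⟩
        rw [Phi_on φ he hze]
        by_cases hqK : q ∈ D.K
        · exact Phi_on φ he (hb ⟨hq, hqK⟩)
        · rw [Phi_off φ hqK]
          rcases (hlr e he (D.fc q hqK)).1 (D.near_touch subset_rfl he hze hε hb hq hqK) with h | h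
          · rw [h]
          · rw [h, hφ]
      · have ho : IsOpen (connectedComponentIn D.Kᶜ z) := D.K_compact.isClosed.isOpen_compl.connectedComponentIn
        refine ⟨_, ho.mem_nhds (mem_connectedComponentIn hzK), fun q hq => ?_⟩
        obtain ⟨h1, h2⟩ := D.fc_of_mem (D.fc z hzK) hq
        rw [Phi_off φ h1, Phi_off φ hzK, h2]
    obtain ⟨O, hO, hOq⟩ := key
    refine (continuousAt_const (y := (Phi l φ z).val)).congr ?_
    filter_upwards [hO] with q hq
    rw [hOq q hq]
  exact ZMod.val_injective 2 (hS.constant hc ha hb)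

include hlr in
lemma lr_conn (φ : D.Fc → ZMod 2) (h : dl Γ l r φ = 0) (a b : D.Fc) : φ a = φ b := by
  obtain ⟨_, x, hx, rfl⟩ := a
  obtain ⟨_, y, hy, rfl⟩ := b
  have hfin : (range D.vm).Finite := finite_range _
  let P := range D.vm \ {x, y}
  have hP : P.Finite := hfin.subset sdiff_subset
  have hpre : IsPreconnected Pᶜ := by
    have : Acyc (∅ ∪ P) := acyc_fin isClosed_empty (by
      intro f _ _; exact ⟨0, by simp, by simp⟩) hP
    rw [empty_union] at this
    exact acyc_conn hP.isCompact this
  have := Phi_const hlr φ hpre ?_ (a := x) (b := y) (fun h => h.2 (by simp)) (fun h => h.2 (by simp))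
  · rw [Phi_off φ hx, Phi_off φ hy] at this; exact this
  · intro z hz hzK
    have hzK' := hzK
    simp only [PGr.K, PGr.im, mem_iUnion] at hzK
    obtain ⟨e, he, h' | ⟨v, hv, rfl⟩⟩ := hzK
    · refine ⟨e, he, h', ?_⟩
      have := congrFun h e
      simp only [dl, he, if_true, Pi.zero_apply] at this
      exact z2_add_eq_zero.1 this
    · exfalso
      refine hz ⟨mem_range_self v, ?_⟩
      rintro (h | h)
      · exact hx (h ▸ hzK')
      · exact hy ((mem_singleton_iff.1 h) ▸ hzK')

include hlr in
lemma lr_loc (v : V) (φ : D.Fc → ZMod 2) (h : ∀ w, Γ.Adj v w → φ (l s(v, w)) = φ (r s(v, w)))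
    (w w' : V) (hw : Γ.Adj v w) (hw' : Γ.Adj v w') : φ (l s(v, w)) = φ (l s(v, w')) := by
  let T : Set (Sym2 V) := {e | e ∈ Γ.edgeSet ∧ v ∉ e}
  have hT : T ⊆ Γ.edgeSet := fun e he => he.1
  have hvT : D.vm v ∈ (D.im T)ᶜ := fun h => by
    obtain ⟨e, he, hv⟩ := D.vm_mem_im hT h
    exact he.2 hv
  have hclosed : IsClosed (D.im T ∪ D.vm '' {x | x ≠ v}) :=
    (D.im_compact hT).isClosed.union ((toFinite _).isClosed)
  have hvm : D.vm v ∈ (D.im T ∪ D.vm '' {x | x ≠ v})ᶜ := by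
    rintro (h | ⟨x, hx, h⟩)
    · exact hvT h
    · exact hx (D.inj h)
  obtain ⟨ε, hε, hb⟩ := Metric.isOpen_iff.1 hclosed.isOpen_compl _ hvm
  have hpt : ∀ w, Γ.Adj v w → ∃ z ∈ Metric.ball (D.vm v) ε \ {D.vm v}, z ∈ D.ea s(v, w) := by
    intro w hw
    obtain ⟨g, hg, h0, h1, ho⟩ := D.arc v w hw
    have hnb : g ⁻¹' Metric.ball (D.vm v) ε ∈ 𝓝 (0 : unitInterval) :=
      (Metric.isOpen_ball.preimage g.continuous).mem_nhds (by rw [mem_preimage, h0]; exact Metric.mem_ball_self hε)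
    obtain ⟨u, hu, hu'⟩ := exists_Ico_subset_of_mem_nhds hnb ⟨1, zero_lt_one⟩
    obtain ⟨t, ht0, ht1⟩ := exists_between hu
    have hm : g t ∈ D.ea s(v, w) := ho ▸ ⟨t, ⟨ht0, ht1.trans_le unitInterval.le_one'⟩, rfl⟩
    exact ⟨g t, ⟨hu' ⟨ht0.le, ht1⟩, fun h => D.vnot v s(v, w) hw (h ▸ hm)⟩, hm⟩
  obtain ⟨z, hz, hz'⟩ := hpt w hw
  obtain ⟨q, hq, hq'⟩ := hpt w' hw'
  have := Phi_const hlr φ (pre_pball (D.vm v) ε hε) ?_ hz hq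
  · rwa [Phi_on φ hw hz', Phi_on φ hw' hq'] at this
  · rintro p ⟨hp1, hp2⟩ hpK
    have hpb := hb hp1
    simp only [PGr.K, PGr.im, mem_iUnion] at hpK
    obtain ⟨e, he, h' | ⟨x, hx, rfl⟩⟩ := hpK
    · refine ⟨e, he, h', ?_⟩
      by_cases hve : v ∈ e
      · obtain ⟨y, rfl⟩ := hve
        exact h y he
      · exact absurd (Or.inl (D.ea_sub (⟨he, hve⟩ : e ∈ T) h')) hpb
    · exfalso
      by_cases hxv : x = v
      · subst hxv; exact hp2 rfl
      · exact hpb (Or.inr ⟨x, hxv, rfl⟩)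

lemma circ_jordan (D : PGr Γ ℂ) {z : Sym2 V → ZMod 2} (hz : Circ Γ z) {e : Sym2 V} (he : e ∈ sp z) :
    (∀ c ∉ D.im (sp z), (closure (connectedComponentIn (D.im (sp z))ᶜ c) ∩ D.ea e).Nonempty) ∧
    ∃ a b, a ∉ D.im (sp z) ∧ b ∉ D.im (sp z) ∧
      Bornology.IsBounded (connectedComponentIn (D.im (sp z))ᶜ a) ∧
      ¬ Bornology.IsBounded (connectedComponentIn (D.im (sp z))ᶜ b) ∧
      ∀ c ∉ D.im (sp z), connectedComponentIn (D.im (sp z))ᶜ c = connectedComponentIn (D.im (sp z))ᶜ a ∨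
        connectedComponentIn (D.im (sp z))ᶜ c = connectedComponentIn (D.im (sp z))ᶜ b := by
  have hsp := hz.cyc.sp_sub
  induction e with | _ u v
  obtain ⟨g, hg, h0, h1, h⟩ := D.arc u v (hsp he)
  have hss : sp z \ {s(u, v)} ⊆ Γ.edgeSet := sdiff_subset.trans hsp
  have hne : u ≠ v := Γ.ne_of_adj (hsp he)
  have := jordan (D.im_compact hss) (D.acyc hss (hz.fr he)) g hg ?_ (by
    rw [h0, h1]; exact D.joined hss (hz.cyc.rch he) hne)
  · have hU : D.im (sp z \ {s(u, v)}) ∪ range g = D.im (sp z) := by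
      rw [← D.ca_eq h0 h1 h, ← D.im_single, ← D.im_union, sdiff_union_self, union_eq_self_of_subset_right]
      simpa using he
    rw [hU, show oarc g = D.ea s(u, v) from h] at this
    exact this
  · intro t ht
    rcases oarc_cases g (mem_range_self t) with h' | h' | h'
    · exfalso
      have h'' : g t ∈ D.ea s(u, v) := h ▸ h'
      exact D.ea_not (T := sp z \ {s(u, v)}) hss (hsp he) (fun h => h.2 rfl) h'' ht
    · exact Or.inl (hg h')
    · exact Or.inr (hg h')

include hlr in
lemma lr_circ {z : Sym2 V → ZMod 2} (hz : Circ Γ z) (b : ℂ) (hb : b ∉ D.im (sp z)) :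
    dl Γ l r (fun f => if f.1 ⊆ connectedComponentIn (D.im (sp z))ᶜ b then 1 else 0) = z := by
  have hsp := hz.cyc.sp_sub
  have hJK : D.im (sp z) ⊆ D.K := D.im_mono hsp
  have hJc : IsClosed (D.im (sp z)) := (D.im_compact hsp).isClosed
  set U := connectedComponentIn (D.im (sp z))ᶜ b with hU
  have key : ∀ (f : D.Fc) (c q : ℂ), q ∈ f.1 → q ∈ connectedComponentIn (D.im (sp z))ᶜ c →
      f.1 ⊆ connectedComponentIn (D.im (sp z))ᶜ c := by
    rintro ⟨_, x, hx, rfl⟩ c q hq hqc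
    rw [connectedComponentIn_eq hqc, ]
    change connectedComponentIn D.Kᶜ x ⊆ _
    rw [connectedComponentIn_eq hq]
    exact connectedComponentIn_mono _ (compl_subset_compl.2 hJK)
  have fne : ∀ f : D.Fc, f.1.Nonempty := by
    rintro ⟨_, x, hx, rfl⟩; exact ⟨x, mem_connectedComponentIn hx⟩
  have key2 : ∀ (f : D.Fc) (c q : ℂ), q ∈ f.1 → q ∈ connectedComponentIn (D.im (sp z))ᶜ c →
      (f.1 ⊆ U ↔ connectedComponentIn (D.im (sp z))ᶜ c = U) := by
    intro f c q hq hqc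
    have h1 := key f c q hq hqc
    constructor
    · intro h2
      exact cc_eq_of_mem (h1 hq) (h2 hq)
    · intro h; exact h ▸ h1
  funext e
  by_cases he : e ∈ Γ.edgeSet
  swap
  · simp [dl, he, hz.cyc.1 e he]
  simp only [dl, he, if_true]
  by_cases hes : e ∈ sp z
  · have hze : z e = 1 := (z2_cases _).resolve_left hes
    rw [hze]
    have hcomp : ∀ c ∉ D.im (sp z), ∃ f : D.Fc, (f = l e ∨ f = r e) ∧
        (f.1 ⊆ U ↔ connectedComponentIn (D.im (sp z))ᶜ c = U) := by
      intro c hc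
      obtain ⟨y, hy1, hy2⟩ := (circ_jordan D hz hes).1 c hc
      obtain ⟨ε, hε, hball⟩ := D.near subset_rfl he hy2
      obtain ⟨q, hq1, hq2⟩ := mem_closure_iff.1 hy1 _ Metric.isOpen_ball (Metric.mem_ball_self hε)
      have hqJ : q ∉ D.im (sp z) := connectedComponentIn_subset _ _ hq2
      have hqK : q ∉ D.K := fun h => hqJ (D.ea_sub hes (hball ⟨hq1, h⟩))
      exact ⟨D.fc q hqK, (hlr e he _).1 (D.near_touch subset_rfl he hy2 hε hball hq1 hqK),
        key2 _ c q (mem_connectedComponentIn hqK) hq2⟩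
    have hother : ∃ c ∉ D.im (sp z), connectedComponentIn (D.im (sp z))ᶜ c ≠ U := by
      obtain ⟨-, a, b', ha, hb', hab, hub, -⟩ := circ_jordan D hz hes
      by_cases h : connectedComponentIn (D.im (sp z))ᶜ a = U
      · exact ⟨b', hb', fun h' => hub (h' ▸ h ▸ hab)⟩
      · exact ⟨a, ha, h⟩
    obtain ⟨c, hc, hcU⟩ := hother
    obtain ⟨f, hf, hf'⟩ := hcomp c hc
    obtain ⟨f2, hf2, hf2'⟩ := hcomp b hb
    have h1 : ¬ f.1 ⊆ U := fun h => hcU (hf'.1 h)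
    have h2 : f2.1 ⊆ U := hf2'.2 rfl
    rcases hf with rfl | rfl <;> rcases hf2 with rfl | rfl
    · exact absurd h2 h1
    · simp [h1, h2]
    · simp [h1, h2]
    · exact absurd h2 h1
  · have hze : z e = 0 := by by_contra h; exact hes h
    rw [hze, z2_add_eq_zero]
    obtain ⟨g, K', hg, hK', ho, -⟩ := D.edge_data subset_rfl he
    obtain ⟨y, hy⟩ := oarc_ne g
    rw [ho] at hy
    have hsub : D.ea e ⊆ connectedComponentIn (D.im (sp z))ᶜ y :=
      (D.ea_pre he).subset_connectedComponentIn hy (fun w hw => D.ea_not hsp he hes hw)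
    have : ∀ f : D.Fc, (f = l e ∨ f = r e) → (f.1 ⊆ U ↔ connectedComponentIn (D.im (sp z))ᶜ y = U) := by
      intro f hf
      obtain ⟨w, hw1, hw2⟩ := (hlr e he f).2 hf
      obtain ⟨q, hq1, hq2⟩ := mem_closure_iff.1 hw1 _ hJc.isOpen_compl.connectedComponentIn (hsub hw2)
      exact key2 f y q hq2 hq1
    simp only [this _ (Or.inl rfl), this _ (Or.inr rfl)]

include hlr in
lemma lr_exact (z : Sym2 V → ZMod 2) (hz : IsCyc Γ z) : ∃ φ, dl Γ l r φ = z := by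
  obtain ⟨n, hn⟩ : ∃ n, (sp z).ncard = n := ⟨_, rfl⟩
  induction n using Nat.strong_induction_on generalizing z with
  | _ n ih =>
  by_cases h0 : z = 0
  · exact ⟨fun _ => 0, by rw [dl_const, h0]⟩
  by_cases hc : Circ Γ z
  · obtain ⟨o, ho, _⟩ := exists_outer (D.im_compact hz.sp_sub).isBounded
    exact ⟨_, lr_circ hlr hc o ho⟩
  · have : ∃ z', IsCyc Γ z' ∧ (∀ e, z e = 0 → z' e = 0) ∧ z' ≠ 0 ∧ z' ≠ z := by
      by_contra hcon
      push Not at hcon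
      exact hc ⟨hz, h0, fun z' h1 h2 => by
        by_cases h3 : z' = 0
        · exact Or.inl h3
        · exact Or.inr (hcon z' h1 h2 h3)⟩
    obtain ⟨z', hz', hs, h1, h2⟩ := this
    have hs1 : sp z' ⊂ sp z := by
      refine ⟨fun e he h => he (hs e h), fun hsub => h2 ?_⟩
      funext e
      by_cases he : z e = 0
      · rw [he, hs e he]
      · rw [(z2_cases _).resolve_left he, (z2_cases _).resolve_left (hsub he)]
    have hs2 : sp (z + z') ⊂ sp z := by
      refine ⟨fun e he h => he (by simp [h, hs e h]), fun hsub => h1 ?_⟩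
      funext e
      by_cases he : z e = 0
      · rw [hs e he]; rfl
      · have h3 := hsub he
        have h4 := (z2_cases _).resolve_left he
        rcases z2_cases (z' e) with h5 | h5
        · exact h5
        · exact absurd (by simp [h4, h5]; decide) h3
    obtain ⟨φ1, h3⟩ := ih _ (hn ▸ ncard_lt_ncard hs1 (toFinite _)) z' hz' rfl
    obtain ⟨φ2, h4⟩ := ih _ (hn ▸ ncard_lt_ncard hs2 (toFinite _)) (z + z') (hz.add hz') rfl
    refine ⟨φ2 + φ1, ?_⟩
    rw [dl_add, h3, h4]
    funext e
    have : ∀ a b : ZMod 2, a + b + b = a := by decide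
    exact this _ _

include hlr in
lemma lr_even (φ : D.Fc → ZMod 2) : IsCyc Γ (dl Γ l r φ) := by
  obtain ⟨n, hn⟩ : ∃ n, (sp (dl Γ l r φ)).ncard = n := ⟨_, rfl⟩
  induction n using Nat.strong_induction_on generalizing φ with
  | _ n ih =>
  have hsub : sp (dl Γ l r φ) ⊆ Γ.edgeSet := by
    intro e he
    by_contra h
    exact he (by simp [dl, h])
  by_cases hF : Fr Γ (sp (dl Γ l r φ))
  · have hc : ∀ a b, φ a = φ b := by
      rintro ⟨_, x, hx, rfl⟩ ⟨_, y, hy, rfl⟩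
      have hfin : (range D.vm).Finite := finite_range _
      let P := range D.vm \ {x, y}
      have hP : P.Finite := hfin.subset sdiff_subset
      have hTc := D.im_compact hsub
      have hpre := acyc_conn (hTc.union hP.isCompact) (acyc_fin hTc.isClosed (D.acyc hsub hF) hP)
      have hm : ∀ w ∉ D.K, (w = x ∨ w = y) → w ∈ (D.im (sp (dl Γ l r φ)) ∪ P)ᶜ := by
        rintro w hw hxy (h | h)
        · exact hw (D.im_mono hsub h)
        · exact h.2 (by simpa using hxy)
      have := Phi_const hlr φ hpre ?_ (hm x hx (Or.inl rfl)) (hm y hy (Or.inr rfl))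
      · rw [Phi_off φ hx, Phi_off φ hy] at this; exact this
      · intro z hz hzK
        have hzK' := hzK
        simp only [PGr.K, PGr.im, mem_iUnion] at hzK
        obtain ⟨e, he, h' | ⟨v, hv, rfl⟩⟩ := hzK
        · refine ⟨e, he, h', ?_⟩
          by_contra hne
          refine hz (Or.inl (D.ea_sub (?_ : e ∈ sp (dl Γ l r φ)) h'))
          intro h
          simp only [dl, he, if_true] at h
          exact hne (z2_add_eq_zero.1 h)
        · exfalso
          refine hz (Or.inr ⟨mem_range_self v, ?_⟩)
          rintro (h | h)
          · exact hx (h ▸ hzK')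
          · exact hy ((mem_singleton_iff.1 h) ▸ hzK')
    have : dl Γ l r φ = 0 := by
      funext e
      simp only [dl, Pi.zero_apply, hc (l e) (r e)]
      split_ifs
      · exact z2_add_eq_zero.2 rfl
      · rfl
    rw [this]
    exact ⟨fun _ _ => rfl, fun v => by simp⟩
  · unfold Fr at hF
    push Not at hF
    obtain ⟨z', hz', hs, hne⟩ := hF
    obtain ⟨ψ, hψ⟩ := lr_exact hlr z' hz'
    have hs2 : sp (dl Γ l r (φ + ψ)) ⊂ sp (dl Γ l r φ) := by
      rw [dl_add, hψ]
      have hs' : ∀ e, dl Γ l r φ e = 0 → z' e = 0 := fun e he => hs e (fun h => h he)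
      refine ⟨fun e he h => he (by simp [h, hs' e h]), fun hsub => hne ?_⟩
      funext e
      by_cases he : dl Γ l r φ e = 0
      · rw [hs' e he]; rfl
      · have h3 := hsub he
        have h4 := (z2_cases _).resolve_left he
        rcases z2_cases (z' e) with h5 | h5
        · exact h5
        · exact absurd (by simp [h4, h5]; decide) h3
    have := (ih _ (hn ▸ ncard_lt_ncard hs2 (toFinite _)) (φ + ψ) rfl).add hz'
    rw [dl_add, hψ] at this
    convert this using 1
    funext e
    have : ∀ a b : ZMod 2, a = a + b + b := by decide
    exact this _ _

include hlr in
lemma lr_fin : Finite D.Fc := by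
  by_cases hinj : Function.Injective (fun f : D.Fc => dl Γ l r (ind f))
  · exact Finite.of_injective _ hinj
  · simp only [Function.Injective] at hinj
    push Not at hinj
    obtain ⟨a, b, hab, hne⟩ := hinj
    have h0 : dl Γ l r (ind a + ind b) = 0 := by
      rw [dl_add, hab]
      funext e
      exact z2_add_eq_zero.2 rfl
    have hc := lr_conn hlr _ h0
    have : (univ : Set D.Fc) ⊆ {a, b} := by
      intro f _
      by_contra hf
      simp only [mem_insert_iff, mem_singleton_iff, not_or] at hf
      have := hc f a
      simp [ind, hf.1, hf.2, hne, hne.symm, Ne.symm hf.1, Ne.symm hf.2] at this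
    exact finite_univ_iff.1 ((toFinite {a, b}).subset this)

def mkPD : PD Γ where
  F := D.Fc
  fin := lr_fin hlr
  l := l
  r := r
  even := lr_even hlr
  exact := lr_exact hlr
  conn := lr_conn hlr
  loc := lr_loc hlr

end PDG


namespace PDG
open scoped Classical
set_option linter.unusedSectionVars false
set_option linter.unusedSimpArgs false
set_option linter.unusedVariables false
set_option autoImplicit false
open TopP

theorem circ_zc {V : Type} [Fintype V] {Γ : SimpleGraph V} {n : ℕ} [NeZero n] {c : Fin n → V} (hc : Cy Γ c) :
    Circ Γ (zc c) := by
  refine ⟨zc_isCyc hc, fun h => ?_, fun z' h1 h2 => cyc_on hc h1 h2⟩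
  have := congrFun h s(c 0, c (0 + 1))
  have h1 : zc c s(c 0, c (0 + 1)) = 1 := by unfold zc; rw [if_pos ⟨0, rfl⟩]
  rw [h1] at this
  exact one_ne_zero this

theorem disc_extend {V : Type} [Fintype V] {Γ : SimpleGraph V} (D : PGr Γ ℂ) (n : ℕ) [NeZero n] (c : Fin n → V)
    (htf : TF Γ) (hc : Cy Γ c) (b : ℂ) (hb : b ∉ D.im (sp (zc c)))
    (hout : connectedComponentIn (D.im (sp (zc c)))ᶜ b ∩ D.K = ∅)
    (ψ : Fin n → Fin 3) (hψ : ∀ i, ψ i ≠ ψ (i + 1)) :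
    ∃ col : V → Fin 3, (∀ u v, Γ.Adj u v → col u ≠ col v) ∧ ∀ i, col (c i) = ψ i := by
  obtain ⟨l, r, hlr⟩ := D.exists_lr
  have hC := circ_zc hc
  have h1 := lr_circ hlr hC b hb
  have hJK : D.im (sp (zc c)) ⊆ D.K := D.im_mono hC.cyc.sp_sub
  have hsub : connectedComponentIn (D.im (sp (zc c)))ᶜ b ⊆ D.Kᶜ :=
    fun z hz hK => (hout ▸ (⟨hz, hK⟩ : z ∈ _ ∩ D.K) : z ∈ (∅ : Set ℂ))
  have hbK : b ∉ D.K := hsub (mem_connectedComponentIn hb)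
  have heq : connectedComponentIn (D.im (sp (zc c)))ᶜ b = connectedComponentIn D.Kᶜ b :=
    Subset.antisymm (isPreconnected_connectedComponentIn.subset_connectedComponentIn (mem_connectedComponentIn hb) hsub)
      (connectedComponentIn_mono _ (compl_subset_compl.2 hJK))
  refine extend Γ (mkPD hlr) n c htf hc (D.fc b hbK) ?_ ψ hψ
  rw [← h1]
  change dl Γ l r _ = _
  congr 1
  funext f
  have : f = D.fc b hbK ↔ f.1 ⊆ connectedComponentIn (D.im (sp (zc c)))ᶜ b := by
    rw [heq]
    constructor
    · intro h; rw [h]; exact subset_rfl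
    · obtain ⟨_, x, hx, rfl⟩ := f
      intro h
      exact Subtype.ext (connectedComponentIn_eq (h (mem_connectedComponentIn hx))).symm
  simp only [ind, this]

/-! arcs -/
section arcs
variable {S : Type} [TopologicalSpace S] [T2Space S] [CompactSpace S]

lemma arc_ends {A : Set S} (h : (Ioo (0 : ℝ) 1) ≃ₜ A) {u w : S} (hcl : closure A = A ∪ {u, w})
    {O : Set S} (hO : IsOpen O) (hu : u ∈ O) (hw : w ∈ O) :
    ∃ ε > 0, ε < (1/2 : ℝ) ∧ ∀ t : Ioo (0 : ℝ) 1, (h t : S) ∉ O → ε ≤ t.1 ∧ t.1 ≤ 1 - ε := by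
  have hQ : IsCompact (closure A \ O) := (isClosed_closure.sdiff hO).isCompact
  have hQA : closure A \ O ⊆ A := by
    rintro z ⟨h1, h2⟩
    rw [hcl] at h1
    rcases h1 with h1 | rfl | h1
    · exact h1
    · exact absurd hu h2
    · exact absurd ((mem_singleton_iff.1 h1) ▸ hw) h2
  have hc2 : IsCompact ((fun a : A => (h.symm a : ℝ)) '' {a : A | (a : S) ∈ closure A \ O}) := by
    apply IsCompact.image
    · rw [Subtype.isCompact_iff]
      convert hQ
      ext z
      constructor
      · rintro ⟨a, ha, rfl⟩; exact ha
      · intro hz; exact ⟨⟨z, hQA hz⟩, hz, rfl⟩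
    · exact continuous_subtype_val.comp h.symm.continuous
  have hsub : ((fun a : A => (h.symm a : ℝ)) '' {a : A | (a : S) ∈ closure A \ O}) ⊆ Ioo 0 1 := by
    rintro _ ⟨a, _, rfl⟩; exact (h.symm a).2
  have hm : ∀ t : Ioo (0 : ℝ) 1, (h t : S) ∉ O → (t : ℝ) ∈ ((fun a : A => (h.symm a : ℝ)) '' {a : A | (a : S) ∈ closure A \ O}) := by
    intro t ht
    exact ⟨h t, ⟨subset_closure (h t).2, ht⟩, by simp⟩
  by_cases hne : ((fun a : A => (h.symm a : ℝ)) '' {a : A | (a : S) ∈ closure A \ O}).Nonempty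
  · obtain ⟨a, ha, ha'⟩ := hc2.exists_isLeast hne
    obtain ⟨b, hb, hb'⟩ := hc2.exists_isGreatest hne
    have h1 := hsub ha
    have h2 := hsub hb
    refine ⟨min (min a (1 - b)) (1/4), by simp [h1.1, h2.2], by
      exact (min_le_right _ _).trans_lt (by norm_num), fun t ht => ⟨?_, ?_⟩⟩
    · exact ((min_le_left _ _).trans (min_le_left _ _)).trans (ha' (hm t ht))
    · have := hb' (hm t ht)
      have h3 : min (min a (1 - b)) (1/4) ≤ 1 - b := (min_le_left _ _).trans (min_le_right _ _)
      linarith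
  · exact ⟨1/4, by norm_num, by norm_num, fun t ht => absurd ⟨_, hm t ht⟩ hne⟩

def hext {A : Set S} (h : (Ioo (0 : ℝ) 1) ≃ₜ A) (t : ℝ) : S :=
  if ht : t ∈ Ioo (0 : ℝ) 1 then h ⟨t, ht⟩ else h ⟨1/2, by norm_num, by norm_num⟩

lemma hext_eq {A : Set S} (h : (Ioo (0 : ℝ) 1) ≃ₜ A) {t : ℝ} (ht : t ∈ Ioo (0 : ℝ) 1) : hext h t = h ⟨t, ht⟩ := by
  simp only [hext, ht, dite_true]

lemma hext_cont {A : Set S} (h : (Ioo (0 : ℝ) 1) ≃ₜ A) : ContinuousOn (hext h) (Ioo 0 1) := by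
  rw [continuousOn_iff_continuous_domRestrict]
  have : (Ioo (0:ℝ) 1).domRestrict (hext h) = fun t => (h t : S) := by
    funext t; exact hext_eq h t.2
  rw [this]
  exact continuous_subtype_val.comp h.continuous

/-- one end -/
lemma arc_end {A : Set S} (h : (Ioo (0 : ℝ) 1) ≃ₜ A) {u w : S} (huw : u ≠ w) (hcl : closure A = A ∪ {u, w})
    (I : ℝ → Set ℝ) (hI : ∀ ε, 0 < ε → ε < 1/2 → IsPreconnected (I ε) ∧ (I ε).Nonempty ∧ I ε ⊆ Ioo 0 1)
    (hmono : ∀ ε ε', ε ≤ ε' → I ε ⊆ I ε') (hI2 : ∀ ε, ∀ t ∈ I ε, ¬ (ε ≤ t ∧ t ≤ 1 - ε)) :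
    ∃ v, (v = u ∨ v = w) ∧ ∀ N : Set S, IsOpen N → v ∈ N → ∃ ε > 0, ε < 1/2 ∧ ∀ t ∈ I ε, hext h t ∈ N := by
  have key : ∀ O1 O2 : Set S, IsOpen O1 → IsOpen O2 → u ∈ O1 → w ∈ O2 →
      ∃ ε > 0, ε < (1/2:ℝ) ∧ ∀ t ∈ I ε, hext h t ∈ O1 ∪ O2 := by
    intro O1 O2 h1 h2 hu hw
    obtain ⟨ε, hε, hε2, hh⟩ := arc_ends h hcl (h1.union h2) (Or.inl hu) (Or.inr hw)
    refine ⟨ε, hε, hε2, fun t ht => ?_⟩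
    by_contra hn
    have ht' := (hI ε hε hε2).2.2 ht
    rw [hext_eq h ht'] at hn
    exact hI2 ε t ht (hh ⟨t, ht'⟩ hn)
  obtain ⟨O1, O2, o1, o2, hu, hw, hdis⟩ := t2_separation huw
  obtain ⟨ε0, hε0, hε02, h0⟩ := key O1 O2 o1 o2 hu hw
  obtain ⟨hpre, ⟨t0, ht0⟩, hsub⟩ := hI ε0 hε0 hε02
  have himg : IsPreconnected (hext h '' I ε0) := hpre.image _ ((hext_cont h).mono hsub)
  have hcase : hext h '' I ε0 ⊆ O1 ∨ hext h '' I ε0 ⊆ O2 := by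
    refine isPreconnected_iff_subset_of_disjoint.1 himg O1 O2 o1 o2 ?_ ?_
    · rintro _ ⟨t, ht, rfl⟩; exact h0 t ht
    · rw [hdis.inter_eq, inter_empty]
  rcases hcase with hc | hc
  · refine ⟨u, Or.inl rfl, fun N hN huN => ?_⟩
    obtain ⟨ε, hε, hε2, h1⟩ := key (N ∩ O1) O2 (hN.inter o1) o2 ⟨huN, hu⟩ hw
    refine ⟨min ε ε0, lt_min hε hε0, (min_le_left _ _).trans_lt hε2, fun t ht => ?_⟩
    rcases h1 t (hmono _ _ (min_le_left _ _) ht) with h | h2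
    · exact h.1
    · exact absurd h2 (fun h2 => disjoint_left.1 hdis (hc ⟨t, hmono _ _ (min_le_right _ _) ht, rfl⟩) h2)
  · refine ⟨w, Or.inr rfl, fun N hN huN => ?_⟩
    obtain ⟨ε, hε, hε2, h1⟩ := key O1 (N ∩ O2) o1 (hN.inter o2) hu ⟨huN, hw⟩
    refine ⟨min ε ε0, lt_min hε hε0, (min_le_left _ _).trans_lt hε2, fun t ht => ?_⟩
    rcases h1 t (hmono _ _ (min_le_left _ _) ht) with h2 | h
    · exact absurd h2 (fun h2 => disjoint_left.1 hdis h2 (hc ⟨t, hmono _ _ (min_le_right _ _) ht, rfl⟩))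
    · exact h.1

lemma arc_asm {A : Set S} (h : (Ioo (0 : ℝ) 1) ≃ₜ A) {u w a b : S} (hab : a ≠ b)
    (ta : Filter.Tendsto (hext h) (𝓝[>] 0) (𝓝 a)) (tb : Filter.Tendsto (hext h) (𝓝[<] 1) (𝓝 b))
    (haA : a ∉ A) (hbA : b ∉ A) (hc : (a = u ∧ b = w) ∨ (a = w ∧ b = u)) :
    ∃ g : C(unitInterval, S), Function.Injective g ∧ ((g 0 = u ∧ g 1 = w) ∨ (g 0 = w ∧ g 1 = u)) ∧
      g '' Ioo 0 1 = A := by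
  have hcc := continuousOn_Icc_extendFrom_Ioo (hext_cont h) ta tb
  have e0 := eq_lim_at_left_extendFrom_Ioo (zero_lt_one (α := ℝ)) ta
  have e1 := eq_lim_at_right_extendFrom_Ioo (zero_lt_one (α := ℝ)) tb
  have ei : ∀ t (ht : t ∈ Ioo (0:ℝ) 1), extendFrom (Ioo 0 1) (hext h) t = h ⟨t, ht⟩ := fun t ht =>
    (extendFrom_extends (hext_cont h) t ht).trans (hext_eq h ht)
  generalize extendFrom (Ioo 0 1) (hext h) = F at hcc e0 e1 ei
  have key : ∀ t : unitInterval, t = 0 ∨ t = 1 ∨ t.1 ∈ Ioo (0:ℝ) 1 := by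
    intro t
    by_cases h0 : t = 0
    · exact Or.inl h0
    by_cases h1 : t = 1
    · exact Or.inr (Or.inl h1)
    · exact Or.inr (Or.inr ⟨lt_of_le_of_ne t.2.1 (fun h => h0 (Subtype.ext h.symm)), lt_of_le_of_ne t.2.2 (fun h => h1 (Subtype.ext h))⟩)
  have iA : ∀ t (ht : t ∈ Ioo (0:ℝ) 1), F t ∈ A := fun t ht => by rw [ei t ht]; exact (h _).2
  have e0' : F (((0 : unitInterval)) : ℝ) = a := e0
  have e1' : F (((1 : unitInterval)) : ℝ) = b := e1
  refine ⟨⟨fun t : unitInterval => F t, continuousOn_iff_continuous_domRestrict.1 hcc⟩, ?_, ?_, ?_⟩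
  · intro s t hst
    change F s = F t at hst
    rcases key s with rfl | rfl | hs <;> rcases key t with rfl | rfl | ht
    · rfl
    · rw [e0', e1'] at hst; exact absurd hst hab
    · rw [e0'] at hst; exact absurd (hst ▸ iA _ ht) haA
    · rw [e0', e1'] at hst; exact absurd hst.symm hab
    · rfl
    · rw [e1'] at hst; exact absurd (hst ▸ iA _ ht) hbA
    · rw [e0'] at hst; exact absurd (hst ▸ iA _ hs) haA
    · rw [e1'] at hst; exact absurd (hst ▸ iA _ hs) hbA
    · rw [ei _ hs, ei _ ht] at hst
      have := h.injective (Subtype.ext hst)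
      exact Subtype.ext (congrArg (fun z : Ioo (0:ℝ) 1 => z.1) this)
  · change (F _ = u ∧ F _ = w) ∨ (F _ = w ∧ F _ = u)
    rw [e0', e1']; exact hc
  · ext z
    constructor
    · rintro ⟨t, ⟨h1, h2⟩, rfl⟩
      exact iA _ ⟨h1, h2⟩
    · intro hz
      have h1 := (h.symm ⟨z, hz⟩).2
      refine ⟨⟨(h.symm ⟨z, hz⟩).1, h1.1.le, h1.2.le⟩, ⟨h1.1, h1.2⟩, ?_⟩
      change F (h.symm ⟨z, hz⟩).1 = z
      rw [ei _ h1]; simp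

lemma arc_param0 {A : Set S} (h : (Ioo (0 : ℝ) 1) ≃ₜ A) {u w : S} (huw : u ≠ w) (hcl : closure A = A ∪ {u, w})
    (hu : u ∉ A) (hw : w ∉ A) :
    ∃ g : C(unitInterval, S), Function.Injective g ∧ ((g 0 = u ∧ g 1 = w) ∨ (g 0 = w ∧ g 1 = u)) ∧
      g '' Ioo 0 1 = A := by
  obtain ⟨a, ha, ha'⟩ := arc_end h huw hcl (fun ε => Ioo 0 ε) (fun ε h1 h2 => ⟨isPreconnected_Ioo, nonempty_Ioo.2 h1,
    Ioo_subset_Ioo_right (by linarith)⟩) (fun ε ε' h => Ioo_subset_Ioo_right h) (fun ε t ht h => by linarith [ht.2])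
  obtain ⟨b, hb, hb'⟩ := arc_end h huw hcl (fun ε => Ioo (1 - ε) 1) (fun ε h1 h2 => ⟨isPreconnected_Ioo, nonempty_Ioo.2 (by linarith),
    Ioo_subset_Ioo_left (by linarith)⟩) (fun ε ε' h => Ioo_subset_Ioo_left (by linarith)) (fun ε t ht h => by linarith [ht.1])
  have hab : a ≠ b := by
    rintro rfl
    obtain ⟨v, hv, hva⟩ : ∃ v, (v = u ∨ v = w) ∧ v ≠ a := by
      rcases ha with rfl | rfl
      · exact ⟨w, Or.inr rfl, huw.symm⟩
      · exact ⟨u, Or.inl rfl, huw⟩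
    obtain ⟨O1, O2, o1, o2, h1, h2, hdis⟩ := t2_separation hva
    obtain ⟨ε1, p1, q1, r1⟩ := ha' O2 o2 h2
    obtain ⟨ε2, p2, q2, r2⟩ := hb' O2 o2 h2
    have hcomp : IsCompact (hext h '' Icc ε1 (1 - ε2)) :=
      isCompact_Icc.image_of_continuousOn ((hext_cont h).mono (fun t ht => ⟨by linarith [ht.1], by linarith [ht.2]⟩))
    have hvn : v ∉ hext h '' Icc ε1 (1 - ε2) := by
      rintro ⟨t, ht, rfl⟩
      have ht' : t ∈ Ioo (0:ℝ) 1 := ⟨by linarith [ht.1], by linarith [ht.2]⟩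
      rw [hext_eq h ht'] at hv
      rcases hv with hv | hv
      · exact hu (hv ▸ (h _).2)
      · exact hw (hv ▸ (h _).2)
    have hvcl : v ∈ closure A := by
      rw [hcl]; right; simpa using hv
    obtain ⟨q, ⟨hq1, hq2⟩, hq3⟩ := mem_closure_iff.1 hvcl _ (o1.inter hcomp.isClosed.isOpen_compl) ⟨h1, hvn⟩
    have hq : q = hext h (h.symm ⟨q, hq3⟩) := by
      rw [hext_eq h (h.symm ⟨q, hq3⟩).2]; simp
    set t := (h.symm ⟨q, hq3⟩ : ℝ) with ht
    have ht' : t ∈ Ioo (0:ℝ) 1 := (h.symm ⟨q, hq3⟩).2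
    by_cases c1 : t < ε1
    · exact disjoint_left.1 hdis hq1 (hq ▸ r1 t ⟨ht'.1, c1⟩)
    by_cases c2 : 1 - ε2 < t
    · exact disjoint_left.1 hdis hq1 (hq ▸ r2 t ⟨c2, ht'.2⟩)
    · exact hq2 ⟨t, ⟨by linarith, by linarith⟩, hq.symm⟩
  have ta : Filter.Tendsto (hext h) (𝓝[>] 0) (𝓝 a) := by
    rw [tendsto_nhds]
    intro N hN haN
    obtain ⟨ε, hε, _, h1⟩ := ha' N hN haN
    filter_upwards [Ioo_mem_nhdsGT hε] with t ht using h1 t ht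
  have tb : Filter.Tendsto (hext h) (𝓝[<] 1) (𝓝 b) := by
    rw [tendsto_nhds]
    intro N hN haN
    obtain ⟨ε, hε, _, h1⟩ := hb' N hN haN
    filter_upwards [Ioo_mem_nhdsLT (show 1 - ε < 1 by linarith)] with t ht using h1 t ht
  exact arc_asm h hab ta tb (fun hh => by rcases ha with rfl | rfl
                                          · exact hu hh
                                          · exact hw hh) (fun hh => by rcases hb with rfl | rfl
                                                                       · exact hu hh
                                                                       · exact hw hh) (by
    rcases ha with rfl | rfl <;> rcases hb with rfl | rfl
    · exact absurd rfl hab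
    · exact Or.inl ⟨rfl, rfl⟩
    · exact Or.inr ⟨rfl, rfl⟩
    · exact absurd rfl hab)

lemma arc_param {A : Set S} (h : IsArc A) {u w : S} (huw : u ≠ w) (hcl : closure A = A ∪ {u, w})
    (hu : u ∉ A) (hw : w ∉ A) :
    ∃ g : C(unitInterval, S), Function.Injective g ∧ g 0 = u ∧ g 1 = w ∧ g '' Ioo 0 1 = A := by
  obtain ⟨h⟩ := h
  obtain ⟨g, hg, h1 | h1, h2⟩ := arc_param0 h huw hcl hu hw
  · exact ⟨g, hg, h1.1, h1.2, h2⟩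
  · refine ⟨g.comp ⟨unitInterval.symm, unitInterval.continuous_symm⟩, ?_, ?_, ?_, ?_⟩
    · exact hg.comp unitInterval.symm_bijective.injective
    · simp [h1.2]
    · simp [h1.1]
    · rw [← h2]
      ext z
      constructor
      · rintro ⟨t, ⟨a, b⟩, rfl⟩
        refine ⟨unitInterval.symm t, ⟨?_, ?_⟩, rfl⟩
        · rw [← Subtype.coe_lt_coe] at b ⊢; simp at b ⊢; exact b
        · rw [← Subtype.coe_lt_coe] at a ⊢; simp at a ⊢; exact a
      · rintro ⟨t, ⟨a, b⟩, rfl⟩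
        refine ⟨unitInterval.symm t, ⟨?_, ?_⟩, by simp⟩
        · rw [← Subtype.coe_lt_coe] at b ⊢; simp at b ⊢; exact b
        · rw [← Subtype.coe_lt_coe] at a ⊢; simp at a ⊢; exact a

end arcs
end PDG


namespace PDG
open scoped Classical
set_option linter.unusedSectionVars false
set_option linter.unusedSimpArgs false
set_option linter.unusedVariables false
set_option autoImplicit false
open TopP

/-- universal covering of the torus -/
def pr (z : ℂ) : Torus := ((z.re : Circle1), (z.im : Circle1))

lemma pr_cont : Continuous pr := by
  unfold pr
  exact ((AddCircle.continuous_mk' 1).comp Complex.continuous_re).prodMk ((AddCircle.continuous_mk' 1).comp Complex.continuous_im)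

lemma pr_open : IsOpenMap pr := by
  have h : IsOpenMap (Prod.map (fun x : ℝ => (x : Circle1)) (fun x : ℝ => (x : Circle1))) :=
    IsOpenMap.prodMap QuotientAddGroup.isOpenMap_coe QuotientAddGroup.isOpenMap_coe
  exact h.comp Complex.equivRealProdCLM.toHomeomorph.isOpenMap

lemma pr_surj : Function.Surjective pr := by
  rintro ⟨a, b⟩
  obtain ⟨x, rfl⟩ := QuotientAddGroup.mk_surjective a
  obtain ⟨y, rfl⟩ := QuotientAddGroup.mk_surjective b
  exact ⟨⟨x, y⟩, rfl⟩

lemma pr_add (z w : ℂ) : pr (z + w) = pr z + pr w := by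
  simp [pr]
lemma pr_sub (z w : ℂ) : pr (z - w) = pr z - pr w := by
  simp [pr]
lemma pr_neg (z : ℂ) : pr (- z) = - pr z := by
  simp [pr]
lemma pr_zero : pr 0 = 0 := by simp [pr]
lemma pr_eq {z w : ℂ} : pr z = pr w ↔ pr (z - w) = 0 := by rw [pr_sub, sub_eq_zero]
lemma pr_eq_zero {z : ℂ} : pr z = 0 ↔ ∃ m n : ℤ, z = m + n * Complex.I := by
  simp only [pr, Prod.mk_eq_zero, AddCircle.coe_eq_zero_iff]
  constructor
  · rintro ⟨⟨m, hm⟩, ⟨n, hn⟩⟩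
    refine ⟨m, n, ?_⟩
    apply Complex.ext <;> simp at * <;> simp [hm, hn]
  · rintro ⟨m, n, rfl⟩
    exact ⟨⟨m, by simp⟩, ⟨n, by simp⟩⟩
lemma pr_small {z : ℂ} (h : pr z = 0) (hz : ‖z‖ < 1) : z = 0 := by
  obtain ⟨m, n, rfl⟩ := pr_eq_zero.1 h
  have h1 := (Complex.abs_re_le_norm _).trans_lt hz
  have h2 := (Complex.abs_im_le_norm _).trans_lt hz
  simp at h1 h2
  have e1 : |m| < 1 := by exact_mod_cast h1
  have e2 : |n| < 1 := by exact_mod_cast h2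
  rw [Int.abs_lt_one_iff] at e1 e2
  simp [e1, e2]
def prHom : ℂ →+ Torus where
  toFun := pr
  map_zero' := pr_zero
  map_add' := pr_add

lemma pr_cov : IsCoveringMap pr := by
  have hq : IsQuotientMap prHom := pr_open.isQuotientMap pr_cont pr_surj
  refine (hq.isAddQuotientCoveringMap_of_isDiscrete_ker_addMonoidHom ?_).isCoveringMap
  constructor
  rw [discreteTopology_iff_isOpen_singleton_zero]
  have : ({0} : Set prHom.ker) = Subtype.val ⁻¹' Metric.ball (0 : ℂ) 1 := by
    ext ⟨z, hz⟩
    simp only [mem_singleton_iff, mem_preimage, Metric.mem_ball, dist_zero_right]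
    constructor
    · intro h; rw [Subtype.ext_iff] at h; simp at h; simp [h]
    · intro h; exact Subtype.ext (pr_small hz h)
  rw [this]
  exact Metric.isOpen_ball.preimage continuous_subtype_val

lemma pr_injOn (x : ℂ) {r : ℝ} (hr : r < 1/2) : InjOn pr (Metric.closedBall x r) := by
  intro z hz w hw h
  have := pr_small (pr_eq.1 h) (by
    rw [← dist_eq_norm]
    rw [Metric.mem_closedBall] at hz hw
    calc dist z w ≤ dist z x + dist w x := dist_triangle_right _ _ _
      _ < 1 := by linarith)
  exact sub_eq_zero.1 this
/-- local inverse -/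
lemma sec_cont {Q : Set ℂ} (hQ : IsCompact Q) (hi : InjOn pr Q) :
    ContinuousOn (Function.invFunOn pr Q) (pr '' Q) := by
  rw [continuousOn_iff_isClosed]
  intro t ht
  refine ⟨pr '' (t ∩ Q), ?_, ?_⟩
  · exact ((hQ.inter_left ht).image pr_cont).isClosed
  · ext y
    constructor
    · rintro ⟨h1, z, hz, rfl⟩
      have := hi.leftInvOn_invFunOn hz
      rw [mem_preimage, this] at h1
      exact ⟨⟨z, ⟨h1, hz⟩, rfl⟩, z, hz, rfl⟩
    · rintro ⟨⟨z, hz, rfl⟩, h2⟩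
      refine ⟨?_, h2⟩
      rw [mem_preimage, hi.leftInvOn_invFunOn hz.2]
      exact hz.1

lemma near_touch' {K O : Set ℂ} (hK : IsClosed K) {x : ℂ}
    {ε : ℝ} (hx : x ∈ O) (hxK : x ∈ K) (hb : Metric.ball x ε ∩ K ⊆ O) {q : ℂ} (hq : q ∈ Metric.ball x ε)
    (hqT : q ∉ K) : (closure (connectedComponentIn Kᶜ q) ∩ O).Nonempty := by
  by_contra hne
  set U := connectedComponentIn Kᶜ q with hU
  have hUo : IsOpen U := hK.isOpen_compl.connectedComponentIn
  have hcl : ∀ y ∈ Metric.ball x ε, y ∈ closure U → y ∈ U := by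
    intro y hy hyU
    by_cases hyT : y ∈ K
    · exact absurd ⟨y, hyU, hb ⟨hy, hyT⟩⟩ hne
    · exact cc_closure hK.isOpen_compl hyU hyT
  have hε : 0 < ε := Metric.pos_of_mem_ball hq
  have hpre : IsPreconnected (Metric.ball x ε) := (convex_ball x ε).isPreconnected
  have hsub : Metric.ball x ε ⊆ U := by
    refine hpre.subset_of_closure_inter_subset hUo ⟨q, hq, mem_connectedComponentIn hqT⟩ ?_
    rintro y ⟨h1, h2⟩
    exact hcl y h2 h1
  exact connectedComponentIn_subset _ _ (hsub (Metric.mem_ball_self hε)) hxK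

lemma loc0 {C : Set Torus} (g : C(unitInterval, Torus)) (hg : Function.Injective g)
    (hcl : IsClosed (C \ g '' Ioo 0 1)) (hsub : range g ⊆ C) {x : ℂ} {t0 : unitInterval} (ht0 : t0 ∈ Ioo 0 1)
    (hx : g t0 = pr x) : ∃ r : ℝ, 0 < r ∧ r < 1/2 ∧ ∃ (K' : Set ℂ) (α : C(unitInterval, ℂ)), IsCompact K' ∧
      Function.Injective α ∧ (∀ t, α t ∈ K' → t = 0 ∨ t = 1) ∧ α 0 ∈ K' ∧ α 1 ∈ K' ∧ x ∈ oarc α ∧ 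
      oarc α ⊆ pr ⁻¹' (g '' Ioo 0 1) ∧
      Metric.sphere x r ⊆ K' ∧ Metric.ball x r ∩ (K' ∪ range α) = Metric.ball x r ∩ pr ⁻¹' C := by
  have ht0' : pr x ∈ g '' Ioo 0 1 := ⟨t0, ht0, hx⟩
  have hO : IsOpen (pr ⁻¹' (C \ g '' Ioo 0 1)ᶜ) := hcl.isOpen_compl.preimage pr_cont
  obtain ⟨R, hR, hRb⟩ := Metric.isOpen_iff.1 hO x (fun h => h.2 ht0')
  set r : ℝ := min (R/2) (1/4) with hr
  have hr0 : 0 < r := lt_min (by linarith) (by norm_num)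
  have hr1 : r < 1/2 := (min_le_right _ _).trans_lt (by norm_num)
  have hrR : Metric.closedBall x r ⊆ Metric.ball x R :=
    Metric.closedBall_subset_ball ((min_le_left _ _).trans_lt (by linarith))
  have hcb : ∀ z ∈ Metric.closedBall x r, pr z ∈ C → pr z ∈ g '' Ioo 0 1 := by
    intro z hz hC
    by_contra h
    exact hRb (hrR hz) ⟨hC, h⟩
  set σ := Function.invFunOn pr (Metric.closedBall x r) with hσ
  have hQ := isCompact_closedBall x r
  have hinj := pr_injOn x hr1
  have hσc := sec_cont hQ hinj
  have hσl : ∀ z ∈ Metric.closedBall x r, σ (pr z) = z := fun z hz => hinj.leftInvOn_invFunOn hz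
  have hN : IsOpen (pr '' Metric.ball x r) := pr_open _ Metric.isOpen_ball
  have hF : IsClosed (g ⁻¹' (pr '' Metric.ball x r)ᶜ) := hN.isClosed_compl.preimage g.continuous
  have hxN : pr x ∈ pr '' Metric.ball x r := ⟨x, Metric.mem_ball_self hr0, rfl⟩
  have hends : ∀ t : unitInterval, t = 0 ∨ t = 1 → g t ∉ pr '' Metric.closedBall x r := by
    rintro t ht ⟨z, hz, hzt⟩
    have := hcb z hz (hzt ▸ hsub ⟨t, rfl⟩)
    rw [hzt] at this
    obtain ⟨s, hs, hst⟩ := this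
    rw [hg hst] at hs
    rcases ht with rfl | rfl
    · exact lt_irrefl _ hs.1
    · exact lt_irrefl _ hs.2
  have hends' : ∀ t : unitInterval, t = 0 ∨ t = 1 → g t ∉ pr '' Metric.ball x r :=
    fun t ht h => hends t ht (image_mono Metric.ball_subset_closedBall h)
  obtain ⟨s1, ⟨hs1, hs1'⟩, hs1m⟩ := (hF.inter (isClosed_Iic (a := t0))).isCompact.exists_isGreatest ⟨0, hends' 0 (Or.inl rfl), t0.2.1⟩
  obtain ⟨s2, ⟨hs2, hs2'⟩, hs2m⟩ := (hF.inter (isClosed_Ici (a := t0))).isCompact.exists_isLeast ⟨1, hends' 1 (Or.inr rfl), t0.2.2⟩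
  have n1 : s1 ≠ t0 := by rintro rfl; exact hs1 (hx ▸ hxN)
  have n2 : s2 ≠ t0 := by rintro rfl; exact hs2 (hx ▸ hxN)
  have l1 : s1 < t0 := lt_of_le_of_ne hs1' n1
  have l2 : t0 < s2 := lt_of_le_of_ne hs2' n2.symm
  have hin : ∀ t, s1 < t → t < s2 → g t ∈ pr '' Metric.ball x r := by
    intro t h1 h2
    by_contra h
    rcases le_total t t0 with h3 | h3
    · exact absurd (hs1m ⟨h, h3⟩) (not_le.2 h1)
    · exact absurd (hs2m ⟨h, h3⟩) (not_le.2 h2)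
  have hclo : ∀ t ∈ Icc s1 s2, g t ∈ pr '' Metric.closedBall x r := by
    have hc : IsClosed (g ⁻¹' (pr '' Metric.closedBall x r)) := (hQ.image pr_cont).isClosed.preimage g.continuous
    have : closure (Ioo s1 s2) ⊆ g ⁻¹' (pr '' Metric.closedBall x r) :=
      closure_minimal (fun t ht => image_mono Metric.ball_subset_closedBall (hin t ht.1 ht.2)) hc
    rwa [closure_Ioo (l1.trans l2).ne] at this
  -- affine parametrization
  have haff : ∀ t : unitInterval, s1.1 + t.1 * (s2.1 - s1.1) ∈ unitInterval := by
    intro t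
    have := t.2.1; have := t.2.2; have h1 := s1.2.1; have h2 := s2.2.2
    have h3 : s1.1 < s2.1 := l1.trans l2
    exact ⟨by nlinarith, by nlinarith⟩
  set β : unitInterval → unitInterval := fun t => ⟨s1.1 + t.1 * (s2.1 - s1.1), haff t⟩ with hβ
  have h3 : s1.1 < s2.1 := l1.trans l2
  have hβc : Continuous β := by fun_prop
  have hβi : Function.Injective β := by
    intro a b hab
    have := congrArg Subtype.val hab
    simp only [hβ] at this
    have h4 : (a.1 - b.1) * (s2.1 - s1.1) = 0 := by linarith
    rcases mul_eq_zero.1 h4 with h | h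
    · exact Subtype.ext (by linarith)
    · linarith
  have hβm : ∀ t, β t ∈ Icc s1 s2 := by
    intro t
    have := t.2.1; have := t.2.2
    exact ⟨by rw [← Subtype.coe_le_coe]; simp only [hβ]; nlinarith, by rw [← Subtype.coe_le_coe]; simp only [hβ]; nlinarith⟩
  have hβo : ∀ t, t ≠ 0 → t ≠ 1 → s1 < β t ∧ β t < s2 := by
    intro t h0 h1
    have a0 : β 0 = s1 := Subtype.ext (by simp [hβ])
    have a1 : β 1 = s2 := Subtype.ext (by simp [hβ])
    exact ⟨lt_of_le_of_ne (hβm t).1 (fun h => h0 (hβi (a0.trans h)).symm), lt_of_le_of_ne (hβm t).2 (fun h => h1 (hβi (h.trans a1.symm)))⟩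
  have hβs : ∀ t ∈ Icc s1 s2, ∃ s, β s = t := by
    intro t ht
    have e1 : s1.1 ≤ t.1 := ht.1
    have e2 : t.1 ≤ s2.1 := ht.2
    refine ⟨⟨(t.1 - s1.1) / (s2.1 - s1.1), div_nonneg (by linarith) (by linarith), (div_le_one (by linarith)).2 (by linarith)⟩, Subtype.ext ?_⟩
    simp only [hβ]
    have : s2.1 - s1.1 ≠ 0 := by linarith
    field_simp
    ring
  have hpα : ∀ t, pr (σ (g (β t))) = g (β t) := by
    intro t
    obtain ⟨z, hz, hzt⟩ := hclo _ (hβm t)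
    rw [← hzt, hσl z hz]
  have hαm : ∀ t, σ (g (β t)) ∈ Metric.closedBall x r := by
    intro t
    obtain ⟨z, hz, hzt⟩ := hclo _ (hβm t)
    rw [← hzt, hσl z hz]; exact hz
  have hαo : ∀ t, t ≠ 0 → t ≠ 1 → σ (g (β t)) ∈ Metric.ball x r := by
    intro t h0 h1
    obtain ⟨z, hz, hzt⟩ := hin _ (hβo t h0 h1).1 (hβo t h0 h1).2
    rw [← hzt, hσl z (Metric.ball_subset_closedBall hz)]; exact hz
  have hαc : Continuous (fun t => σ (g (β t))) :=
    hσc.comp_continuous (g.continuous.comp hβc) (fun t => hclo _ (hβm t))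
  set α : C(unitInterval, ℂ) := ⟨fun t => σ (g (β t)), hαc⟩ with hα
  have hαv : ∀ t, α t = σ (g (β t)) := fun t => rfl
  have hsph : ∀ t, g (β t) ∉ pr '' Metric.ball x r → α t ∈ Metric.sphere x r := by
    intro t h
    have h1 := hαm t
    rw [Metric.mem_closedBall] at h1
    rw [Metric.mem_sphere]
    refine le_antisymm h1 (not_lt.1 fun h2 => h ⟨α t, Metric.mem_ball.2 h2, hpα t⟩)
  have b0 : β 0 = s1 := Subtype.ext (by simp [hβ])
  have b1 : β 1 = s2 := Subtype.ext (by simp [hβ])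
  refine ⟨r, hr0, hr1, Metric.sphere x r ∪ (Metric.closedBall x r ∩ pr ⁻¹' (g '' (Iic s1 ∪ Ici s2))), α, ?_, ?_, ?_, ?_, ?_, ?_, ?_, subset_union_left, ?_⟩
  · refine (isCompact_sphere x r).union (hQ.inter_right ?_)
    exact (((isClosed_Iic.union isClosed_Ici).isCompact.image g.continuous).isClosed).preimage pr_cont
  · intro a b hab
    apply hβi; apply hg
    exact (hpα a).symm.trans ((congrArg pr hab).trans (hpα b))
  · intro t ht
    by_contra hne
    push Not at hne
    rcases ht with ht | ⟨_, s, hs, hst⟩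
    · have := hαo t hne.1 hne.2
      rw [Metric.mem_ball] at this
      rw [Metric.mem_sphere] at ht
      exact this.ne ht
    · rw [hαv, hpα] at hst
      rw [hg hst] at hs
      rcases hs with hs | hs
      · exact absurd (hβo t hne.1 hne.2).1 (not_lt.2 hs)
      · exact absurd (hβo t hne.1 hne.2).2 (not_lt.2 hs)
  · left; apply hsph; rw [b0]; exact hs1
  · left; apply hsph; rw [b1]; exact hs2
  · obtain ⟨s, hs⟩ := hβs t0 ⟨l1.le, l2.le⟩
    refine ⟨s, ⟨lt_of_le_of_ne s.2.1 ?_, lt_of_le_of_ne s.2.2 ?_⟩, ?_⟩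
    · intro h; have : s = 0 := h.symm
      rw [this, b0] at hs; exact n1 hs
    · intro h; have : s = 1 := h
      rw [this, b1] at hs; exact n2 hs
    · rw [hαv, hs, hx]
      exact hσl x (Metric.mem_closedBall_self hr0.le)
  · rintro _ ⟨t, ⟨h0, h1⟩, rfl⟩
    rw [mem_preimage, hαv, hpα]
    refine ⟨β t, ⟨?_, ?_⟩, rfl⟩
    · exact lt_of_le_of_lt s1.2.1 (hβo t h0.ne' h1.ne).1
    · exact lt_of_lt_of_le (hβo t h0.ne' h1.ne).2 s2.2.2
  · ext z
    constructor
    · rintro ⟨hz, (h | ⟨_, s, _, hs⟩) | ⟨t, rfl⟩⟩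
      · rw [Metric.mem_ball] at hz; rw [Metric.mem_sphere] at h; exact absurd h hz.ne
      · exact ⟨hz, by rw [mem_preimage, ← hs]; exact hsub ⟨s, rfl⟩⟩
      · refine ⟨hz, ?_⟩
        rw [mem_preimage, hαv, hpα]; exact hsub ⟨_, rfl⟩
    · rintro ⟨hz, hC⟩
      refine ⟨hz, ?_⟩
      have hz' := Metric.ball_subset_closedBall hz
      obtain ⟨s, hs, hsz⟩ := hcb z hz' hC
      by_cases hs' : s ∈ Icc s1 s2
      · right
        obtain ⟨u, hu⟩ := hβs s hs'
        exact ⟨u, by rw [hαv, hu, hsz, hσl z hz']⟩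
      · left; right
        refine ⟨hz', s, ?_, hsz⟩
        by_cases h : s ≤ s1
        · exact Or.inl h
        · right
          by_contra h'
          exact hs' ⟨(not_le.1 h).le, (not_le.1 h').le⟩

theorem loc {C : Set Torus} (g : C(unitInterval, Torus)) (hg : Function.Injective g)
    (hcl : IsClosed (C \ g '' Ioo 0 1)) (hsub : range g ⊆ C) {y : Torus} (hy : y ∈ g '' Ioo 0 1)
    {a b : Torus} (ha : a ∉ C) (hb : b ∉ C) (hab : connectedComponentIn Cᶜ a ≠ connectedComponentIn Cᶜ b)
    (hya : y ∈ closure (connectedComponentIn Cᶜ a)) (hyb : y ∈ closure (connectedComponentIn Cᶜ b)) :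
    ∃ N, IsOpen N ∧ y ∈ N ∧ N ⊆ connectedComponentIn Cᶜ a ∪ connectedComponentIn Cᶜ b ∪ g '' Ioo 0 1 := by
  obtain ⟨t0, ht0, rfl⟩ := hy
  obtain ⟨x, hx⟩ := pr_surj (g t0)
  obtain ⟨r, hr0, hr1, K', α, hK', hα, hd, h0, h1, hxo, hoA, hsph, hball⟩ := loc0 g hg hcl hsub ht0 hx.symm
  have hKc : IsClosed (K' ∪ range α) := (hK'.union (isCompact_range α.continuous)).isClosed
  have hxK : x ∉ K' := by
    obtain ⟨t, ⟨q1, q2⟩, rfl⟩ := hxo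
    intro h
    rcases hd t h with rfl | rfl
    · exact lt_irrefl _ q1
    · exact lt_irrefl _ q2
  obtain ⟨ε0, hε0, hb0⟩ := Metric.isOpen_iff.1 hK'.isClosed.isOpen_compl x hxK
  set ε := min ε0 r with hε
  have hεp : 0 < ε := lt_min hε0 hr0
  have hbε : Metric.ball x ε ⊆ K'ᶜ := (Metric.ball_subset_ball (min_le_left _ _)).trans hb0
  have hbr : Metric.ball x ε ⊆ Metric.ball x r := Metric.ball_subset_ball (min_le_right _ _)
  have hbo : Metric.ball x ε ∩ (K' ∪ range α) ⊆ oarc α := by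
    rintro z ⟨hz, h | h⟩
    · exact absurd h (hbε hz)
    · rcases oarc_cases α h with h | rfl | rfl
      · exact h
      · exact absurd h0 (hbε hz)
      · exact absurd h1 (hbε hz)
  have hxKK : x ∈ K' ∪ range α := Or.inr (oarc_sub _ hxo)
  have hnotC : ∀ q ∈ Metric.ball x r, pr q ∉ C → q ∉ K' ∪ range α := by
    intro q hq hC h
    have : q ∈ Metric.ball x r ∩ (K' ∪ range α) := ⟨hq, h⟩
    rw [hball] at this
    exact hC this.2
  have hcomp : ∀ q ∈ Metric.ball x r, pr q ∉ C → 
      pr '' connectedComponentIn (K' ∪ range α)ᶜ q ⊆ connectedComponentIn Cᶜ (pr q) := by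
    intro q hq hC
    have hqn := hnotC q hq hC
    have hin : connectedComponentIn (K' ∪ range α)ᶜ q ⊆ Metric.ball x r := by
      refine isPreconnected_connectedComponentIn.subset_of_closure_inter_subset Metric.isOpen_ball ⟨q, mem_connectedComponentIn hqn, hq⟩ ?_
      rintro z ⟨hz1, hz2⟩
      have hz1 := Metric.closure_ball_subset_closedBall hz1
      by_contra hn
      have : z ∈ Metric.sphere x r := by
        rw [Metric.mem_sphere]; exact le_antisymm hz1 (not_lt.1 hn)
      exact connectedComponentIn_subset _ _ hz2 (Or.inl (hsph this))
    refine (isPreconnected_connectedComponentIn.image _ pr_cont.continuousOn).subset_connectedComponentIn ⟨q, mem_connectedComponentIn hqn, rfl⟩ ?_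
    rintro _ ⟨z, hz, rfl⟩ hzC
    have : z ∈ Metric.ball x r ∩ pr ⁻¹' C := ⟨hin hz, hzC⟩
    rw [← hball] at this
    exact connectedComponentIn_subset _ _ hz this.2
  have hNo : IsOpen (pr '' Metric.ball x ε) := pr_open _ Metric.isOpen_ball
  have hyN : g t0 ∈ pr '' Metric.ball x ε := ⟨x, Metric.mem_ball_self hεp, hx⟩
  obtain ⟨_, ⟨q1, hq1, rfl⟩, hq1a⟩ := mem_closure_iff.1 hya _ hNo hyN
  obtain ⟨_, ⟨q2, hq2, rfl⟩, hq2b⟩ := mem_closure_iff.1 hyb _ hNo hyN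
  have hq1C : pr q1 ∉ C := connectedComponentIn_subset _ _ hq1a
  have hq2C : pr q2 ∉ C := connectedComponentIn_subset _ _ hq2b
  have ea := connectedComponentIn_eq hq1a
  have eb := connectedComponentIn_eq hq2b
  refine ⟨_, hNo, hyN, ?_⟩
  rintro _ ⟨q, hq, rfl⟩
  by_cases hqC : pr q ∈ C
  · right
    have : q ∈ Metric.ball x r ∩ pr ⁻¹' C := ⟨hbr hq, hqC⟩
    rw [← hball] at this
    exact hoA (hbo ⟨hq, this.2⟩)
  · left
    have m : ∀ q' ∈ Metric.ball x ε, pr q' ∉ C → _ := fun q' hq' hC => 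
      near_touch' hKc hxo hxKK hbo hq' (hnotC q' (hbr hq') hC)
    have pick : ∀ q1 ∈ Metric.ball x ε, ∀ q2 ∈ Metric.ball x ε, pr q1 ∉ C → pr q2 ∉ C → 
        connectedComponentIn (K' ∪ range α)ᶜ q1 = connectedComponentIn (K' ∪ range α)ᶜ q2 →
        connectedComponentIn Cᶜ (pr q1) = connectedComponentIn Cᶜ (pr q2) := by
      intro q1 h1 q2 h2 h1C h2C he
      have := hcomp q1 (hbr h1) h1C ⟨q2, he ▸ mem_connectedComponentIn (hnotC q2 (hbr h2) h2C), rfl⟩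
      exact connectedComponentIn_eq this
    rcases lemmaE hK' α hα hd h0 h1 q1 q2 q (hnotC _ (hbr hq1) hq1C) (hnotC _ (hbr hq2) hq2C) (hnotC _ (hbr hq) hqC)
      (m q1 hq1 hq1C) (m q2 hq2 hq2C) (m q hq hqC) with h | h | h
    · exact absurd (ea.trans ((pick q1 hq1 q2 hq2 hq1C hq2C h).trans eb.symm)) hab
    · left; rw [ea, pick q1 hq1 q hq hq1C hqC h]; exact mem_connectedComponentIn hqC
    · right; rw [eb, pick q2 hq2 q hq hq2C hqC h]; exact mem_connectedComponentIn hqC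

end PDG


namespace PDG
open scoped Classical
set_option linter.unusedSectionVars false
set_option linter.unusedSimpArgs false
set_option linter.unusedVariables false
set_option autoImplicit false
open TopP

section ar
variable {X : Type} [TopologicalSpace X] (δ : C(Circle1, X))

def ar (a L : ℝ) : C(unitInterval, X) :=
  ⟨fun t => δ ((a + L * t.1 : ℝ) : Circle1), δ.continuous.comp ((AddCircle.continuous_mk' 1).comp (by fun_prop))⟩

lemma ar_app (a L : ℝ) (t : unitInterval) : ar δ a L t = δ ((a + L * t.1 : ℝ) : Circle1) := rfl

lemma coe_c1 {x y : ℝ} : (x : Circle1) = (y : Circle1) ↔ ∃ n : ℤ, y - x = n := by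
  rw [eq_comm, ← sub_eq_zero, ← AddCircle.coe_sub, AddCircle.coe_eq_zero_iff]
  constructor
  · rintro ⟨n, h⟩; exact ⟨n, by simpa using h.symm⟩
  · rintro ⟨n, h⟩; exact ⟨n, by simpa using h.symm⟩

lemma ar_inj (hδ : Function.Injective δ) {a L : ℝ} (h0 : 0 < L) (h1 : L < 1) : Function.Injective (ar δ a L) := by
  intro s t hst
  obtain ⟨n, hn⟩ := coe_c1.1 (hδ hst)
  have h2 : (n : ℝ) = L * (t.1 - s.1) := by linarith
  have := s.2.1; have := s.2.2; have := t.2.1; have := t.2.2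
  have h3 : (n : ℝ) < 1 := by nlinarith
  have h4 : (-1 : ℝ) < n := by nlinarith
  have h5 : n = 0 := by
    have : n < 1 := by exact_mod_cast h3
    have : -1 < n := by exact_mod_cast h4
    omega
  rw [h5] at h2
  have h6 : t.1 - s.1 = 0 := by
    rcases mul_eq_zero.1 (show L * (t.1 - s.1) = 0 by rw [← h2]; simp) with h | h
    · linarith
    · exact h
  exact Subtype.ext (by linarith)

lemma ar_disj (hδ : Function.Injective δ) {a L : ℝ} (h0 : 0 < L) (h1 : L < 1) (t : unitInterval)
    (h : ar δ a L t ∈ range (ar δ (a + L) (1 - L))) : t = 0 ∨ t = 1 := by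
  obtain ⟨s, hs⟩ := h
  obtain ⟨n, hn⟩ := coe_c1.1 (hδ hs)
  have := s.2.1; have := s.2.2; have := t.2.1; have := t.2.2
  have h2 : (n : ℝ) = - (L * (1 - t.1) + (1 - L) * s.1) := by linarith
  have e1 : 0 ≤ L * (1 - t.1) := by nlinarith
  have e2 : L * (1 - t.1) ≤ L := by nlinarith
  have e3 : 0 ≤ (1 - L) * s.1 := by nlinarith
  have e4 : (1 - L) * s.1 ≤ 1 - L := by nlinarith
  have h3 : n = 0 ∨ n = -1 := by
    have h3 : (n : ℝ) ≤ 0 := by linarith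
    have h4 : (-1 : ℝ) ≤ n := by linarith
    have : n ≤ 0 := by exact_mod_cast h3
    have : -1 ≤ n := by exact_mod_cast h4
    omega
  rcases h3 with rfl | rfl
  · right
    have : L * (1 - t.1) = 0 := by push_cast at h2; linarith
    rcases mul_eq_zero.1 this with h | h
    · linarith
    · exact Subtype.ext (show t.1 = _ by first | exact h | (change t.1 = 1; linarith))
  · left
    have : L * t.1 = 0 := by push_cast at h2; linarith
    rcases mul_eq_zero.1 this with h | h
    · linarith
    · exact Subtype.ext (show t.1 = _ by first | exact h | (change t.1 = 1; linarith))

lemma ar_cover {a L : ℝ} (h0 : 0 < L) (h1 : L < 1) : range (ar δ (a + L) (1 - L)) ∪ range (ar δ a L) = range δ := by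
  ext z
  constructor
  · rintro (⟨t, rfl⟩ | ⟨t, rfl⟩) <;> exact ⟨_, rfl⟩
  · rintro ⟨θ, rfl⟩
    obtain ⟨x, rfl⟩ := QuotientAddGroup.mk_surjective θ
    have e : ((x : ℝ) : Circle1) = ((a + Int.fract (x - a) : ℝ) : Circle1) := by
      rw [coe_c1]
      exact ⟨-⌊x - a⌋, by rw [Int.fract]; push_cast; ring⟩
    have f0 := Int.fract_nonneg (x - a)
    have f1 := (Int.fract_lt_one (x - a)).le
    change δ ((x : ℝ) : Circle1) ∈ _
    rw [e]
    by_cases h : Int.fract (x - a) ≤ L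
    · right
      refine ⟨⟨Int.fract (x - a) / L, by positivity, (div_le_one h0).2 h⟩, ?_⟩
      rw [ar_app]
      change δ ((a + L * (Int.fract (x - a) / L) : ℝ) : Circle1) = _
      rw [mul_div_cancel₀ _ h0.ne']
    · left
      push Not at h
      have h2 : 0 < 1 - L := by linarith
      refine ⟨⟨(Int.fract (x - a) - L) / (1 - L), div_nonneg (by linarith) h2.le, (div_le_one h2).2 (by linarith)⟩, ?_⟩
      rw [ar_app]
      change δ ((a + L + (1 - L) * ((Int.fract (x - a) - L) / (1 - L)) : ℝ) : Circle1) = _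
      rw [mul_div_cancel₀ _ h2.ne']
      congr 2
      ring

lemma ar_ends (a L : ℝ) : ar δ (a + L) (1 - L) 0 = ar δ a L 1 ∧ ar δ (a + L) (1 - L) 1 = ar δ a L 0 := by
  constructor
  · rw [ar_app, ar_app]; simp
  · rw [ar_app, ar_app]; congr 1
    rw [coe_c1]
    exact ⟨-1, by simp⟩

lemma ar_diff (hδ : Function.Injective δ) {a L : ℝ} (h0 : 0 < L) (h1 : L < 1) :
    range δ \ ar δ a L '' Ioo 0 1 = range (ar δ (a + L) (1 - L)) := by
  ext z
  constructor
  · rintro ⟨h, h'⟩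
    rw [← ar_cover δ h0 h1, range_eq_I (ar δ a L)] at h
    obtain ⟨e1, e2⟩ := ar_ends δ a L
    rcases h with h | h | rfl | h
    · exact h
    · exact absurd h h'
    · exact ⟨1, e2⟩
    · rw [mem_singleton_iff.1 h]; exact ⟨0, e1⟩
  · intro h
    refine ⟨by rw [← ar_cover δ h0 h1]; exact Or.inl h, ?_⟩
    rintro ⟨t, ⟨t0, t1⟩, rfl⟩
    rcases ar_disj δ hδ h0 h1 t h with rfl | rfl
    · exact lt_irrefl _ t0
    · exact lt_irrefl _ t1

end ar

/-- Jordan data -/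
structure JD (J D O : Set ℂ) : Prop where
  Do : IsOpen D
  Oo : IsOpen O
  Dp : IsPreconnected D
  Op : IsPreconnected O
  Db : Bornology.IsBounded D
  Ob : ¬ Bornology.IsBounded O
  Dn : D.Nonempty
  cov : D ∪ O = Jᶜ
  disj : D ∩ O = ∅
  Dc : J ⊆ closure D
  Oc : J ⊆ closure O
  Jc : IsCompact J

theorem jc (δ : C(Circle1, ℂ)) (hδ : Function.Injective δ) : ∃ D O, JD (range δ) D O := by
  have key : ∀ a L : ℝ, 0 < L → L < 1 → 
     (∀ c ∉ range δ, (closure (connectedComponentIn (range δ)ᶜ c) ∩ oarc (ar δ a L)).Nonempty) ∧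
      ∃ a b, a ∉ range δ ∧ b ∉ range δ ∧
      Bornology.IsBounded (connectedComponentIn (range δ)ᶜ a) ∧
      ¬ Bornology.IsBounded (connectedComponentIn (range δ)ᶜ b) ∧
      ∀ c ∉ range δ, connectedComponentIn (range δ)ᶜ c = connectedComponentIn (range δ)ᶜ a ∨
        connectedComponentIn (range δ)ᶜ c = connectedComponentIn (range δ)ᶜ b := by
    intro a L h0 h1
    have := jordan (B := range (ar δ (a + L) (1 - L))) (isCompact_range (ContinuousMap.continuous _))
      (acyc_arc _ (ar_inj δ hδ (by linarith) (by linarith))) (ar δ a L) (ar_inj δ hδ h0 h1)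
      (ar_disj δ hδ h0 h1) (by
        obtain ⟨e1, e2⟩ := ar_ends δ a L
        rw [← e1, ← e2]
        let γ : Path (ar δ (a + L) (1 - L) 0) (ar δ (a + L) (1 - L) 1) := ⟨ar δ (a + L) (1 - L), rfl, rfl⟩
        exact JoinedIn.symm ⟨γ, fun t => ⟨t, rfl⟩⟩)
    rw [ar_cover δ h0 h1] at this
    exact this
  obtain ⟨-, a, b, ha, hb, hab, hbb, hall⟩ := key 0 (1/2) (by norm_num) (by norm_num)
  have hJ : IsCompact (range δ) := isCompact_range δ.continuous
  have ho : IsOpen (range δ)ᶜ := hJ.isClosed.isOpen_compl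
  have hcl : ∀ c ∉ range δ, range δ ⊆ closure (connectedComponentIn (range δ)ᶜ c) := by
    rintro c hc _ ⟨θ, rfl⟩
    rw [mem_closure_iff]
    intro N hN hθ
    obtain ⟨x, rfl⟩ := QuotientAddGroup.mk_surjective θ
    have hcont : Continuous (fun y : ℝ => δ (y : Circle1)) := δ.continuous.comp (AddCircle.continuous_mk' 1)
    obtain ⟨ε, hε, hb⟩ := Metric.isOpen_iff.1 (hN.preimage hcont) x hθ
    obtain ⟨y, hy1, t, ht, rfl⟩ := (key x (min (ε/2) (1/2)) (lt_min (by linarith) (by norm_num)) ((min_le_right _ _).trans_lt (by norm_num))).1 c hc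
    obtain ⟨w, hw⟩ := mem_closure_iff.1 hy1 N hN (by
      apply hb
      rw [Metric.mem_ball, Real.dist_eq]
      have := t.2.1; have := t.2.2
      have h1 : 0 < min (ε/2) (1/2) := lt_min (by linarith) (by norm_num)
      have h2 : min (ε/2) (1/2) ≤ ε/2 := min_le_left _ _
      rw [add_sub_cancel_left, abs_of_nonneg (by positivity)]
      nlinarith)
    exact ⟨w, hw⟩
  have hne : connectedComponentIn (range δ)ᶜ a ≠ connectedComponentIn (range δ)ᶜ b := fun h => hbb (h ▸ hab)
  refine ⟨connectedComponentIn (range δ)ᶜ a, connectedComponentIn (range δ)ᶜ b, ho.connectedComponentIn,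
    ho.connectedComponentIn, isPreconnected_connectedComponentIn, isPreconnected_connectedComponentIn,
    hab, hbb, ⟨a, mem_connectedComponentIn ha⟩, ?_, ?_, hcl a ha, hcl b hb, hJ⟩
  · apply Subset.antisymm
    · exact union_subset (connectedComponentIn_subset _ _) (connectedComponentIn_subset _ _)
    · intro c hc
      rcases hall c hc with h | h
      · left; rw [← h]; exact mem_connectedComponentIn hc
      · right; rw [← h]; exact mem_connectedComponentIn hc
  · rw [eq_empty_iff_forall_notMem]
    rintro z ⟨h1, h2⟩
    exact hne ((connectedComponentIn_eq h1).trans (connectedComponentIn_eq h2).symm)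

namespace JD
variable {J D O : Set ℂ} (h : JD J D O)
include h
lemma DJ : D ∩ J = ∅ := by
  rw [eq_empty_iff_forall_notMem]
  rintro z ⟨h1, h2⟩
  have : z ∈ Jᶜ := h.cov ▸ Or.inl h1
  exact this h2
lemma OJ : O ∩ J = ∅ := by
  rw [eq_empty_iff_forall_notMem]
  rintro z ⟨h1, h2⟩
  have : z ∈ Jᶜ := h.cov ▸ Or.inr h1
  exact this h2
lemma tri (z : ℂ) : z ∈ D ∨ z ∈ J ∨ z ∈ O := by
  by_cases hz : z ∈ J
  · exact Or.inr (Or.inl hz)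
  · have : z ∈ D ∪ O := h.cov ▸ hz
    rcases this with h | h
    · exact Or.inl h
    · exact Or.inr (Or.inr h)
lemma clD : closure D = D ∪ J := by
  apply Subset.antisymm
  · intro z hz
    rcases h.tri z with h1 | h1 | h1
    · exact Or.inl h1
    · exact Or.inr h1
    · obtain ⟨w, hw1, hw2⟩ := mem_closure_iff.1 hz O h.Oo h1
      exact absurd (show w ∈ D ∩ O from ⟨hw2, hw1⟩) (by rw [h.disj]; simp)
  · exact union_subset subset_closure h.Dc
lemma cpt : IsCompact (D ∪ J) := by
  rw [← h.clD]
  exact h.Db.isCompact_closure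
/-- a connected set avoiding J -/
lemma side {S : Set ℂ} (hS : IsPreconnected S) (hd : S ∩ J = ∅) : S ⊆ D ∨ S ⊆ O := by
  refine isPreconnected_iff_subset_of_disjoint.1 hS D O h.Do h.Oo ?_ ?_
  · intro z hz
    rcases h.tri z with h1 | h1 | h1
    · exact Or.inl h1
    · exact absurd (show z ∈ S ∩ J from ⟨hz, h1⟩) (by rw [hd]; simp)
    · exact Or.inr h1
  · rw [h.disj, inter_empty]
end JD
end PDG


namespace PDG
open scoped Classical
set_option linter.unusedSectionVars false
set_option linter.unusedSimpArgs false
set_option linter.unusedVariables false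
set_option autoImplicit false
open TopP

lemma bdd_shift {Q : Set ℂ} (hb : Bornology.IsBounded Q) (hn : Q.Nonempty) {s : ℂ} (h : ∀ q ∈ Q, q + s ∈ Q) : s = 0 := by
  obtain ⟨q, hq⟩ := hn
  by_contra hs
  have hit : ∀ n : ℕ, q + n * s ∈ Q := by
    intro n
    induction n with
    | zero => simpa using hq
    | succ n ih => have := h _ ih; push_cast; convert this using 1; ring
  obtain ⟨R, hR⟩ := hb.exists_norm_le
  have hs' : 0 < ‖s‖ := norm_pos_iff.2 hs
  obtain ⟨n, hn⟩ := exists_nat_gt ((R + ‖q‖) / ‖s‖)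
  have h1 := hR _ (hit n)
  have h2 : ‖(n : ℂ) * s‖ = n * ‖s‖ := by simp
  have h3 : ‖(n : ℂ) * s‖ ≤ ‖q + n * s‖ + ‖q‖ := by
    have := norm_sub_le (q + n * s) q
    simpa using this
  rw [div_lt_iff₀ hs'] at hn
  linarith

/-- shift of Jordan disc -/
lemma JD.shift {J D O : Set ℂ} (h : JD J D O) (hJp : IsPreconnected J) (hJn : J.Nonempty)
    (hdis : ∀ s, pr s = 0 → s ≠ 0 → ∀ z ∈ J, z + s ∉ J) : InjOn pr (D ∪ J) := by
  have im : ∀ (S : Set ℂ) (s : ℂ), IsPreconnected S → IsPreconnected ((fun z => z + s) '' S) :=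
    fun S s hS => hS.image _ (by fun_prop)
  have hO' : ∀ z ∈ O, z ∉ D ∪ J := by
    rintro z hz (h1 | h1)
    · exact absurd (show z ∈ D ∩ O from ⟨h1, hz⟩) (by rw [h.disj]; simp)
    · exact absurd (show z ∈ O ∩ J from ⟨hz, h1⟩) (by rw [h.OJ]; simp)
  have A : ∀ s, pr s = 0 → s ≠ 0 → (fun z => z + s) '' J ⊆ O := by
    intro s hs hs0
    rcases h.side (im J s hJp) (by
      rw [eq_empty_iff_forall_notMem]
      rintro _ ⟨⟨z, hz, rfl⟩, h2⟩
      exact hdis s hs hs0 z hz h2) with h1 | h1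
    · exfalso
      rcases h.side (im O (-s) h.Op) (by
        rw [eq_empty_iff_forall_notMem]
        rintro _ ⟨⟨z, hz, rfl⟩, h2⟩
        have := h1 ⟨_, h2, rfl⟩
        simp at this
        exact hO' z hz (Or.inl this)) with h2 | h2
      · apply h.Ob
        have : O ⊆ (fun z => z + s) '' D := by
          intro z hz
          exact ⟨z + -s, h2 ⟨z, hz, rfl⟩, by simp⟩
        refine Bornology.IsBounded.subset ?_ this
        have := h.Db.isCompact_closure.image (f := fun z => z + s) (by fun_prop)
        exact this.isBounded.subset (image_mono subset_closure)
      · apply hs0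
        refine bdd_shift h.cpt.isBounded (hJn.mono subset_union_right) (fun q hq => ?_)
        rcases h.tri (q + s) with h3 | h3 | h3
        · exact Or.inl h3
        · exact Or.inr h3
        · have := h2 ⟨_, h3, rfl⟩
          simp at this
          exact absurd hq (hO' q this)
    · exact h1
  have B : ∀ s, pr s = 0 → s ≠ 0 → (fun z => z + s) '' D ⊆ O := by
    intro s hs hs0
    rcases h.side (im D s h.Dp) (by
      rw [eq_empty_iff_forall_notMem]
      rintro _ ⟨⟨z, hz, rfl⟩, h2⟩
      have := A (-s) (by rw [pr_neg, hs, neg_zero]) (neg_ne_zero.2 hs0) ⟨_, h2, rfl⟩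
      simp at this
      exact hO' z this (Or.inl hz)) with h1 | h1
    · exact absurd (bdd_shift h.Db h.Dn (fun q hq => h1 ⟨q, hq, rfl⟩)) hs0
    · exact h1
  intro z hz w hw hzw
  by_contra hne
  have hs : pr (z - w) = 0 := pr_eq.1 hzw
  have hs0 : z - w ≠ 0 := sub_ne_zero.2 hne
  have : z ∈ O := by
    rcases hw with hw | hw
    · have := B _ hs hs0 ⟨w, hw, rfl⟩; simpa using this
    · have := A _ hs hs0 ⟨w, hw, rfl⟩; simpa using this
  exact hO' z this hz

structure Disc (A : Set Torus) (J D O : Set ℂ) : Prop extends JD J D O where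
  pJ : pr '' J = A
  inj : InjOn pr (D ∪ J)

theorem contr_disc {A : Set Torus} (h : ContractibleSet A) : ∃ J D O, Disc A J D O := by
  obtain ⟨γ, hγ, rfl, c, ⟨H0⟩⟩ := h
  obtain ⟨c', hc'⟩ := pr_surj c
  let H := H0.symm
  have H_0 : ∀ a, H (0, a) = pr (ContinuousMap.const Circle1 c' a) := by
    intro a; simp [H, hc']
  let L := pr_cov.liftHomotopy H.toContinuousMap (ContinuousMap.const Circle1 c') H_0
  have hL : ∀ q, pr (L q) = H q := fun q => congrFun (pr_cov.liftHomotopy_lifts H.toContinuousMap (ContinuousMap.const Circle1 c') H_0) q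
  let δ : C(Circle1, ℂ) := ⟨fun a => L (1, a), by fun_prop⟩
  have hδ : ∀ a, pr (δ a) = γ a := by
    intro a
    have := hL (1, a)
    rw [show pr (δ a) = pr (L (1, a)) from rfl, this]
    simp [H]
  have hinj : Function.Injective δ := fun a b hab => hγ (by rw [← hδ, ← hδ, hab])
  obtain ⟨D, O, hJ⟩ := jc δ hinj
  refine ⟨range δ, D, O, hJ, ?_, hJ.shift (isPreconnected_range δ.continuous) (range_nonempty _) ?_⟩
  · rw [← range_comp]; congr 1; funext a; exact hδ a
  · rintro s hs hs0 _ ⟨a, rfl⟩ ⟨b, hb⟩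
    have : γ b = γ a := by rw [← hδ, ← hδ, hb, pr_add, hs, add_zero]
    rw [hγ this] at hb
    apply hs0
    simpa using hb.symm

namespace Disc
variable {A : Set Torus} {J D O : Set ℂ} (h : Disc A J D O)
include h
lemma pDo : IsOpen (pr '' D) := pr_open _ h.Do
lemma pDA : pr '' D ∩ A = ∅ := by
  rw [eq_empty_iff_forall_notMem, ← h.pJ]
  rintro _ ⟨⟨z, hz, rfl⟩, w, hw, hwz⟩
  have := h.inj (Or.inr hw) (Or.inl hz) hwz
  subst this
  exact absurd (show w ∈ D ∩ J from ⟨hz, hw⟩) (by rw [h.toJD.DJ]; simp)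
lemma pcl : closure (pr '' D) = pr '' D ∪ A := by
  rw [← h.pJ, ← image_union, ← h.toJD.clD]
  apply Subset.antisymm
  · exact closure_minimal (image_mono subset_closure) ((h.Db.isCompact_closure.image pr_cont).isClosed)
  · exact image_closure_subset_closure_image pr_cont
lemma Acl : IsClosed A := by
  rw [← h.pJ]; exact (h.Jc.image pr_cont).isClosed
lemma pcc {x : Torus} (hx : x ∈ pr '' D) : connectedComponentIn Aᶜ x = pr '' D := by
  have hsub : pr '' D ⊆ Aᶜ := fun z hz hA => by
    have : z ∈ pr '' D ∩ A := ⟨hz, hA⟩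
    rw [h.pDA] at this; exact this
  apply Subset.antisymm
  · refine isPreconnected_connectedComponentIn.subset_of_closure_inter_subset h.pDo ⟨x, mem_connectedComponentIn (hsub hx), hx⟩ ?_
    rintro z ⟨h1, h2⟩
    rw [h.pcl] at h1
    rcases h1 with h1 | h1
    · exact h1
    · exact absurd h1 (connectedComponentIn_subset _ _ h2)
  · exact (h.Dp.image _ pr_cont.continuousOn).subset_connectedComponentIn hx hsub
end Disc
end PDG


namespace PDG
open scoped Classical
set_option linter.unusedSectionVars false
set_option linter.unusedSimpArgs false
set_option linter.unusedVariables false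
set_option autoImplicit false
open TopP

variable {V : Type} [Fintype V] {G : SimpleGraph V}

def toP (d : Drawing G Torus) : PGr G Torus where
  vm := d.vmap
  ea e := if h : e ∈ G.edgeSet then d.emap ⟨e, h⟩ else ∅
  arc u v h := by
    have he : s(u, v) ∈ G.edgeSet := h
    rw [dif_pos he]
    exact arc_param (d.arc _) (fun h' => h.ne (d.vinj h')) (d.closure_emap ⟨s(u, v), he⟩ u v rfl)
      (d.vertex_notin _ _) (d.vertex_notin _ _)
  vnot x e he := by rw [dif_pos he]; exact d.vertex_notin _ _
  disj e he f hf hne := by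
    rw [dif_pos he, dif_pos hf]
    exact d.edges_disj _ _ (fun h => hne (congrArg Subtype.val h))
  inj := d.vinj

/-- image of a cycle -/
def cim (P : PGr G Torus) {n : ℕ} [NeZero n] (c : Fin n → V) : Set Torus :=
  ⋃ i, (P.ea s(c i, c (i + 1)) ∪ {P.vm (c i)})

def img (P : PGr G Torus) : Set Torus := range P.vm ∪ ⋃ e ∈ G.edgeSet, P.ea e

structure Crit (G : SimpleGraph V) : Prop where
  tf : TF G
  no : ¬ ∃ col : V → Fin 3, ∀ u v, G.Adj u v → col u ≠ col v
  crit : ∀ Γ : SimpleGraph V, Γ < G → ∃ col : V → Fin 3, ∀ u v, Γ.Adj u v → col u ≠ col v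
  iso : ∀ x, ∃ y, G.Adj x y

variable (P : PGr G Torus)

lemma nomem {S : Type} {A B : Set S} (h : A ∩ B = ∅) {z : S} (ha : z ∈ A) (hb : z ∈ B) : False := by
  have : z ∈ A ∩ B := ⟨ha, hb⟩
  rw [h] at this; exact this

lemma eaT_pre {e : Sym2 V} (he : e ∈ G.edgeSet) : IsPreconnected (P.ea e) ∧ (P.ea e).Nonempty := by
  induction e with | _ u v
  obtain ⟨g, hg, h0, h1, h2⟩ := P.arc u v he
  rw [← h2]
  exact ⟨isPreconnected_Ioo.image _ g.continuous.continuousOn, (nonempty_Ioo.2 zero_lt_one).image _⟩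

lemma eaT_end {u v : V} (h : G.Adj u v) : P.vm u ∈ closure (P.ea s(u, v)) ∧ P.vm v ∈ closure (P.ea s(u, v)) := by
  obtain ⟨g, hg, h0, h1, h2⟩ := P.arc u v h
  rw [← h2, ← h0, ← h1]
  have hc : closure (Ioo (0 : unitInterval) 1) = univ := by
    rw [closure_Ioo zero_ne_one]
    ext t; simp [unitInterval.nonneg', unitInterval.le_one']
  have := image_closure_subset_closure_image g.continuous (s := Ioo (0 : unitInterval) 1)
  rw [hc] at this
  exact ⟨this ⟨0, trivial, rfl⟩, this ⟨1, trivial, rfl⟩⟩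

lemma eaT_cl {e : Sym2 V} (he : e ∈ G.edgeSet) : IsCompact (P.ea e ∪ P.vm '' {x | x ∈ e}) := by
  induction e with | _ u v
  obtain ⟨g, hg, h0, h1, h2⟩ := P.arc u v he
  have : P.ea s(u, v) ∪ P.vm '' {x | x ∈ s(u, v)} = range g := by
    rw [range_eq_I g, h2, h0, h1]
    congr 1
    ext z; simp [eq_comm]
  rw [this]; exact isCompact_range g.continuous

variable {n : ℕ} [NeZero n] {c : Fin n → V}

lemma ea_cim {e : Sym2 V} (he : e ∈ G.edgeSet) (hc : Cy G c) :
    (∃ i, e = s(c i, c (i + 1))) ∨ P.ea e ∩ cim P c = ∅ := by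
  by_cases h : ∃ i, e = s(c i, c (i + 1))
  · exact Or.inl h
  · right
    push Not at h
    ext z
    simp only [mem_inter_iff, mem_empty_iff_false, iff_false, not_and, cim, mem_iUnion, not_exists]
    rintro hz i (h1 | h1)
    · have := P.disj e he _ (hc.adj i) (h i)
      exact (this ▸ (⟨hz, h1⟩ : z ∈ P.ea e ∩ _) : z ∈ (∅ : Set Torus))
    · rw [mem_singleton_iff] at h1
      exact P.vnot _ e he (h1 ▸ hz)

lemma vm_cim {x : V} (hx : P.vm x ∈ cim P c) (hc : Cy G c) : ∃ i, x = c i := by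
  obtain ⟨i, h | h⟩ := mem_iUnion.1 hx
  · exact absurd h (P.vnot _ _ (hc.adj i))
  · exact ⟨i, P.inj h⟩

lemma ea_side {J D O : Set ℂ} (hD : Disc (cim P c) J D O) (hc : Cy G c) {e : Sym2 V} (he : e ∈ G.edgeSet) :
    P.ea e ⊆ pr '' D ∨ P.ea e ∩ pr '' D = ∅ := by
  rcases ea_cim P he hc with ⟨i, rfl⟩ | h
  · right
    have h1 : P.ea s(c i, c (i + 1)) ⊆ cim P c := fun z hz => mem_iUnion.2 ⟨i, Or.inl hz⟩
    ext z
    simp only [mem_inter_iff, mem_empty_iff_false, iff_false, not_and]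
    intro hz hz'
    exact (hD.pDA ▸ (⟨hz', h1 hz⟩ : z ∈ pr '' D ∩ _) : z ∈ (∅ : Set Torus))
  · rcases (P.ea e ∩ pr '' D).eq_empty_or_nonempty with h' | h'
    · exact Or.inr h'
    · left
      refine (eaT_pre P he).1.subset_of_closure_inter_subset hD.pDo h' ?_
      rw [hD.pcl]
      rintro z ⟨h1 | h1, h2⟩
      · exact h1
      · exact (nomem h h2 h1).elim

/-- The part of the graph in the closed disc, drawn in the plane. -/
def dG (Q : Set ℂ) : SimpleGraph {v : V // P.vm v ∈ pr '' Q} where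
  Adj a b := G.Adj a.1 b.1 ∧ P.ea s(a.1, b.1) ⊆ pr '' Q
  symm := ⟨fun a b h => ⟨h.1.symm, by rw [Sym2.eq_swap]; exact h.2⟩⟩
  loopless := ⟨fun a h => G.loopless.irrefl _ h.1⟩

lemma dG_edge {Q : Set ℂ} {e : Sym2 {v : V // P.vm v ∈ pr '' Q}} (he : e ∈ (dG P Q).edgeSet) :
    e.map Subtype.val ∈ G.edgeSet ∧ P.ea (e.map Subtype.val) ⊆ pr '' Q := by
  induction e with | _ u v
  exact he

lemma pr_sg {Q : Set ℂ} {x : Torus} (hx : x ∈ pr '' Q) : pr (Function.invFunOn pr Q x) = x :=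
  Function.invFunOn_eq hx

def dP (Q : Set ℂ) (hQ : IsCompact Q) (hi : InjOn pr Q) : PGr (dG P Q) ℂ where
  vm v := Function.invFunOn pr Q (P.vm v.1)
  ea e := Function.invFunOn pr Q '' P.ea (e.map Subtype.val)
  arc u v h := by
    obtain ⟨g, hg, h0, h1, h2⟩ := P.arc u.1 v.1 h.1
    have hr : ∀ t, g t ∈ pr '' Q := by
      intro t
      have : g t ∈ range g := ⟨t, rfl⟩
      rw [range_eq_I g, h2, h0, h1] at this
      rcases this with h' | h' | h'
      · exact h.2 h'
      · rw [h']; exact u.2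
      · rw [h']; exact v.2
    refine ⟨⟨fun t => Function.invFunOn pr Q (g t), ?_⟩, ?_, ?_, ?_, ?_⟩
    · exact (sec_cont hQ hi).comp_continuous g.continuous hr
    · intro s t hst
      have := congrArg pr hst
      simp only [ContinuousMap.coe_mk] at this
      rw [pr_sg (hr s), pr_sg (hr t)] at this
      exact hg this
    · simp [h0]
    · simp [h1]
    · simp only [Sym2.map_mk, ContinuousMap.coe_mk]
      rw [← h2, image_image]
  vnot x e he := by
    rintro ⟨y, hy, hxy⟩
    have := congrArg pr hxy
    rw [pr_sg x.2, pr_sg ((dG_edge P he).2 hy)] at this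
    exact P.vnot _ _ (dG_edge P he).1 (this ▸ hy)
  disj e he f hf hne := by
    ext z
    simp only [mem_inter_iff, mem_empty_iff_false, iff_false, not_and]
    rintro ⟨y, hy, hxy⟩ ⟨y', hy', hxy'⟩
    have := congrArg pr (hxy.trans hxy'.symm)
    rw [pr_sg ((dG_edge P he).2 hy), pr_sg ((dG_edge P hf).2 hy')] at this
    subst this
    have h1 := P.disj _ (dG_edge P he).1 _ (dG_edge P hf).1
      (fun h => hne (Sym2.map.injective Subtype.val_injective h))
    exact nomem h1 hy hy'
  inj u v h := by
    have := congrArg pr h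
    simp only at this
    rw [pr_sg u.2, pr_sg v.2] at this
    exact Subtype.ext (P.inj this)

lemma mem_sp_zc {W : Type} [Fintype W] {n : ℕ} [NeZero n] {c : Fin n → W} {e : Sym2 W} :
    e ∈ sp (zc c) ↔ ∃ i, e = s(c i, c (i + 1)) := by
  unfold sp zc
  simp

theorem disc_empty (hG : Crit G) {J D O : Set ℂ} (hc : Cy G c) (hD : Disc (cim P c) J D O) :
    pr '' D ∩ img P = ∅ := by
  by_contra hne
  obtain ⟨z, hzD, hz⟩ := nonempty_iff_ne_empty.2 hne
  -- some edge meets the disc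
  have hE : ∃ e ∈ G.edgeSet, (P.ea e ∩ pr '' D).Nonempty := by
    rcases hz with ⟨x, rfl⟩ | hz
    · obtain ⟨y, hy⟩ := hG.iso x
      obtain ⟨w, h1, h2⟩ := mem_closure_iff.1 (eaT_end P hy).1 _ hD.pDo hzD
      exact ⟨_, hy, w, h2, h1⟩
    · simp only [mem_iUnion] at hz
      obtain ⟨e, he, hz⟩ := hz
      exact ⟨e, he, z, hz, hzD⟩
  obtain ⟨e₀, he₀, hne₀⟩ := hE
  let Γ : SimpleGraph V := 
    { Adj := fun a b => G.Adj a b ∧ P.ea s(a, b) ∩ pr '' D = ∅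
      symm := ⟨fun a b h => ⟨h.1.symm, by rw [Sym2.eq_swap]; exact h.2⟩⟩
      loopless := ⟨fun a h => G.loopless.irrefl _ h.1⟩ }
  have hlt : Γ < G := by
    refine lt_of_le_of_ne (fun a b h => h.1) ?_
    intro h
    induction e₀ with | _ u v
    have h1 : Γ.Adj u v := h ▸ he₀
    exact hne₀.ne_empty h1.2
  obtain ⟨col1, h1⟩ := hG.crit Γ hlt
  have hA : ∀ z ∈ cim P c, z ∉ pr '' D := fun z h h' => (hD.pDA ▸ (⟨h', h⟩ : z ∈ pr '' D ∩ _) : z ∈ (∅ : Set Torus))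
  have hci : ∀ i, P.ea s(c i, c (i + 1)) ⊆ cim P c := fun i z hz => mem_iUnion.2 ⟨i, Or.inl hz⟩
  have hcv : ∀ i, P.vm (c i) ∈ cim P c := fun i => mem_iUnion.2 ⟨i, Or.inr rfl⟩
  have hAQ : cim P c ⊆ pr '' (D ∪ J) := by
    rw [← hD.pJ]; exact image_mono subset_union_right
  let Q := D ∪ J
  let c' : Fin n → {v : V // P.vm v ∈ pr '' Q} := fun i => ⟨c i, hAQ (hcv i)⟩
  have hc' : Cy (dG P Q) c' := by
    refine ⟨fun i j h => hc.inj (congrArg Subtype.val h), fun i => ⟨hc.adj i, (hci i).trans hAQ⟩, hc.len⟩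
  let D' := dP P Q hD.cpt hD.inj
  have hsJ : ∀ x ∈ cim P c, Function.invFunOn pr Q x ∈ J := by
    intro x hx
    have hx' := hx
    rw [← hD.pJ] at hx'
    obtain ⟨j, hj, rfl⟩ := hx'
    have : Function.invFunOn pr Q (pr j) = j := 
      hD.inj (Function.invFunOn_mem (hAQ hx)) (Or.inr hj) (pr_sg (hAQ hx))
    rw [this]; exact hj
  have hJs : J ⊆ Function.invFunOn pr Q '' cim P c := by
    intro j hj
    have hx : pr j ∈ cim P c := by rw [← hD.pJ]; exact ⟨j, hj, rfl⟩
    exact ⟨pr j, hx, hD.inj (Function.invFunOn_mem (hAQ hx)) (Or.inr hj) (pr_sg (hAQ hx))⟩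
  have him : D'.im (sp (zc c')) = J := by
    ext z
    constructor
    · intro hz
      simp only [PGr.im, mem_iUnion] at hz
      obtain ⟨e, he, hz⟩ := hz
      obtain ⟨i, rfl⟩ := mem_sp_zc.1 he
      rcases hz with ⟨x, hx, rfl⟩ | ⟨x, hx, rfl⟩
      · exact hsJ _ (hci i hx)
      · rcases Sym2.mem_iff.1 hx with rfl | rfl
        · exact hsJ _ (hcv i)
        · exact hsJ _ (hcv (i + 1))
    · intro hz
      obtain ⟨x, hx, rfl⟩ := hJs hz
      obtain ⟨i, hx⟩ := mem_iUnion.1 hx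
      simp only [PGr.im, mem_iUnion]
      refine ⟨s(c' i, c' (i + 1)), mem_sp_zc.2 ⟨i, rfl⟩, ?_⟩
      rcases hx with hx | rfl
      · left; exact ⟨x, hx, rfl⟩
      · right; exact ⟨c' i, by simp, rfl⟩
  have hK : D'.K ⊆ Q := by
    intro z hz
    simp only [PGr.K, PGr.im, mem_iUnion] at hz
    obtain ⟨e, he, hz⟩ := hz
    rcases hz with ⟨x, hx, rfl⟩ | ⟨x, hx, rfl⟩
    · exact Function.invFunOn_mem ((dG_edge P he).2 hx)
    · exact Function.invFunOn_mem x.2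
  obtain ⟨b, hb⟩ : O.Nonempty := by
    rw [nonempty_iff_ne_empty]; intro h; exact hD.Ob (h ▸ Bornology.isBounded_empty)
  have hOJ : ∀ z ∈ O, z ∉ J := fun z h h' => (hD.OJ ▸ (⟨h, h'⟩ : z ∈ O ∩ J) : z ∈ (∅ : Set ℂ))
  have hOD : ∀ z ∈ O, z ∉ D := fun z h h' => Set.disjoint_left.1 (Set.disjoint_iff_inter_eq_empty.2 hD.disj) h' h
  have hbJ : b ∉ D'.im (sp (zc c')) := by rw [him]; exact hOJ b hb
  have hout : connectedComponentIn (D'.im (sp (zc c')))ᶜ b ∩ D'.K = ∅ := by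
    rw [him]
    rw [him] at hbJ
    have hs : connectedComponentIn Jᶜ b ∩ J = ∅ := by
      ext z
      simp only [mem_inter_iff, mem_empty_iff_false, iff_false, not_and]
      exact fun h h' => connectedComponentIn_subset _ _ h h'
    have hs' : connectedComponentIn Jᶜ b ⊆ O := by
      rcases hD.side isPreconnected_connectedComponentIn hs with h | h
      · exact absurd (h (mem_connectedComponentIn hbJ)) (hOD b hb)
      · exact h
    ext z
    simp only [mem_inter_iff, mem_empty_iff_false, iff_false, not_and]
    intro h h'
    rcases hK h' with h2 | h2
    · exact hOD z (hs' h) h2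
    · exact hOJ z (hs' h) h2
  have htf : TF (dG P Q) := fun a b c h1 h2 h3 => hG.tf a.1 b.1 c.1 h1.1 h2.1 h3.1
  have hψ : ∀ i, (fun i => col1 (c i)) i ≠ (fun i => col1 (c i)) (i + 1) := by
    intro i
    refine h1 _ _ ⟨hc.adj i, ?_⟩
    ext z
    simp only [mem_inter_iff, mem_empty_iff_false, iff_false, not_and]
    exact fun h => hA z (hci i h)
  obtain ⟨col2, h2, h2'⟩ := disc_extend D' n c' htf hc' b hbJ hout (fun i => col1 (c i)) hψ
  refine hG.no ⟨fun v => if h : P.vm v ∈ pr '' D then col2 ⟨v, image_mono subset_union_left h⟩ else col1 v, ?_⟩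
  intro u v huv
  have key : ∀ w (h : P.vm w ∈ pr '' Q), (if h : P.vm w ∈ pr '' D then col2 ⟨w, image_mono subset_union_left h⟩ else col1 w) = col2 ⟨w, h⟩ := by
    intro w h
    by_cases hw : P.vm w ∈ pr '' D
    · rw [dif_pos hw]
    · rw [dif_neg hw]
      have : P.vm w ∈ cim P c := by
        rw [image_union, hD.pJ] at h
        exact h.resolve_left hw
      obtain ⟨i, rfl⟩ := vm_cim P this hc
      exact (h2' i).symm
  have hend := eaT_end P huv
  rcases ea_side P hD hc (e := s(u, v)) huv with hs | hs
  · have hcl : closure (P.ea s(u, v)) ⊆ pr '' Q := by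
      have := closure_mono hs
      rwa [hD.pcl, ← hD.pJ, ← image_union] at this
    simp only
    rw [key u (hcl hend.1), key v (hcl hend.2)]
    exact h2 _ _ ⟨huv, hs.trans (image_mono subset_union_left)⟩
  · have hn : ∀ w, P.vm w ∈ closure (P.ea s(u, v)) → P.vm w ∉ pr '' D := by
      intro w hw h
      obtain ⟨z, hz, hz'⟩ := mem_closure_iff.1 hw _ hD.pDo h
      exact nomem hs hz' hz
    simp only
    rw [dif_neg (hn _ hend.1), dif_neg (hn _ hend.2)]
    exact h1 _ _ ⟨huv, hs⟩

end PDG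


namespace PDG
open scoped Classical
set_option linter.unusedSectionVars false
set_option linter.unusedSimpArgs false
set_option linter.unusedVariables false
set_option autoImplicit false
open TopP

lemma pre_joined {U K : Set ℂ} (hU : IsOpen U) (hp : IsPreconnected U) (hd : U ∩ K = ∅) {a b : ℂ} (ha : a ∈ U) (hb : b ∈ U) :
    JoinedIn Kᶜ a b := by
  have := hU.isConnected_iff_isPathConnected.1 ⟨⟨a, ha⟩, hp⟩
  exact (this.joinedIn a ha b hb).mono (fun z hz h => nomem hd hz h)

lemma JD.ext {J D O : Set ℂ} (h : JD J D O) {M : ℝ} (hM : 0 < M) (hJ : ∀ z ∈ J, ‖z‖ ≤ M) {z : ℂ} (hz : M < ‖z‖) : z ∈ O := by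
  have hd : {z : ℂ | M < ‖z‖} ∩ J = ∅ := by
    rw [eq_empty_iff_forall_notMem]
    rintro w ⟨h1, h2⟩
    exact absurd (hJ w h2) (not_le.2 h1)
  rcases h.side (pre_ext M hM) hd with h1 | h1
  · exact absurd (h.Db.subset h1) (not_bdd_ext M)
  · exact h1 hz

theorem annulus {L D O : Set ℂ} (h : JD L D O) (hLc : IsPreconnected L) (hLn : L.Nonempty) (h0 : (0 : ℂ) ∈ D)
    (μ : ℂ) (hμ : 1 < ‖μ‖) (hd : ∀ x ∈ L, μ * x ∉ L) :
    ∃ R : Set ℂ, IsPreconnected R ∧ (∀ z ∈ R, z ≠ 0 ∧ ∀ j : ℤ, μ ^ j * z ∉ L) ∧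
      ∀ z, z ≠ 0 → (∀ j : ℤ, μ ^ j * z ∉ L) → ∃ j : ℤ, μ ^ j * z ∈ R := by
  have hμ0 : μ ≠ 0 := by rintro rfl; simp at hμ; linarith
  have h0L : (0 : ℂ) ∉ L := fun h' => nomem h.DJ h0 h'
  have hDO : ∀ z, z ∈ D → z ∈ O → False := fun z h1 h2 => nomem h.disj h1 h2
  have hDL : ∀ z, z ∈ D → z ∈ L → False := fun z h1 h2 => nomem h.DJ h1 h2
  have hOL : ∀ z, z ∈ O → z ∈ L → False := fun z h1 h2 => nomem h.OJ h1 h2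
  have hcm : Continuous fun z : ℂ => μ * z := continuous_const.mul continuous_id
  have hcm' : Continuous fun z : ℂ => μ⁻¹ * z := continuous_const.mul continuous_id
  -- μ L ⊆ O
  have hA : ∀ x ∈ L, μ * x ∈ O := by
    obtain ⟨m, hm, hmax⟩ := h.Jc.exists_isMaxOn hLn continuous_norm.continuousOn
    have hm0 : 0 < ‖m‖ := norm_pos_iff.2 (fun h' => h0L (h' ▸ hm))
    have hmO : μ * m ∈ O := h.ext hm0 (fun z hz => hmax hz) (by rw [norm_mul]; nlinarith)
    have hd' : ((fun z => μ * z) '' L) ∩ L = ∅ := by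
      rw [eq_empty_iff_forall_notMem]
      rintro _ ⟨⟨x, hx, rfl⟩, h2⟩
      exact hd x hx h2
    rcases h.side (hLc.image _ hcm.continuousOn) hd' with h1 | h1
    · exact (hDO _ (h1 ⟨m, hm, rfl⟩) hmO).elim
    · exact fun x hx => h1 ⟨x, hx, rfl⟩
  have hB : ∀ x ∈ L, μ⁻¹ * x ∈ D := by
    obtain ⟨m, hm, hmin⟩ := h.Jc.exists_isMinOn hLn continuous_norm.continuousOn
    have hm0 : 0 < ‖m‖ := norm_pos_iff.2 (fun h' => h0L (h' ▸ hm))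
    have hball : Metric.ball (0 : ℂ) ‖m‖ ⊆ D := by
      have hd' : Metric.ball (0 : ℂ) ‖m‖ ∩ L = ∅ := by
        rw [eq_empty_iff_forall_notMem]
        rintro w ⟨h1, h2⟩
        have : ‖m‖ ≤ ‖w‖ := hmin h2
        rw [Metric.mem_ball, dist_zero_right] at h1; linarith
      rcases h.side (convex_ball _ _).isPreconnected hd' with h1 | h1
      · exact h1
      · exact (hDO 0 h0 (h1 (Metric.mem_ball_self hm0))).elim
    have hmD : μ⁻¹ * m ∈ D := by
      apply hball
      rw [Metric.mem_ball, dist_zero_right, norm_mul, norm_inv]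
      have : ‖μ‖⁻¹ < 1 := inv_lt_one_of_one_lt₀ hμ
      nlinarith
    have hd' : ((fun z => μ⁻¹ * z) '' L) ∩ L = ∅ := by
      rw [eq_empty_iff_forall_notMem]
      rintro _ ⟨⟨x, hx, rfl⟩, h2⟩
      refine hd _ h2 ?_
      simpa [mul_inv_cancel_left₀ hμ0] using hx
    rcases h.side (hLc.image _ hcm'.continuousOn) hd' with h1 | h1
    · exact fun x hx => h1 ⟨x, hx, rfl⟩
    · exact (hDO _ hmD (h1 ⟨m, hm, rfl⟩)).elim
  have hC : ∀ x ∈ D, μ⁻¹ * x ∈ D := by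
    have hd' : ((fun z => μ⁻¹ * z) '' D) ∩ L = ∅ := by
      rw [eq_empty_iff_forall_notMem]
      rintro _ ⟨⟨x, hx, rfl⟩, h2⟩
      have := hA _ h2
      simp only [mul_inv_cancel_left₀ hμ0] at this
      exact hDO _ hx this
    rcases h.side (h.Dp.image _ hcm'.continuousOn) hd' with h1 | h1
    · exact fun x hx => h1 ⟨x, hx, rfl⟩
    · exact (hDO _ h0 (h1 ⟨0, h0, by simp⟩)).elim
  have hC' : ∀ (i : ℕ), ∀ x ∈ D, (μ⁻¹) ^ i * x ∈ D := by
    intro i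
    induction i with
    | zero => intro x hx; simpa using hx
    | succ i ih => intro x hx; rw [pow_succ, mul_assoc]; exact ih _ (hC x hx)
  have hO1 : ∀ z ∈ O, μ * z ∈ O := by
    intro z hz
    rcases h.tri (μ * z) with h1 | h1 | h1
    · have := hC _ h1; rw [inv_mul_cancel_left₀ hμ0] at this; exact (hDO _ this hz).elim
    · have := hB _ h1; rw [inv_mul_cancel_left₀ hμ0] at this; exact (hDO _ this hz).elim
    · exact h1
  have hO' : ∀ (i : ℕ), ∀ x ∈ O, μ ^ i * x ∈ O := by
    intro i
    induction i with
    | zero => intro x hx; simpa using hx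
    | succ i ih => intro x hx; rw [pow_succ, mul_assoc]; exact ih _ (hO1 x hx)
  refine ⟨{z | z ∈ O ∧ μ⁻¹ * z ∈ D}, ?_, ?_, ?_⟩
  · -- preconnected
    let L' : Set ℂ := (fun z => μ * z) '' L
    have hL'c : IsCompact L' := h.Jc.image hcm
    have hL'i : ∀ z, z ∈ L' ↔ μ⁻¹ * z ∈ L := by
      intro z
      constructor
      · rintro ⟨x, hx, rfl⟩; simpa [inv_mul_cancel_left₀ hμ0] using hx
      · intro hz; exact ⟨_, hz, by simp [mul_inv_cancel_left₀ hμ0]⟩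
    have hK : IsCompact (L ∪ L') := h.Jc.union hL'c
    apply isPreconnected_of_forall_pair
    intro a ha b hb
    have hnot : ∀ z, z ∈ O ∧ μ⁻¹ * z ∈ D → z ∉ L ∪ L' := by
      rintro z ⟨h1, h2⟩ (h3 | h3)
      · exact hOL z h1 h3
      · exact hDL _ h2 ((hL'i z).1 h3)
    have hs := sep hK (hnot a ha) (hnot b hb) (by
      obtain ⟨f, hf1, hf2⟩ := hl_move L b a (pre_joined h.Oo h.Op h.OJ hb.1 ha.1)
      obtain ⟨g, hg1, hg2⟩ := hl_move L (μ⁻¹ * b) (μ⁻¹ * a) (pre_joined h.Do h.Dp h.DJ hb.2 ha.2)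
      refine hl_glue h.Jc.isClosed hL'c.isClosed (L := f) (M := fun z => g (μ⁻¹ * z)) hf1
        (hg1.comp hcm'.continuousOn (fun z hz => (hL'i z).1 hz)) hf2 ?_ ?_
      · intro z hz
        rw [hg2 _ ((hL'i z).1 hz)]
        simp only []
        rw [← mul_sub, ← mul_sub, mul_div_mul_left _ _ (inv_ne_zero hμ0)]
      · rintro z hz ⟨x, hx, rfl⟩
        exact (hd x hx hz).elim)
    refine ⟨connectedComponentIn (L ∪ L')ᶜ a, ?_, mem_connectedComponentIn (hnot a ha), ?_, isPreconnected_connectedComponentIn⟩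
    · intro z hz
      have hsub := connectedComponentIn_subset (L ∪ L')ᶜ a
      constructor
      · have hd' : connectedComponentIn (L ∪ L')ᶜ a ∩ L = ∅ := by
          rw [eq_empty_iff_forall_notMem]
          rintro w ⟨h1, h2⟩
          exact hsub h1 (Or.inl h2)
        rcases h.side isPreconnected_connectedComponentIn hd' with h1 | h1
        · exact (hDO _ (h1 (mem_connectedComponentIn (hnot a ha))) ha.1).elim
        · exact h1 hz
      · have hd' : ((fun z => μ⁻¹ * z) '' connectedComponentIn (L ∪ L')ᶜ a) ∩ L = ∅ := by
          rw [eq_empty_iff_forall_notMem]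
          rintro _ ⟨⟨w, h1, rfl⟩, h2⟩
          exact hsub h1 (Or.inr ((hL'i w).2 h2))
        rcases h.side (isPreconnected_connectedComponentIn.image _ hcm'.continuousOn) hd' with h1 | h1
        · exact h1 ⟨z, hz, rfl⟩
        · exact (hDO _ ha.2 (h1 ⟨a, mem_connectedComponentIn (hnot a ha), rfl⟩)).elim
    · rw [hs]; exact mem_connectedComponentIn (hnot b hb)
  · rintro z ⟨h1, h2⟩
    refine ⟨fun h' => hDO _ h0 (h' ▸ h1), fun j hj => ?_⟩
    obtain ⟨i, rfl | rfl⟩ := j.eq_nat_or_neg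
    · rw [zpow_natCast] at hj
      exact hOL _ (hO' i z h1) hj
    · rw [zpow_neg, zpow_natCast, ← inv_pow] at hj
      cases i with
      | zero => simp at hj; exact hOL _ h1 hj
      | succ i =>
        rw [pow_succ, mul_assoc] at hj
        exact hDL _ (hC' i _ h2) hj
  · intro z hz0 hz
    obtain ⟨M, hM, hMb⟩ := h.Jc.isBounded.exists_pos_norm_le
    have hbig : ∃ i : ℕ, μ ^ i * z ∈ O := by
      obtain ⟨i, hi⟩ := pow_unbounded_of_one_lt (M / ‖z‖) hμ
      refine ⟨i, h.ext hM hMb ?_⟩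
      rw [norm_mul, norm_pow]
      rwa [div_lt_iff₀ (norm_pos_iff.2 hz0)] at hi
    have hsmall : ∃ i : ℕ, (μ⁻¹) ^ i * z ∈ D := by
      obtain ⟨ε, hε, hb⟩ := Metric.isOpen_iff.1 h.Do 0 h0
      obtain ⟨i, hi⟩ := exists_pow_lt_of_lt_one (div_pos hε (norm_pos_iff.2 hz0)) (inv_lt_one_of_one_lt₀ hμ)
      refine ⟨i, hb ?_⟩
      rw [Metric.mem_ball, dist_zero_right, norm_mul, norm_pow, norm_inv]
      rwa [lt_div_iff₀ (norm_pos_iff.2 hz0)] at hi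
    obtain ⟨i, hi⟩ := hsmall
    let w := (μ⁻¹) ^ i * z
    have hw : ∀ k : ℕ, μ ^ k * w = μ ^ ((k : ℤ) - i) * z := by
      intro k
      simp only [w]
      rw [zpow_sub₀ hμ0, zpow_natCast, zpow_natCast, inv_pow, div_eq_mul_inv, mul_assoc]
    have hex : ∃ k : ℕ, μ ^ k * w ∈ O := by
      obtain ⟨k, hk⟩ := hbig
      refine ⟨k + i, ?_⟩
      rw [hw]; simpa using hk
    have hk := Nat.find_spec hex
    have hmin := fun m => Nat.find_min hex (m := m)
    set k := Nat.find hex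
    rcases Nat.eq_zero_or_pos k with h1 | h1
    · rw [h1] at hk; simp at hk; exact (hDO _ hi hk).elim
    · refine ⟨(k : ℤ) - i, by rw [← hw]; exact hk, ?_⟩
      have h2 : μ⁻¹ * (μ ^ ((k : ℤ) - i) * z) = μ ^ (k - 1) * w := by
        rw [← hw]
        obtain ⟨m, hm⟩ := Nat.exists_eq_succ_of_ne_zero h1.ne'
        rw [hm, Nat.succ_sub_one, pow_succ', mul_assoc, inv_mul_cancel_left₀ hμ0]
      rw [h2]
      rcases h.tri (μ ^ (k - 1) * w) with h3 | h3 | h3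
      · exact h3
      · rw [hw] at h3; exact (hz _ h3).elim
      · exact (hmin (k - 1) (by omega) h3).elim

lemma close_up {X : Type} [TopologicalSpace X] (g : C(unitInterval, X)) (h : g 0 = g 1) :
    ∃ δ : C(Circle1, X), ∀ t : unitInterval, δ ((t : ℝ) : Circle1) = g t := by
  let f : ℝ → X := IccExtend (zero_le_one (α := ℝ)) g
  have hf : Continuous f := g.continuous.Icc_extend'
  have h01 : f 0 = f 1 := by simp [f, h]
  refine ⟨⟨AddCircle.liftIco 1 0 f, AddCircle.liftIco_continuous (by simpa using h01) hf.continuousOn⟩, ?_⟩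
  intro t
  simp only [ContinuousMap.coe_mk]
  have hft : f t = g t := IccExtend_val _ _ _
  by_cases ht : (t : ℝ) < 1
  · rw [AddCircle.liftIco_coe_apply ⟨t.2.1, by simpa using ht⟩, hft]
  · have ht1 : (t : ℝ) = 1 := le_antisymm t.2.2 (not_lt.1 ht)
    have e1 : ((t : ℝ) : Circle1) = ((0 : ℝ) : Circle1) := coe_c1.2 ⟨-1, by rw [ht1]; norm_num⟩
    rw [e1, AddCircle.liftIco_coe_apply ⟨le_rfl, by norm_num⟩, h01, ← hft, ht1]

lemma c1_rep (x : Circle1) : ∃ t : unitInterval, ((t : ℝ) : Circle1) = x := by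
  obtain ⟨y, rfl⟩ := QuotientAddGroup.mk_surjective x
  refine ⟨⟨Int.fract y, Int.fract_nonneg y, (Int.fract_lt_one y).le⟩, ?_⟩
  exact coe_c1.2 ⟨⌊y⌋, by have := Int.fract_add_floor y; simp only; linarith⟩

end PDG


namespace PDG
open scoped Classical
set_option linter.unusedSectionVars false
set_option linter.unusedSimpArgs false
set_option linter.unusedVariables false
set_option autoImplicit false
open TopP

lemma lat_split {t : ℂ} (ht0 : t ≠ 0) (ht : pr t = 0) : ∃ (k : ℤ) (τ s : ℂ), t = k * τ ∧ k ≠ 0 ∧ τ ≠ 0 ∧ pr τ = 0 ∧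
    pr s = 0 ∧ (∀ z, pr z = 0 → ∃ u v : ℤ, z = u * τ + v * s) ∧ (s / τ).im < 0 := by
  obtain ⟨m, n, rfl⟩ := pr_eq_zero.1 ht
  have hg : Int.gcd m n ≠ 0 := by
    intro h
    rw [Int.gcd_eq_zero_iff] at h
    apply ht0; simp [h.1, h.2]
  obtain ⟨m', n', hco, hm, hn⟩ := Int.exists_gcd_one (Nat.pos_of_ne_zero hg)
  obtain ⟨a, b, hab⟩ := Int.isCoprime_iff_gcd_eq_one.2 hco
  set k := (Int.gcd m n : ℤ) with hk
  have hk0 : k ≠ 0 := by rw [hk]; exact_mod_cast hg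
  have hτ : ((m' : ℂ) + n' * Complex.I) ≠ 0 := by
    intro h
    apply ht0
    rw [hm, hn]; push_cast
    linear_combination (k : ℂ) * h
  refine ⟨k, m' + n' * Complex.I, b - a * Complex.I, ?_, hk0, hτ, pr_eq_zero.2 ⟨m', n', rfl⟩, pr_eq_zero.2 ⟨b, -a, by push_cast; ring⟩, ?_, ?_⟩
  · rw [hm, hn]; push_cast; ring
  · intro z hz
    obtain ⟨p, q, rfl⟩ := pr_eq_zero.1 hz
    refine ⟨a * p + b * q, n' * p - m' * q, ?_⟩
    have : (a : ℂ) * m' + b * n' = 1 := by exact_mod_cast hab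
    push_cast
    linear_combination (-(p : ℂ) - q * Complex.I) * this
  · have : ((m' : ℝ) : ℝ) * a + n' * b = 1 := by
      have : (a : ℝ) * m' + b * n' = 1 := by exact_mod_cast hab
      linarith
    have hns : 0 < Complex.normSq ((m' : ℂ) + n' * Complex.I) := Complex.normSq_pos.2 hτ
    rw [Complex.div_im]
    simp
    rw [← sub_neg, ← sub_div]
    apply div_neg_of_neg_of_pos _ hns
    linarith

def EE (τ : ℂ) (z : ℂ) : ℂ := Complex.exp (2 * Real.pi * Complex.I * (z / τ))

lemma EE_cont (τ : ℂ) : Continuous (EE τ) := by unfold EE; fun_prop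

lemma two_pi_I : (2 * Real.pi * Complex.I : ℂ) ≠ 0 := Complex.two_pi_I_ne_zero

lemma EE_ne (τ z : ℂ) : EE τ z ≠ 0 := Complex.exp_ne_zero _

lemma EE_eq {τ : ℂ} (hτ : τ ≠ 0) {z w : ℂ} : EE τ z = EE τ w ↔ ∃ n : ℤ, z = w + n * τ := by
  unfold EE
  rw [Complex.exp_eq_exp_iff_exists_int]
  refine exists_congr fun n => ?_
  have := two_pi_I
  constructor
  · intro h
    have h2 : (2 * Real.pi * Complex.I : ℂ) * (z / τ) = (2 * Real.pi * Complex.I : ℂ) * (w / τ + n) := by rw [h]; ring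
    have h3 := mul_left_cancel₀ this h2
    field_simp at h3
    rw [h3, mul_comm]
  · rintro rfl
    field_simp

lemma EE_add {τ : ℂ} (z w : ℂ) (v : ℤ) : EE τ (z + v * w) = EE τ w ^ v * EE τ z := by
  unfold EE
  rw [← Complex.exp_int_mul, ← Complex.exp_add]
  congr 1; ring

def EL (τ : ℂ) (z : ℂ) : ℂ := τ / (2 * Real.pi * Complex.I) * Complex.log z

lemma EE_EL {τ : ℂ} (hτ : τ ≠ 0) {z : ℂ} (hz : z ≠ 0) : EE τ (EL τ z) = z := by
  unfold EE EL
  have := two_pi_I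
  have h : 2 * Real.pi * Complex.I * (τ / (2 * Real.pi * Complex.I) * Complex.log z / τ) = Complex.log z := by
    field_simp
  rw [h, Complex.exp_log hz]

lemma prn {τ : ℂ} (hτ : pr τ = 0) (n : ℤ) : pr (n * τ) = 0 := by
  obtain ⟨p, q, rfl⟩ := pr_eq_zero.1 hτ
  exact pr_eq_zero.2 ⟨n * p, n * q, by push_cast; ring⟩

lemma pr_of_EE {τ : ℂ} (hτ : τ ≠ 0) (h0 : pr τ = 0) {z w : ℂ} (h : EE τ z = EE τ w) : pr z = pr w := by
  obtain ⟨n, rfl⟩ := (EE_eq hτ).1 h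
  rw [pr_add, prn h0, add_zero]

lemma q_cont {τ : ℂ} (hτ : τ ≠ 0) (h0 : pr τ = 0) : ContinuousOn (fun z => pr (EL τ z)) {z | z ≠ 0} := by
  intro z hz
  apply ContinuousAt.continuousWithinAt
  have h1 : ContinuousAt (fun w => pr (EL τ z + EL τ (w / z))) z := by
    apply pr_cont.continuousAt.comp
    unfold EL
    have : ContinuousAt (fun w => Complex.log (w / z)) z := by
      apply ContinuousAt.clog (by fun_prop)
      rw [div_self hz]; exact Complex.one_mem_slitPlane
    fun_prop
  refine h1.congr ?_
  have : ∀ᶠ w in 𝓝 z, w ≠ 0 := isOpen_ne.mem_nhds hz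
  filter_upwards [this] with w hw
  apply pr_of_EE hτ h0
  rw [EE_EL hτ hw]
  have := EE_add (τ := τ) (EL τ z) (EL τ (w / z)) 1
  simp only [Int.cast_one, one_mul, zpow_one] at this
  rw [this, EE_EL hτ hz, EE_EL hτ (div_ne_zero hw hz), div_mul_cancel₀ _ hz]

theorem noncontr (γ : C(Circle1, Torus)) (hγ : Function.Injective γ) (hn : ¬ NullHomotopic γ) :
    IsPreconnected (range γ)ᶜ := by
  let p : C(unitInterval, Torus) := ⟨fun t => γ ((t : ℝ) : Circle1), by
    exact γ.continuous.comp ((AddCircle.continuous_mk' 1).comp continuous_subtype_val)⟩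
  obtain ⟨e, he⟩ := pr_surj (p 0)
  let g : C(unitInterval, ℂ) := pr_cov.liftPath p e he.symm
  have hg : ∀ t : unitInterval, pr (g t) = γ ((t : ℝ) : Circle1) := fun t => congrFun (pr_cov.liftPath_lifts p e he.symm) t
  have e01 : (((0 : unitInterval) : ℝ) : Circle1) = (((1 : unitInterval) : ℝ) : Circle1) := coe_c1.2 ⟨1, by simp⟩
  have ht : pr (g 1 - g 0) = 0 := by rw [← pr_eq, hg, hg, e01]
  have ht0 : g 1 - g 0 ≠ 0 := by
    intro h
    obtain ⟨η, hη⟩ := close_up g (sub_eq_zero.1 h).symm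
    apply hn
    have h1 : γ = ContinuousMap.comp ⟨pr, pr_cont⟩ η := by
      ext1 x
      obtain ⟨t, rfl⟩ := c1_rep x
      simp only [ContinuousMap.comp_apply, ContinuousMap.coe_mk]
      rw [hη, hg]
    refine ⟨pr 0, ?_⟩
    have h2 : ContinuousMap.Homotopic η (ContinuousMap.const _ 0) := by
      refine ⟨⟨⟨fun q => ((1 - (q.1 : ℝ) : ℝ) : ℂ) * η q.2, by fun_prop⟩, fun x => ?_, fun x => ?_⟩⟩
      · simp
      · simp
    have h3 := ContinuousMap.Homotopic.comp (ContinuousMap.Homotopic.refl (⟨pr, pr_cont⟩ : C(ℂ, Torus))) h2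
    rw [← h1] at h3
    exact h3
  obtain ⟨k, τ, s, hk, hk0, hτ, hτ0, hs0, hlat, him⟩ := lat_split ht0 ht
  set μ := EE τ s with hμ
  have hμ1 : 1 < ‖μ‖ := by
    rw [hμ, EE, Complex.norm_exp]
    rw [Real.one_lt_exp_iff]
    have : (2 * Real.pi * Complex.I * (s / τ) : ℂ).re = - (2 * Real.pi * (s / τ).im) := by
      rw [mul_assoc, show (2 * Real.pi : ℂ) = ((2 * Real.pi : ℝ) : ℂ) by push_cast; rfl, Complex.re_ofReal_mul]
      simp
    rw [this]
    have := Real.pi_pos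
    nlinarith [mul_pos this (neg_pos.2 him)]
  have hEq : ∀ z w, pr z = pr w ↔ ∃ v : ℤ, EE τ z = μ ^ v * EE τ w := by
    intro z w
    constructor
    · intro h
      obtain ⟨u, v, huv⟩ := hlat _ (pr_eq.1 h)
      refine ⟨v, ?_⟩
      rw [← EE_add, EE_eq hτ]
      exact ⟨u, by linear_combination huv⟩
    · rintro ⟨v, hv⟩
      rw [← EE_add] at hv
      rw [pr_of_EE hτ hτ0 hv, pr_add, prn hs0, add_zero]
  have hE01 : EE τ (g 0) = EE τ (g 1) := (EE_eq hτ).2 ⟨-k, by push_cast; linear_combination -hk⟩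
  obtain ⟨δ, hδ⟩ := close_up ⟨fun t => EE τ (g t), (EE_cont τ).comp g.continuous⟩ hE01
  simp only [ContinuousMap.coe_mk] at hδ
  have hγδ : ∀ x y, ∀ v : ℤ, δ x = μ ^ v * δ y → x = y := by
    intro x y v hv
    obtain ⟨a, rfl⟩ := c1_rep x
    obtain ⟨b, rfl⟩ := c1_rep y
    rw [hδ, hδ] at hv
    apply hγ
    rw [← hg, ← hg]
    exact (hEq _ _).2 ⟨v, hv⟩
  have hδi : Function.Injective δ := fun x y h => hγδ x y 0 (by simpa using h)
  have hδ0 : ∀ x, δ x ≠ 0 := by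
    intro x; obtain ⟨a, rfl⟩ := c1_rep x; rw [hδ]; exact EE_ne _ _
  obtain ⟨D, O, hJ⟩ := jc δ hδi
  have h0D : (0 : ℂ) ∈ D := by
    rcases hJ.tri 0 with h | ⟨x, hx⟩ | h
    · exact h
    · exact (hδ0 x hx).elim
    exfalso
    obtain ⟨M, hM, hMb⟩ := hJ.Jc.isBounded.exists_pos_norm_le
    let b : ℂ := ((M + 1 : ℝ) : ℂ)
    have hbn : ‖b‖ = M + 1 := by simp only [b, Complex.norm_real, Real.norm_eq_abs]; rw [abs_of_pos]; linarith
    have hbO : b ∈ O := hJ.ext hM hMb (by rw [hbn]; linarith)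
    have h1 := hl_move _ 0 b (pre_joined hJ.Oo hJ.Op hJ.OJ h hbO)
    have h2 : HL (range δ) (fun z => z - b) := by
      refine ⟨fun z => Complex.log (-b) + Complex.log (1 - z / b), ?_, ?_⟩
      · apply continuousOn_const.add
        apply ContinuousOn.clog (by fun_prop)
        intro z hz
        have hz' := hMb z hz
        rw [Complex.mem_slitPlane_iff]
        left
        have : ‖z / b‖ < 1 := by rw [norm_div, hbn, div_lt_one (by linarith)]; linarith
        have := (Complex.abs_re_le_norm (z / b)).trans_lt this
        rw [abs_lt] at this
        simp only [Complex.sub_re, Complex.one_re]; linarith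
      · intro z hz
        have hz' := hMb z hz
        have hb0 : b ≠ 0 := by rw [← norm_pos_iff, hbn]; linarith
        have hzb : 1 - z / b ≠ 0 := by
          intro h'
          have : z = b := by field_simp at h'; linear_combination -h'
          rw [this, hbn] at hz'; linarith
        rw [Complex.exp_add, Complex.exp_log (neg_ne_zero.2 hb0), Complex.exp_log hzb]
        field_simp; ring
    have h3 : HL (range δ) (fun z => z) := by
      refine (h2.mul h1.inv).congr ?_
      rintro z ⟨x, rfl⟩
      have : δ x - b ≠ 0 := by
        intro h'
        have := hMb (δ x) ⟨x, rfl⟩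
        rw [sub_eq_zero.1 h', hbn] at this; linarith
      have := hδ0 x
      simp only [sub_zero]
      field_simp
    obtain ⟨f, hf1, hf2⟩ := h3
    have hfc : Continuous (fun t : unitInterval => f (EE τ (g t))) := by
      refine hf1.comp_continuous ((EE_cont τ).comp g.continuous) (fun t => ⟨_, hδ t⟩)
    have := log_unique (S := univ) isPreconnected_univ (L := fun t : unitInterval => f (EE τ (g t)))
      (M := fun t : unitInterval => 2 * Real.pi * Complex.I * (g t / τ)) hfc.continuousOn (by fun_prop)
      (fun t _ => hf2 _ ⟨_, hδ t⟩) (mem_univ 0) 1 (mem_univ _)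
    rw [hE01] at this
    have h4 : (2 * Real.pi * Complex.I : ℂ) * (g 1 / τ) = 2 * Real.pi * Complex.I * (g 0 / τ) := by linear_combination -this
    have h5 := mul_left_cancel₀ two_pi_I h4
    rw [div_left_inj' hτ] at h5
    exact ht0 (sub_eq_zero.2 h5)
  obtain ⟨R, hR, hR1, hR2⟩ := annulus hJ (isPreconnected_range δ.continuous) (range_nonempty _) h0D μ hμ1 (by
    rintro _ ⟨x, rfl⟩ ⟨y, hy⟩
    have := hγδ y x 1 (by simpa using hy)
    subst this
    have h1 : μ = 1 := mul_right_cancel₀ (hδ0 y) (by rw [← hy, one_mul])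
    rw [h1] at hμ1; simp at hμ1)
  have : (range γ)ᶜ = (fun z => pr (EL τ z)) '' R := by
    ext P
    constructor
    · intro hP
      obtain ⟨w, rfl⟩ := pr_surj P
      have : ∀ j : ℤ, μ ^ j * EE τ w ∉ range δ := by
        rintro j ⟨x, hx⟩
        obtain ⟨a, rfl⟩ := c1_rep x
        rw [hδ] at hx
        apply hP
        exact ⟨_, (hg a).symm.trans ((hEq _ _).2 ⟨j, hx⟩)⟩
      obtain ⟨j, hj⟩ := hR2 _ (EE_ne τ w) this
      refine ⟨_, hj, (hEq _ _).2 ⟨j, ?_⟩⟩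
      exact EE_EL hτ (hR1 _ hj).1
    · rintro ⟨z, hz, rfl⟩ ⟨x, hx⟩
      obtain ⟨a, rfl⟩ := c1_rep x
      rw [← hg] at hx
      obtain ⟨v, hv⟩ := (hEq _ _).1 hx
      rw [EE_EL hτ (hR1 z hz).1] at hv
      exact (hR1 z hz).2 v ⟨_, (hδ a).trans hv⟩
  rw [this]
  exact hR.image _ ((q_cont hτ hτ0).mono (fun z hz => (hR1 z hz).1))

end PDG


namespace PDG
open scoped Classical
set_option linter.unusedSectionVars false
set_option linter.unusedSimpArgs false
set_option linter.unusedVariables false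
set_option autoImplicit false
open TopP

lemma join_arc {X : Type} [TopologicalSpace X] (g h : C(unitInterval, X)) (hg : Function.Injective g)
    (hh : Function.Injective h) (h1 : g 1 = h 0) (hd : ∀ a b, g a = h b → (a = 1 ∧ b = 0) ∨ (a = 0 ∧ b = 1)) :
    ∃ k : C(unitInterval, X), k 0 = g 0 ∧ k 1 = h 1 ∧ range k = range g ∪ range h ∧
      ∀ s t, k s = k t → s = t ∨ (s = 0 ∧ t = 1) ∨ (s = 1 ∧ t = 0) := by
  let p : Path (g 0) (g 1) := ⟨g, rfl, rfl⟩
  let q : Path (g 1) (h 1) := ⟨h, h1.symm, rfl⟩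
  refine ⟨(p.trans q).toContinuousMap, (p.trans q).source, (p.trans q).target, ?_, ?_⟩
  · exact Path.trans_range p q
  · have hp : ∀ s, p s = g s := fun _ => rfl
    have hq : ∀ s, q s = h s := fun _ => rfl
    have key : ∀ s t : unitInterval, (s : ℝ) ≤ 1/2 → ¬ (t : ℝ) ≤ 1/2 → (p.trans q) s = (p.trans q) t → s = 0 ∧ t = 1 := by
      intro s t hs ht hst
      rw [Path.trans_apply, Path.trans_apply, dif_pos hs, dif_neg ht, hp, hq] at hst
      rcases hd _ _ hst with ⟨h2, h3⟩ | ⟨h2, h3⟩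
      · have := congrArg Subtype.val h3; simp at this; exact absurd (by linarith) ht
      · have e2 := congrArg Subtype.val h2; have e3 := congrArg Subtype.val h3
        simp at e2 e3
        exact ⟨e2, Subtype.ext (show (t:ℝ) = 1 by linarith)⟩
    intro s t hst
    change (p.trans q) s = (p.trans q) t at hst
    by_cases hs : (s : ℝ) ≤ 1/2 <;> by_cases ht : (t : ℝ) ≤ 1/2
    · rw [Path.trans_apply, Path.trans_apply, dif_pos hs, dif_pos ht, hp, hp] at hst
      have := congrArg Subtype.val (hg hst); simp at this
      left; exact Subtype.ext this
    · exact Or.inr (Or.inl (key s t hs ht hst))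
    · right; right; have := key t s ht hs hst.symm; exact ⟨this.2, this.1⟩
    · rw [Path.trans_apply, Path.trans_apply, dif_neg hs, dif_neg ht, hq, hq] at hst
      have := congrArg Subtype.val (hh hst); simp at this
      left; exact Subtype.ext (by linarith)

variable {V : Type} [Fintype V] {G : SimpleGraph V} (P : PGr G Torus)

lemma quad_curve {a b c d : V} (h1 : G.Adj a b) (h2 : G.Adj b c) (h3 : G.Adj c d) (h4 : G.Adj d a) (hac : a ≠ c)
    (hbd : b ≠ d) : ∃ γ : C(Circle1, Torus), Function.Injective γ ∧ range γ = cim P ![a, b, c, d] := by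
  obtain ⟨g1, i1, s1, t1, r1⟩ := P.arc a b h1
  obtain ⟨g2, i2, s2, t2, r2⟩ := P.arc b c h2
  obtain ⟨g3, i3, s3, t3, r3⟩ := P.arc c d h3
  obtain ⟨g4, i4, s4, t4, r4⟩ := P.arc d a h4
  have R1 : range g1 = P.ea s(a, b) ∪ {P.vm a, P.vm b} := by rw [range_eq_I g1, r1, s1, t1]
  have R2 : range g2 = P.ea s(b, c) ∪ {P.vm b, P.vm c} := by rw [range_eq_I g2, r2, s2, t2]
  have R3 : range g3 = P.ea s(c, d) ∪ {P.vm c, P.vm d} := by rw [range_eq_I g3, r3, s3, t3]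
  have R4 : range g4 = P.ea s(d, a) ∪ {P.vm d, P.vm a} := by rw [range_eq_I g4, r4, s4, t4]
  have n1 := h1.ne
  have n2 := h2.ne
  have n3 := h3.ne
  have n4 := h4.ne
  have inter : ∀ u v u' v', G.Adj u v → G.Adj u' v' → s(u, v) ≠ s(u', v') → ∀ z,
      z ∈ P.ea s(u, v) ∪ {P.vm u, P.vm v} → z ∈ P.ea s(u', v') ∪ {P.vm u', P.vm v'} →
      ∃ w, z = P.vm w ∧ (w = u ∨ w = v) ∧ (w = u' ∨ w = v') := by
    rintro u v u' v' h h' hne z (hz | hz) (hz' | hz')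
    · exact (nomem (P.disj _ h _ h' hne) hz hz').elim
    · rcases hz' with rfl | rfl <;> exact (P.vnot _ _ h hz).elim
    · rcases hz with rfl | rfl <;> exact (P.vnot _ _ h' hz').elim
    · rcases hz with rfl | rfl
      · refine ⟨u, rfl, Or.inl rfl, ?_⟩
        rcases hz' with hz' | hz'
        · exact Or.inl (P.inj hz')
        · exact Or.inr (P.inj hz')
      · refine ⟨v, rfl, Or.inr rfl, ?_⟩
        rcases hz' with hz' | hz'
        · exact Or.inl (P.inj hz')
        · exact Or.inr (P.inj hz')
  have e12 : s(a, b) ≠ s(b, c) := by simp [n1, hac]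
  have e13 : s(a, b) ≠ s(c, d) := by simp [hac, n4.symm]
  have e14 : s(a, b) ≠ s(d, a) := by simp [hbd, n4.symm]
  have e23 : s(b, c) ≠ s(c, d) := by simp [n2, hbd]
  have e24 : s(b, c) ≠ s(d, a) := by simp [hbd, n1.symm]
  have e34 : s(c, d) ≠ s(d, a) := by simp [n3, hac.symm]
  obtain ⟨k, k0, k1, kr, ki⟩ := join_arc g1 g2 i1 i2 (t1.trans s2.symm) (by
    intro x y hxy
    obtain ⟨w, hw, hw1, hw2⟩ := inter a b b c h1 h2 e12 (g1 x) (by rw [← R1]; exact ⟨x, rfl⟩) (by rw [hxy, ← R2]; exact ⟨y, rfl⟩)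
    have : w = b := by
      rcases hw1 with rfl | rfl
      · rcases hw2 with h | h
        · exact h
        · exact (hac h).elim
      · rfl
    subst this
    left
    exact ⟨i1 (hw.trans t1.symm), i2 ((hxy.symm.trans hw).trans s2.symm)⟩)
  obtain ⟨l, l0, l1, lr, li⟩ := join_arc g3 g4 i3 i4 (t3.trans s4.symm) (by
    intro x y hxy
    obtain ⟨w, hw, hw1, hw2⟩ := inter c d d a h3 h4 e34 (g3 x) (by rw [← R3]; exact ⟨x, rfl⟩) (by rw [hxy, ← R4]; exact ⟨y, rfl⟩)
    have : w = d := by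
      rcases hw1 with rfl | rfl
      · rcases hw2 with h | h
        · exact h
        · exact (hac h.symm).elim
      · rfl
    subst this
    left
    exact ⟨i3 (hw.trans t3.symm), i4 ((hxy.symm.trans hw).trans s4.symm)⟩)
  have kinj : Function.Injective k := by
    intro s t hst
    rcases ki s t hst with h | ⟨rfl, rfl⟩ | ⟨rfl, rfl⟩
    · exact h
    · rw [k0, k1, s1, t2] at hst; exact (hac (P.inj hst)).elim
    · rw [k0, k1, s1, t2] at hst; exact (hac (P.inj hst).symm).elim
  have linj : Function.Injective l := by
    intro s t hst
    rcases li s t hst with h | ⟨rfl, rfl⟩ | ⟨rfl, rfl⟩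
    · exact h
    · rw [l0, l1, s3, t4] at hst; exact (hac (P.inj hst).symm).elim
    · rw [l0, l1, s3, t4] at hst; exact (hac (P.inj hst)).elim
  obtain ⟨m, m0, m1, mr, mi⟩ := join_arc k l kinj linj (by rw [k1, l0, t2, s3]) (by
    intro x y hxy
    have hx : k x ∈ range g1 ∪ range g2 := by rw [← kr]; exact ⟨x, rfl⟩
    have hy : k x ∈ range g3 ∪ range g4 := by rw [hxy, ← lr]; exact ⟨y, rfl⟩
    have : ∃ w, k x = P.vm w ∧ (w = a ∨ w = c) := by
      rw [R1, R2] at hx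
      rw [R3, R4] at hy
      rcases hx with hx | hx <;> rcases hy with hy | hy
      · obtain ⟨w, hw, h5, h6⟩ := inter a b c d h1 h3 e13 _ hx hy
        rcases h5 with rfl | rfl
        · exact ⟨_, hw, Or.inl rfl⟩
        · exact ⟨_, hw, Or.inr (h6.resolve_right hbd)⟩
      · obtain ⟨w, hw, h5, h6⟩ := inter a b d a h1 h4 e14 _ hx hy
        rcases h5 with rfl | rfl
        · exact ⟨_, hw, Or.inl rfl⟩
        · exact ⟨_, hw, Or.inl (h6.resolve_left hbd)⟩
      · obtain ⟨w, hw, h5, h6⟩ := inter b c c d h2 h3 e23 _ hx hy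
        rcases h5 with rfl | rfl
        · exact ⟨_, hw, Or.inr (h6.resolve_right hbd)⟩
        · exact ⟨_, hw, Or.inr rfl⟩
      · obtain ⟨w, hw, h5, h6⟩ := inter b c d a h2 h4 e24 _ hx hy
        rcases h5 with rfl | rfl
        · exact ⟨_, hw, Or.inl (h6.resolve_left hbd)⟩
        · exact ⟨_, hw, Or.inr rfl⟩
    obtain ⟨w, hw, rfl | rfl⟩ := this
    · right
      exact ⟨kinj (by rw [hw, k0, s1]), linj (by rw [← hxy, hw, l1, t4])⟩
    · left
      exact ⟨kinj (by rw [hw, k1, t2]), linj (by rw [← hxy, hw, l0, s3])⟩)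
  obtain ⟨γ, hγ⟩ := close_up m (by rw [m0, m1, k0, l1, s1, t4])
  refine ⟨γ, ?_, ?_⟩
  · intro x y hxy
    obtain ⟨s, rfl⟩ := c1_rep x
    obtain ⟨t, rfl⟩ := c1_rep y
    rw [hγ, hγ] at hxy
    rcases mi s t hxy with h | ⟨rfl, rfl⟩ | ⟨rfl, rfl⟩
    · rw [h]
    · exact coe_c1.2 ⟨1, by simp⟩
    · exact coe_c1.2 ⟨-1, by simp⟩
  · have : range γ = range m := by
      ext z
      constructor
      · rintro ⟨x, rfl⟩
        obtain ⟨s, rfl⟩ := c1_rep x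
        exact ⟨s, (hγ s).symm⟩
      · rintro ⟨s, rfl⟩; exact ⟨_, hγ s⟩
    rw [this, mr, kr, lr, R1, R2, R3, R4]
    ext z
    simp only [cim, mem_iUnion]
    constructor
    · rintro (((h | rfl | rfl) | h | rfl | rfl) | (h | rfl | rfl) | h | rfl | rfl)
      · exact ⟨(0 : Fin 4), Or.inl h⟩
      · exact ⟨(0 : Fin 4), Or.inr rfl⟩
      · exact ⟨(1 : Fin 4), Or.inr rfl⟩
      · exact ⟨(1 : Fin 4), Or.inl h⟩
      · exact ⟨(1 : Fin 4), Or.inr rfl⟩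
      · exact ⟨(2 : Fin 4), Or.inr rfl⟩
      · exact ⟨(2 : Fin 4), Or.inl h⟩
      · exact ⟨(2 : Fin 4), Or.inr rfl⟩
      · exact ⟨(3 : Fin 4), Or.inr rfl⟩
      · exact ⟨(3 : Fin 4), Or.inl h⟩
      · exact ⟨(3 : Fin 4), Or.inr rfl⟩
      · exact ⟨(0 : Fin 4), Or.inr rfl⟩
    · rintro ⟨i, h⟩
      fin_cases i
      · rcases h with h | h
        · exact Or.inl (Or.inl (Or.inl h))
        · exact Or.inl (Or.inl (Or.inr (Or.inl h)))
      · rcases h with h | h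
        · exact Or.inl (Or.inr (Or.inl h))
        · exact Or.inl (Or.inr (Or.inr (Or.inl h)))
      · rcases h with h | h
        · exact Or.inr (Or.inl (Or.inl h))
        · exact Or.inr (Or.inl (Or.inr (Or.inl h)))
      · rcases h with h | h
        · exact Or.inr (Or.inr (Or.inl h))
        · exact Or.inr (Or.inr (Or.inr (Or.inl h)))

end PDG


namespace PDG
open scoped Classical
set_option linter.unusedSectionVars false
set_option linter.unusedSimpArgs false
set_option linter.unusedVariables false
set_option autoImplicit false
open TopP

variable {V : Type} [Fintype V] {G : SimpleGraph V} (P : PGr G Torus)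

lemma torus_pre : IsPreconnected (univ : Set Torus) := by
  rw [← pr_surj.range_eq]
  exact isPreconnected_range pr_cont

lemma cim_sub_img {n : ℕ} [NeZero n] {c : Fin n → V} (hc : Cy G c) : cim P c ⊆ img P := by
  intro z hz
  obtain ⟨i, h | h⟩ := mem_iUnion.1 hz
  · exact Or.inr (mem_biUnion (show s(c i, c (i + 1)) ∈ G.edgeSet from hc.adj i) h)
  · exact Or.inl ⟨_, h.symm⟩

theorem quad_face (hG : Crit G) {a b c d : V} (h1 : G.Adj a b) (h2 : G.Adj b c) (h3 : G.Adj c d) (h4 : G.Adj d a)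
    (hac : a ≠ c) (hbd : b ≠ d) {g : Set Torus} (go : IsOpen g) (gp : IsPreconnected g) (gn : g.Nonempty)
    (gC : g ∩ cim P ![a, b, c, d] = ∅) (gf : frontier g = cim P ![a, b, c, d]) {e : Sym2 V} (he : e ∈ G.edgeSet)
    (heC : P.ea e ∩ cim P ![a, b, c, d] = ∅) (heg : P.ea e ∩ g = ∅) :
    ∃ J D O, Disc (cim P ![a, b, c, d]) J D O ∧ g = pr '' D := by
  have hc := cy4 h1 h2 h3 h4 hac hbd
  obtain ⟨γ, hγ, hr⟩ := quad_curve P h1 h2 h3 h4 hac hbd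
  set C := cim P ![a, b, c, d] with hCdef
  obtain ⟨x, hx⟩ := gn
  obtain ⟨z, hz⟩ := (eaT_pre P he).2
  have hxC : x ∈ Cᶜ := fun h => nomem gC hx h
  have hzC : z ∈ Cᶜ := fun h => nomem heC hz h
  have gcl : closure g = g ∪ C := by
    rw [← gf, closure_eq_self_union_frontier]
  have gcc : connectedComponentIn Cᶜ x = g := by
    refine Subset.antisymm ?_ (gp.subset_connectedComponentIn hx (fun y hy h => nomem gC hy h))
    refine isPreconnected_connectedComponentIn.subset_of_closure_inter_subset go ⟨x, mem_connectedComponentIn hxC, hx⟩ ?_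
    rintro y ⟨hy1, hy2⟩
    rw [gcl] at hy1
    exact hy1.resolve_right (connectedComponentIn_subset _ _ hy2)
  have Ccl : IsClosed C := by rw [← gf]; exact isClosed_frontier
  by_cases hcon : ContractibleSet C
  · obtain ⟨J, D, O, hD⟩ := contr_disc hcon
    refine ⟨J, D, O, hD, ?_⟩
    by_contra hne
    obtain ⟨w, hw⟩ := hD.Dn
    have hwp : pr w ∈ pr '' D := ⟨w, hw, rfl⟩
    have hwC : pr w ∉ C := fun h => nomem hD.pDA hwp h
    have hwcc := hD.pcc hwp
    have hW : IsClopen (g ∪ pr '' D ∪ C) := by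
      constructor
      · have : g ∪ pr '' D ∪ C = closure g ∪ closure (pr '' D) := by
          rw [gcl, hD.pcl]
          ext q; simp only [mem_union]; tauto
        rw [this]; exact isClosed_closure.union isClosed_closure
      · rw [isOpen_iff_mem_nhds]
        rintro y ((hy | hy) | hy)
        · exact Filter.mem_of_superset (go.mem_nhds hy) (fun q hq => Or.inl (Or.inl hq))
        · exact Filter.mem_of_superset (hD.pDo.mem_nhds hy) (fun q hq => Or.inl (Or.inr hq))
        · have hy' := hy
          rw [← hr] at hy'
          obtain ⟨θ, hθ⟩ := hy'
          obtain ⟨t, rfl⟩ := c1_rep θ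
          have hsub : range (ar γ ((t : ℝ) - 1/4) (1/2)) ⊆ C := by
            rw [← hr]; rintro _ ⟨s, rfl⟩; exact ⟨_, rfl⟩
          obtain ⟨N, hN, hyN, hNs⟩ := loc (C := C) (ar γ ((t : ℝ) - 1/4) (1/2)) (ar_inj γ hγ (by norm_num) (by norm_num))
            (by
              rw [← hr, ar_diff γ hγ (by norm_num) (by norm_num)]
              exact (isCompact_range (ContinuousMap.continuous _)).isClosed) hsub (y := y)
            ⟨⟨1/2, by norm_num, by norm_num⟩, ⟨by rw [← Subtype.coe_lt_coe]; norm_num, by rw [← Subtype.coe_lt_coe]; norm_num⟩, by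
              rw [ar_app, ← hθ]; congr 2; ring⟩ hxC hwC (by rw [gcc, hwcc]; exact hne)
            (by rw [gcc, gcl]; exact Or.inr hy) (by rw [hwcc, hD.pcl]; exact Or.inr hy)
          refine Filter.mem_of_superset (hN.mem_nhds hyN) (hNs.trans ?_)
          rw [gcc, hwcc]
          exact union_subset_union_right _ ((image_subset_range _ _).trans hsub)
    have hU : univ ⊆ g ∪ pr '' D ∪ C := torus_pre.subset_isClopen hW ⟨x, trivial, Or.inl (Or.inl hx)⟩
    rcases hU (mem_univ z) with (h | h) | h
    · exact nomem heg hz h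
    · exact nomem (disc_empty P hG hc hD) h (Or.inr (mem_biUnion he hz))
    · exact hzC h
  · exfalso
    have := noncontr γ hγ (fun hn => hcon ⟨γ, hγ, hr, hn⟩)
    rw [hr] at this
    have h5 : z ∈ connectedComponentIn Cᶜ x := this.subset_connectedComponentIn hxC Subset.rfl hzC
    rw [gcc] at h5
    exact nomem heg hz h5

lemma third_nb (hG : Crit G) {v1 v2 v3 : V} (h12 : G.Adj v1 v2) : ∃ t, G.Adj v2 t ∧ t ≠ v1 ∧ t ≠ v3 := by
  by_contra hn
  push Not at hn
  let Γ : SimpleGraph V :=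
    { Adj := fun a b => G.Adj a b ∧ a ≠ v2 ∧ b ≠ v2
      symm := ⟨fun a b h => ⟨h.1.symm, h.2.2, h.2.1⟩⟩
      loopless := ⟨fun a h => G.loopless.irrefl a h.1⟩ }
  have hlt : Γ < G := by
    refine lt_of_le_of_ne (fun a b h => h.1) ?_
    intro h
    have : Γ.Adj v1 v2 := h ▸ h12
    exact this.2.2 rfl
  obtain ⟨col, hcol⟩ := hG.crit Γ hlt
  obtain ⟨k, hk1, hk3⟩ : ∃ k : Fin 3, k ≠ col v1 ∧ k ≠ col v3 := by
    generalize col v1 = p; generalize col v3 = q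
    revert p q; decide
  apply hG.no
  have nb : ∀ t, G.Adj v2 t → k ≠ col t := by
    intro t ht
    by_cases h : t = v1
    · rw [h]; exact hk1
    · rw [hn t ht h]; exact hk3
  refine ⟨fun a => if a = v2 then k else col a, ?_⟩
  intro a b hab
  dsimp only
  by_cases ha : a = v2
  · subst ha
    rw [if_pos rfl, if_neg hab.ne.symm]; exact nb b hab
  · by_cases hb : b = v2
    · subst hb
      rw [if_pos rfl, if_neg ha]; exact (nb a hab.symm).symm
    · rw [if_neg ha, if_neg hb]; exact hcol a b ⟨hab, ha, hb⟩

lemma cl_edges (T : Set (Sym2 V)) (hT : T ⊆ G.edgeSet) : IsClosed (⋃ e ∈ T, (P.ea e ∪ P.vm '' {x | x ∈ e})) :=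
  T.toFinite.isClosed_biUnion fun e he => (eaT_cl P (hT he)).isClosed

lemma img_cl : IsClosed (img P) := by
  have : img P = range P.vm ∪ ⋃ e ∈ G.edgeSet, (P.ea e ∪ P.vm '' {x | x ∈ e}) := by
    ext z
    constructor
    · rintro (h | h)
      · exact Or.inl h
      · obtain ⟨e, he, h⟩ := mem_iUnion₂.1 h
        exact Or.inr (mem_biUnion he (Or.inl h))
    · rintro (h | h)
      · exact Or.inl h
      · obtain ⟨e, he, h | ⟨x, _, h⟩⟩ := mem_iUnion₂.1 h
        · exact Or.inr (mem_biUnion he h)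
        · exact Or.inl ⟨x, h⟩
  rw [this]
  exact (finite_range _).isClosed.union (cl_edges P _ Subset.rfl)

lemma img_diff_cl {e : Sym2 V} (he : e ∈ G.edgeSet) : IsClosed (img P \ P.ea e) := by
  have : img P \ P.ea e = range P.vm ∪ ⋃ f ∈ G.edgeSet \ {e}, (P.ea f ∪ P.vm '' {x | x ∈ f}) := by
    ext z
    constructor
    · rintro ⟨h | h, h'⟩
      · exact Or.inl h
      · obtain ⟨f, hf, h⟩ := mem_iUnion₂.1 h
        refine Or.inr (mem_biUnion (x := f) ⟨hf, ?_⟩ (Or.inl h))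
        rintro rfl; exact h' h
    · rintro (⟨x, rfl⟩ | h)
      · exact ⟨Or.inl ⟨x, rfl⟩, P.vnot _ _ he⟩
      · obtain ⟨f, hf, h | ⟨x, _, rfl⟩⟩ := mem_iUnion₂.1 h
        · exact ⟨Or.inr (mem_biUnion hf.1 h), fun h' => nomem (P.disj _ hf.1 _ he hf.2) h h'⟩
        · exact ⟨Or.inl ⟨x, rfl⟩, P.vnot _ _ he⟩
  rw [this]
  exact (finite_range _).isClosed.union (cl_edges P _ sdiff_subset)

theorem face_cc (hG : Crit G) {n : ℕ} [NeZero n] {c : Fin n → V} {J D O : Set ℂ} (hc : Cy G c)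
    (hD : Disc (cim P c) J D O) : ∃ x, x ∉ img P ∧ connectedComponentIn (img P)ᶜ x = pr '' D := by
  obtain ⟨w, hw⟩ := hD.Dn
  have hwp : pr w ∈ pr '' D := ⟨w, hw, rfl⟩
  have hem := disc_empty P hG hc hD
  refine ⟨pr w, fun h => nomem hem hwp h, Subset.antisymm ?_ ?_⟩
  · rw [← hD.pcc hwp]
    exact connectedComponentIn_mono _ (compl_subset_compl.2 (cim_sub_img P hc))
  · exact (hD.Dp.image _ pr_cont.continuousOn).subset_connectedComponentIn hwp (fun y hy h => nomem hem hy h)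

theorem two_disc (hG : Crit G) {v1 v2 v3 : V} (h12 : G.Adj v1 v2) (h23 : G.Adj v2 v3) 
    {n m : ℕ} [NeZero n] [NeZero m] {c : Fin n → V} {c' : Fin m → V} (hc : Cy G c) (hc' : Cy G c')
    {J D O J' D' O' : Set ℂ} (hD : Disc (cim P c) J D O) (hD' : Disc (cim P c') J' D' O') (hne : cim P c ≠ cim P c')
    (i1 : P.ea s(v1, v2) ⊆ cim P c ∩ cim P c') (i2 : P.ea s(v2, v3) ⊆ cim P c ∩ cim P c')
    (l : ∀ i, v2 ∈ s(c i, c (i + 1)) → s(c i, c (i + 1)) = s(v1, v2) ∨ s(c i, c (i + 1)) = s(v2, v3))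
    (l' : ∀ i, v2 ∈ s(c' i, c' (i + 1)) → s(c' i, c' (i + 1)) = s(v1, v2) ∨ s(c' i, c' (i + 1)) = s(v2, v3)) : False := by
  obtain ⟨t, ht, ht1, ht3⟩ := third_nb (v3 := v3) hG h12
  obtain ⟨x, hx, hxD⟩ := face_cc P hG hc hD
  obtain ⟨x', hx', hxD'⟩ := face_cc P hG hc' hD'
  have hDD : pr '' D ≠ pr '' D' := by
    intro h
    apply hne
    have e1 := hD.pcl
    have e2 := hD'.pcl
    have e3 := hD.pDA
    have e4 := hD'.pDA
    rw [← h] at e2 e4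
    rw [e1] at e2
    apply Subset.antisymm
    · intro z hz
      have : z ∈ pr '' D ∪ cim P c := Or.inr hz
      rw [e2] at this
      exact this.resolve_left (fun h => nomem e3 h hz)
    · intro z hz
      have : z ∈ pr '' D ∪ cim P c' := Or.inr hz
      rw [← e2] at this
      exact this.resolve_left (fun h => nomem e4 h hz)
  have lo : ∀ u v, G.Adj u v → P.ea s(u, v) ⊆ cim P c ∩ cim P c' → ∀ y ∈ P.ea s(u, v), 
      pr '' D ∪ pr '' D' ∪ P.ea s(u, v) ∈ 𝓝 y := by
    intro u v huv hs y hy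
    obtain ⟨g, hg, g0, g1, hr⟩ := P.arc u v huv
    obtain ⟨N, hN, hyN, hNs⟩ := loc (C := img P) g hg (by rw [hr]; exact img_diff_cl P huv)
      (by
        rw [range_eq_I g, hr, g0, g1]
        rintro z (h | rfl | rfl)
        · exact Or.inr (mem_biUnion (show s(u, v) ∈ G.edgeSet from huv) h)
        · exact Or.inl ⟨_, rfl⟩
        · exact Or.inl ⟨_, rfl⟩) (y := y) (by rw [hr]; exact hy) hx hx' (by rw [hxD, hxD']; exact hDD)
        (by rw [hxD, hD.pcl]; exact Or.inr (hs hy).1) (by rw [hxD', hD'.pcl]; exact Or.inr (hs hy).2)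
    rw [hxD, hxD', hr] at hNs
    exact Filter.mem_of_superset (hN.mem_nhds hyN) hNs
  set U := pr '' D ∪ pr '' D' ∪ P.ea s(v1, v2) ∪ P.ea s(v2, v3) with hU
  have Uo : IsOpen U := by
    rw [isOpen_iff_mem_nhds]
    rintro y (((hy | hy) | hy) | hy)
    · exact Filter.mem_of_superset (hD.pDo.mem_nhds hy) (fun q hq => Or.inl (Or.inl (Or.inl hq)))
    · exact Filter.mem_of_superset (hD'.pDo.mem_nhds hy) (fun q hq => Or.inl (Or.inl (Or.inr hq)))
    · exact Filter.mem_of_superset (lo _ _ h12 i1 y hy) (fun q hq => Or.inl hq)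
    · refine Filter.mem_of_superset (lo _ _ h23 i2 y hy) ?_
      rintro q (hq | hq)
      · exact Or.inl (Or.inl hq)
      · exact Or.inr hq
  set K := P.vm '' {v2}ᶜ ∪ ⋃ e ∈ {e ∈ G.edgeSet | v2 ∉ e}, (P.ea e ∪ P.vm '' {x | x ∈ e}) with hK
  have Kc : IsClosed K := (toFinite _).isClosed.union (cl_edges P _ (fun e he => he.1))
  have vK : P.vm v2 ∉ K := by
    rintro (⟨y, hy, h⟩ | h)
    · exact hy (P.inj h)
    · obtain ⟨e, he, h | ⟨y, hy, h⟩⟩ := mem_iUnion₂.1 h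
      · exact P.vnot _ _ he.1 h
      · have := P.inj h; subst this; exact he.2 hy
  obtain ⟨w, hw⟩ := pr_surj (P.vm v2)
  obtain ⟨r0, hr0, hb0⟩ := Metric.isOpen_iff.1 (Kc.isOpen_compl.preimage pr_cont) w (by rw [mem_preimage, hw]; exact vK)
  set r := min r0 (1/3) with hr
  have hrp : 0 < r := lt_min hr0 (by norm_num)
  have hb : Metric.ball w r ⊆ pr ⁻¹' Kᶜ := (Metric.ball_subset_ball (min_le_left _ _)).trans hb0
  set S := pr '' (Metric.ball w r \ {w}) with hS
  have Sp : IsPreconnected S := (pre_pball w r hrp).image _ pr_cont.continuousOn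
  have SK : ∀ z ∈ S, z ∉ K := by
    rintro _ ⟨q, hq, rfl⟩; exact hb hq.1
  have Sv : P.vm v2 ∉ S := by
    rintro ⟨q, hq, h⟩
    rw [← hw] at h
    exact hq.2 (pr_injOn w (r := r) ((min_le_right _ _).trans_lt (by norm_num)) (Metric.ball_subset_closedBall hq.1)
      (Metric.mem_closedBall_self hrp.le) h)
  have Se : ∀ u, G.Adj v2 u → (S ∩ P.ea s(v2, u)).Nonempty := by
    intro u hu
    obtain ⟨z, ⟨q, hq, rfl⟩, hz⟩ := mem_closure_iff.1 (eaT_end P hu).1 _ (pr_open _ Metric.isOpen_ball) ⟨w, Metric.mem_ball_self hrp, hw⟩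
    refine ⟨pr q, ⟨q, ⟨hq, ?_⟩, rfl⟩, hz⟩
    rintro rfl
    rw [hw] at hz
    exact P.vnot _ _ hu hz
  have Svm : ∀ u, P.vm u ∉ S := by
    intro u hu
    by_cases h : u = v2
    · subst h; exact Sv hu
    · exact SK _ hu (Or.inl ⟨u, h, rfl⟩)
  have cims : ∀ {n : ℕ} [NeZero n] {c : Fin n → V}, Cy G c → 
      (∀ i, v2 ∈ s(c i, c (i + 1)) → s(c i, c (i + 1)) = s(v1, v2) ∨ s(c i, c (i + 1)) = s(v2, v3)) →
      ∀ z ∈ S, z ∈ cim P c → z ∈ U := by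
    intro n _ c hc l z hzS hz
    obtain ⟨i, h | h⟩ := mem_iUnion.1 hz
    · by_cases hi : v2 ∈ s(c i, c (i + 1))
      · rcases l i hi with h' | h'
        · rw [h'] at h; exact Or.inl (Or.inr h)
        · rw [h'] at h; exact Or.inr h
      · exact (SK z hzS (Or.inr (mem_biUnion (x := s(c i, c (i + 1))) ⟨hc.adj i, hi⟩ (Or.inl h)))).elim
    · rw [mem_singleton_iff] at h; subst h
      exact (Svm _ hzS).elim
  have ecl : ∀ u v, G.Adj u v → closure (P.ea s(u, v)) ⊆ P.ea s(u, v) ∪ P.vm '' {x | x ∈ s(u, v)} := by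
    intro u v h
    exact closure_minimal subset_union_left (eaT_cl P (e := s(u, v)) h).isClosed
  have SU : S ⊆ U := by
    refine Sp.subset_of_closure_inter_subset Uo ?_ ?_
    · obtain ⟨z, h1, h2⟩ := Se v3 h23
      exact ⟨z, h1, Or.inr h2⟩
    · rintro z ⟨hz, hzS⟩
      rw [hU, closure_union, closure_union, closure_union, hD.pcl, hD'.pcl] at hz
      rcases hz with (((h | h) | h | h) | h) | h
      · exact Or.inl (Or.inl (Or.inl h))
      · exact cims hc l z hzS h
      · exact Or.inl (Or.inl (Or.inr h))
      · exact cims hc' l' z hzS h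
      · rcases ecl _ _ h12 h with h | ⟨y, _, rfl⟩
        · exact Or.inl (Or.inr h)
        · exact (Svm _ hzS).elim
      · rcases ecl _ _ h23 h with h | ⟨y, _, rfl⟩
        · exact Or.inr h
        · exact (Svm _ hzS).elim
  obtain ⟨z, hzS, hz⟩ := Se t ht
  have hzi : z ∈ img P := Or.inr (mem_biUnion (show s(v2, t) ∈ G.edgeSet from ht) hz)
  rcases SU hzS with ((h | h) | h) | h
  · exact nomem (disc_empty P hG hc hD) h hzi
  · exact nomem (disc_empty P hG hc' hD') h hzi
  · refine nomem (P.disj _ ht _ h12 ?_) hz h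
    simp [ht1, ht.ne.symm, h12.ne.symm]
  · refine nomem (P.disj _ ht _ h23 ?_) hz h
    simp [ht3, ht.ne.symm]

end PDG


namespace PDG
open scoped Classical
set_option linter.unusedSectionVars false
set_option linter.unusedSimpArgs false
set_option linter.unusedVariables false
set_option autoImplicit false
open TopP

variable {V : Type} [Fintype V] {G : SimpleGraph V}

lemma locT : LocallyConnectedSpace Torus :=
  (pr_open.isQuotientMap pr_cont pr_surj).locallyConnectedSpace

lemma crit_of (h1 : TriangleFree G) (h2 : FourCritical G) : Crit G where
  tf := by
    intro a b c hab hbc hca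
    refine h1 a (.cons hab (.cons hbc (.cons hca .nil))) ?_ rfl
    rw [SimpleGraph.Walk.isCycle_def]
    refine ⟨?_, by simp, ?_⟩
    · rw [SimpleGraph.Walk.isTrail_def]
      simp [hab.ne, hbc.ne, hca.ne, hab.ne.symm, hbc.ne.symm, hca.ne.symm]
    · simp [hab.ne, hbc.ne, hca.ne, hab.ne.symm, hbc.ne.symm, hca.ne.symm]
  no := by
    rintro ⟨col, hcol⟩
    have : G.Colorable 3 := ⟨SimpleGraph.Coloring.mk col (fun {u v} h => hcol u v h)⟩
    have := this.chromaticNumber_le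
    rw [h2.1] at this
    exact absurd this (by decide)
  crit := by
    intro Γ hΓ
    have hne : SimpleGraph.toSubgraph Γ hΓ.le ≠ ⊤ := by
      intro h
      apply hΓ.ne
      ext a b
      have : (SimpleGraph.toSubgraph Γ hΓ.le).Adj a b ↔ (⊤ : G.Subgraph).Adj a b := by rw [h]
      exact this
    have hc := h2.2 _ hne
    have hc : (SimpleGraph.toSubgraph Γ hΓ.le).coe.Colorable 3 := SimpleGraph.chromaticNumber_le_iff_colorable.1 hc
    obtain ⟨C⟩ := hc
    exact ⟨fun v => C ⟨v, trivial⟩, fun u v h => C.valid h⟩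
  iso := by
    intro x
    by_contra hn
    push Not at hn
    have hne : (⊤ : G.Subgraph).deleteVerts {x} ≠ ⊤ := by
      intro h
      have : x ∈ ((⊤ : G.Subgraph).deleteVerts {x}).verts := by rw [h]; trivial
      simp at this
    have hc : ((⊤ : G.Subgraph).deleteVerts {x}).coe.Colorable 3 := SimpleGraph.chromaticNumber_le_iff_colorable.1 (h2.2 _ hne)
    obtain ⟨C⟩ := hc
    have : G.Colorable 3 := by
      refine ⟨SimpleGraph.Coloring.mk (fun v => if h : v = x then 0 else C ⟨v, by simpa using h⟩) ?_⟩
      intro u v huv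
      have hu : u ≠ x := by rintro rfl; exact hn _ huv
      have hv : v ≠ x := by rintro rfl; exact hn _ huv.symm
      rw [dif_neg hu, dif_neg hv]
      apply C.valid
      simp [hu, hv, huv]
    have := this.chromaticNumber_le
    rw [h2.1] at this
    exact absurd this (by decide)

lemma walk_cons {u v b : V} {l : List V} (w : G.Walk u v) (hs : w.support = u :: b :: l) :
    ∃ (h : G.Adj u b) (p : G.Walk b v), w = .cons h p ∧ p.support = b :: l := by
  cases w with
  | nil => simp at hs
  | cons h p =>
    rename_i c
    have h1 : p.support = b :: l := by simpa using hs
    have h2 : c = b := by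
      have := p.head_support
      simp only [h1, List.head_cons] at this
      exact this.symm
    subst h2
    exact ⟨h, p, rfl, h1⟩

lemma walk4 {a b c e : V} (w : G.Walk a a) (hs : w.support = [a, b, c, e, a]) :
    ∃ (h1 : G.Adj a b) (h2 : G.Adj b c) (h3 : G.Adj c e) (h4 : G.Adj e a),
      w = .cons h1 (.cons h2 (.cons h3 (.cons h4 .nil))) := by
  obtain ⟨h1, p1, rfl, s1⟩ := walk_cons w hs
  obtain ⟨h2, p2, rfl, s2⟩ := walk_cons p1 s1
  obtain ⟨h3, p3, rfl, s3⟩ := walk_cons p2 s2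
  obtain ⟨h4, p4, rfl, s4⟩ := walk_cons p3 s3
  have : p4.length = 0 := by
    have := p4.length_support
    rw [s4] at this
    simpa using this.symm
  rw [(SimpleGraph.Walk.length_eq_zero_iff.1 this).eq_nil]
  exact ⟨h1, h2, h3, h4, rfl⟩

lemma toP_ea (d : Drawing G Torus) (e : G.edgeSet) : (toP d).ea e.1 = d.emap e := by
  simp [toP]

lemma walkImage_eq (d : Drawing G Torus) {a b : V} (w : G.Walk a b) (z : Torus) : z ∈ walkImage d w ↔
    (∃ v ∈ w.support, z = (toP d).vm v) ∨ ∃ e ∈ w.edges, z ∈ (toP d).ea e := by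
  unfold walkImage
  simp only [mem_union, mem_iUnion, mem_singleton_iff, exists_prop]
  refine or_congr Iff.rfl ⟨?_, ?_⟩
  · rintro ⟨e, he, h⟩
    exact ⟨e.1, he, by rw [toP_ea]; exact h⟩
  · rintro ⟨e, he, h⟩
    refine ⟨⟨e, w.edges_subset_edgeSet he⟩, he, ?_⟩
    rw [← toP_ea]; exact h

lemma wi4 (d : Drawing G Torus) {a b c e : V} (h1 : G.Adj a b) (h2 : G.Adj b c) (h3 : G.Adj c e) (h4 : G.Adj e a) :
    walkImage d (.cons h1 (.cons h2 (.cons h3 (.cons h4 .nil)))) = cim (toP d) ![a, b, c, e] := by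
  ext z
  rw [walkImage_eq]
  simp only [cim, mem_iUnion, SimpleGraph.Walk.support_cons, SimpleGraph.Walk.edges_cons, SimpleGraph.Walk.support_nil,
    SimpleGraph.Walk.edges_nil, List.mem_cons, List.not_mem_nil, or_false]
  constructor
  · rintro (⟨v, rfl | rfl | rfl | rfl | rfl, rfl⟩ | ⟨f, rfl | rfl | rfl | rfl, h⟩)
    · exact ⟨(0 : Fin 4), Or.inr rfl⟩
    · exact ⟨(1 : Fin 4), Or.inr rfl⟩
    · exact ⟨(2 : Fin 4), Or.inr rfl⟩
    · exact ⟨(3 : Fin 4), Or.inr rfl⟩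
    · exact ⟨(0 : Fin 4), Or.inr rfl⟩
    · exact ⟨(0 : Fin 4), Or.inl h⟩
    · exact ⟨(1 : Fin 4), Or.inl h⟩
    · exact ⟨(2 : Fin 4), Or.inl h⟩
    · exact ⟨(3 : Fin 4), Or.inl h⟩
  · rintro ⟨i, h | h⟩
    · right; fin_cases i
      · exact ⟨_, Or.inl rfl, h⟩
      · exact ⟨_, Or.inr (Or.inl rfl), h⟩
      · exact ⟨_, Or.inr (Or.inr (Or.inl rfl)), h⟩
      · exact ⟨_, Or.inr (Or.inr (Or.inr rfl)), h⟩
    · left; fin_cases i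
      · exact ⟨_, Or.inl rfl, h⟩
      · exact ⟨_, Or.inr (Or.inl rfl), h⟩
      · exact ⟨_, Or.inr (Or.inr (Or.inl rfl)), h⟩
      · exact ⟨_, Or.inr (Or.inr (Or.inr (Or.inl rfl))), h⟩

lemma wi5 (d : Drawing G Torus) {a b c e f : V} (h1 : G.Adj a b) (h2 : G.Adj b c) (h3 : G.Adj c e) (h4 : G.Adj e f)
    (h5 : G.Adj f a) :
    walkImage d (.cons h1 (.cons h2 (.cons h3 (.cons h4 (.cons h5 .nil))))) = cim (toP d) ![a, b, c, e, f] := by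
  ext z
  rw [walkImage_eq]
  simp only [cim, mem_iUnion, SimpleGraph.Walk.support_cons, SimpleGraph.Walk.edges_cons, SimpleGraph.Walk.support_nil,
    SimpleGraph.Walk.edges_nil, List.mem_cons, List.not_mem_nil, or_false]
  constructor
  · rintro (⟨v, rfl | rfl | rfl | rfl | rfl | rfl, rfl⟩ | ⟨q, rfl | rfl | rfl | rfl | rfl, h⟩)
    · exact ⟨(0 : Fin 5), Or.inr rfl⟩
    · exact ⟨(1 : Fin 5), Or.inr rfl⟩
    · exact ⟨(2 : Fin 5), Or.inr rfl⟩
    · exact ⟨(3 : Fin 5), Or.inr rfl⟩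
    · exact ⟨(4 : Fin 5), Or.inr rfl⟩
    · exact ⟨(0 : Fin 5), Or.inr rfl⟩
    · exact ⟨(0 : Fin 5), Or.inl h⟩
    · exact ⟨(1 : Fin 5), Or.inl h⟩
    · exact ⟨(2 : Fin 5), Or.inl h⟩
    · exact ⟨(3 : Fin 5), Or.inl h⟩
    · exact ⟨(4 : Fin 5), Or.inl h⟩
  · rintro ⟨i, h | h⟩
    · right; fin_cases i
      · exact ⟨_, Or.inl rfl, h⟩
      · exact ⟨_, Or.inr (Or.inl rfl), h⟩
      · exact ⟨_, Or.inr (Or.inr (Or.inl rfl)), h⟩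
      · exact ⟨_, Or.inr (Or.inr (Or.inr (Or.inl rfl))), h⟩
      · exact ⟨_, Or.inr (Or.inr (Or.inr (Or.inr rfl))), h⟩
    · left; fin_cases i
      · exact ⟨_, Or.inl rfl, h⟩
      · exact ⟨_, Or.inr (Or.inl rfl), h⟩
      · exact ⟨_, Or.inr (Or.inr (Or.inl rfl)), h⟩
      · exact ⟨_, Or.inr (Or.inr (Or.inr (Or.inl rfl))), h⟩
      · exact ⟨_, Or.inr (Or.inr (Or.inr (Or.inr (Or.inl rfl)))), h⟩

lemma image_eq (d : Drawing G Torus) : d.image = img (toP d) := by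
  ext z
  unfold MDrawing.image img
  refine or_congr Iff.rfl ⟨?_, ?_⟩
  · intro h
    obtain ⟨e, h⟩ := mem_iUnion.1 h
    exact mem_biUnion e.2 (by rw [toP_ea]; exact h)
  · intro h
    obtain ⟨e, he, h⟩ := mem_iUnion₂.1 h
    exact mem_iUnion.2 ⟨⟨e, he⟩, by rw [← toP_ea]; exact h⟩

lemma ea_sub (d : Drawing G Torus) (A : G.Subgraph) {e : Sym2 V} (he : e ∈ A.edgeSet) : (toP d).ea e ⊆ subImage d A := by
  intro z hz
  refine Or.inr (mem_iUnion₂.2 ⟨⟨e, A.edgeSet_subset he⟩, he, ?_⟩)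
  rw [← toP_ea]; exact hz

lemma subImage_cl (d : Drawing G Torus) (A : G.Subgraph) : IsClosed (subImage d A) := by
  have : subImage d A = d.vmap '' A.verts ∪ ⋃ e ∈ A.edgeSet, ((toP d).ea e ∪ (toP d).vm '' {x | x ∈ e}) := by
    ext z
    constructor
    · rintro (h | h)
      · exact Or.inl h
      · obtain ⟨e, he, h⟩ := mem_iUnion₂.1 h
        exact Or.inr (mem_biUnion he (Or.inl (by rw [toP_ea]; exact h)))
    · rintro (h | h)
      · exact Or.inl h
      · obtain ⟨e, he, h | ⟨x, hx, h⟩⟩ := mem_iUnion₂.1 h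
        · exact ea_sub d A he h
        · exact Or.inl ⟨x, A.mem_verts_of_mem_edge he hx, h⟩
  rw [this]
  exact (toFinite _).isClosed.union (cl_edges (toP d) _ A.edgeSet_subset)

lemma defl_path (hT : TF G) {v1 v3 : V} (h13 : v1 ≠ v3) (h : ¬ DeflationTriangleFree G v1 v3) :
    ∃ x y, G.Adj v1 x ∧ G.Adj x y ∧ G.Adj y v3 := by
  unfold DeflationTriangleFree at h
  rw [not_not] at h
  obtain ⟨a, b, c, hab, hbc, hac, e1, e2, e3⟩ := h
  have fs : ∀ {p q}, DeflAdj G v1 v3 p q → DeflAdj G v1 v3 q p := by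
    rintro p q ⟨x, y, h, hx, hy⟩; exact ⟨y, x, h.symm, hy, hx⟩
  have f1 : ∀ x p, deflateFun v1 v3 x = p → p ≠ v1 → x = p := by
    intro x p h hp
    unfold deflateFun at h
    split_ifs at h with hx
    · exact (hp h.symm).elim
    · exact h
  have f2 : ∀ x, deflateFun v1 v3 x = v1 → x = v1 ∨ x = v3 := by
    intro x h
    unfold deflateFun at h
    split_ifs at h with hx
    · exact Or.inr hx
    · exact Or.inl h
  have g1 : ∀ {p q}, DeflAdj G v1 v3 p q → p ≠ v1 → q ≠ v1 → G.Adj p q := by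
    rintro p q ⟨x, y, h, hx, hy⟩ hp hq
    rw [← f1 x p hx hp, ← f1 y q hy hq]; exact h
  have g2 : ∀ {q}, DeflAdj G v1 v3 v1 q → q ≠ v1 → G.Adj v1 q ∨ G.Adj v3 q := by
    rintro q ⟨x, y, h, hx, hy⟩ hq
    rw [← f1 y q hy hq]
    rcases f2 x hx with rfl | rfl
    · exact Or.inl h
    · exact Or.inr h
  have main : ∀ {p q}, p ≠ v1 → q ≠ v1 → DeflAdj G v1 v3 v1 p → DeflAdj G v1 v3 p q → DeflAdj G v1 v3 v1 q →
      ∃ x y, G.Adj v1 x ∧ G.Adj x y ∧ G.Adj y v3 := by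
    intro p q hp hq h1 h2 h3
    have h2 := g1 h2 hp hq
    rcases g2 h1 hp with h1 | h1 <;> rcases g2 h3 hq with h3 | h3
    · exact (hT _ _ _ h1 h2 h3.symm).elim
    · exact ⟨p, q, h1, h2, h3.symm⟩
    · exact ⟨q, p, h3, h2.symm, h1.symm⟩
    · exact (hT _ _ _ h1 h2 h3.symm).elim
  by_cases ha : a = v1
  · subst ha; exact main hab.symm hac.symm e1 e2 e3
  by_cases hb : b = v1
  · subst hb; exact main hab hbc.symm (fs e1) e3 e2
  by_cases hc : c = v1
  · subst hc; exact main hac hbc (fs e3) e1 (fs e2)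
  exact (hT _ _ _ (g1 e1 ha hb) (g1 e2 hb hc) (g1 (fs e3) hc ha)).elim

theorem main_thm (d : Drawing G Torus) (hirr : IrreducibleDrawing d)
    (H : G.Subgraph) (hbase : ContainsBase d H)
    (g : Set Torus) (v1 v2 v3 v4 : V)
    (hquad : SubQuadFace d H g v1 v2 v3 v4) :
    ∃ (x y : V) (c5 : G.Walk v1 v1), c5.IsCycle ∧
      c5.support = [v1, x, y, v3, v2, v1] ∧ ¬ ContractibleWalk d c5 := by
  obtain ⟨tf, fc, irr⟩ := hirr
  have hG := crit_of tf fc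
  obtain ⟨⟨x0, hx0, gdef⟩, w, wcyc, wsup, wH, gfr⟩ := hquad
  have gfr0 := gfr
  obtain ⟨h1, h2, h3, h4, hw⟩ := walk4 w wsup
  have nd := wcyc.support_nodup
  rw [wsup] at nd
  simp only [List.tail_cons, List.nodup_cons, List.mem_cons, List.not_mem_nil, or_false, not_or] at nd
  have hac : v1 ≠ v3 := fun h => nd.2.1.2 h.symm
  have hbd : v2 ≠ v4 := nd.1.2.1
  have : LocallyConnectedSpace Torus := locT
  have go : IsOpen g := by
    rw [gdef]; exact (subImage_cl d H).isOpen_compl.connectedComponentIn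
  have gp : IsPreconnected g := by rw [gdef]; exact isPreconnected_connectedComponentIn
  have gn : g.Nonempty := ⟨x0, by rw [gdef]; exact mem_connectedComponentIn hx0⟩
  have gs : g ⊆ (subImage d H)ᶜ := by rw [gdef]; exact connectedComponentIn_subset _ _
  have hc := cy4 h1 h2 h3 h4 hac hbd
  have hwi : walkImage d w = cim (toP d) ![v1, v2, v3, v4] := by rw [hw]; exact wi4 d h1 h2 h3 h4
  rw [hwi] at gfr
  have hex : ∃ e ∈ H.edgeSet, e ∉ w.edges := by
    by_contra hn
    push Not at hn
    obtain ⟨B, hB, fB, a1, a2, a3, a4, x, y, z, t, hnd, hv, hE, -⟩ := hbase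
    have hBe : ∀ e ∈ B.edgeSet, e ∈ w.edges := fun e he => hn e (SimpleGraph.Subgraph.edgeSet_mono hB he)
    have hin : ∀ e ∈ B.edgeSet, ∀ u ∈ e, u ∈ [v1, v2, v3, v4] := by
      intro e he u hu
      have : u ∈ w.support := by
        induction e with | _ p q
        rcases Sym2.mem_iff.1 hu with rfl | rfl
        · exact w.fst_mem_support_of_mem_edges (hBe _ he)
        · exact w.snd_mem_support_of_mem_edges (hBe _ he)
      rw [wsup] at this
      simp only [List.mem_cons, List.not_mem_nil, or_false] at this ⊢
      tauto
    rw [hE] at hin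
    have hsub : [a1, a2, a3, a4, x, y, z, t] ⊆ [v1, v2, v3, v4] := by
      intro u hu
      simp only [List.mem_cons, List.not_mem_nil, or_false] at hu
      rcases hu with rfl | rfl | rfl | rfl | rfl | rfl | rfl | rfl
      · exact hin s(u, a2) (by simp) u (by simp)
      · exact hin s(a1, u) (by simp) u (by simp)
      · exact hin s(a2, u) (by simp) u (by simp)
      · exact hin s(a3, u) (by simp) u (by simp)
      · exact hin s(a1, u) (by simp) u (by simp)
      · exact hin s(x, u) (by simp) u (by simp)
      · exact hin s(a2, u) (by simp) u (by simp)
      · exact hin s(z, u) (by simp) u (by simp)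
    have := (hnd.subperm hsub).length_le
    simp at this
  obtain ⟨e, heH, hew⟩ := hex
  have he := H.edgeSet_subset heH
  have heC : (toP d).ea e ∩ cim (toP d) ![v1, v2, v3, v4] = ∅ := by
    refine (ea_cim (toP d) he hc).resolve_left ?_
    rintro ⟨i, rfl⟩
    apply hew
    rw [hw]
    fin_cases i <;> simp
  obtain ⟨J, D, O, hD, hgD⟩ := quad_face (toP d) hG h1 h2 h3 h4 hac hbd go gp gn
    (by rw [← gfr]; exact go.inter_frontier_eq) gfr he heC
    (by
      ext z; simp only [mem_inter_iff, mem_empty_iff_false, iff_false, not_and]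
      intro hz hz'; exact gs hz' (ea_sub d H heH hz))
  obtain ⟨x1, hx1, hcc⟩ := face_cc (toP d) hG hc hD
  have hQ : IsQuadFace d g v1 v2 v3 v4 := by
    refine ⟨⟨x1, ?_, ?_⟩, w, wcyc, wsup, gfr0⟩
    · rw [image_eq]; exact hx1
    · rw [image_eq, hcc, hgD]
  have hnd : ¬ DeflationTriangleFree G v1 v3 := fun h => irr ⟨g, v1, v2, v3, v4, hQ, Or.inl h⟩
  obtain ⟨x, y, p1, p2, p3⟩ := defl_path hG.tf hac hnd
  have n1 : x ≠ v2 := by rintro rfl; exact hG.tf _ _ _ p2 p3 h2.symm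
  have n2 : y ≠ v2 := by rintro rfl; exact hG.tf _ _ _ p1 p2 h1.symm
  have n3 : x ≠ v3 := by rintro rfl; exact hG.tf _ _ _ h1 h2 p1.symm
  have n4 : y ≠ v1 := by rintro rfl; exact hG.tf _ _ _ h1 h2 p3.symm
  have n5 : x ≠ v4 := by rintro rfl; exact hG.tf _ _ _ p2 p3 h3
  have m1 := p1.ne
  have m2 := p2.ne
  have m3 := p3.ne
  have m4 := h1.ne
  have m5 := h2.ne
  have hc' := cy5 p1 p2 p3 h2.symm h1.symm n4.symm n3 n2 hac.symm n1.symm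
  refine ⟨x, y, .cons p1 (.cons p2 (.cons p3 (.cons h2.symm (.cons h1.symm .nil)))), ?_, by simp, ?_⟩
  · rw [SimpleGraph.Walk.isCycle_def]
    refine ⟨?_, by simp, ?_⟩
    · rw [SimpleGraph.Walk.isTrail_def]
      simp [m1, m2, m3, m4, m5, n1, n2, n3, n4, hac, m1.symm, m2.symm, m3.symm, m4.symm, m5.symm, n1.symm, n2.symm, n3.symm, n4.symm, hac.symm]
    · simp [m1, m2, m3, m4, m5, n1, n2, n3, n4, hac, m1.symm, m2.symm, m3.symm, m4.symm, m5.symm, n1.symm, n2.symm, n3.symm, n4.symm, hac.symm]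
  · intro hcon
    unfold ContractibleWalk at hcon
    rw [wi5] at hcon
    obtain ⟨J', D', O', hD'⟩ := contr_disc hcon
    refine two_disc (toP d) hG h1 h2 hc hc' hD hD' ?_ ?_ ?_ ?_ ?_
    · intro h
      have : (toP d).vm x ∈ cim (toP d) ![v1, v2, v3, v4] := by
        rw [h]; exact mem_iUnion.2 ⟨(1 : Fin 5), Or.inr rfl⟩
      obtain ⟨i, hi⟩ := vm_cim (toP d) this hc
      fin_cases i
      · exact m1 hi.symm
      · exact n1 hi
      · exact n3 hi
      · exact n5 hi
    · intro z hz
      refine ⟨mem_iUnion.2 ⟨(0 : Fin 4), Or.inl hz⟩, mem_iUnion.2 ⟨(4 : Fin 5), Or.inl ?_⟩⟩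
      rw [Sym2.eq_swap] at hz; exact hz
    · intro z hz
      refine ⟨mem_iUnion.2 ⟨(1 : Fin 4), Or.inl hz⟩, mem_iUnion.2 ⟨(3 : Fin 5), Or.inl ?_⟩⟩
      rw [Sym2.eq_swap] at hz; exact hz
    · intro i hi
      fin_cases i
      · exact Or.inl rfl
      · exact Or.inr rfl
      · simp [m5, hbd] at hi
      · simp [hbd, m4.symm] at hi
    · intro i hi
      fin_cases i
      · simp [m4.symm, n1.symm] at hi
      · simp [n1.symm, n2.symm] at hi
      · simp [n2.symm, m5] at hi
      · exact Or.inr Sym2.eq_swap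
      · exact Or.inl Sym2.eq_swap

end PDG


/-- Let `G` be an irreducible 4-critical triangle-free graph drawn
in the torus and `H` a connected subgraph of `G` containing the base graph.  For any
4-face `g` of `H` bounded by a cycle `v1 v2 v3 v4` such that the pair of opposite
vertices `v1`, `v3` is not linked in `H`, there is a path `P = v1 x y v3` of length 3
such that `v1 x y v3 v2` is a non-contractible 5-cycle and `H + P` is a subgraph of
`G` (the path `P` lies in `G`). -/
theorem unlinked_pair_has_link {V : Type} [Fintype V] {G : SimpleGraph V}
    (d : Drawing G Torus) (hirr : IrreducibleDrawing d)
    (H : G.Subgraph) (hconn : H.coe.Connected) (hbase : ContainsBase d H)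
    (g : Set Torus) (v1 v2 v3 v4 : V)
    (hquad : SubQuadFace d H g v1 v2 v3 v4)
    (hunlinked : ¬ LinkedPairIn d H v1 v2 v3) :
    ∃ (x y : V) (c5 : G.Walk v1 v1), c5.IsCycle ∧
      c5.support = [v1, x, y, v3, v2, v1] ∧ ¬ ContractibleWalk d c5 := by
  exact PDG.main_thm d hirr H hbase g v1 v2 v3 v4 hquad
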